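/- Let X be a metric space homeomorphic to the 2-sphere that is Ahlfors 2-regular. Then there exists a quasisymmetric homeomorphism from X onto the standard 2-sphere (the Riemann sphere Ĉ with the spherical metric) if and only if X is linearly locally connected. -/

import Mathlib

open Metric MeasureTheory Set
open scoped ENNReal NNReal Topology

/-!
STATEMENT 10: The Bonk–Kleiner theorem.  Let `X` be a metric space homeomorphic to the
2-sphere that is Ahlfors 2-regular.  Then there is a quasisymmetric homeomorphism from `X`
onto the standard 2-sphere if and only if `X` is linearly locally connected.

The standard 2-sphere is realized as the unit sphere in Euclidean 3-space; its restricted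
(chordal) metric is bi-Lipschitz equivalent to the Riemannian spherical metric, so being
quasisymmetrically equivalent to one is the same as being quasisymmetrically equivalent to
the other.  The Hausdorff 2-measure is normalized so as to coincide with Lebesgue measure
on the plane.  A distortion function `η` for a quasisymmetric map is a homeomorphism of
`[0,∞)` onto itself, which we model as a self-homeomorphism of `ℝ≥0`.
-/

/-- The Hausdorff 2-measure, normalized so as to coincide with Lebesgue measure on `ℝ²`. -/
noncomputable def hausdorff2 (X : Type*) [MetricSpace X] [MeasurableSpace X] [BorelSpace X] :
    Measure X := (ENNReal.ofReal (Real.pi / 4)) • MeasureTheory.Measure.hausdorffMeasure 2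

/-- A quasisymmetric map: there is a homeomorphism `η` of `[0,∞)` such that
`d(f x, f y)/d(f x, f z) ≤ η (d(x,y)/d(x,z))` for all triples of distinct points. -/
def IsQuasisymmetric {X Y : Type*} [MetricSpace X] [MetricSpace Y] (f : X → Y) : Prop :=
  ∃ η : ℝ≥0 ≃ₜ ℝ≥0, ∀ x y z : X, x ≠ y → x ≠ z → y ≠ z →
    nndist (f x) (f y) / nndist (f x) (f z) ≤ η (nndist x y / nndist x z)

/-- Ahlfors 2-regularity: `C⁻¹ r² ≤ H²(B(x,r)) ≤ C r²` for all `x` and `0 < r < diam X`. -/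
def AhlforsTwoRegular (X : Type*) [MetricSpace X] [MeasurableSpace X] [BorelSpace X] : Prop :=
  ∃ C : ℝ, 1 ≤ C ∧ ∀ x : X, ∀ r : ℝ, 0 < r → ENNReal.ofReal r < EMetric.diam (univ : Set X) →
    ENNReal.ofReal (r ^ 2 / C) ≤ hausdorff2 X (Metric.ball x r) ∧
    hausdorff2 X (Metric.ball x r) ≤ ENNReal.ofReal (C * r ^ 2)

/-- Linear local connectivity: there is `λ ≥ 1` such that any two points of a ball
`B(a,r)` lie in a continuum inside `B(a, λr)`, and any two points outside `B(a,r)` lie in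
a continuum outside `B(a, r/λ)`. -/
def LinearlyLocallyConnected (X : Type*) [MetricSpace X] : Prop :=
  ∃ lam : ℝ, 1 ≤ lam ∧ ∀ (a : X) (r : ℝ),
    (∀ x ∈ Metric.ball a r, ∀ y ∈ Metric.ball a r,
      ∃ E : Set X, IsCompact E ∧ IsConnected E ∧ x ∈ E ∧ y ∈ E ∧
        E ⊆ Metric.ball a (lam * r)) ∧
    (∀ x ∉ Metric.ball a r, ∀ y ∉ Metric.ball a r,
      ∃ E : Set X, IsCompact E ∧ IsConnected E ∧ x ∈ E ∧ y ∈ E ∧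
        E ⊆ (Metric.ball a (r / lam))ᶜ)

section
open Metric MeasureTheory Set
open scoped ENNReal NNReal Topology

namespace BK

/-! ### Connectivity inside a set along a relation -/

/-- `x` and `y` are joined by an `r`-chain inside `S`. -/
def Conn {α : Type*} (r : α → α → Prop) (S : Set α) (x y : α) : Prop :=
  x ∈ S ∧ Relation.ReflTransGen (fun a b => r a b ∧ b ∈ S) x y

namespace Conn
variable {α β : Type*} {r : α → α → Prop} {S T : Set α} {x y z : α}

theorem refl (hx : x ∈ S) : Conn r S x x := ⟨hx, .refl⟩

theorem left (h : Conn r S x y) : x ∈ S := h.1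

theorem right (h : Conn r S x y) : y ∈ S := by
  obtain ⟨hx, h⟩ := h
  induction h with
  | refl => exact hx
  | tail _ h _ => exact h.2

theorem trans (h : Conn r S x y) (h2 : Conn r S y z) : Conn r S x z := ⟨h.1, h.2.trans h2.2⟩

theorem step (h : Conn r S x y) (hr : r y z) (hz : z ∈ S) : Conn r S x z :=
  ⟨h.1, h.2.tail ⟨hr, hz⟩⟩

theorem single (hx : x ∈ S) (hr : r x y) (hy : y ∈ S) : Conn r S x y := (refl hx).step hr hy

theorem rec' {P : α → Prop} (h : Conn r S x y) (h0 : P x)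
    (hs : ∀ a b, a ∈ S → b ∈ S → r a b → P a → P b) : P y := by
  have : P y ∧ y ∈ S := by
    obtain ⟨hx, h⟩ := h
    induction h with
    | refl => exact ⟨h0, hx⟩
    | tail _ h ih => exact ⟨hs _ _ ih.2 h.2 h.1 ih.1, h.2⟩
  exact this.1

theorem symm (hsymm : ∀ a b, r a b → r b a) (h : Conn r S x y) : Conn r S y x :=
  h.rec' (P := fun y => Conn r S y x) (refl h.1)
    fun _ _ ha hb hab ih => (single hb (hsymm _ _ hab) ha).trans ih

theorem mono (h : Conn r S x y) (hST : S ⊆ T) : Conn r T x y :=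
  h.rec' (P := fun y => Conn r T x y) (refl (hST h.1))
    fun _ _ _ hb hab ih => ih.step hab (hST hb)

theorem mono_rel {r' : α → α → Prop} (h : Conn r S x y) (hr : ∀ a b, r a b → r' a b) :
    Conn r' S x y :=
  h.rec' (P := fun y => Conn r' S x y) (refl h.1)
    fun _ _ _ hb hab ih => ih.step (hr _ _ hab) hb

/-- The part of the chain reached from `x`. -/
theorem restrict (h : Conn r S x y) : Conn r {z | Conn r S x z} x y := by
  have : Conn r S x y ∧ Conn r {z | Conn r S x z} x y :=
    h.rec' (P := fun y => Conn r S x y ∧ Conn r {z | Conn r S x z} x y)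
      ⟨refl h.1, refl (refl h.1)⟩
      fun a b _ hb hab ih => ⟨ih.1.step hab hb, ih.2.step hab (ih.1.step hab hb)⟩
  exact this.2

theorem map {r' : β → β → Prop} {T : Set β} (f : α → β) (h : Conn r S x y) (hx : f x ∈ T)
    (hf : ∀ a b, a ∈ S → b ∈ S → r a b → f a ∈ T → Conn r' T (f a) (f b)) :
    Conn r' T (f x) (f y) :=
  h.rec' (P := fun y => Conn r' T (f x) (f y)) (refl hx)
    fun a b ha hb hab ih => ih.trans (hf a b ha hb hab ih.right)

theorem of_walk {n : ℕ} {g : ℕ → α} (hS : ∀ k ≤ n, g k ∈ S) (hr : ∀ k < n, r (g k) (g (k + 1))) :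
    Conn r S (g 0) (g n) := by
  have : ∀ k ≤ n, Conn r S (g 0) (g k) := by
    intro k
    induction k with
    | zero => intro _; exact refl (hS 0 (Nat.zero_le _))
    | succ k ih => intro hk; exact (ih (by omega)).step (hr k (by omega)) (hS _ hk)
  exact this n le_rfl

theorem of_walk' {n i j : ℕ} {g : ℕ → α} (hij : i ≤ j) (hj : j ≤ n)
    (hS : ∀ k, i ≤ k → k ≤ j → g k ∈ S) (hr : ∀ k < n, r (g k) (g (k + 1))) :
    Conn r S (g i) (g j) := by
  have := of_walk (r := r) (S := S) (n := j - i) (g := fun k => g (i + k))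
    (fun k hk => hS _ (by omega) (by omega)) (fun k hk => hr _ (by omega))
  simpa [Nat.add_sub_cancel' hij] using this

theorem exists_walk (h : Conn r S x y) : ∃ (n : ℕ) (g : ℕ → α), g 0 = x ∧ g n = y ∧
    (∀ k ≤ n, g k ∈ S) ∧ ∀ k < n, r (g k) (g (k + 1)) := by
  refine h.rec' (P := fun y => ∃ (n : ℕ) (g : ℕ → α), g 0 = x ∧ g n = y ∧
    (∀ k ≤ n, g k ∈ S) ∧ ∀ k < n, r (g k) (g (k + 1))) ?_ ?_
  · exact ⟨0, fun _ => x, rfl, rfl, fun _ _ => h.1, fun _ hk => absurd hk (by omega)⟩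
  · rintro a b _ hb hab ⟨n, g, h0, hn, hS, hr⟩
    refine ⟨n + 1, fun k => if k ≤ n then g k else b, ?_, ?_, ?_, ?_⟩
    · simp [h0]
    · simp
    · intro k hk
      by_cases h' : k ≤ n
      · simp only [h', if_true]; exact hS k h'
      · simp only [h', if_false]; exact hb
    · intro k hk
      by_cases h' : k + 1 ≤ n
      · have : k ≤ n := by omega
        simp only [h', this, if_true]; exact hr k (by omega)
      · have h'' : k = n := by omega
        subst h''
        simp [hn, hab]

/-- A chain can be shortened to a simple one. -/
theorem exists_simple_walk (h : Conn r S x y) : ∃ (n : ℕ) (g : ℕ → α), g 0 = x ∧ g n = y ∧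
    (∀ k ≤ n, g k ∈ S) ∧ (∀ k < n, r (g k) (g (k + 1))) ∧
    ∀ i j, i < j → j ≤ n → g i ≠ g j := by
  classical
  have hex : ∃ n, ∃ g : ℕ → α, g 0 = x ∧ g n = y ∧
    (∀ k ≤ n, g k ∈ S) ∧ ∀ k < n, r (g k) (g (k + 1)) := h.exists_walk
  obtain ⟨g, h0, hn, hS, hr⟩ := Nat.find_spec hex
  refine ⟨Nat.find hex, g, h0, hn, hS, hr, ?_⟩
  intro i j hij hj heq
  set n := Nat.find hex with hndef
  refine Nat.find_min hex (m := n - (j - i)) (by omega)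
    ⟨fun k => if k ≤ i then g k else g (k + (j - i)), by simp [h0], ?_, ?_, ?_⟩
  · by_cases h' : n - (j - i) ≤ i
    · have h1 : n - (j - i) = i := by omega
      have h2 : j = n := by omega
      simp only [h', if_true]
      rw [h1, heq, h2, hn]
    · simp only [h', if_false]
      rw [show n - (j - i) + (j - i) = n by omega, hn]
  · intro k hk
    by_cases h' : k ≤ i
    · simp only [h', if_true]; exact hS _ (by omega)
    · simp only [h', if_false]; exact hS _ (by omega)
  · intro k hk
    by_cases h' : k + 1 ≤ i
    · have : k ≤ i := by omega
      simp only [h', this, if_true]; exact hr _ (by omega)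
    · by_cases h'' : k ≤ i
      · have h3 : k = i := by omega
        subst h3
        simp only [le_refl, if_true, h', if_false, heq]
        rw [show k + 1 + (j - k) = j + 1 by omega]
        exact hr _ (by omega)
      · simp only [h', h'', if_false]
        rw [show k + 1 + (j - i) = k + (j - i) + 1 by omega]
        exact hr _ (by omega)

end Conn

/-! ### Hexagonal cells -/

/-- Hexagonal adjacency on `ℤ × ℤ`. -/
def hadj (c d : ℤ × ℤ) : Prop :=
  (d.1 = c.1 + 1 ∧ d.2 = c.2) ∨ (d.1 + 1 = c.1 ∧ d.2 = c.2) ∨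
  (d.1 = c.1 ∧ d.2 = c.2 + 1) ∨ (d.1 = c.1 ∧ d.2 + 1 = c.2) ∨
  (d.1 = c.1 + 1 ∧ d.2 + 1 = c.2) ∨ (d.1 + 1 = c.1 ∧ d.2 = c.2 + 1)

theorem hadj_symm (c d : ℤ × ℤ) (h : hadj c d) : hadj d c := by
  unfold hadj at *; omega

def strip (L : ℕ) : Set (ℤ × ℤ) := {c | 0 ≤ c.2 ∧ c.2 ≤ L}

section CH1
variable (L : ℕ) (U : Set (ℤ × ℤ))

/-- Cells reachable from row `0` in the complement of `U`. -/
def reach : Set (ℤ × ℤ) := {c | ∃ i : ℤ, Conn hadj (strip L \ U) (i, 0) c}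

open Classical in
/-- Boundary labels for the connectivity argument. -/
noncomputable def bdl (c d : ℤ × ℤ) : Set (ℤ × ℤ) →₀ ZMod 2 :=
  if c ∈ reach L U ∧ d ∉ reach L U then Finsupp.single {e | Conn hadj U d e} 1
  else if c ∉ reach L U ∧ d ∈ reach L U then Finsupp.single {e | Conn hadj U c e} 1
  else 0

variable {L U}

theorem mem_U_of_reach {c d : ℤ × ℤ} (hc : c ∈ reach L U) (hd : d ∉ reach L U) (hcd : hadj c d)
    (hds : d ∈ strip L) : d ∈ U := by
  by_contra h
  obtain ⟨i, hi⟩ := hc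
  exact hd ⟨i, hi.step hcd ⟨hds, h⟩⟩

theorem comp_eq {c d : ℤ × ℤ} (hc : c ∈ U) (hd : d ∈ U) (hcd : hadj c d) :
    {e | Conn hadj U c e} = {e | Conn hadj U d e} := by
  ext e
  exact ⟨fun h => (Conn.single hd (hadj_symm _ _ hcd) hc).trans h,
    fun h => (Conn.single hc hcd hd).trans h⟩

theorem bdl_triangle {c d e : ℤ × ℤ} (hc : c ∈ strip L) (hd : d ∈ strip L) (he : e ∈ strip L)
    (hcd : hadj c d) (hde : hadj d e) (hce : hadj c e) :
    bdl L U c d + bdl L U d e + bdl L U c e = 0 := by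
  have two : ∀ s : Set (ℤ × ℤ) →₀ ZMod 2, s + s = 0 := fun s => by
    ext a; exact CharTwo.add_self_eq_zero (s a)
  have hdc := hadj_symm _ _ hcd
  have hed := hadj_symm _ _ hde
  have hec := hadj_symm _ _ hce
  by_cases h1 : c ∈ reach L U <;> by_cases h2 : d ∈ reach L U <;> by_cases h3 : e ∈ reach L U
  · simp [bdl, h1, h2, h3]
  · simp [bdl, h1, h2, h3, two]
  · simp [bdl, h1, h2, h3, two]
  · simp only [bdl, h1, h2, h3]
    simp [comp_eq (mem_U_of_reach h1 h2 hcd hd) (mem_U_of_reach h1 h3 hce he) hde, two]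
  · simp [bdl, h1, h2, h3, two]
  · simp only [bdl, h1, h2, h3]
    simp [comp_eq (mem_U_of_reach h2 h1 hdc hc) (mem_U_of_reach h2 h3 hde he) hce, two]
  · simp only [bdl, h1, h2, h3]
    simp [comp_eq (mem_U_of_reach h3 h1 hec hc) (mem_U_of_reach h3 h2 hed hd) hcd, two]
  · simp [bdl, h1, h2, h3]

/-- First crossing lemma: if the complement of `U` does not connect the two boundary rows, then
a connected component of `U` meets every column. -/
theorem CH1 (hU : ∀ c ∈ U, 0 < c.2 ∧ c.2 < L)
    (hno : ∀ c d : ℤ × ℤ, c.2 = 0 → d.2 = L → ¬ Conn hadj (strip L \ U) c d) :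
    ∃ c0 ∈ U, ∀ i : ℤ, ∃ j : ℤ, Conn hadj U c0 (i, j) := by
  classical
  have two : ∀ s : Set (ℤ × ℤ) →₀ ZMod 2, s + s = 0 := fun s => by
    ext a; exact CharTwo.add_self_eq_zero (s a)
  have row0 : ∀ i : ℤ, ((i, 0) : ℤ × ℤ) ∈ reach L U := fun i =>
    ⟨i, Conn.refl ⟨⟨le_rfl, by simp⟩, fun h => absurd (hU _ h).1 (by simp)⟩⟩
  have rowL : ∀ i : ℤ, ((i, (L : ℤ)) : ℤ × ℤ) ∉ reach L U := fun i ⟨k, hk⟩ =>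
    hno _ _ rfl rfl hk
  set n : ℤ → (Set (ℤ × ℤ) →₀ ZMod 2) := fun i =>
    ∑ j ∈ Finset.range L, bdl L U (i, (j : ℤ)) (i, (j : ℤ) + 1) with hn
  have hstep : ∀ i, n (i + 1) = n i := by
    intro i
    have hsq : ∀ j ∈ Finset.range L, bdl L U (i, (j : ℤ)) (i, (j : ℤ) + 1) +
        bdl L U (i + 1, (j : ℤ)) (i + 1, (j : ℤ) + 1) =
        bdl L U (i, ((j + 1 : ℕ) : ℤ)) (i + 1, ((j + 1 : ℕ) : ℤ)) - bdl L U (i, (j : ℤ)) (i + 1, (j : ℤ)) := by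
      intro j hj
      have hjL := Finset.mem_range.1 hj
      have m1 : ((i, (j : ℤ)) : ℤ × ℤ) ∈ strip L := by simp [strip]; omega
      have m2 : ((i + 1, (j : ℤ)) : ℤ × ℤ) ∈ strip L := by simp [strip]; omega
      have m3 : ((i, (j : ℤ) + 1) : ℤ × ℤ) ∈ strip L := by simp [strip]; omega
      have m4 : ((i + 1, (j : ℤ) + 1) : ℤ × ℤ) ∈ strip L := by simp [strip]; omega
      have t1 := bdl_triangle (U := U) m1 m3 m2 (by simp [hadj]) (by simp [hadj]) (by simp [hadj])
      have t2 := bdl_triangle (U := U) m3 m2 m4 (by simp [hadj]) (by simp [hadj]) (by simp [hadj])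
      push_cast
      generalize bdl L U (i, (j : ℤ)) (i, (j : ℤ) + 1) = A at *
      generalize bdl L U (i, (j : ℤ) + 1) (i + 1, (j : ℤ)) = B at *
      generalize bdl L U (i, (j : ℤ)) (i + 1, (j : ℤ)) = C at *
      generalize bdl L U (i + 1, (j : ℤ)) (i + 1, (j : ℤ) + 1) = D at *
      generalize bdl L U (i, (j : ℤ) + 1) (i + 1, (j : ℤ) + 1) = E at *
      have hC := two C
      have hE := two E
      have hB := two B
      have : A + D = (A + B + C) + (B + D + E) - (B + B) - (E + E) + E - C := by abel
      rw [this, t1, t2, hB, hE]; abel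
    have hs := Finset.sum_congr rfl hsq
    rw [Finset.sum_add_distrib,
      Finset.sum_range_sub (fun j : ℕ => bdl L U (i, (j : ℤ)) (i + 1, (j : ℤ)))] at hs
    have z1 : bdl L U (i, ((0 : ℕ) : ℤ)) (i + 1, ((0 : ℕ) : ℤ)) = 0 := by
      simp [bdl, row0]
    have z2 : bdl L U (i, (L : ℤ)) (i + 1, (L : ℤ)) = 0 := by
      simp [bdl, rowL]
    rw [z1, z2] at hs
    have hs' : n i + n (i + 1) = 0 := by simpa [hn] using hs
    have := two (n i)
    have h3 : n (i + 1) = (n i + n (i + 1)) - (n i + n i) + n i := by abel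
    rw [h3, hs', this]; abel
  have hconst : ∀ i, n i = n 0 := by
    intro i
    induction i using Int.induction_on with
    | zero => rfl
    | succ k ih => rw [hstep, ih]
    | pred k ih =>
      have := hstep (-(k : ℤ) - 1)
      rw [sub_add_cancel, ih] at this
      exact this.symm
  let φ : (Set (ℤ × ℤ) →₀ ZMod 2) →+ ZMod 2 :=
    Finsupp.liftAddHom (fun _ => AddMonoidHom.id (ZMod 2))
  have hφ : ∀ c d, φ (bdl L U c d) =
      (if d ∈ reach L U then 1 else 0) - (if c ∈ reach L U then 1 else 0) := by
    intro c d
    have t1 : (-1 : ZMod 2) = 1 := by decide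
    by_cases h1 : c ∈ reach L U <;> by_cases h2 : d ∈ reach L U <;> simp [bdl, h1, h2, φ, t1]
  have hsum : φ (n 0) = 1 := by
    have : φ (n 0) = ∑ j ∈ Finset.range L,
      ((if ((0, ((j + 1 : ℕ) : ℤ)) : ℤ × ℤ) ∈ reach L U then (1 : ZMod 2) else 0) -
        (if ((0, (j : ℤ)) : ℤ × ℤ) ∈ reach L U then 1 else 0)) := by
      simp only [hn, map_sum, hφ]
      push_cast; rfl
    rw [this, Finset.sum_range_sub (fun j : ℕ =>
      (if ((0, (j : ℤ)) : ℤ × ℤ) ∈ reach L U then (1 : ZMod 2) else 0))]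
    simp [row0, rowL]
  have hne : n 0 ≠ 0 := fun h => by rw [h, map_zero] at hsum; exact absurd hsum (by decide)
  obtain ⟨K, hK⟩ := Finsupp.ne_iff.1 hne
  have hex : ∀ i : ℤ, ∃ j : ℤ, (i, j) ∈ U ∧ {e | Conn hadj U (i, j) e} = K := by
    intro i
    have h1 : n i K ≠ 0 := by rw [hconst]; exact hK
    rw [hn] at h1
    simp only [Finsupp.finsetSum_apply] at h1
    obtain ⟨j, hj, hjK⟩ := Finset.exists_ne_zero_of_sum_ne_zero h1
    have hjL := Finset.mem_range.1 hj
    have m1 : ((i, (j : ℤ)) : ℤ × ℤ) ∈ strip L := by simp [strip]; omega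
    have m3 : ((i, (j : ℤ) + 1) : ℤ × ℤ) ∈ strip L := by simp [strip]; omega
    by_cases a1 : ((i, (j : ℤ)) : ℤ × ℤ) ∈ reach L U <;>
      by_cases a2 : ((i, (j : ℤ) + 1) : ℤ × ℤ) ∈ reach L U
    · simp [bdl, a1, a2] at hjK
    · refine ⟨j + 1, mem_U_of_reach a1 a2 (by simp [hadj]) m3, ?_⟩
      simp only [bdl, a1, a2] at hjK
      simp only [not_false_eq_true, and_self, if_true] at hjK
      by_contra hcon
      exact hjK (Finsupp.single_eq_of_ne (Ne.symm hcon))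
    · refine ⟨j, mem_U_of_reach a2 a1 (by simp [hadj]) m1, ?_⟩
      simp only [bdl, a1, a2] at hjK
      simp only [not_true_eq_false, not_false_eq_true, and_self, if_true, if_false] at hjK
      by_contra hcon
      exact hjK (Finsupp.single_eq_of_ne (Ne.symm hcon))
    · simp [bdl, a1, a2] at hjK
  obtain ⟨j0, hj0, hK0⟩ := hex 0
  refine ⟨(0, j0), hj0, fun i => ?_⟩
  obtain ⟨j, hj, hKj⟩ := hex i
  refine ⟨j, ?_⟩
  have : ((i, j) : ℤ × ℤ) ∈ {e | Conn hadj U (i, j) e} := Conn.refl hj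
  rw [hKj, ← hK0] at this
  exact this

end CH1

section CH3

/-- Contribution of a step from `p` to `q` to the winding parity at `c`. -/
def chi (p q c : ℤ × ℤ) : ZMod 2 :=
  if (p.2 = c.2 ∧ q.2 = c.2 + 1 ∧ p.1 < c.1) ∨ (q.2 = c.2 ∧ p.2 = c.2 + 1 ∧ q.1 < c.1)
  then 1 else 0

/-- Winding parity of a walk at the cell `c`. -/
def windp (L m : ℕ) (g : ℕ → ℤ × ℤ) (c : ℤ × ℤ) : ZMod 2 :=
  (∑ k ∈ Finset.range m, chi (g k) (g (k + 1)) c) + if c.2 = L ∧ (g m).1 < c.1 then 1 else 0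

variable {L m : ℕ} {g : ℕ → ℤ × ℤ}

theorem windp_up (hg : ∀ k < m, hadj (g k) (g (k + 1))) (h0 : (g 0).2 = 0) (hm : (g m).2 = L)
    {c d : ℤ × ℤ} (hc : c ∈ strip L) (hd : d ∈ strip L) (hcd : d.2 = c.2 + 1)
    (hcd' : d.1 = c.1 ∨ d.1 + 1 = c.1)
    (hcg : ∀ k ≤ m, g k ≠ c) (hdg : ∀ k ≤ m, g k ≠ d) : windp L m g c = windp L m g d := by
  simp only [strip, mem_ofPred_eq] at hc hd
  have hstep : ∀ k ∈ Finset.range m, chi (g k) (g (k + 1)) c - chi (g k) (g (k + 1)) d =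
      (if (g (k + 1)).2 = d.2 ∧ (g (k + 1)).1 < d.1 then 1 else 0) -
        (if (g k).2 = d.2 ∧ (g k).1 < d.1 then 1 else 0) := by
    intro k hk
    have hk' := Finset.mem_range.1 hk
    have h1 := hg k hk'
    have n1 := hcg k (by omega)
    have n2 := hdg k (by omega)
    have n3 := hcg (k + 1) (by omega)
    have n4 := hdg (k + 1) (by omega)
    rw [Ne, Prod.ext_iff] at n1 n2 n3 n4
    generalize g k = p at *
    generalize g (k + 1) = q at *
    have t1 : (1 : ZMod 2) = -1 := by decide
    unfold hadj at h1
    unfold chi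
    split_ifs <;> first | decide | (exfalso; omega)
  have hs := Finset.sum_congr rfl hstep
  rw [Finset.sum_sub_distrib, Finset.sum_range_sub (fun k : ℕ =>
    (if (g k).2 = d.2 ∧ (g k).1 < d.1 then (1 : ZMod 2) else 0))] at hs
  have e0 : ¬ ((g 0).2 = d.2 ∧ (g 0).1 < d.1) := by omega
  have e1 : ¬ (c.2 = L ∧ (g m).1 < c.1) := by omega
  unfold windp
  rw [if_neg e1]
  rw [if_neg e0] at hs
  have e2 : ((g m).2 = d.2 ∧ (g m).1 < d.1) ↔ (d.2 = L ∧ (g m).1 < d.1) := by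
    rw [hm]; constructor <;> rintro ⟨a, b⟩ <;> exact ⟨a.symm, b⟩
  simp only [e2] at hs
  linear_combination hs

theorem windp_right (hg : ∀ k < m, hadj (g k) (g (k + 1))) (hm : (g m).2 = L)
    {c d : ℤ × ℤ} (hcd : d.2 = c.2) (hcd' : d.1 = c.1 + 1)
    (hcg : ∀ k ≤ m, g k ≠ c) : windp L m g c = windp L m g d := by
  unfold windp
  congr 1
  · refine Finset.sum_congr rfl fun k hk => ?_
    have hk' := Finset.mem_range.1 hk
    have n1 := hcg k (by omega)
    have n3 := hcg (k + 1) (by omega)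
    rw [Ne, Prod.ext_iff] at n1 n3
    unfold chi
    split_ifs <;> first | rfl | (exfalso; omega)
  · have n1 := hcg m le_rfl
    rw [Ne, Prod.ext_iff] at n1
    split_ifs <;> first | rfl | (exfalso; omega)

theorem windp_adj (hg : ∀ k < m, hadj (g k) (g (k + 1))) (h0 : (g 0).2 = 0) (hm : (g m).2 = L)
    {c d : ℤ × ℤ} (hc : c ∈ strip L) (hd : d ∈ strip L) (hcd : hadj c d)
    (hcg : ∀ k ≤ m, g k ≠ c) (hdg : ∀ k ≤ m, g k ≠ d) : windp L m g c = windp L m g d := by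
  rcases hcd with h | h | h | h | h | h
  · exact windp_right hg hm h.2 h.1 hcg
  · exact (windp_right hg hm h.2.symm h.1.symm hdg).symm
  · exact windp_up hg h0 hm hc hd h.2 (Or.inl h.1) hcg hdg
  · exact (windp_up hg h0 hm hd hc h.2.symm (Or.inl h.1.symm) hdg hcg).symm
  · exact (windp_up hg h0 hm hd hc h.2.symm (Or.inr h.1.symm) hdg hcg).symm
  · exact windp_up hg h0 hm hc hd h.2 (Or.inr h.1) hcg hdg

/-- Second crossing lemma: a set disjoint from a row `0` to row `L` walk does not connect
the left side of the walk to its right side. -/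
theorem CH3 {S T : Set (ℤ × ℤ)} (hS : S ⊆ strip L) (hST : Disjoint S T) {p q : ℤ × ℤ}
    (hp : p.2 = 0) (hq : q.2 = L) (hT : Conn hadj T p q) {a b : ℤ × ℤ} {A B : ℤ}
    (hA : ∀ e ∈ T, A ≤ e.1) (hB : ∀ e ∈ T, e.1 ≤ B) (ha : a.1 ≤ A) (hb : B < b.1)
    (hab : Conn hadj S a b) : False := by
  obtain ⟨m, g, g0, gm, gT, gr⟩ := hT.exists_walk
  have h0 : (g 0).2 = 0 := by rw [g0, hp]
  have hm : (g m).2 = L := by rw [gm, hq]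
  have hne : ∀ c ∈ S, ∀ k ≤ m, g k ≠ c := fun c hc k hk h =>
    Set.disjoint_left.1 hST hc (h ▸ gT k hk)
  have heq : windp L m g a = windp L m g b :=
    hab.rec' (P := fun b => windp L m g a = windp L m g b) rfl fun c d hc hd hcd ih =>
      ih.trans (windp_adj gr h0 hm (hS hc) (hS hd) hcd (hne c hc) (hne d hd))
  have ea : windp L m g a = 0 := by
    unfold windp
    have h1 := hA _ (gT m le_rfl)
    rw [if_neg (by omega), Finset.sum_eq_zero, add_zero]
    intro k hk
    have hk' := Finset.mem_range.1 hk
    have h2 := hA _ (gT k (by omega))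
    have h3 := hA _ (gT (k + 1) (by omega))
    unfold chi
    rw [if_neg (by omega)]
  have eb : windp L m g b = 1 := by
    unfold windp
    have hbs := hS hab.right
    simp only [strip, mem_ofPred_eq] at hbs
    have h1 := hB _ (gT m le_rfl)
    have hst : ∀ k ∈ Finset.range m, chi (g k) (g (k + 1)) b =
      (if (g (k + 1)).2 ≤ b.2 then 1 else 0) - (if (g k).2 ≤ b.2 then 1 else 0) := by
      intro k hk
      have hk' := Finset.mem_range.1 hk
      have h2 := hB _ (gT k (by omega))
      have h3 := hB _ (gT (k + 1) (by omega))
      have h1 := gr k hk'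
      unfold hadj at h1
      unfold chi
      split_ifs <;> first | decide | (exfalso; omega)
    rw [Finset.sum_congr rfl hst, Finset.sum_range_sub (fun k : ℕ =>
      (if (g k).2 ≤ b.2 then (1 : ZMod 2) else 0)), h0, hm]
    split_ifs <;> first | decide | (exfalso; omega)
  rw [ea, eb] at heq
  exact absurd heq (by decide)

end CH3
end BK

end

section
open Metric MeasureTheory Set
open scoped ENNReal NNReal Topology

namespace BK

/-- Shift of the second coordinate. -/
def sh {V : Type} (k : ℤ) (x : V × ℤ) : V × ℤ := (x.1, x.2 + k)

theorem sh_sh {V : Type} (k l : ℤ) (x : V × ℤ) : sh k (sh l x) = sh (l + k) x := by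
  simp [sh, add_assoc]

/-- A combinatorial strip, periodic under the shift. -/
structure Strip (V : Type) where
  adj : V × ℤ → V × ℤ → Prop
  symm : ∀ x y, adj x y → adj y x
  shift : ∀ (k : ℤ) x y, adj x y → adj (sh k x) (sh k y)
  top : Set V
  bot : Set V
  H : ∀ S : Set (V × ℤ), (∃ x y, x.1 ∈ top ∧ y.1 ∈ bot ∧ Conn adj S x y) ∨
    ∀ K : ℤ, ∃ x y, x.2 < -K ∧ K < y.2 ∧ Conn adj Sᶜ x y
  H3 : ∀ S : Set (V × ℤ), S.Finite → (∃ x y, x.1 ∈ top ∧ y.1 ∈ bot ∧ Conn adj S x y) →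
    ∃ K : ℤ, ∀ x y, x.2 < -K → K < y.2 → ¬ Conn adj Sᶜ x y
  conn : ∀ x y, Conn adj univ x y

namespace Strip
variable {V : Type} (S : Strip V)

/-- Crossing sets of vertices. -/
def Crossing (F : Set V) : Prop :=
  ∃ x y, x.1 ∈ S.top ∧ y.1 ∈ S.bot ∧ Conn S.adj {z | z.1 ∈ F} x y

/-- Good crossings. -/
def Good (G : Set (V × ℤ)) : Prop :=
  G.Finite ∧ (∃ x y, x.1 ∈ S.top ∧ y.1 ∈ S.bot ∧ Conn S.adj G x y) ∧
    ∀ x ∈ G, ∀ y ∈ G, x.1 = y.1 → x = y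

theorem conn_sh {A : Set (V × ℤ)} {x y : V × ℤ} (k : ℤ) (h : Conn S.adj A x y) :
    Conn S.adj (sh k '' A) (sh k x) (sh k y) :=
  h.map (sh k) ⟨x, h.left, rfl⟩ fun a b ha hb hab _ =>
    Conn.single ⟨a, ha, rfl⟩ (S.shift k _ _ hab) ⟨b, hb, rfl⟩

theorem exists_good {F : Set V} (hF : S.Crossing F) :
    ∃ G, S.Good G ∧ ∀ x ∈ G, x.1 ∈ F := by
  classical
  have hex : ∃ n, ∃ g : ℕ → V × ℤ, (g 0).1 ∈ S.top ∧ (g n).1 ∈ S.bot ∧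
    (∀ k ≤ n, (g k).1 ∈ F) ∧ ∀ k < n, S.adj (g k) (g (k + 1)) := by
    obtain ⟨x, y, hx, hy, h⟩ := hF
    obtain ⟨n, g, h0, hn, hS, hr⟩ := h.exists_walk
    exact ⟨n, g, h0 ▸ hx, hn ▸ hy, hS, hr⟩
  obtain ⟨g, h0, hn, hS, hr⟩ := Nat.find_spec hex
  set n := Nat.find hex with hndef
  have hinj : ∀ i j, i < j → j ≤ n → (g i).1 ≠ (g j).1 := by
    intro i j hij hj heq
    set d := (g i).2 - (g j).2 with hd
    have hij' : sh d (g j) = g i := by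
      ext
      · exact heq.symm
      · simp [sh, hd]
    refine Nat.find_min hex (m := n - (j - i)) (by omega)
      ⟨fun k => if k ≤ i then g k else sh d (g (k + (j - i))), by simp [h0], ?_, ?_, ?_⟩
    · by_cases h' : n - (j - i) ≤ i
      · have h1 : n - (j - i) = i := by omega
        have h2 : j = n := by omega
        simp only [h', if_true]
        rw [h1, heq, h2]; exact hn
      · simp only [h', if_false]
        rw [show n - (j - i) + (j - i) = n by omega]; exact hn
    · intro k hk
      by_cases h' : k ≤ i
      · simp only [h', if_true]; exact hS _ (by omega)
      · simp only [h', if_false]; exact hS _ (by omega)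
    · intro k hk
      by_cases h' : k + 1 ≤ i
      · have : k ≤ i := by omega
        simp only [h', this, if_true]; exact hr _ (by omega)
      · by_cases h'' : k ≤ i
        · have h3 : k = i := by omega
          subst h3
          simp only [le_refl, if_true, h', if_false, ← hij']
          rw [show k + 1 + (j - k) = j + 1 by omega]
          exact S.shift _ _ _ (hr _ (by omega))
        · simp only [h', h'', if_false]
          rw [show k + 1 + (j - i) = k + (j - i) + 1 by omega]
          exact S.shift _ _ _ (hr _ (by omega))
  refine ⟨g '' Set.Iic n, ⟨(Set.finite_Iic n).image g, ⟨g 0, g n, h0, hn, ?_⟩, ?_⟩, ?_⟩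
  · exact Conn.of_walk (fun k hk => ⟨k, hk, rfl⟩) hr
  · rintro _ ⟨i, hi, rfl⟩ _ ⟨j, hj, rfl⟩ hij
    rcases lt_trichotomy i j with h | h | h
    · exact absurd hij (hinj i j h hj)
    · rw [h]
    · exact absurd hij.symm (hinj j i h hi)
  · rintro _ ⟨i, hi, rfl⟩
    exact hS i hi

theorem crossing_univ : S.Crossing univ := by
  rcases S.H univ with ⟨x, y, hx, hy, h⟩ | h
  · exact ⟨x, y, hx, hy, h.mono (by intro z _; trivial)⟩
  · obtain ⟨x, y, -, -, h⟩ := h 0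
    exact absurd h.left (by simp)

/-- Cells on the right of `G`. -/
def rightOf (G : Set (V × ℤ)) : Set (V × ℤ) :=
  {x | x ∉ G ∧ ∀ K : ℤ, ∃ y, K < y.2 ∧ Conn S.adj Gᶜ x y}

theorem far_left {G : Set (V × ℤ)} (hG : S.Good G) :
    ∃ K : ℤ, ∀ x : V × ℤ, x.2 < -K → x ∉ S.rightOf G := by
  obtain ⟨K, hK⟩ := S.H3 G hG.1 hG.2.1
  refine ⟨K, fun x hx hr => ?_⟩
  obtain ⟨y, hy, h⟩ := hr.2 K
  exact hK x y hx hy h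

theorem far_right {G : Set (V × ℤ)} (hG : S.Good G) (v : V) :
    ∃ K : ℤ, ∀ k : ℤ, K < k → (v, k) ∈ S.rightOf G := by
  obtain ⟨n, g, g0, gn, -, gr⟩ := (S.conn (v, 0) (v, 1)).exists_walk
  obtain ⟨B, hB⟩ : ∃ B : ℤ, ∀ k ≤ n, -B ≤ (g k).2 := by
    obtain ⟨B, hB⟩ := ((Set.finite_Iic n).image (fun k => -(g k).2)).bddAbove
    exact ⟨B, fun k hk => by
      have := hB ⟨k, hk, rfl⟩
      simp only at this; linarith⟩
  obtain ⟨A, hA⟩ : ∃ A : ℤ, ∀ x ∈ G, x.2 ≤ A := by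
    obtain ⟨A, hA⟩ := (hG.1.image (fun x => x.2)).bddAbove
    exact ⟨A, fun x hx => hA ⟨x, hx, rfl⟩⟩
  have hstep : ∀ k : ℤ, A + B < k → Conn S.adj Gᶜ (v, k) (v, k + 1) := by
    intro k hk
    have := Conn.of_walk (r := S.adj) (S := Gᶜ) (n := n) (g := fun i => sh k (g i))
      (fun i hi hmem => by
        have h1 := hA _ hmem
        have h2 := hB i hi
        simp only [sh] at h1; linarith)
      (fun i hi => S.shift k _ _ (gr i hi))
    simpa [g0, gn, sh, add_comm] using this
  have hfar : ∀ k : ℤ, A + B < k → ∀ m : ℕ, Conn S.adj Gᶜ (v, k) (v, k + m) := by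
    intro k hk m
    induction m with
    | zero => simpa using Conn.refl (hstep k hk).left
    | succ m ih =>
      have := ih.trans (hstep (k + m) (by omega))
      simpa [add_assoc] using this
  refine ⟨A + B, fun k hk => ⟨(hstep k hk).left, fun K => ?_⟩⟩
  exact ⟨(v, k + (K - k + 1).toNat), by simp; omega, hfar k hk _⟩

theorem mem_rightOf_sh {G : Set (V × ℤ)} {x : V × ℤ} (k : ℤ) (hx : x ∈ S.rightOf G) :
    sh k x ∈ S.rightOf (sh k '' G) := by
  have hc : sh k '' Gᶜ ⊆ (sh k '' G)ᶜ := by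
    rintro _ ⟨y, hy, rfl⟩ ⟨z, hz, hzy⟩
    apply hy
    have : z = y := by
      simp only [sh, Prod.mk.injEq, add_left_inj] at hzy
      exact Prod.ext hzy.1 hzy.2
    exact this ▸ hz
  refine ⟨hc ⟨x, hx.1, rfl⟩, fun K => ?_⟩
  obtain ⟨y, hy, h⟩ := hx.2 (K - k)
  exact ⟨sh k y, by simp [sh]; omega, (S.conn_sh k h).mono hc⟩

open Classical in
/-- The counting function of a good crossing. -/
theorem exists_psi {G : Set (V × ℤ)} (hG : S.Good G) : ∃ ψ : V × ℤ → ℝ,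
    (∀ x, ψ (sh 1 x) = ψ x + 1) ∧
    ∀ x y, S.adj x y → ψ x ≤ ψ y + if (∃ k, (y.1, k) ∈ G) then 1 else 0 := by
  set f : V × ℤ → ℤ → ℝ := fun x k =>
    (if sh (-k) x ∈ S.rightOf G then 1 else 0) - (if k < 0 then 1 else 0) with hf
  have hfs : ∀ x, (Function.support (f x)).Finite := by
    intro x
    obtain ⟨K1, hK1⟩ := S.far_left hG
    obtain ⟨K2, hK2⟩ := S.far_right hG x.1
    refine (Set.finite_Icc (-(|x.2| + |K2| + |K1|) - 1) (|x.2| + |K1| + |K2| + 1)).subset ?_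
    intro k hk
    by_contra hcon
    apply hk
    have a1 := neg_abs_le x.2
    have a2 := le_abs_self x.2
    have a3 := le_abs_self K1
    have a4 := le_abs_self K2
    have a5 := abs_nonneg K1
    have a6 := abs_nonneg K2
    simp only [Set.mem_Icc, not_and_or, not_le] at hcon
    rcases hcon with h | h
    · have : sh (-k) x ∈ S.rightOf G := hK2 _ (by linarith)
      have h2 : k < 0 := by linarith [abs_nonneg x.2]
      simp [hf, this, h2]
    · have : sh (-k) x ∉ S.rightOf G := hK1 _ (by simp only [sh]; linarith)
      have h2 : ¬ k < 0 := by linarith [abs_nonneg x.2]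
      simp [hf, this, h2]
  have hsum : ∀ x, Summable (f x) := fun x => summable_of_hasFiniteSupport (hfs x)
  refine ⟨fun x => ∑' k, f x k, fun x => ?_, fun x y hxy => ?_⟩
  · have h1 : ∀ k, f (sh 1 x) (k + 1) = f x k + if k = -1 then 1 else 0 := by
      intro k
      have : sh (-(k + 1)) (sh 1 x) = sh (-k) x := by rw [sh_sh]; congr 1; ring
      simp only [hf, this]
      by_cases h2 : k < -1
      · have e1 : k + 1 < 0 := by omega
        have e2 : k < 0 := by omega
        have e3 : k ≠ -1 := by omega
        simp [e1, e2, e3]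
      · by_cases h3 : k = -1
        · subst h3; simp
        · have e1 : ¬ k + 1 < 0 := by omega
          have e2 : ¬ k < 0 := by omega
          simp [e1, e2, h3]
    show ∑' k, f (sh 1 x) k = ∑' k, f x k + 1
    rw [← (Equiv.addRight (1 : ℤ)).tsum_eq (f (sh 1 x))]
    simp only [Equiv.coe_addRight, h1]
    rw [Summable.tsum_add (hsum x) (summable_of_hasFiniteSupport
      ((Set.finite_singleton (-1 : ℤ)).subset (by intro k; simp)))]
    simp
  · set e : ℤ → ℝ := fun k => if sh (-k) y ∈ G then 1 else 0 with he
    have huniq : ∀ k l, sh (-k) y ∈ G → sh (-l) y ∈ G → k = l := by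
      intro k l hk hl
      have := hG.2.2 _ hk _ hl rfl
      simp only [sh, Prod.mk.injEq, true_and] at this
      omega
    have hesum : Summable e := by
      refine summable_of_hasFiniteSupport (Set.Subsingleton.finite ?_)
      intro k hk l hl
      simp only [he, Function.mem_support, ne_eq, ite_eq_right_iff, one_ne_zero, imp_false,
        not_not] at hk hl
      exact huniq k l hk hl
    have hele : ∑' k, e k ≤ if (∃ k, (y.1, k) ∈ G) then 1 else 0 := by
      split_ifs with h
      · obtain ⟨k, hk⟩ := h
        rw [tsum_eq_single (y.2 - k)]
        · simp only [he]; split_ifs <;> norm_num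
        · intro l hl
          simp only [he, ite_eq_right_iff, one_ne_zero, imp_false]
          intro hm
          refine hl (huniq _ _ hm ?_)
          simpa [sh] using hk
      · have : ∀ k, e k = 0 := by
          intro k
          simp only [he, ite_eq_right_iff, one_ne_zero, imp_false]
          exact fun hm => h ⟨_, hm⟩
        simp [this]
    have : ∑' k, f x k ≤ ∑' k, (f y k + e k) := by
      refine Summable.tsum_le_tsum (fun k => ?_) (hsum x) ((hsum y).add hesum)
      have hadj := S.shift (-k) _ _ hxy
      simp only [hf, he]
      by_cases h1 : sh (-k) x ∈ S.rightOf G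
      · by_cases h2 : sh (-k) y ∈ G
        · simp only [h1, h2, if_true]; split_ifs <;> norm_num
        · have : sh (-k) y ∈ S.rightOf G := by
            refine ⟨h2, fun K => ?_⟩
            obtain ⟨z, hz, h⟩ := h1.2 K
            exact ⟨z, hz, (Conn.single h2 (S.symm _ _ hadj) h1.1).trans h⟩
          simp [h1, h2, this]
      · simp only [h1, if_false]; split_ifs <;> norm_num
    rw [Summable.tsum_add (hsum y) hesum] at this
    linarith

/-- The square tiling data. -/
structure Tiling [Fintype V] where
  ρ : V → ℝ
  u : V → ℝ
  Ψ : V × ℤ → ℝ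
  h : ℝ
  ρ_nonneg : ∀ v, 0 ≤ ρ v
  ρ_le : ∀ v, ρ v ≤ 1
  h_pos : 0 < h
  sum_sq : ∑ v, ρ v ^ 2 = h
  u_ge : ∀ v, ρ v ≤ u v
  u_top : ∀ v ∈ S.top, u v = ρ v
  u_adj : ∀ x y, S.adj x y → u y.1 ≤ u x.1 + ρ y.1
  u_bot : ∀ v ∈ S.bot, h ≤ u v
  Ψ_sh : ∀ x, Ψ (sh 1 x) = Ψ x + 1
  Ψ_adj : ∀ x y, S.adj x y → Ψ x ≤ Ψ y + ρ y.1
  vert : ∀ w : V → ℝ, (∀ F : Finset V, S.Crossing F → 1 ≤ ∑ v ∈ F, w v) →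
    1 ≤ ∑ v, w v * ρ v

open Classical in
theorem exists_tiling [Fintype V] : Nonempty (S.Tiling) := by
  -- the finite set of images of good crossings
  let I := {F : Finset V // ∃ G, S.Good G ∧ ∀ v, v ∈ F ↔ ∃ k, (v, k) ∈ G}
  have hI : ∀ F : Finset V, S.Crossing F → ∃ i : I, (i : Finset V) ⊆ F := by
    intro F hF
    obtain ⟨G, hG, hGF⟩ := S.exists_good hF
    refine ⟨⟨Finset.univ.filter (fun v => ∃ k, (v, k) ∈ G), G, hG, by simp⟩, ?_⟩
    intro v hv
    simp only [Finset.mem_filter, Finset.mem_univ, true_and] at hv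
    obtain ⟨k, hk⟩ := hv
    exact hGF _ hk
  have hIc : ∀ i : I, S.Crossing (i : Finset V) := by
    rintro ⟨F, G, hG, hFG⟩
    obtain ⟨x, y, hx, hy, h⟩ := hG.2.1
    exact ⟨x, y, hx, hy, h.mono fun z hz => (hFG z.1).2 ⟨z.2, hz⟩⟩
  obtain ⟨i0, -⟩ := hI Finset.univ (by simpa using S.crossing_univ)
  have : Nonempty I := ⟨i0⟩
  let one : I → V → ℝ := fun i v => if v ∈ (i : Finset V) then 1 else 0
  let R : (I → ℝ) → V → ℝ := fun t v => ∑ i, t i * one i v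
  have hRc : Continuous fun t : I → ℝ => ∑ v, (R t v) ^ 2 := by fun_prop
  obtain ⟨t, ht, hmin⟩ := (isCompact_stdSimplex (𝕜 := ℝ) (ι := I)).exists_isMinOn
    ⟨Pi.single i0 1, single_mem_stdSimplex ℝ i0⟩ hRc.continuousOn
  have h01 : ∀ i v, 0 ≤ one i v ∧ one i v ≤ 1 := by
    intro i v; simp only [one]; split_ifs <;> norm_num
  have hvar : ∀ i : I, ∑ v, (R t v) ^ 2 ≤ ∑ v, one i v * R t v := by
    intro i
    by_contra hcon
    push Not at hcon
    set A := ∑ v, (R t v) ^ 2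
    set B := ∑ v, one i v * R t v
    set D := ∑ v, (one i v - R t v) ^ 2 with hD
    have hD0 : 0 ≤ D := Finset.sum_nonneg fun v _ => sq_nonneg _
    have key : ∀ ε : ℝ, 0 ≤ ε → ε ≤ 1 → A ≤ A + 2 * ε * (B - A) + ε ^ 2 * D := by
      intro ε h0 h1
      have hm : (1 - ε) • t + ε • (Pi.single i 1 : I → ℝ) ∈ stdSimplex ℝ I :=
        convex_stdSimplex ℝ I ht (single_mem_stdSimplex ℝ i) (by linarith) h0 (by ring)
      have h2 := hmin hm
      simp only [mem_ofPred_eq] at h2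
      refine h2.trans (le_of_eq ?_)
      have hR : ∀ v, R ((1 - ε) • t + ε • (Pi.single i 1 : I → ℝ)) v =
          R t v + ε * (one i v - R t v) := by
        intro v
        simp only [R, Pi.add_apply, Pi.smul_apply, smul_eq_mul, add_mul, Finset.sum_add_distrib,
          mul_assoc, ← Finset.mul_sum]
        have hs1 : ∑ x : I, (Pi.single i 1 : I → ℝ) x * one x v = one i v := by
          rw [Finset.sum_eq_single i]
          · simp
          · intro b _ hb; simp [Pi.single_eq_of_ne hb]
          · simp
        rw [hs1]; ring
      simp only [hR]
      have : ∀ v, (R t v + ε * (one i v - R t v)) ^ 2 =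
        (R t v) ^ 2 + 2 * ε * (one i v * R t v - (R t v) ^ 2) +
          ε ^ 2 * (one i v - R t v) ^ 2 := fun v => by ring
      simp only [this, Finset.sum_add_distrib, ← Finset.mul_sum, Finset.sum_sub_distrib]
      rfl
    have hpos : 0 < A - B := by linarith
    have hDp : 0 < D + (A - B) := by linarith
    have h3 := key ((A - B) / (D + (A - B))) (by positivity) ((div_le_one hDp).2 (by linarith))
    have h4 : ((A - B) / (D + (A - B))) * D ≤ A - B := by
      rw [div_mul_eq_mul_div, div_le_iff₀ hDp]; nlinarith
    have h5 : 0 < (A - B) / (D + (A - B)) := by positivity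
    nlinarith
  set ρ := R t with hρ
  have ht0 : ∀ i, 0 ≤ t i := ht.1
  have hρ0 : ∀ v, 0 ≤ ρ v := fun v =>
    Finset.sum_nonneg fun i _ => mul_nonneg (ht0 i) (h01 i v).1
  have hρ1 : ∀ v, ρ v ≤ 1 := fun v => by
    calc ρ v ≤ ∑ i, t i := Finset.sum_le_sum fun i _ => by
          have := mul_le_mul_of_nonneg_left (h01 i v).2 (ht0 i); simpa using this
      _ = 1 := ht.2
  have hlen : ∀ F : Finset V, S.Crossing F → ∑ v, ρ v ^ 2 ≤ ∑ v ∈ F, ρ v := by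
    intro F hF
    obtain ⟨i, hi⟩ := hI F hF
    refine (hvar i).trans ?_
    have : ∑ v, one i v * ρ v = ∑ v ∈ (i : Finset V), ρ v := by
      simp [one, Finset.sum_ite_mem]
    rw [this]
    exact Finset.sum_le_sum_of_subset_of_nonneg hi fun v _ _ => hρ0 v
  have hvert : ∀ w : V → ℝ, (∀ F : Finset V, S.Crossing F → 1 ≤ ∑ v ∈ F, w v) →
      1 ≤ ∑ v, w v * ρ v := by
    intro w hw
    have : ∑ v, w v * ρ v = ∑ i, t i * ∑ v ∈ (i : Finset V), w v := by
      simp only [hρ, R, Finset.mul_sum]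
      rw [Finset.sum_comm]
      refine Finset.sum_congr rfl fun i _ => ?_
      rw [← Finset.sum_filter_add_sum_filter_not Finset.univ (fun v => v ∈ (i : Finset V))]
      simp only [one]
      rw [Finset.sum_eq_zero (s := Finset.univ.filter (fun v => v ∉ (i : Finset V)))]
      · rw [add_zero, Finset.filter_mem_eq_inter, Finset.univ_inter]
        exact Finset.sum_congr rfl fun v hv => by simp [hv, mul_comm]
      · intro v hv
        simp only [Finset.mem_filter, Finset.mem_univ, true_and] at hv
        simp [hv]
    rw [this, ← ht.2]
    exact Finset.sum_le_sum fun i _ => by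
      have := mul_le_mul_of_nonneg_left (hw i (hIc i)) (ht0 i); simpa using this
  have hpos : 0 < ∑ v, ρ v ^ 2 := by
    have h1 := hvert (fun _ => 1) (by
      intro F hF
      obtain ⟨x, y, -, -, h⟩ := hF
      have : 0 < F.card := Finset.card_pos.2 ⟨x.1, h.left⟩
      simp only [Finset.sum_const, nsmul_eq_mul, mul_one]
      exact_mod_cast this)
    by_contra hcon
    have h2 : ∑ v, ρ v ^ 2 = 0 := le_antisymm (not_lt.1 hcon)
      (Finset.sum_nonneg fun v _ => sq_nonneg _)
    rw [Finset.sum_eq_zero_iff_of_nonneg (fun v _ => sq_nonneg _)] at h2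
    have h3 : ∑ v, 1 * ρ v = 0 := Finset.sum_eq_zero fun v hv => by
      have := h2 v hv; simpa using this
    linarith
  -- the potential
  have hu : ∀ v, ∃ F : Finset V, (∃ x k, x.1 ∈ S.top ∧ Conn S.adj {z | z.1 ∈ F} x (v, k)) ∧
      ∀ F' : Finset V, (∃ x k, x.1 ∈ S.top ∧ Conn S.adj {z | z.1 ∈ F'} x (v, k)) →
        ∑ w ∈ F, ρ w ≤ ∑ w ∈ F', ρ w := by
    intro v
    obtain ⟨F, hF, hF'⟩ := Finset.exists_min_image
      (Finset.univ.filter fun F : Finset V =>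
        ∃ x k, x.1 ∈ S.top ∧ Conn S.adj {z | z.1 ∈ F} x (v, k)) (fun F => ∑ w ∈ F, ρ w) (by
      obtain ⟨x, y, hx, -, -⟩ := S.crossing_univ
      refine ⟨Finset.univ, ?_⟩
      simp only [Finset.mem_filter, Finset.mem_univ, true_and]
      exact ⟨x, 0, hx, (S.conn x (v, 0)).mono fun z _ => trivial⟩)
    simp only [Finset.mem_filter, Finset.mem_univ, true_and] at hF hF'
    exact ⟨F, hF, hF'⟩
  choose Fu hFu hFmin using hu
  have hψ : ∀ i : I, ∃ ψ : V × ℤ → ℝ, (∀ x, ψ (sh 1 x) = ψ x + 1) ∧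
      ∀ x y, S.adj x y → ψ x ≤ ψ y + one i y.1 := by
    rintro ⟨F, G, hG, hFG⟩
    obtain ⟨ψ, h1, h2⟩ := S.exists_psi hG
    refine ⟨ψ, h1, fun x y hxy => ?_⟩
    have := h2 x y hxy
    simpa [one, hFG] using this
  choose ψ hψ1 hψ2 using hψ
  refine ⟨⟨ρ, fun v => ∑ w ∈ Fu v, ρ w, fun x => ∑ i, t i * ψ i x, ∑ v, ρ v ^ 2, hρ0, hρ1, hpos,
    rfl, ?_, ?_, ?_, ?_, ?_, ?_, hvert⟩⟩
  · intro v
    obtain ⟨x, k, -, h⟩ := hFu v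
    exact Finset.single_le_sum (f := ρ) (fun w _ => hρ0 w) (h.right : v ∈ Fu v)
  · intro v hv
    refine le_antisymm ?_ ?_
    · have := hFmin v {v} ⟨(v, 0), 0, hv, Conn.refl (by simp)⟩
      simpa using this
    · obtain ⟨x, k, -, h⟩ := hFu v
      exact Finset.single_le_sum (f := ρ) (fun w _ => hρ0 w) (h.right : v ∈ Fu v)
  · intro x y hxy
    obtain ⟨a, k, ha, h⟩ := hFu x.1
    have h1 : Conn S.adj {z | z.1 ∈ insert y.1 (Fu x.1)} (sh (x.2 - k) a) y := by
      have h2 := (S.conn_sh (x.2 - k) h).mono (T := {z | z.1 ∈ insert y.1 (Fu x.1)}) (by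
        rintro _ ⟨z, hz, rfl⟩
        exact Finset.mem_insert_of_mem hz)
      have h3 : sh (x.2 - k) (x.1, k) = x := by simp [sh]
      rw [h3] at h2
      exact h2.step hxy (Finset.mem_insert_self _ _)
    have h4 := hFmin y.1 (insert y.1 (Fu x.1)) ⟨sh (x.2 - k) a, y.2, ha, h1⟩
    refine h4.trans ?_
    by_cases h5 : y.1 ∈ Fu x.1
    · rw [Finset.insert_eq_of_mem h5]; linarith [hρ0 y.1]
    · rw [Finset.sum_insert h5]; linarith
  · intro v hv
    obtain ⟨x, k, hx, h⟩ := hFu v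
    exact hlen _ ⟨x, (v, k), hx, hv, h⟩
  · intro x
    simp only [hψ1, mul_add, mul_one, Finset.sum_add_distrib]
    rw [ht.2]
  · intro x y hxy
    have : ∑ i, t i * ψ i y + ρ y.1 = ∑ i, t i * (ψ i y + one i y.1) := by
      simp only [mul_add, Finset.sum_add_distrib]; rfl
    rw [this]
    exact Finset.sum_le_sum fun i _ => mul_le_mul_of_nonneg_left (hψ2 i x y hxy) (ht0 i)

end Strip
end BK

end

section
open Metric MeasureTheory Set
open scoped ENNReal NNReal Topology

namespace BK

/-- Intervals along a chain of touching intervals cover everything in between. -/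
theorem conn_cover {α : Type*} {r : α → α → Prop} {S : Set α} {x y : α} {l R : α → ℝ} {τ : ℝ}
    (h : Conn r S x y) (hc : ∀ a ∈ S, ∀ b ∈ S, r a b → l b ≤ R a) (hx : l x ≤ τ) (hy : τ ≤ R y) :
    ∃ z ∈ S, l z ≤ τ ∧ τ ≤ R z := by
  have : (∃ z ∈ S, l z ≤ τ ∧ τ ≤ R z) ∨ R y < τ := by
    refine h.rec' (P := fun y => (∃ z ∈ S, l z ≤ τ ∧ τ ≤ R z) ∨ R y < τ) ?_ ?_
    · by_cases h1 : τ ≤ R x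
      · exact Or.inl ⟨x, h.left, hx, h1⟩
      · exact Or.inr (not_le.1 h1)
    · rintro a b ha hb hab (h1 | h1)
      · exact Or.inl h1
      · by_cases h2 : τ ≤ R b
        · exact Or.inl ⟨b, hb, (hc a ha b hb hab).trans h1.le, h2⟩
        · exact Or.inr (not_le.1 h2)
  rcases this with h1 | h1
  · exact h1
  · linarith

/-- Walk version, with control of the index. -/
theorem walk_cover {l R : ℕ → ℝ} {τ : ℝ} {n : ℕ} (h1 : ∀ k < n, l (k + 1) ≤ R k)
    (h2 : ∀ k < n, l k ≤ R (k + 1)) {i j : ℕ} (hi : i ≤ n) (hj : j ≤ n) (hli : l i ≤ τ)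
    (hRj : τ ≤ R j) : ∃ m, min i j ≤ m ∧ m ≤ max i j ∧ l m ≤ τ ∧ τ ≤ R m := by
  have up : ∀ d i, i + d ≤ n → l i ≤ τ → τ ≤ R (i + d) →
      ∃ m, i ≤ m ∧ m ≤ i + d ∧ l m ≤ τ ∧ τ ≤ R m := by
    intro d
    induction d with
    | zero => intro i _ a b; exact ⟨i, le_rfl, le_rfl, a, b⟩
    | succ d ih =>
      intro i hin a b
      by_cases h : τ ≤ R i
      · exact ⟨i, le_rfl, by omega, a, h⟩
      · obtain ⟨m, m1, m2, m3⟩ := ih (i + 1) (by omega)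
          ((h1 i (by omega)).trans (not_le.1 h).le)
          (by rw [show i + 1 + d = i + (d + 1) by omega]; exact b)
        exact ⟨m, by omega, by omega, m3⟩
  have down : ∀ d i, d ≤ i → i ≤ n → l i ≤ τ → τ ≤ R (i - d) →
      ∃ m, i - d ≤ m ∧ m ≤ i ∧ l m ≤ τ ∧ τ ≤ R m := by
    intro d
    induction d with
    | zero => intro i _ _ a b; exact ⟨i, by omega, le_rfl, a, b⟩
    | succ d ih =>
      intro i hdi hin a b
      by_cases h : τ ≤ R i
      · exact ⟨i, by omega, le_rfl, a, h⟩
      · have := h2 (i - 1) (by omega)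
        rw [show i - 1 + 1 = i by omega] at this
        obtain ⟨m, m1, m2, m3⟩ := ih (i - 1) (by omega) (by omega)
          (this.trans (not_le.1 h).le)
          (by rw [show i - 1 - d = i - (d + 1) by omega]; exact b)
        exact ⟨m, by omega, by omega, m3⟩
  rcases le_total i j with h | h
  · obtain ⟨m, m1, m2, m3⟩ := up (j - i) i (by omega) hli (by rwa [Nat.add_sub_cancel' h])
    exact ⟨m, by omega, by omega, m3⟩
  · obtain ⟨m, m1, m2, m3⟩ := down (i - j) i (by omega) hi hli (by rwa [Nat.sub_sub_self h])
    exact ⟨m, by omega, by omega, m3⟩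

/-- Abstract line lemma. -/
theorem line_lemma {α : Type*} {r : α → α → Prop} (hr : ∀ a b, r a b → r b a) {N : Set α}
    {l R : α → ℝ} {W : Set ℝ} (hpos : ∀ x ∈ N, l x < R x)
    (hc : ∀ a ∈ N, ∀ b ∈ N, r a b → l b ≤ R a) (hW : IsOpen W)
    (hdis : ∀ x ∈ N, ∀ y ∈ N, ∀ τ ∈ W, l x < τ → τ < R x → l y < τ → τ < R y → x = y)
    {x0 xn : α} (hconn : Conn r N x0 xn) {a b : α} (ha : a ∈ N) (hb : b ∈ N) {τa τb : ℝ}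
    (hτa : τa ∈ W) (hτb : τb ∈ W) (ha1 : l a < τa) (ha2 : τa < R a) (hb1 : l b < τb)
    (hb2 : τb < R b) (hab : τa ≤ τb) (h0 : l x0 ≤ τa) (hn : τb ≤ R xn) :
    Conn r {x | x ∈ N ∧ l x ≤ τb ∧ τa ≤ R x} a b := by
  -- closed intervals containing an interior point of another interval
  have key : ∀ x ∈ N, ∀ y ∈ N, ∀ τ ∈ W, l x < τ → τ < R x → l y ≤ τ → τ ≤ R y → y = x := by
    intro x hx y hy τ hτ h1 h2 h3 h4
    have hy' := hpos y hy
    obtain ⟨ε, hε, hball⟩ := Metric.isOpen_iff.1 hW τ hτ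
    rcases lt_or_ge τ (R y) with h5 | h5
    · have hlt : τ < min (min (R x) (R y)) (τ + ε) := by
        simp only [lt_min_iff]; exact ⟨⟨h2, h5⟩, by linarith⟩
      obtain ⟨σ, hσ1, hσ2⟩ := exists_between hlt
      simp only [lt_min_iff] at hσ2
      refine (hdis x hx y hy σ (hball ?_) (h1.trans hσ1) hσ2.1.1 (h3.trans_lt hσ1) hσ2.1.2).symm
      rw [Metric.mem_ball, Real.dist_eq, abs_lt]; constructor <;> linarith
    · have hlt : max (max (l x) (l y)) (τ - ε) < τ := by
        simp only [max_lt_iff]; exact ⟨⟨h1, by linarith⟩, by linarith⟩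
      obtain ⟨σ, hσ1, hσ2⟩ := exists_between hlt
      simp only [max_lt_iff] at hσ1
      refine (hdis x hx y hy σ (hball ?_) hσ1.1.1 (hσ2.trans h2) hσ1.1.2 (hσ2.trans_le h4)).symm
      rw [Metric.mem_ball, Real.dist_eq, abs_lt]; constructor <;> linarith
  obtain ⟨n, g, g0, gn, gN, gr, ginj⟩ := hconn.exists_simple_walk
  have ginj' : ∀ i j, i ≤ n → j ≤ n → g i = g j → i = j := by
    intro i j hi hj h
    rcases lt_trichotomy i j with h' | h' | h'
    · exact absurd h (ginj i j h' hj)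
    · exact h'
    · exact absurd h.symm (ginj j i h' hi)
  have c1 : ∀ k < n, l (g (k + 1)) ≤ R (g k) := fun k hk =>
    hc _ (gN k (by omega)) _ (gN _ (by omega)) (gr k hk)
  have c2 : ∀ k < n, l (g k) ≤ R (g (k + 1)) := fun k hk =>
    hc _ (gN (k + 1) (by omega)) _ (gN _ (by omega)) (hr _ _ (gr k hk))
  obtain ⟨p, -, hp, p1, p2⟩ := walk_cover (l := fun k => l (g k)) (R := fun k => R (g k)) (τ := τa)
    c1 c2 (Nat.zero_le n) le_rfl (by rw [g0]; exact h0) (by rw [gn]; linarith)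
  obtain ⟨q, -, hq, q1, q2⟩ := walk_cover (l := fun k => l (g k)) (R := fun k => R (g k)) (τ := τb)
    c1 c2 (Nat.zero_le n) le_rfl (by rw [g0]; linarith) (by rw [gn]; exact hn)
  have hp' : p ≤ n := by omega
  have hq' : q ≤ n := by omega
  have ep : g p = a := key a ha _ (gN p hp') τa hτa ha1 ha2 p1 p2
  have eq : g q = b := key b hb _ (gN q hq') τb hτb hb1 hb2 q1 q2
  have hmid : ∀ k, min p q ≤ k → k ≤ max p q → g k ∈ {x | x ∈ N ∧ l x ≤ τb ∧ τa ≤ R x} := by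
    intro k hk1 hk2
    have hkn : k ≤ n := by omega
    refine ⟨gN k hkn, ?_, ?_⟩
    · by_contra hcon
      push Not at hcon
      obtain ⟨m, m1, m2, m3, m4⟩ := walk_cover (l := fun k => l (g k)) (R := fun k => R (g k))
        (τ := τb) c1 c2 hp' hkn (by rw [ep]; linarith) (by linarith [hpos _ (gN k hkn)])
      have e2 : g m = g q := by rw [eq]; exact key b hb _ (gN m (by omega)) τb hτb hb1 hb2 m3 m4
      have e3 := ginj' m q (by omega) hq' e2
      have e4 : k = q := by omega
      rw [e4, eq] at hcon
      linarith
    · by_contra hcon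
      push Not at hcon
      obtain ⟨m, m1, m2, m3, m4⟩ := walk_cover (l := fun k => l (g k)) (R := fun k => R (g k))
        (τ := τa) c1 c2 hkn hq' (by linarith [hpos _ (gN k hkn)]) (by rw [eq]; linarith)
      have e2 : g m = g p := by rw [ep]; exact key a ha _ (gN m (by omega)) τa hτa ha1 ha2 m3 m4
      have e3 := ginj' m p (by omega) hp' e2
      have e4 : k = p := by omega
      rw [e4, ep] at hcon
      linarith
  rw [← ep, ← eq]
  rcases le_total p q with h | h
  · exact Conn.of_walk' h hq' (fun k h1 h2 => hmid k (by omega) (by omega)) gr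
  · exact (Conn.of_walk' h hp' (fun k h1 h2 => hmid k (by omega) (by omega)) gr).symm hr

namespace Strip.Tiling
variable {V : Type} [Fintype V] {S : Strip V} (T : S.Tiling)

/-- The square of a vertex. -/
def D (x : V × ℤ) : Set (ℝ × ℝ) :=
  Icc (T.Ψ x) (T.Ψ x + T.ρ x.1) ×ˢ Icc (T.u x.1 - T.ρ x.1) (T.u x.1)

theorem mem_D {x : V × ℤ} {p : ℝ × ℝ} : p ∈ T.D x ↔
    (T.Ψ x ≤ p.1 ∧ p.1 ≤ T.Ψ x + T.ρ x.1) ∧ (T.u x.1 - T.ρ x.1 ≤ p.2 ∧ p.2 ≤ T.u x.1) := Iff.rfl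

theorem Ψ_shk (k : ℤ) (x : V × ℤ) : T.Ψ (sh k x) = T.Ψ x + k := by
  induction k using Int.induction_on with
  | zero => simp [sh]
  | succ k ih =>
    have : sh ((k : ℤ) + 1) x = sh 1 (sh k x) := by rw [sh_sh]
    rw [this, T.Ψ_sh, ih]; push_cast; ring
  | pred k ih =>
    have h1 : sh (-(k : ℤ)) x = sh 1 (sh (-(k : ℤ) - 1) x) := by rw [sh_sh]; congr 1; ring
    rw [h1, T.Ψ_sh] at ih
    push_cast at *; linarith

theorem Ψ_eq (v : V) (k : ℤ) : T.Ψ (v, k) = T.Ψ (v, 0) + k := by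
  have := T.Ψ_shk k (v, 0)
  simpa [sh] using this

theorem Ψ_bdd : ∃ B : ℝ, ∀ x, |T.Ψ x - x.2| ≤ B := by
  obtain ⟨B, hB⟩ := (Set.finite_range (fun v => |T.Ψ (v, 0)|)).bddAbove
  refine ⟨B, fun x => ?_⟩
  have : T.Ψ x - x.2 = T.Ψ (x.1, 0) := by
    have := T.Ψ_eq x.1 x.2
    simp only [Prod.mk.eta] at this
    linarith
  rw [this]
  exact hB ⟨x.1, rfl⟩

/-- Horizontal chains in level sets. -/
theorem horiz {s : ℝ} (h0 : 0 < s) (h1 : s < T.h) (M : ℝ) :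
    ∃ x y, T.Ψ x + T.ρ x.1 < -M ∧ M < T.Ψ y ∧
      Conn S.adj {z | T.u z.1 - T.ρ z.1 ≤ s ∧ s ≤ T.u z.1} x y := by
  rcases S.H {z | T.u z.1 - T.ρ z.1 ≤ s ∧ s ≤ T.u z.1}ᶜ with ⟨x, y, hx, hy, h⟩ | h
  · exfalso
    have hinv : T.u y.1 < s := by
      refine h.rec' (P := fun y => T.u y.1 < s) ?_ ?_
      · have := h.left
        by_contra hcon
        exact this ⟨by rw [T.u_top _ hx]; simpa using h0.le, not_lt.1 hcon⟩
      · intro a b _ hb hab ha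
        by_contra hcon
        exact hb ⟨by linarith [T.u_adj _ _ hab], not_lt.1 hcon⟩
    linarith [T.u_bot _ hy]
  · obtain ⟨B, hB⟩ := T.Ψ_bdd
    obtain ⟨K, hK⟩ := exists_int_gt (|M| + B + 1)
    obtain ⟨x, y, hx, hy, hc⟩ := h K
    rw [compl_compl] at hc
    have hx' : (x.2 : ℝ) < -K := by exact_mod_cast hx
    have hy' : (K : ℝ) < y.2 := by exact_mod_cast hy
    have b1 := abs_le.1 (hB x)
    have b2 := abs_le.1 (hB y)
    exact ⟨x, y, by linarith [T.ρ_le x.1, le_abs_self M], by linarith [le_abs_self M], hc⟩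

theorem cover {t s : ℝ} (h0 : 0 < s) (h1 : s < T.h) : ∃ x, (t, s) ∈ T.D x := by
  obtain ⟨x, y, hx, hy, h⟩ := T.horiz h0 h1 |t|
  obtain ⟨z, hz, h2, h3⟩ := conn_cover (l := T.Ψ) (R := fun x => T.Ψ x + T.ρ x.1) (τ := t) h
    (fun a _ b _ hab => T.Ψ_adj _ _ (S.symm _ _ hab))
    (by linarith [T.ρ_nonneg x.1, neg_abs_le t]) (by linarith [T.ρ_nonneg y.1, le_abs_self t])
  exact ⟨z, ⟨h2, h3⟩, hz⟩

/-- Vertical chains. -/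
theorem vchain (t : ℝ) : ∃ x y, x.1 ∈ S.top ∧ y.1 ∈ S.bot ∧
    Conn S.adj {z | T.Ψ z ≤ t ∧ t ≤ T.Ψ z + T.ρ z.1} x y := by
  rcases S.H {z | T.Ψ z ≤ t ∧ t ≤ T.Ψ z + T.ρ z.1} with h | h
  · exact h
  · exfalso
    obtain ⟨B, hB⟩ := T.Ψ_bdd
    obtain ⟨K, hK⟩ := exists_int_gt (|t| + B + 1)
    obtain ⟨x, y, hx, hy, hc⟩ := h K
    have hx' : (x.2 : ℝ) < -K := by exact_mod_cast hx
    have hy' : (K : ℝ) < y.2 := by exact_mod_cast hy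
    have b1 := abs_le.1 (hB x)
    have b2 := abs_le.1 (hB y)
    obtain ⟨z, hz, h2, h3⟩ := conn_cover (l := T.Ψ) (R := fun x => T.Ψ x + T.ρ x.1) (τ := t) hc
      (fun a _ b _ hab => T.Ψ_adj _ _ (S.symm _ _ hab))
      (by linarith [T.ρ_le x.1, neg_abs_le t])
      (by linarith [T.ρ_nonneg y.1, le_abs_self t])
    exact hz ⟨h2, h3⟩

theorem sum_J (v : V) :
    ∑' k : ℤ, volume (Icc (T.Ψ (v, k)) (T.Ψ (v, k) + T.ρ v) ∩ Ico (0 : ℝ) 1) =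
      ENNReal.ofReal (T.ρ v) := by
  have h1 : ∀ k : ℤ, volume (Icc (T.Ψ (v, k)) (T.Ψ (v, k) + T.ρ v) ∩ Ico (0 : ℝ) 1) =
      volume (Icc (T.Ψ (v, 0)) (T.Ψ (v, 0) + T.ρ v) ∩ Ico (-(k : ℝ)) (-k + 1)) := by
    intro k
    rw [← measure_preimage_add_right volume (k : ℝ)
      (Icc (T.Ψ (v, k)) (T.Ψ (v, k) + T.ρ v) ∩ Ico (0 : ℝ) 1)]
    congr 1
    ext t
    rw [T.Ψ_eq v k]
    simp only [mem_preimage, mem_inter_iff, mem_Icc, mem_Ico]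
    constructor <;> rintro ⟨⟨a, b⟩, c, d⟩ <;> refine ⟨⟨?_, ?_⟩, ?_, ?_⟩ <;> linarith
  simp only [h1]
  rw [← (Equiv.neg ℤ).tsum_eq]
  simp only [Equiv.neg_apply, Int.cast_neg, neg_neg]
  rw [← measure_iUnion, ← inter_iUnion]
  · have : (⋃ i : ℤ, Ico (i : ℝ) (i + 1)) = univ := iUnion_Ico_intCast ℝ
    rw [this, inter_univ, Real.volume_Icc]; congr 1; ring
  · intro i j hij
    exact (pairwise_disjoint_Ico_intCast ℝ hij).mono inter_subset_right inter_subset_right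
  · exact fun i => measurableSet_Icc.inter measurableSet_Ico

theorem sum_area (W : Set ℝ) :
    ∑' x, volume (T.D x ∩ (Ico (0 : ℝ) 1 ×ˢ W)) =
      ∑ v, ENNReal.ofReal (T.ρ v) * volume (Icc (T.u v - T.ρ v) (T.u v) ∩ W) := by
  rw [ENNReal.tsum_prod', tsum_fintype]
  refine Finset.sum_congr rfl fun v _ => ?_
  rw [← T.sum_J v, ← ENNReal.tsum_mul_right]
  refine tsum_congr fun k => ?_
  rw [D, prod_inter_prod, Measure.volume_eq_prod, Measure.prod_prod]

theorem mem_D_sh {x : V × ℤ} {p : ℝ × ℝ} (k : ℤ) :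
    (p.1 + k, p.2) ∈ T.D (sh k x) ↔ p ∈ T.D x := by
  rw [mem_D, mem_D, T.Ψ_shk]
  simp only [sh]
  constructor <;> rintro ⟨⟨a, b⟩, c⟩ <;> exact ⟨⟨by linarith, by linarith⟩, c⟩

theorem measurable_D (x : V × ℤ) : MeasurableSet (T.D x) := measurableSet_Icc.prod measurableSet_Icc

theorem area_ge {x y : V × ℤ} (hxy : x ≠ y) :
    ENNReal.ofReal T.h + volume (T.D x ∩ T.D y ∩ (Ico (0 : ℝ) 1 ×ˢ Ioo (0 : ℝ) T.h)) ≤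
      ∑ v, ENNReal.ofReal (T.ρ v) * volume (Icc (T.u v - T.ρ v) (T.u v) ∩ Ioo (0 : ℝ) T.h) := by
  classical
  set Q := (Ico (0 : ℝ) 1 ×ˢ Ioo (0 : ℝ) T.h) with hQ
  have hQm : MeasurableSet Q := measurableSet_Ico.prod measurableSet_Ioo
  have hQv : volume Q = ENNReal.ofReal T.h := by
    rw [hQ, Measure.volume_eq_prod, Measure.prod_prod, Real.volume_Ico, Real.volume_Ioo]; simp
  rw [← T.sum_area, ← hQv]
  have hm : ∀ z, MeasurableSet (T.D z ∩ Q) := fun z => (T.measurable_D z).inter hQm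
  have hm2 : MeasurableSet (T.D x ∩ T.D y ∩ Q) :=
    ((T.measurable_D x).inter (T.measurable_D y)).inter hQm
  simp only [← hQ]
  calc volume Q + volume (T.D x ∩ T.D y ∩ Q)
      = ∫⁻ p, (Q.indicator 1 p + (T.D x ∩ T.D y ∩ Q).indicator 1 p) := by
        rw [lintegral_add_left (measurable_one.indicator hQm), lintegral_indicator_one hQm,
          lintegral_indicator_one hm2]
    _ ≤ ∫⁻ p, ∑' z, (T.D z ∩ Q).indicator 1 p := by
        refine lintegral_mono fun p => ?_
        by_cases hp : p ∈ Q
        · by_cases hp2 : p ∈ T.D x ∩ T.D y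
          · have := ENNReal.sum_le_tsum (f := fun z => (T.D z ∩ Q).indicator 1 p) {x, y}
            rw [Finset.sum_pair hxy] at this
            simpa [hp, hp2.1, hp2.2, indicator] using this
          · obtain ⟨z, hz⟩ := T.cover (t := p.1) hp.2.1 hp.2.2
            have hz' : p ∈ T.D z := hz
            have := ENNReal.le_tsum (f := fun z => (T.D z ∩ Q).indicator (1 : ℝ × ℝ → ℝ≥0∞) p) z
            have h3 : p ∉ T.D x ∩ T.D y ∩ Q := fun h => hp2 h.1
            simp only [indicator_of_notMem h3, indicator_of_mem hp, add_zero]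
            refine le_trans ?_ this
            rw [indicator_of_mem (show p ∈ T.D z ∩ Q from ⟨hz', hp⟩)]
        · have h3 : p ∉ T.D x ∩ T.D y ∩ Q := fun h => hp h.2
          simp [indicator_of_notMem h3, indicator_of_notMem hp]
    _ = ∑' z, volume (T.D z ∩ Q) := by
        rw [lintegral_tsum fun z => (measurable_one.indicator (hm z)).aemeasurable]
        exact tsum_congr fun z => lintegral_indicator_one (hm z)

theorem area_le_term (v : V) (W : Set ℝ) :
    ENNReal.ofReal (T.ρ v) * volume (Icc (T.u v - T.ρ v) (T.u v) ∩ W) ≤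
      ENNReal.ofReal (T.ρ v ^ 2) := by
  rw [pow_two, ENNReal.ofReal_mul (T.ρ_nonneg v)]
  gcongr
  refine (measure_mono inter_subset_left).trans ?_
  rw [Real.volume_Icc]; apply le_of_eq; congr 1; ring

theorem ofReal_h : ∑ v, ENNReal.ofReal (T.ρ v ^ 2) = ENNReal.ofReal T.h := by
  rw [← T.sum_sq, ENNReal.ofReal_sum_of_nonneg fun v _ => sq_nonneg _]

/-- Distinct squares have disjoint interiors in the strip. -/
theorem disj {x y : V × ℤ} {p : ℝ × ℝ} (hp0 : 0 < p.2) (hph : p.2 < T.h)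
    (hx1 : T.Ψ x < p.1) (hx2 : p.1 < T.Ψ x + T.ρ x.1) (hx3 : T.u x.1 - T.ρ x.1 < p.2)
    (hx4 : p.2 < T.u x.1)
    (hy1 : T.Ψ y < p.1) (hy2 : p.1 < T.Ψ y + T.ρ y.1) (hy3 : T.u y.1 - T.ρ y.1 < p.2)
    (hy4 : p.2 < T.u y.1) : x = y := by
  by_contra hxy
  set k : ℤ := -⌊p.1⌋ with hk
  have hk1 : 0 ≤ p.1 + k := by rw [hk]; push_cast; linarith [Int.floor_le p.1]
  have hk2 : p.1 + k < 1 := by rw [hk]; push_cast; linarith [Int.lt_floor_add_one p.1]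
  have hne : sh k x ≠ sh k y := by
    intro h
    simp only [sh, Prod.mk.injEq, add_left_inj] at h
    exact hxy (Prod.ext h.1 h.2)
  have h1 := T.area_ge hne
  have h2 : ∑ v, ENNReal.ofReal (T.ρ v) * volume (Icc (T.u v - T.ρ v) (T.u v) ∩ Ioo (0 : ℝ) T.h) ≤
      ENNReal.ofReal T.h := by
    rw [← T.ofReal_h]
    exact Finset.sum_le_sum fun v _ => T.area_le_term v _
  have h3 : volume (T.D (sh k x) ∩ T.D (sh k y) ∩ (Ico (0 : ℝ) 1 ×ˢ Ioo (0 : ℝ) T.h)) = 0 := by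
    have h4 := h1.trans h2
    nth_rewrite 2 [← add_zero (ENNReal.ofReal T.h)] at h4
    exact le_antisymm ((ENNReal.add_le_add_iff_left ENNReal.ofReal_ne_top).1 h4) (zero_le)
  set b := min (min (T.Ψ x + T.ρ x.1 + k) (T.Ψ y + T.ρ y.1 + k)) 1 with hb
  set c := max (max (T.u x.1 - T.ρ x.1) (T.u y.1 - T.ρ y.1)) 0 with hc
  set d := min (min (T.u x.1) (T.u y.1)) T.h with hd
  have hpb : p.1 + k < b := by simp only [hb, lt_min_iff]; exact ⟨⟨by linarith, by linarith⟩, hk2⟩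
  have hcd : c < d := by
    have h5 : c < p.2 := by simp only [hc, max_lt_iff]; exact ⟨⟨hx3, hy3⟩, hp0⟩
    have h6 : p.2 < d := by simp only [hd, lt_min_iff]; exact ⟨⟨hx4, hy4⟩, hph⟩
    exact h5.trans h6
  have h5 : Ioo (p.1 + k) b ×ˢ Ioo c d ⊆
      T.D (sh k x) ∩ T.D (sh k y) ∩ (Ico (0 : ℝ) 1 ×ˢ Ioo (0 : ℝ) T.h) := by
    rintro ⟨t, s⟩ ⟨⟨a1, a2⟩, a3, a4⟩
    simp only [hb, hc, hd, lt_min_iff, max_lt_iff] at a1 a2 a3 a4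
    refine ⟨⟨?_, ?_⟩, ⟨by linarith, a2.2⟩, a3.2, a4.2⟩
    · rw [mem_D, T.Ψ_shk]
      simp only [sh]
      exact ⟨⟨by linarith, by linarith⟩, by linarith, by linarith⟩
    · rw [mem_D, T.Ψ_shk]
      simp only [sh]
      exact ⟨⟨by linarith, by linarith⟩, by linarith, by linarith⟩
  have h6 := measure_mono_null h5 h3
  rw [Measure.volume_eq_prod, Measure.prod_prod, Real.volume_Ioo, Real.volume_Ioo, mul_eq_zero,
    ENNReal.ofReal_eq_zero, ENNReal.ofReal_eq_zero] at h6
  rcases h6 with h6 | h6 <;> linarith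

theorem u_le_h {v : V} (hv : 0 < T.ρ v) : T.u v ≤ T.h := by
  by_contra hcon
  push Not at hcon
  have hne : ((v, 0) : V × ℤ) ≠ (v, 1) := by simp
  have h1 := le_trans le_self_add (T.area_ge hne)
  have hlt : ENNReal.ofReal (T.ρ v) * volume (Icc (T.u v - T.ρ v) (T.u v) ∩ Ioo (0 : ℝ) T.h) <
      ENNReal.ofReal (T.ρ v ^ 2) := by
    rw [pow_two, ENNReal.ofReal_mul (T.ρ_nonneg v)]
    refine ENNReal.mul_lt_mul_right (by simpa using hv) ENNReal.ofReal_ne_top ?_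
    have : Icc (T.u v - T.ρ v) (T.u v) ∩ Ioo (0 : ℝ) T.h ⊆ Icc (T.u v - T.ρ v) T.h :=
      fun s hs => ⟨hs.1.1, hs.2.2.le⟩
    refine (measure_mono this).trans_lt ?_
    rw [Real.volume_Icc]
    exact (ENNReal.ofReal_lt_ofReal_iff hv).2 (by linarith)
  have h2 : ∑ v, ENNReal.ofReal (T.ρ v) * volume (Icc (T.u v - T.ρ v) (T.u v) ∩ Ioo (0 : ℝ) T.h) <
      ENNReal.ofReal T.h := by
    rw [← T.ofReal_h]
    classical
    rw [← Finset.add_sum_erase _ _ (Finset.mem_univ v), ← Finset.add_sum_erase (a := v)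
      (f := fun v => ENNReal.ofReal (T.ρ v ^ 2)) _ (Finset.mem_univ v)]
    have h3 : ∑ x ∈ Finset.univ.erase v, ENNReal.ofReal (T.ρ x) *
        volume (Icc (T.u x - T.ρ x) (T.u x) ∩ Ioo (0 : ℝ) T.h) ≤
        ∑ x ∈ Finset.univ.erase v, ENNReal.ofReal (T.ρ x ^ 2) :=
      Finset.sum_le_sum fun v _ => T.area_le_term v _
    refine ENNReal.add_lt_add_of_lt_of_le (ne_top_of_le_ne_top ?_ h3) hlt h3
    exact (ENNReal.sum_lt_top.2 fun _ _ => ENNReal.ofReal_lt_top).ne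
  exact absurd h1 (not_le.2 h2)

end Strip.Tiling
end BK

end

section
open Metric MeasureTheory Set
open scoped ENNReal NNReal Topology

namespace BK

theorem avg_lemma {ι : Type*} (s : Finset ι) (w lam : ι → ℝ) (hw : ∀ i, 0 ≤ w i)
    (hl : ∀ i, 0 ≤ lam i) (A : ι → Set ℝ) (hA : ∀ i, MeasurableSet (A i)) (B : Set ℝ)
    (hB : MeasurableSet B) (hvol : ∀ i ∈ s, volume (A i ∩ B) ≤ ENNReal.ofReal (lam i)) {L : ℝ}
    (hL : volume B = ENNReal.ofReal L)
    (hone : ∀ᵐ δ : ℝ, δ ∈ B → ∃ s' ⊆ s, (∀ i ∈ s', δ ∈ A i) ∧ 1 ≤ ∑ i ∈ s', w i) :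
    L ≤ ∑ i ∈ s, w i * lam i := by
  have h0 : 0 ≤ ∑ i ∈ s, w i * lam i := Finset.sum_nonneg fun i _ => mul_nonneg (hw i) (hl i)
  rw [← ENNReal.ofReal_le_ofReal_iff h0, ← hL]
  calc volume B = ∫⁻ δ in B, 1 := by simp
    _ ≤ ∫⁻ δ in B, ∑ i ∈ s, ENNReal.ofReal (w i) * (A i).indicator 1 δ := by
        refine lintegral_mono_ae ((ae_restrict_iff' hB).2 ?_)
        filter_upwards [hone] with δ hδ hδB
        obtain ⟨s', hs', hA', h1⟩ := hδ hδB
        calc (1 : ℝ≥0∞) ≤ ENNReal.ofReal (∑ i ∈ s', w i) := by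
              rw [← ENNReal.ofReal_one]; exact ENNReal.ofReal_le_ofReal h1
          _ = ∑ i ∈ s', ENNReal.ofReal (w i) :=
              ENNReal.ofReal_sum_of_nonneg fun i _ => hw i
          _ = ∑ i ∈ s', ENNReal.ofReal (w i) * (A i).indicator 1 δ :=
              Finset.sum_congr rfl fun i hi => by rw [indicator_of_mem (hA' i hi)]; simp
          _ ≤ _ := Finset.sum_le_sum_of_subset hs'
    _ = ∑ i ∈ s, ENNReal.ofReal (w i) * volume (A i ∩ B) := by
        rw [lintegral_finsetSum]
        · refine Finset.sum_congr rfl fun i _ => ?_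
          rw [lintegral_const_mul _ (measurable_one.indicator (hA i)),
            lintegral_indicator_one (hA i), Measure.restrict_apply (hA i)]
        · exact fun i _ => (measurable_one.indicator (hA i)).const_mul _
    _ ≤ ∑ i ∈ s, ENNReal.ofReal (w i * lam i) := by
        refine Finset.sum_le_sum fun i hi => ?_
        rw [ENNReal.ofReal_mul (hw i)]
        gcongr
        exact hvol i hi
    _ = ENNReal.ofReal (∑ i ∈ s, w i * lam i) :=
        (ENNReal.ofReal_sum_of_nonneg fun i _ => mul_nonneg (hw i) (hl i)).symm

namespace Strip.Tiling
variable {V : Type} [Fintype V] {S : Strip V} (T : S.Tiling)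

theorem area_fin (X : Finset (V × ℤ)) {W : Set (ℝ × ℝ)} (hWm : MeasurableSet W)
    (hW : ∀ p ∈ W, 0 < p.2 ∧ p.2 < T.h) : ∑ x ∈ X, volume (T.D x ∩ W) ≤ volume W := by
  set O : V × ℤ → Set (ℝ × ℝ) := fun x =>
    Ioo (T.Ψ x) (T.Ψ x + T.ρ x.1) ×ˢ Ioo (T.u x.1 - T.ρ x.1) (T.u x.1) with hO
  have h1 : ∀ x, volume (T.D x ∩ W) = volume (O x ∩ W) := by
    intro x
    refine measure_congr (Filter.EventuallyEq.inter ?_ (Filter.EventuallyEq.refl _ _))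
    rw [Measure.volume_eq_prod]
    exact Measure.set_prod_ae_eq Ioo_ae_eq_Icc.symm Ioo_ae_eq_Icc.symm
  simp only [h1]
  rw [← measure_biUnion_finset]
  · exact measure_mono (iUnion₂_subset fun x _ => inter_subset_right)
  · intro x _ y _ hxy
    refine Set.disjoint_left.2 ?_
    rintro p ⟨⟨⟨a1, a2⟩, a3, a4⟩, hp⟩ ⟨⟨⟨b1, b2⟩, b3, b4⟩, -⟩
    exact hxy (T.disj (hW p hp).1 (hW p hp).2 a1 a2 a3 a4 b1 b2 b3 b4)
  · exact fun x _ => (measurableSet_Ioo.prod measurableSet_Ioo).inter hWm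

theorem band {s1 s2 : ℝ} (h1 : 0 ≤ s1) (h2 : s2 ≤ T.h) :
    ∑ v, ENNReal.ofReal (T.ρ v) * volume (Icc (T.u v - T.ρ v) (T.u v) ∩ Ioo s1 s2) ≤
      ENNReal.ofReal (s2 - s1) := by
  rw [← T.sum_area, ENNReal.tsum_eq_iSup_sum]
  refine iSup_le fun X => ?_
  refine (T.area_fin X (measurableSet_Ico.prod measurableSet_Ioo) ?_).trans ?_
  · rintro p ⟨-, hp⟩
    exact ⟨h1.trans_lt hp.1, hp.2.trans_le h2⟩
  · rw [Measure.volume_eq_prod, Measure.prod_prod, Real.volume_Ico, Real.volume_Ioo]; simp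

/-- Squares meeting a horizontal segment. -/
def Hs (α β s : ℝ) : Set (V × ℤ) :=
  {z | (T.Ψ z ≤ β ∧ α ≤ T.Ψ z + T.ρ z.1) ∧ (T.u z.1 - T.ρ z.1 ≤ s ∧ s ≤ T.u z.1)}

/-- Squares meeting a vertical segment. -/
def Vs (α β t : ℝ) : Set (V × ℤ) :=
  {z | (T.Ψ z ≤ t ∧ t ≤ T.Ψ z + T.ρ z.1) ∧ (T.u z.1 - T.ρ z.1 ≤ β ∧ α ≤ T.u z.1)}

def genS (s : ℝ) : Prop := ∀ v, T.u v - T.ρ v ≠ s ∧ T.u v ≠ s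
def genT (t : ℝ) : Prop := ∀ x : V × ℤ, T.Ψ x ≠ t ∧ T.Ψ x + T.ρ x.1 ≠ t

theorem hline {s : ℝ} (h0 : 0 < s) (hh : s < T.h) (hs : T.genS s) {a b : V × ℤ} {τa τb : ℝ}
    (ha : T.u a.1 - T.ρ a.1 ≤ s ∧ s ≤ T.u a.1) (hb : T.u b.1 - T.ρ b.1 ≤ s ∧ s ≤ T.u b.1)
    (ha1 : T.Ψ a < τa) (ha2 : τa < T.Ψ a + T.ρ a.1) (hb1 : T.Ψ b < τb)
    (hb2 : τb < T.Ψ b + T.ρ b.1) : Conn S.adj (T.Hs (min τa τb) (max τa τb) s) a b := by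
  wlog hab : τa ≤ τb generalizing a b τa τb
  · rw [min_comm, max_comm]
    exact (this hb ha hb1 hb2 ha1 ha2 (le_of_not_ge hab)).symm S.symm
  obtain ⟨x, y, hx, hy, hxy⟩ := T.horiz h0 hh (|τa| + |τb|)
  have hst : ∀ z : V × ℤ, (T.u z.1 - T.ρ z.1 ≤ s ∧ s ≤ T.u z.1) →
      T.u z.1 - T.ρ z.1 < s ∧ s < T.u z.1 := fun z hz =>
    ⟨lt_of_le_of_ne hz.1 (hs z.1).1, lt_of_le_of_ne hz.2 (Ne.symm (hs z.1).2)⟩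
  have := line_lemma (r := S.adj) S.symm (N := {z | T.u z.1 - T.ρ z.1 ≤ s ∧ s ≤ T.u z.1})
    (l := T.Ψ) (R := fun x => T.Ψ x + T.ρ x.1) (W := univ)
    (fun z hz => by have := hst z hz; linarith)
    (fun a _ b _ hab => T.Ψ_adj _ _ (S.symm _ _ hab)) isOpen_univ
    (fun z hz z' hz' τ _ c1 c2 c3 c4 => T.disj (p := (τ, s)) h0 hh c1 c2 (hst z hz).1 (hst z hz).2
      c3 c4 (hst z' hz').1 (hst z' hz').2)
    hxy ha hb trivial trivial ha1 ha2 hb1 hb2 hab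
    (by linarith [T.ρ_nonneg x.1, neg_abs_le τa, abs_nonneg τb])
    (by linarith [T.ρ_nonneg y.1, abs_nonneg τa, le_abs_self τb])
  refine this.mono ?_
  rintro z ⟨z1, z2⟩
  rw [min_eq_left hab, max_eq_right hab]
  exact ⟨z2, z1⟩

theorem vline {t : ℝ} (ht : T.genT t) {a b : V × ℤ} {τa τb : ℝ}
    (ha0 : 0 < τa) (hah : τa < T.h) (hb0 : 0 < τb) (hbh : τb < T.h)
    (ha : T.Ψ a ≤ t ∧ t ≤ T.Ψ a + T.ρ a.1) (hb : T.Ψ b ≤ t ∧ t ≤ T.Ψ b + T.ρ b.1)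
    (ha1 : T.u a.1 - T.ρ a.1 < τa) (ha2 : τa < T.u a.1) (hb1 : T.u b.1 - T.ρ b.1 < τb)
    (hb2 : τb < T.u b.1) : Conn S.adj (T.Vs (min τa τb) (max τa τb) t) a b := by
  wlog hab : τa ≤ τb generalizing a b τa τb
  · rw [min_comm, max_comm]
    exact (this hb0 hbh ha0 hah hb ha hb1 hb2 ha1 ha2 (le_of_not_ge hab)).symm S.symm
  obtain ⟨x, y, hx, hy, hxy⟩ := T.vchain t
  have hst : ∀ z : V × ℤ, (T.Ψ z ≤ t ∧ t ≤ T.Ψ z + T.ρ z.1) →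
      T.Ψ z < t ∧ t < T.Ψ z + T.ρ z.1 := fun z hz =>
    ⟨lt_of_le_of_ne hz.1 (ht z).1, lt_of_le_of_ne hz.2 (Ne.symm (ht z).2)⟩
  have := line_lemma (r := S.adj) S.symm (N := {z | T.Ψ z ≤ t ∧ t ≤ T.Ψ z + T.ρ z.1})
    (l := fun x => T.u x.1 - T.ρ x.1) (R := fun x => T.u x.1) (W := Ioo 0 T.h)
    (fun z hz => by have := hst z hz; linarith)
    (fun a _ b _ hab => by linarith [T.u_adj _ _ hab]) isOpen_Ioo
    (fun z hz z' hz' τ hτ c1 c2 c3 c4 => T.disj (p := (t, τ)) hτ.1 hτ.2 (hst z hz).1 (hst z hz).2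
      c1 c2 (hst z' hz').1 (hst z' hz').2 c3 c4)
    hxy ha hb ⟨ha0, hah⟩ ⟨hb0, hbh⟩ ha1 ha2 hb1 hb2 hab
    (by rw [T.u_top _ hx]; linarith)
    (by linarith [T.u_bot _ hy])
  refine this.mono ?_
  rintro z ⟨z1, z2⟩
  rw [min_eq_left hab, max_eq_right hab]
  exact ⟨z1, z2⟩

theorem hside {s α β : ℝ} (h0 : 0 < s) (hh : s < T.h) (hs : T.genS s) (hα : T.genT α)
    (hβ : T.genT β) (hαβ : α < β) {a b : V × ℤ} (ha : a ∈ T.Hs α β s) (hb : b ∈ T.Hs α β s) :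
    Conn S.adj (T.Hs α β s) a b := by
  have key : ∀ z ∈ T.Hs α β s, ∃ τ, α < τ ∧ τ < β ∧ T.Ψ z < τ ∧ τ < T.Ψ z + T.ρ z.1 := by
    rintro z ⟨⟨z1, z2⟩, z3, z4⟩
    have e1 := lt_of_le_of_ne z1 (hβ z).1
    have e2 := lt_of_le_of_ne z2 (Ne.symm (hα z).2)
    have e3 := lt_of_le_of_ne z3 (hs z.1).1
    have e4 := lt_of_le_of_ne z4 (Ne.symm (hs z.1).2)
    have : max (T.Ψ z) α < min (T.Ψ z + T.ρ z.1) β := by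
      simp only [lt_min_iff, max_lt_iff]
      exact ⟨⟨by linarith, e2⟩, e1, hαβ⟩
    obtain ⟨τ, t1, t2⟩ := exists_between this
    simp only [lt_min_iff, max_lt_iff] at t1 t2
    exact ⟨τ, t1.2, t2.2, t1.1, t2.1⟩
  obtain ⟨τa, a1, a2, a3, a4⟩ := key a ha
  obtain ⟨τb, b1, b2, b3, b4⟩ := key b hb
  refine (T.hline h0 hh hs ha.2 hb.2 a3 a4 b3 b4).mono ?_
  rintro z ⟨⟨z1, z2⟩, z3⟩
  exact ⟨⟨z1.trans (max_le a2.le b2.le), (le_min a1.le b1.le).trans z2⟩, z3⟩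

theorem vside {t α β : ℝ} (h0 : 0 < α) (hh : β < T.h) (ht : T.genT t) (hα : T.genS α)
    (hβ : T.genS β) (hαβ : α < β) {a b : V × ℤ} (ha : a ∈ T.Vs α β t) (hb : b ∈ T.Vs α β t) :
    Conn S.adj (T.Vs α β t) a b := by
  have key : ∀ z ∈ T.Vs α β t, ∃ τ, α < τ ∧ τ < β ∧ T.u z.1 - T.ρ z.1 < τ ∧ τ < T.u z.1 := by
    rintro z ⟨⟨z1, z2⟩, z3, z4⟩
    have e1 := lt_of_le_of_ne z1 (ht z).1
    have e2 := lt_of_le_of_ne z2 (Ne.symm (ht z).2)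
    have e3 := lt_of_le_of_ne z3 (hβ z.1).1
    have e4 := lt_of_le_of_ne z4 (Ne.symm (hα z.1).2)
    have : max (T.u z.1 - T.ρ z.1) α < min (T.u z.1) β := by
      simp only [lt_min_iff, max_lt_iff]
      exact ⟨⟨by linarith, e4⟩, e3, hαβ⟩
    obtain ⟨τ, t1, t2⟩ := exists_between this
    simp only [lt_min_iff, max_lt_iff] at t1 t2
    exact ⟨τ, t1.2, t2.2, t1.1, t2.1⟩
  obtain ⟨τa, a1, a2, a3, a4⟩ := key a ha
  obtain ⟨τb, b1, b2, b3, b4⟩ := key b hb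
  refine (T.vline ht (h0.trans a1) (a2.trans hh) (h0.trans b1) (b2.trans hh) ha.1 hb.1
    a3 a4 b3 b4).mono ?_
  rintro z ⟨z3, z1, z2⟩
  exact ⟨z3, z1.trans (max_le a2.le b2.le), (le_min a1.le b1.le).trans z2⟩

/-- Squares meeting the boundary of the square of centre `q` and radius `δ`. -/
def ringSet (q : ℝ × ℝ) (δ : ℝ) : Set (V × ℤ) := {z | ∃ p ∈ T.D z, dist p q = δ}

theorem ring {q : ℝ × ℝ} {δ : ℝ} (hδ : 0 < δ) (h0 : 0 < q.2 - δ) (hh : q.2 + δ < T.h)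
    (g1 : T.genT (q.1 - δ)) (g2 : T.genT (q.1 + δ)) (g3 : T.genS (q.2 - δ))
    (g4 : T.genS (q.2 + δ)) {x y : V × ℤ} (hx : x ∈ T.ringSet q δ) (hy : y ∈ T.ringSet q δ) :
    Conn S.adj (T.ringSet q δ) x y := by
  have hHsub : ∀ s, |s - q.2| = δ → T.Hs (q.1 - δ) (q.1 + δ) s ⊆ T.ringSet q δ := by
    rintro s hs z ⟨⟨z1, z2⟩, z3⟩
    refine ⟨(max (T.Ψ z) (q.1 - δ), s), ⟨⟨le_max_left _ _, max_le (by
      linarith [T.ρ_nonneg z.1]) z2⟩, z3⟩, ?_⟩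
    rw [Prod.dist_eq, Real.dist_eq, Real.dist_eq, hs]
    refine max_eq_right (abs_le.2 ⟨?_, ?_⟩)
    · linarith [le_max_right (T.Ψ z) (q.1 - δ)]
    · have : max (T.Ψ z) (q.1 - δ) ≤ q.1 + δ := max_le z1 (by linarith)
      linarith
  have hVsub : ∀ t, |t - q.1| = δ → T.Vs (q.2 - δ) (q.2 + δ) t ⊆ T.ringSet q δ := by
    rintro t ht z ⟨z3, z1, z2⟩
    refine ⟨(t, max (T.u z.1 - T.ρ z.1) (q.2 - δ)), ⟨z3, le_max_left _ _, max_le (by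
      linarith [T.ρ_nonneg z.1]) z2⟩, ?_⟩
    rw [Prod.dist_eq, Real.dist_eq, Real.dist_eq, ht]
    refine max_eq_left (abs_le.2 ⟨?_, ?_⟩)
    · linarith [le_max_right (T.u z.1 - T.ρ z.1) (q.2 - δ)]
    · have : max (T.u z.1 - T.ρ z.1) (q.2 - δ) ≤ q.2 + δ := max_le z1 (by linarith)
      linarith
  have am : |q.2 - δ - q.2| = δ := by rw [sub_sub_cancel_left, abs_neg, abs_of_pos hδ]
  have ap : |q.2 + δ - q.2| = δ := by rw [add_sub_cancel_left, abs_of_pos hδ]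
  have am1 : |q.1 - δ - q.1| = δ := by rw [sub_sub_cancel_left, abs_neg, abs_of_pos hδ]
  have ap1 : |q.1 + δ - q.1| = δ := by rw [add_sub_cancel_left, abs_of_pos hδ]
  obtain ⟨c1, hc1⟩ := T.cover (t := q.1 - δ) (s := q.2 - δ) h0 (by linarith)
  obtain ⟨c2, hc2⟩ := T.cover (t := q.1 + δ) (s := q.2 - δ) h0 (by linarith)
  obtain ⟨c3, hc3⟩ := T.cover (t := q.1 - δ) (s := q.2 + δ) (by linarith) hh
  rw [mem_D] at hc1 hc2 hc3
  simp only at hc1 hc2 hc3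
  have hdown : ∀ z ∈ T.Hs (q.1 - δ) (q.1 + δ) (q.2 - δ), Conn S.adj (T.ringSet q δ) c1 z :=
    fun z hz => (T.hside h0 (by linarith) g3 g1 g2 (by linarith)
      (a := c1) ⟨⟨by linarith, hc1.1.2⟩, hc1.2⟩ hz).mono (hHsub _ am)
  have hleft : ∀ z ∈ T.Vs (q.2 - δ) (q.2 + δ) (q.1 - δ), Conn S.adj (T.ringSet q δ) c1 z :=
    fun z hz => (T.vside h0 hh g1 g3 g4 (by linarith)
      (a := c1) ⟨hc1.1, by linarith, by linarith⟩ hz).mono (hVsub _ am1)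
  have h12 := hdown c2 ⟨⟨hc2.1.1, by linarith⟩, hc2.2⟩
  have h13 := hleft c3 ⟨hc3.1, hc3.2.1, by linarith⟩
  have hup : ∀ z ∈ T.Hs (q.1 - δ) (q.1 + δ) (q.2 + δ), Conn S.adj (T.ringSet q δ) c1 z :=
    fun z hz => h13.trans ((T.hside (by linarith) hh g4 g1 g2 (by linarith)
      (a := c3) ⟨⟨by linarith, hc3.1.2⟩, hc3.2⟩ hz).mono (hHsub _ ap))
  have hright : ∀ z ∈ T.Vs (q.2 - δ) (q.2 + δ) (q.1 + δ), Conn S.adj (T.ringSet q δ) c1 z :=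
    fun z hz => h12.trans ((T.vside h0 hh g2 g3 g4 (by linarith)
      (a := c2) ⟨hc2.1, by linarith, by linarith⟩ hz).mono (hVsub _ ap1))
  have hall : ∀ z ∈ T.ringSet q δ, Conn S.adj (T.ringSet q δ) c1 z := by
    rintro z ⟨p, hp, hpq⟩
    rw [Prod.dist_eq, Real.dist_eq, Real.dist_eq] at hpq
    rw [mem_D] at hp
    have b1 := abs_le.1 ((le_max_left _ _).trans hpq.le)
    have b2 := abs_le.1 ((le_max_right _ _).trans hpq.le)
    rcases max_choice |p.1 - q.1| |p.2 - q.2| with h | h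
    · rw [h] at hpq
      rcases (abs_eq hδ.le).1 hpq with h' | h'
      · refine hright z ⟨?_, by linarith, by linarith⟩
        rw [show q.1 + δ = p.1 by linarith]; exact hp.1
      · refine hleft z ⟨?_, by linarith, by linarith⟩
        rw [show q.1 - δ = p.1 by linarith]; exact hp.1
    · rw [h] at hpq
      rcases (abs_eq hδ.le).1 hpq with h' | h'
      · refine hup z ⟨⟨by linarith, by linarith⟩, ?_⟩
        rw [show q.2 + δ = p.2 by linarith]; exact hp.2
      · refine hdown z ⟨⟨by linarith, by linarith⟩, ?_⟩
        rw [show q.2 - δ = p.2 by linarith]; exact hp.2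
  exact ((hall x hx).symm S.symm).trans (hall y hy)

theorem ae_genS : ∀ᵐ s : ℝ, T.genS s := by
  have h1 : (range (fun v => T.u v - T.ρ v) ∪ range T.u).Countable :=
    (countable_range _).union (countable_range _)
  filter_upwards [h1.ae_notMem volume] with s hs v
  exact ⟨fun h => hs (Or.inl ⟨v, h⟩), fun h => hs (Or.inr ⟨v, h⟩)⟩

theorem ae_gen (q : ℝ × ℝ) : ∀ᵐ δ : ℝ, T.genT (q.1 - δ) ∧ T.genT (q.1 + δ) ∧ T.genS (q.2 - δ) ∧
    T.genS (q.2 + δ) := by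
  have : Countable V := Finite.to_countable
  have c1 : (range (fun x => q.1 - T.Ψ x) ∪ range (fun x => q.1 - (T.Ψ x + T.ρ x.1))).Countable :=
    (countable_range _).union (countable_range _)
  have c2 : (range (fun x => T.Ψ x - q.1) ∪ range (fun x => (T.Ψ x + T.ρ x.1) - q.1)).Countable :=
    (countable_range _).union (countable_range _)
  have c3 : (range (fun v => q.2 - (T.u v - T.ρ v)) ∪ range (fun v => q.2 - T.u v)).Countable :=
    (countable_range _).union (countable_range _)
  have c4 : (range (fun v => (T.u v - T.ρ v) - q.2) ∪ range (fun v => T.u v - q.2)).Countable :=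
    (countable_range _).union (countable_range _)
  filter_upwards [c1.ae_notMem volume, c2.ae_notMem volume, c3.ae_notMem volume,
    c4.ae_notMem volume] with δ h1 h2 h3 h4
  refine ⟨fun x => ⟨fun h => h1 (Or.inl ⟨x, ?_⟩), fun h => h1 (Or.inr ⟨x, ?_⟩)⟩,
    fun x => ⟨fun h => h2 (Or.inl ⟨x, ?_⟩), fun h => h2 (Or.inr ⟨x, ?_⟩)⟩,
    fun x => ⟨fun h => h3 (Or.inl ⟨x, ?_⟩), fun h => h3 (Or.inr ⟨x, ?_⟩)⟩,
    fun x => ⟨fun h => h4 (Or.inl ⟨x, ?_⟩), fun h => h4 (Or.inr ⟨x, ?_⟩)⟩⟩ <;>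
  simp only <;> linarith

/-- Admissible weights for two families. -/
def Adm (S : Strip V) (E F : Set (V × ℤ)) (w : V → ℝ) : Prop :=
  ∀ e ∈ E, ∀ f ∈ F, ∀ A : Finset V, Conn S.adj {z | z.1 ∈ A} e f → 1 ≤ ∑ v ∈ A, w v

theorem LOOP {s1 s2 : ℝ} (h1 : 0 ≤ s1) (h12 : s1 < s2) (h2 : s2 ≤ T.h) {E F : Set (V × ℤ)}
    (hE : ∀ s ∈ Ioo s1 s2, ∃ x ∈ E, T.u x.1 - T.ρ x.1 ≤ s ∧ s ≤ T.u x.1)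
    (hF : ∀ s ∈ Ioo s1 s2, ∃ x ∈ F, T.u x.1 - T.ρ x.1 ≤ s ∧ s ≤ T.u x.1)
    {w : V → ℝ} (hw : ∀ v, 0 ≤ w v) (hadm : Adm S E F w) : s2 - s1 ≤ ∑ v, w v ^ 2 := by
  classical
  set A : V → Set ℝ := fun v => Icc (T.u v - T.ρ v) (T.u v) with hA
  set lam : V → ℝ := fun v => (volume (A v ∩ Ioo s1 s2)).toReal with hlam
  have hfin : ∀ v, volume (A v ∩ Ioo s1 s2) ≠ ∞ := fun v =>
    ne_top_of_le_ne_top (by rw [Real.volume_Ioo]; exact ENNReal.ofReal_ne_top)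
      (measure_mono (inter_subset_right : A v ∩ Ioo s1 s2 ⊆ Ioo s1 s2))
  have hl0 : ∀ v, 0 ≤ lam v := fun v => ENNReal.toReal_nonneg
  have hlr : ∀ v, lam v ≤ T.ρ v := by
    intro v
    refine ENNReal.toReal_le_of_le_ofReal (T.ρ_nonneg v) ((measure_mono inter_subset_left).trans ?_)
    rw [hA, Real.volume_Icc]; apply le_of_eq; congr 1; ring
  have havg : s2 - s1 ≤ ∑ v, w v * lam v := by
    refine avg_lemma Finset.univ w lam hw hl0 A (fun v => measurableSet_Icc) (Ioo s1 s2)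
      measurableSet_Ioo (fun v _ => by rw [hlam, ENNReal.ofReal_toReal (hfin v)])
      (Real.volume_Ioo) ?_
    filter_upwards [T.ae_genS] with s hs hsI
    refine ⟨Finset.univ.filter fun v => s ∈ A v, Finset.subset_univ _, by simp, ?_⟩
    obtain ⟨e, he, hes⟩ := hE s hsI
    obtain ⟨f, hf, hfs⟩ := hF s hsI
    have hst : ∀ z : V × ℤ, (T.u z.1 - T.ρ z.1 ≤ s ∧ s ≤ T.u z.1) → 0 < T.ρ z.1 := fun z hz => by
      have := lt_of_le_of_ne hz.1 (hs z.1).1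
      have := lt_of_le_of_ne hz.2 (Ne.symm (hs z.1).2)
      linarith
    have p1 := hst e hes
    have p2 := hst f hfs
    refine hadm e he f hf _ ((T.hline (a := e) (b := f) (τa := T.Ψ e + T.ρ e.1 / 2)
      (τb := T.Ψ f + T.ρ f.1 / 2) (h1.trans_lt hsI.1) (hsI.2.trans_le h2) hs hes hfs (by linarith)
      (by linarith) (by linarith) (by linarith)).mono ?_)
    rintro z ⟨-, hz⟩
    simp only [Finset.mem_filter, Finset.mem_univ, true_and, mem_ofPred_eq]
    exact hz
  have hband : ∑ v, lam v ^ 2 ≤ s2 - s1 := by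
    have hb := T.band h1 h2
    have : ∑ v, lam v ^ 2 ≤ ∑ v, T.ρ v * lam v :=
      Finset.sum_le_sum fun v _ => by nlinarith [hl0 v, hlr v]
    refine this.trans ?_
    rw [← ENNReal.ofReal_le_ofReal_iff (by linarith),
      ENNReal.ofReal_sum_of_nonneg fun v _ => mul_nonneg (T.ρ_nonneg v) (hl0 v)]
    refine le_trans (le_of_eq ?_) hb
    refine Finset.sum_congr rfl fun v _ => ?_
    rw [ENNReal.ofReal_mul (T.ρ_nonneg v), hlam, ENNReal.ofReal_toReal (hfin v)]
  have hcs := Finset.sum_mul_sq_le_sq_mul_sq Finset.univ w lam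
  have hw2 : 0 ≤ ∑ v, w v ^ 2 := Finset.sum_nonneg fun v _ => sq_nonneg _
  have : (s2 - s1) * (s2 - s1) ≤ (∑ v, w v ^ 2) * (s2 - s1) := by
    calc (s2 - s1) * (s2 - s1) ≤ (∑ v, w v * lam v) ^ 2 := by
          rw [← pow_two]; exact pow_le_pow_left₀ (by linarith) havg 2
      _ ≤ _ := hcs
      _ ≤ _ := mul_le_mul_of_nonneg_left hband hw2
  exact le_of_mul_le_mul_right this (by linarith)

theorem VERT {w : V → ℝ} {s1 s2 : ℝ} (h1 : 0 ≤ s1) (h12 : s1 ≤ s2) (h2 : s2 ≤ T.h)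
    (hcr : ∀ F : Finset V, S.Crossing F → 1 ≤ ∑ v ∈ F, w v)
    (hsupp : ∀ v, w v ≠ 0 → 0 < T.ρ v → s1 ≤ T.u v - T.ρ v ∧ T.u v ≤ s2) :
    1 ≤ (∑ v, w v ^ 2) * (s2 - s1) := by
  classical
  have hv := T.vert w hcr
  set lam : V → ℝ := fun v => if w v = 0 then 0 else T.ρ v with hlam
  have e1 : ∑ v, w v * T.ρ v = ∑ v, w v * lam v := by
    refine Finset.sum_congr rfl fun v _ => ?_
    simp only [hlam]; split_ifs with h <;> simp [h]
  have hband : ∑ v, lam v ^ 2 ≤ s2 - s1 := by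
    have hb := T.band h1 h2
    rw [← ENNReal.ofReal_le_ofReal_iff (by linarith),
      ENNReal.ofReal_sum_of_nonneg fun v _ => sq_nonneg _]
    refine le_trans (Finset.sum_le_sum fun v _ => ?_) hb
    by_cases h : w v = 0
    · simp [hlam, h]
    · rcases (T.ρ_nonneg v).eq_or_lt with h3 | h3
      · simp [hlam, h, ← h3]
      · obtain ⟨a1, a2⟩ := hsupp v h h3
        have hsub : Ioo (T.u v - T.ρ v) (T.u v) ⊆
            Icc (T.u v - T.ρ v) (T.u v) ∩ Ioo s1 s2 := fun s hs =>
          ⟨⟨hs.1.le, hs.2.le⟩, a1.trans_lt hs.1, hs.2.trans_le a2⟩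
        simp only [hlam, h, if_false]
        rw [pow_two, ENNReal.ofReal_mul h3.le]
        gcongr
        refine le_trans (le_of_eq ?_) (measure_mono hsub)
        rw [Real.volume_Ioo]; congr 1; ring
  have hcs := Finset.sum_mul_sq_le_sq_mul_sq Finset.univ w lam
  have hw2 : 0 ≤ ∑ v, w v ^ 2 := Finset.sum_nonneg fun v _ => sq_nonneg _
  calc (1 : ℝ) ≤ (∑ v, w v * lam v) ^ 2 := by
        rw [← e1]; nlinarith
    _ ≤ _ := hcs
    _ ≤ _ := mul_le_mul_of_nonneg_left hband hw2

end Strip.Tiling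
end BK

end

section
open Metric MeasureTheory Set
open scoped ENNReal NNReal Topology

namespace BK
namespace Strip.Tiling
variable {V : Type} [Fintype V] {S : Strip V} (T : S.Tiling)

theorem small_square {x : V × ℤ} {p : ℝ × ℝ} (hp : p ∈ T.D x) {l : ℝ} (h0 : 0 ≤ l)
    (hl : l ≤ T.ρ x.1) : ∃ a b : ℝ, Icc a (a + l) ×ˢ Icc b (b + l) ⊆
      T.D x ∩ (Icc (p.1 - l) (p.1 + l) ×ˢ Icc (p.2 - l) (p.2 + l)) := by
  rw [mem_D] at hp
  obtain ⟨⟨p1, p2⟩, p3, p4⟩ := hp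
  refine ⟨max (T.Ψ x) (p.1 - l), max (T.u x.1 - T.ρ x.1) (p.2 - l), ?_⟩
  rintro y ⟨⟨a1, a2⟩, a3, a4⟩
  have b1 := le_max_left (T.Ψ x) (p.1 - l)
  have b2 := le_max_right (T.Ψ x) (p.1 - l)
  have b3 := le_max_left (T.u x.1 - T.ρ x.1) (p.2 - l)
  have b4 := le_max_right (T.u x.1 - T.ρ x.1) (p.2 - l)
  have c1 : max (T.Ψ x) (p.1 - l) ≤ p.1 := max_le p1 (by linarith)
  have c2 : max (T.u x.1 - T.ρ x.1) (p.2 - l) ≤ p.2 := max_le p3 (by linarith)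
  have c3 : max (T.Ψ x) (p.1 - l) ≤ T.Ψ x + T.ρ x.1 - l := max_le (by linarith) (by linarith)
  have c4 : max (T.u x.1 - T.ρ x.1) (p.2 - l) ≤ T.u x.1 - l := max_le (by linarith) (by linarith)
  refine ⟨⟨⟨?_, ?_⟩, ?_, ?_⟩, ⟨?_, ?_⟩, ?_, ?_⟩ <;> linarith

theorem SQ {q : ℝ × ℝ} {δ0 : ℝ} (hδ0 : 0 < δ0) (h4 : 4 * δ0 ≤ 1) (hq0 : 3 * δ0 < q.2)
    (hqh : q.2 + 3 * δ0 < T.h) {E F : Set (V × ℤ)}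
    (hE : ∀ δ ∈ Ioo δ0 (2 * δ0), ∃ x ∈ E, x ∈ T.ringSet q δ)
    (hF : ∀ δ ∈ Ioo δ0 (2 * δ0), ∃ x ∈ F, x ∈ T.ringSet q δ)
    {w : V → ℝ} (hw : ∀ v, 0 ≤ w v) (hadm : Adm S E F w) : 1 ≤ 108 * ∑ v, w v ^ 2 := by
  classical
  set e := Equiv.sigmaEquivProd V ℤ with he
  set s0 : Finset (Σ _ : V, ℤ) := Finset.univ.sigma fun v =>
    Finset.Icc ⌈q.1 - 2 * δ0 - T.Ψ (v, 0) - T.ρ v⌉ ⌊q.1 + 2 * δ0 - T.Ψ (v, 0)⌋ with hs0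
  set s := s0.filter fun i => ∃ p ∈ T.D (e i), dist p q ≤ 2 * δ0 with hs
  have hmem : ∀ i, (∃ p ∈ T.D (e i), dist p q ≤ 2 * δ0) → i ∈ s := by
    rintro ⟨v, k⟩ ⟨p, hp, hpq⟩
    rw [hs, Finset.mem_filter]
    refine ⟨?_, p, hp, hpq⟩
    rw [mem_D] at hp
    simp only [he, Equiv.sigmaEquivProd_apply, T.Ψ_eq v k] at hp
    rw [Prod.dist_eq, max_le_iff, Real.dist_eq, abs_le] at hpq
    simp only [hs0, Finset.mem_sigma, Finset.mem_univ, true_and, Finset.mem_Icc, Int.ceil_le,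
      Int.le_floor]
    constructor <;> linarith
  have hsum : ∑ i ∈ s, w i.1 ^ 2 ≤ 3 * ∑ v, w v ^ 2 := by
    refine (Finset.sum_le_sum_of_subset_of_nonneg (Finset.filter_subset _ _)
      fun i _ _ => sq_nonneg _).trans ?_
    rw [hs0, Finset.sum_sigma, Finset.mul_sum]
    refine Finset.sum_le_sum fun v _ => ?_
    simp only [Finset.sum_const, nsmul_eq_mul]
    refine mul_le_mul_of_nonneg_right ?_ (sq_nonneg _)
    rw [Int.card_Icc]
    have f1 := Int.floor_le (q.1 + 2 * δ0 - T.Ψ (v, 0))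
    have f2 := Int.le_ceil (q.1 - 2 * δ0 - T.Ψ (v, 0) - T.ρ v)
    have f3 := T.ρ_le v
    have : ((⌊q.1 + 2 * δ0 - T.Ψ (v, 0)⌋ + 1 - ⌈q.1 - 2 * δ0 - T.Ψ (v, 0) - T.ρ v⌉ : ℤ) : ℝ) ≤
        (3 : ℤ) := by push_cast; linarith
    have h3 := Int.cast_le.1 this
    have : (⌊q.1 + 2 * δ0 - T.Ψ (v, 0)⌋ + 1 - ⌈q.1 - 2 * δ0 - T.Ψ (v, 0) - T.ρ v⌉).toNat ≤ 3 := by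
      omega
    exact_mod_cast this
  set A : (Σ _ : V, ℤ) → Set ℝ := fun i =>
    Icc (infDist q (T.D (e i))) (infDist q (T.D (e i)) + T.ρ i.1) with hA
  have hAm : ∀ i δ, e i ∈ T.ringSet q δ → δ ∈ A i := by
    rintro i δ ⟨p, hp, hpq⟩
    refine ⟨by rw [← hpq, dist_comm]; exact infDist_le_dist_of_mem hp, ?_⟩
    have : δ - T.ρ i.1 ≤ infDist q (T.D (e i)) := by
      refine (le_infDist ⟨p, hp⟩).2 fun y hy => ?_
      have h1 : dist p y ≤ T.ρ i.1 := by
        rw [mem_D] at hp hy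
        have : (e i).1 = i.1 := rfl
        rw [this] at hp hy
        rw [Prod.dist_eq, max_le_iff, Real.dist_eq, Real.dist_eq, abs_le, abs_le]
        refine ⟨⟨?_, ?_⟩, ?_, ?_⟩ <;> linarith
      have := dist_triangle p y q
      rw [dist_comm y q] at this
      linarith
    linarith
  set lam : (Σ _ : V, ℤ) → ℝ := fun i => min (T.ρ i.1) δ0 with hlam
  have hl0 : ∀ i, 0 ≤ lam i := fun i => le_min (T.ρ_nonneg _) hδ0.le
  have havg : δ0 ≤ ∑ i ∈ s, w i.1 * lam i := by
    refine avg_lemma s (fun i => w i.1) lam (fun i => hw i.1) hl0 A (fun i => measurableSet_Icc)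
      (Ioo δ0 (2 * δ0)) measurableSet_Ioo ?_ (by rw [Real.volume_Ioo]; congr 1; ring) ?_
    · intro i _
      simp only [hlam]
      rcases min_choice (T.ρ i.1) δ0 with h | h <;> rw [h]
      · refine (measure_mono inter_subset_left).trans ?_
        rw [hA, Real.volume_Icc]; apply le_of_eq; congr 1; ring
      · refine (measure_mono inter_subset_right).trans ?_
        rw [Real.volume_Ioo]; apply le_of_eq; congr 1; ring
    · filter_upwards [T.ae_gen q] with δ hg hδ
      have hring : ∀ i, e i ∈ T.ringSet q δ → i ∈ s := by
        rintro i ⟨p, hp, hpq⟩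
        exact hmem i ⟨p, hp, by rw [hpq]; exact hδ.2.le⟩
      refine ⟨s.filter fun i => e i ∈ T.ringSet q δ, Finset.filter_subset _ _,
        fun i hi => hAm i δ (Finset.mem_filter.1 hi).2, ?_⟩
      obtain ⟨x, hxE, hx⟩ := hE δ hδ
      obtain ⟨y, hyF, hy⟩ := hF δ hδ
      have hc := T.ring (q := q) (δ := δ) (by linarith [hδ.1]) (by linarith [hδ.2])
        (by linarith [hδ.2]) hg.1 hg.2.1 hg.2.2.1 hg.2.2.2 hx hy
      have h1 := hadm x hxE y hyF ((s.filter fun i => e i ∈ T.ringSet q δ).image fun i => i.1)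
        (hc.mono fun z hz => by
          rw [mem_ofPred_eq, Finset.mem_image]
          refine ⟨e.symm z, ?_, rfl⟩
          rw [Finset.mem_filter]
          have : e (e.symm z) ∈ T.ringSet q δ := by rw [Equiv.apply_symm_apply]; exact hz
          exact ⟨hring _ this, this⟩)
      refine h1.trans ?_
      rw [← Finset.sum_fiberwise_of_maps_to (g := fun i : (Σ _ : V, ℤ) => i.1)
        (t := (s.filter fun i => e i ∈ T.ringSet q δ).image fun i => i.1)
        (fun i hi => Finset.mem_image_of_mem _ hi)]
      refine Finset.sum_le_sum fun v hv => ?_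
      obtain ⟨i, hi, rfl⟩ := Finset.mem_image.1 hv
      exact Finset.single_le_sum (f := fun i : (Σ _ : V, ℤ) => w i.1) (fun j _ => hw j.1)
        (Finset.mem_filter.2 ⟨hi, rfl⟩)
  have harea : ∑ i ∈ s, lam i ^ 2 ≤ 36 * δ0 ^ 2 := by
    set W : Set (ℝ × ℝ) := Icc (q.1 - 3 * δ0) (q.1 + 3 * δ0) ×ˢ Icc (q.2 - 3 * δ0) (q.2 + 3 * δ0)
      with hW
    have h1 := T.area_fin (s.map e.toEmbedding) (W := W)
      (measurableSet_Icc.prod measurableSet_Icc)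
      (fun p hp => ⟨by linarith [hp.2.1], by linarith [hp.2.2]⟩)
    rw [Finset.sum_map] at h1
    have hWv : volume W = ENNReal.ofReal (36 * δ0 ^ 2) := by
      rw [hW, Measure.volume_eq_prod, Measure.prod_prod, Real.volume_Icc, Real.volume_Icc,
        ← ENNReal.ofReal_mul (by linarith)]
      congr 1; ring
    rw [hWv] at h1
    rw [← ENNReal.ofReal_le_ofReal_iff (by positivity),
      ENNReal.ofReal_sum_of_nonneg fun v _ => sq_nonneg _]
    refine le_trans (Finset.sum_le_sum fun i hi => ?_) h1
    obtain ⟨p, hp, hpq⟩ := (Finset.mem_filter.1 hi).2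
    obtain ⟨a, b, hab⟩ := T.small_square hp (hl0 i) (min_le_left _ _)
    have hl1 : lam i ≤ δ0 := min_le_right _ _
    rw [Prod.dist_eq, max_le_iff, Real.dist_eq, abs_le, Real.dist_eq, abs_le] at hpq
    have hsub : Icc a (a + lam i) ×ˢ Icc b (b + lam i) ⊆ T.D (e i) ∩ W := by
      refine hab.trans (inter_subset_inter_right _ ?_)
      rintro y ⟨⟨a1, a2⟩, a3, a4⟩
      refine ⟨⟨?_, ?_⟩, ?_, ?_⟩ <;> linarith
    refine le_trans (le_of_eq ?_) (measure_mono hsub)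
    rw [Measure.volume_eq_prod, Measure.prod_prod, Real.volume_Icc, Real.volume_Icc,
        ← ENNReal.ofReal_mul (by linarith [hl0 i])]
    congr 1; ring
  have hcs := Finset.sum_mul_sq_le_sq_mul_sq s (fun i => w i.1) lam
  have hw2 : 0 ≤ ∑ v, w v ^ 2 := Finset.sum_nonneg fun v _ => sq_nonneg _
  have : δ0 ^ 2 ≤ (3 * ∑ v, w v ^ 2) * (36 * δ0 ^ 2) := by
    calc δ0 ^ 2 ≤ (∑ i ∈ s, w i.1 * lam i) ^ 2 := pow_le_pow_left₀ hδ0.le havg 2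
      _ ≤ _ := hcs
      _ ≤ _ := mul_le_mul hsum harea (Finset.sum_nonneg fun _ _ => sq_nonneg _) (by positivity)
  have h2 : 0 < δ0 ^ 2 := by positivity
  by_contra hc
  push Not at hc
  nlinarith

end Strip.Tiling
end BK

end

section
open Metric MeasureTheory Set
open scoped ENNReal NNReal Topology

namespace BK

/-- Quadratic packing bound. -/
def Pack (X : Type*) [MetricSpace X] (Cp : ℝ) : Prop :=
  1 ≤ Cp ∧ ∀ (x : X) (ε R : ℝ), 0 < ε → ε ≤ R → ∀ F : Finset X, (∀ y ∈ F, dist y x ≤ R) →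
    (∀ y ∈ F, ∀ z ∈ F, y ≠ z → ε ≤ dist y z) → (F.card : ℝ) ≤ Cp * (R / ε) ^ 2

theorem exists_pack {X : Type} [MetricSpace X] [MeasurableSpace X] [BorelSpace X] [CompactSpace X]
    (hreg : AhlforsTwoRegular X) : ∃ Cp, Pack X Cp := by
  classical
  obtain ⟨C, hC, hreg⟩ := hreg
  rcases subsingleton_or_nontrivial X with hs | hn
  · refine ⟨1, le_rfl, fun x ε R hε hR F _ _ => ?_⟩
    have h1 : F.card ≤ 1 := Finset.card_le_one.2 fun a _ b _ => Subsingleton.elim a b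
    have h2 : (1 : ℝ) ≤ R / ε := by rwa [le_div_iff₀ hε, one_mul]
    have : (F.card : ℝ) ≤ 1 := by exact_mod_cast h1
    nlinarith
  have hbdd : Bornology.IsBounded (univ : Set X) := isCompact_univ.isBounded
  set d := diam (univ : Set X) with hd
  have hd0 : 0 < d := by
    obtain ⟨x, y, hxy⟩ := exists_pair_ne X
    exact (dist_pos.2 hxy).trans_le (dist_le_diam_of_mem hbdd trivial trivial)
  have hed : EMetric.diam (univ : Set X) = ENNReal.ofReal d := by
    rw [hd, diam, ENNReal.ofReal_toReal hbdd.ediam_ne_top]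
    rfl
  have hlt : ∀ r, r < d → ENNReal.ofReal r < EMetric.diam (univ : Set X) := fun r hr => by
    rw [hed]; exact (ENNReal.ofReal_lt_ofReal_iff hd0).2 hr
  set μ := hausdorff2 X with hμ
  -- total mass
  obtain ⟨t, -, ht⟩ := isCompact_univ.elim_nhds_subcover (fun x : X => ball x (d / 2))
    (fun x _ => ball_mem_nhds x (by linarith))
  have hfin : μ univ ≠ ∞ := by
    refine ne_top_of_le_ne_top ?_ ((measure_mono ht).trans (measure_biUnion_finset_le t _))
    refine (ENNReal.sum_lt_top.2 fun x _ => ?_).ne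
    exact (hreg x (d / 2) (by linarith) (hlt _ (by linarith))).2.trans_lt ENNReal.ofReal_lt_top
  set m := (μ univ).toReal with hm
  have hm0 : 0 ≤ m := ENNReal.toReal_nonneg
  have hmu : μ univ = ENNReal.ofReal m := (ENNReal.ofReal_toReal hfin).symm
  set C2 := C + m / d ^ 2 with hC2
  have hmd : 0 ≤ m / d ^ 2 := by positivity
  have hup : ∀ x : X, ∀ R, 0 < R → μ (ball x R) ≤ ENNReal.ofReal (C2 * R ^ 2) := by
    intro x R hR
    rcases lt_or_ge R d with h | h
    · refine (hreg x R hR (hlt R h)).2.trans (ENNReal.ofReal_le_ofReal ?_)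
      have : 0 ≤ m / d ^ 2 * R ^ 2 := by positivity
      rw [hC2]; linarith
    · refine (measure_mono (subset_univ _)).trans ?_
      rw [hmu]
      refine ENNReal.ofReal_le_ofReal ?_
      have h1 : m = m / d ^ 2 * d ^ 2 := by field_simp
      have h2 : d ^ 2 ≤ R ^ 2 := pow_le_pow_left₀ hd0.le h 2
      have h3 : m / d ^ 2 * d ^ 2 ≤ m / d ^ 2 * R ^ 2 := mul_le_mul_of_nonneg_left h2 hmd
      have h4 : 0 ≤ C * R ^ 2 := by positivity
      rw [hC2]; linarith
  refine ⟨16 * C * C2, ?_, ?_⟩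
  · have : 1 ≤ C2 := by rw [hC2]; linarith
    nlinarith
  intro x ε R hε hR F hF hsep
  have hRe : (1 : ℝ) ≤ R / ε := by rwa [le_div_iff₀ hε, one_mul]
  have hC21 : 1 ≤ C2 := by rw [hC2]; linarith
  rcases Nat.lt_or_ge 1 F.card with h | h
  swap
  · have : (F.card : ℝ) ≤ 1 := by exact_mod_cast h
    have h3 : 1 ≤ C * C2 := by nlinarith
    nlinarith
  obtain ⟨y, hy, z, hz, hyz⟩ := Finset.one_lt_card.1 h
  have hεd : ε ≤ d := (hsep y hy z hz hyz).trans (dist_le_diam_of_mem hbdd trivial trivial)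
  have hdis : (F : Set X).PairwiseDisjoint fun y => ball y (ε / 2) := by
    intro y hy z hz hyz
    refine ball_disjoint_ball ?_
    have := hsep y hy z hz hyz
    linarith
  have hsub : (⋃ y ∈ F, ball y (ε / 2)) ⊆ ball x (2 * R) := by
    refine iUnion₂_subset fun y hy => ball_subset_ball' ?_
    have := hF y hy
    linarith
  have h1 := measure_mono (μ := μ) hsub
  rw [measure_biUnion_finset hdis fun y _ => measurableSet_ball] at h1
  have h2 : ∑ y ∈ F, ENNReal.ofReal ((ε / 2) ^ 2 / C) ≤ ENNReal.ofReal (C2 * (2 * R) ^ 2) :=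
    (Finset.sum_le_sum fun y _ => (hreg y (ε / 2) (by linarith) (hlt _ (by linarith))).1).trans
      (h1.trans (hup x _ (by linarith)))
  rw [← ENNReal.ofReal_sum_of_nonneg fun _ _ => by positivity, ENNReal.ofReal_le_ofReal_iff
    (by positivity), Finset.sum_const, nsmul_eq_mul] at h2
  have hC0 : 0 < C := by linarith
  have e3 : ∀ n : ℝ, n * ((ε / 2) ^ 2 / C) * (4 * C / ε ^ 2) = n := by
    intro n; field_simp; ring
  have e4 : ∀ c : ℝ, c * (2 * R) ^ 2 * (4 * C / ε ^ 2) = 16 * C * c * (R / ε) ^ 2 := by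
    intro c; field_simp; ring
  have h3 := e3 F.card
  have h4 := e4 C2
  rw [← h3, ← h4]
  exact mul_le_mul_of_nonneg_right h2 (by positivity)

/-- Finite `r`-nets. -/
theorem exists_net {X : Type} [MetricSpace X] [CompactSpace X] {r : ℝ} (hr : 0 < r) :
    ∃ Z : Finset X, (∀ y ∈ Z, ∀ z ∈ Z, y ≠ z → r ≤ dist y z) ∧ ∀ x : X, ∃ z ∈ Z, dist x z < r := by
  classical
  obtain ⟨t, -, ht⟩ := isCompact_univ.elim_nhds_subcover (fun x : X => ball x (r / 2))
    (fun x _ => ball_mem_nhds x (by linarith))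
  have key : ∀ Z : Finset X, (∀ y ∈ Z, ∀ z ∈ Z, y ≠ z → r ≤ dist y z) → Z.card ≤ t.card := by
    intro Z hZ
    have : ∀ y : X, ∃ x ∈ t, dist y x < r / 2 := by
      intro y
      obtain ⟨x, hx, hy⟩ := mem_iUnion₂.1 (ht (mem_univ y))
      exact ⟨x, hx, hy⟩
    choose f hf hf' using this
    refine Finset.card_le_card_of_injOn f (fun y _ => hf y) fun y hy z hz hyz => ?_
    by_contra hne
    have h1 := hZ y hy z hz hne
    have h2 := dist_triangle_right y z (f y)
    have h3 := hf' y
    have h4 := hf' z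
    rw [← hyz] at h4
    linarith
  obtain ⟨Z, hZ, hmax⟩ : ∃ Z : Finset X, (∀ y ∈ Z, ∀ z ∈ Z, y ≠ z → r ≤ dist y z) ∧
      ∀ Z' : Finset X, (∀ y ∈ Z', ∀ z ∈ Z', y ≠ z → r ≤ dist y z) → Z'.card ≤ Z.card := by
    have hex : ∃ n, ∃ Z : Finset X, (∀ y ∈ Z, ∀ z ∈ Z, y ≠ z → r ≤ dist y z) ∧
        t.card - Z.card = n := ⟨_, ∅, by simp, rfl⟩
    obtain ⟨Z, hZ, hn⟩ := Nat.find_spec hex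
    refine ⟨Z, hZ, fun Z' hZ' => ?_⟩
    have := Nat.find_min' hex ⟨Z', hZ', rfl⟩
    have h1 := key Z' hZ'
    have h2 := key Z hZ
    omega
  refine ⟨Z, hZ, fun x => ?_⟩
  by_contra hcon
  push Not at hcon
  have hx : x ∉ Z := fun hx => by have := hcon x hx; rw [dist_self] at this; linarith
  have := hmax (insert x Z) ?_
  · rw [Finset.card_insert_of_notMem hx] at this; omega
  · intro y hy z hz hyz
    rcases Finset.mem_insert.1 hy with e1 | e1 <;> rcases Finset.mem_insert.1 hz with e2 | e2
    · exact absurd (e1.trans e2.symm) hyz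
    · rw [e1]; exact hcon z e2
    · rw [e2, dist_comm]; exact hcon y e1
    · exact hZ y e1 z e2 hyz

/-- Greedy colouring. -/
theorem exists_colour {α : Type*} [DecidableEq α] (Z : Finset α) (conf : α → α → Prop)
    (hsymm : ∀ a b, conf a b → conf b a) (N : ℕ)
    (hN : ∀ a ∈ Z, ∀ F ⊆ Z, (∀ b ∈ F, conf a b) → F.card ≤ N) :
    ∃ col : α → ℕ, (∀ a, col a ≤ N) ∧ ∀ a ∈ Z, ∀ b ∈ Z, a ≠ b → conf a b → col a ≠ col b := by
  classical
  induction Z using Finset.induction_on with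
  | empty => exact ⟨fun _ => 0, by simp, by simp⟩
  | insert a Z ha ih =>
    obtain ⟨col, hc, hcol⟩ := ih fun b hb F hF h =>
      hN b (Finset.mem_insert_of_mem hb) F (hF.trans (Finset.subset_insert _ _)) h
    have h1 := hN a (Finset.mem_insert_self _ _) (Z.filter fun b => conf a b)
      ((Finset.filter_subset _ _).trans (Finset.subset_insert _ _))
      (fun b hb => (Finset.mem_filter.1 hb).2)
    obtain ⟨k, hk, hk'⟩ : ∃ k ∈ Finset.range (N + 1), k ∉ (Z.filter fun b => conf a b).image col := by
      refine Finset.exists_mem_notMem_of_card_lt_card ?_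
      have := Finset.card_image_le (s := Z.filter fun b => conf a b) (f := col)
      simp only [Finset.card_range]; omega
    have hkk : ∀ b ∈ Z, conf a b → col b ≠ k := fun b hb hab h =>
      hk' (Finset.mem_image.2 ⟨b, Finset.mem_filter.2 ⟨hb, hab⟩, h⟩)
    have hne : ∀ b ∈ Z, b ≠ a := fun b hb h => ha (h ▸ hb)
    refine ⟨Function.update col a k, fun b => ?_, ?_⟩
    · by_cases h : b = a
      · subst h; simp at hk ⊢; omega
      · simp [h, hc b]
    · intro b hb c hc' hbc hconf
      rcases Finset.mem_insert.1 hb with e1 | e1 <;> rcases Finset.mem_insert.1 hc' with e2 | e2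
      · exact absurd (e1.trans e2.symm) hbc
      · rw [e1] at hconf ⊢
        simp only [Function.update_self, Function.update_of_ne (hne c e2)]
        exact (hkk c e2 hconf).symm
      · rw [e2] at hconf ⊢
        simp only [Function.update_self, Function.update_of_ne (hne b e1)]
        exact hkk b e1 (hsymm _ _ hconf)
      · simp only [Function.update_of_ne (hne b e1), Function.update_of_ne (hne c e2)]
        exact hcol b e1 c e2 hbc hconf

end BK

end

section
open Metric MeasureTheory Set
open scoped ENNReal NNReal Topology

namespace BK

/-- Intersection relation of a family of sets. -/
def bint {X ι : Type*} (β : ι → Set X) (i j : ι) : Prop := (β i ∩ β j).Nonempty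

theorem bint_symm {X ι : Type*} (β : ι → Set X) (i j : ι) (h : bint β i j) : bint β j i := by
  unfold bint at *; rwa [inter_comm]

theorem nerve {X ι : Type*} [TopologicalSpace X] [Finite ι] {P : ι → Set X}
    (hP : ∀ i, IsClosed (P i)) {E : Set X} (hE : IsPreconnected E) (hcov : E ⊆ ⋃ i, P i)
    {x y : X} (hx : x ∈ E) (hy : y ∈ E) {i j : ι} (hxi : x ∈ P i) (hyj : y ∈ P j) :
    Conn (bint P) {k | (P k ∩ E).Nonempty} i j := by
  by_contra hcon
  set R : Set ι := {k | Conn (bint P) {k | (P k ∩ E).Nonempty} i k} with hR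
  have c1 : IsClosed (⋃ k ∈ R, P k) := (toFinite R).isClosed_biUnion fun k _ => hP k
  have c2 : IsClosed (⋃ k ∈ Rᶜ, P k) := (toFinite Rᶜ).isClosed_biUnion fun k _ => hP k
  have hi : i ∈ R := Conn.refl ⟨x, hxi, hx⟩
  obtain ⟨z, hzE, hz1, hz2⟩ := isPreconnected_closed_iff.1 hE _ _ c1 c2 (fun z hz => by
      obtain ⟨k, hk⟩ := mem_iUnion.1 (hcov hz)
      by_cases h : k ∈ R
      · exact Or.inl (mem_biUnion h hk)
      · exact Or.inr (mem_biUnion (show k ∈ Rᶜ from h) hk))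
    ⟨x, hx, mem_biUnion hi hxi⟩ ⟨y, hy, mem_biUnion (show j ∈ Rᶜ from hcon) hyj⟩
  obtain ⟨k, hk, hzk⟩ := mem_iUnion₂.1 hz1
  obtain ⟨l, hl, hzl⟩ := mem_iUnion₂.1 hz2
  exact hl (Conn.step (show Conn _ _ _ _ from hk) ⟨z, hzk, hzl⟩ ⟨z, hzl, hzE⟩)

theorem iter_root {B : Type*} [Finite B] (par : B → B) (key rank : B → ℕ)
    (h0 : ∀ c, key c = 0 → par c = c) (h1 : ∀ c, key c ≠ 0 → rank (par c) < rank c) :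
    ∃ root : B → B, (∀ c, key (root c) = 0) ∧ (∀ c, root (par c) = root c) ∧
      (∀ c, key c = 0 → root c = c) ∧ ∀ c, ∃ n, root c = par^[n] c := by
  obtain ⟨N, hN⟩ := (finite_range rank).bddAbove
  have hN' : ∀ c, rank c ≤ N := fun c => hN ⟨c, rfl⟩
  have h2 : ∀ n c, key (par^[n] c) = 0 ∨ rank (par^[n] c) + n ≤ rank c := by
    intro n c
    induction n with
    | zero => right; simp
    | succ n ih =>
      rw [Function.iterate_succ_apply']
      rcases ih with ih | ih
      · left; rw [h0 _ ih]; exact ih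
      · by_cases h : key (par^[n] c) = 0
        · left; rw [h0 _ h]; exact h
        · right; have := h1 _ h; omega
  have h3 : ∀ c, key (par^[N + 1] c) = 0 := fun c => by
    rcases h2 (N + 1) c with h | h
    · exact h
    · have := hN' c; omega
  refine ⟨par^[N + 1], h3, fun c => ?_, fun c hc => ?_, fun c => ⟨_, rfl⟩⟩
  · rw [← Function.iterate_succ_apply, Function.iterate_succ_apply', h0 _ (h3 c)]
  · exact Function.iterate_fixed (h0 c hc) _

theorem partition {X : Type} [MetricSpace X] [CompactSpace X] {lam : ℝ} (hlam : 1 ≤ lam)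
    (hL : ∀ (a : X) (r : ℝ), ∀ x ∈ ball a r, ∀ y ∈ ball a r,
      ∃ E : Set X, IsCompact E ∧ IsConnected E ∧ x ∈ E ∧ y ∈ E ∧ E ⊆ ball a (lam * r))
    {Cp : ℝ} (hCp : Pack X Cp) : ∃ C1 : ℝ, 1 ≤ C1 ∧ ∀ r : ℝ, 0 < r → ∀ (B : Type) [Finite B]
      (β : B → Set X), (∀ c, IsClosed (β c)) → (∀ c, (β c).Nonempty) → (⋃ c, β c = univ) →
      (∀ c, ∀ x ∈ β c, ∀ y ∈ β c, dist x y ≤ r) →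
      ∃ π : B → X, (∀ c, ∀ x ∈ β c, dist x (π c) ≤ C1 * r) ∧
        (∀ c d, π c = π d → Conn (bint β) {e | π e = π c} c d) ∧
        ∀ c d, π c ≠ π d → r ≤ dist (π c) (π d) := by
  classical
  obtain ⟨hCp1, hpack⟩ := hCp
  set N : ℕ := ⌈Cp * (2 * (lam + 1)) ^ 2⌉₊ with hNdef
  refine ⟨(lam + 1) + N * (2 * (lam + 1)), ?_, ?_⟩
  · have : (0 : ℝ) ≤ N * (2 * (lam + 1)) := by positivity
    linarith
  intro r hr B _ β hcl hne hcov hdiam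
  obtain ⟨Z, hsep, hnet⟩ := exists_net (X := X) hr
  have hmemb : ∀ x : X, ∃ c, x ∈ β c := fun x => mem_iUnion.1 (hcov ▸ mem_univ x)
  choose hm hhm using hmemb
  set W : X → Set B := fun z => {c | (β c ∩ ball z (lam * r)).Nonempty} with hW
  set U : X → Set B := fun z => {c | Conn (bint β) (W z) (hm z) c} with hU
  have hlr : 0 < lam * r := by positivity
  -- points of U z are near z
  have hnear : ∀ z c, c ∈ U z → ∀ x ∈ β c, dist x z ≤ (lam + 1) * r := by
    intro z c hc x hx
    obtain ⟨y, hy, hyz⟩ := Conn.right (show Conn _ _ _ _ from hc)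
    have h1 := hdiam c x hx y hy
    have h2 := dist_triangle x y z
    rw [mem_ball] at hyz
    linarith
  have hUU : ∀ z z' c, c ∈ U z → c ∈ U z' → dist z z' ≤ 2 * (lam + 1) * r := by
    intro z z' c h1 h2
    obtain ⟨x, hx⟩ := hne c
    have := dist_triangle_left z z' x
    linarith [hnear z c h1 x hx, hnear z' c h2 x hx]
  have hex : ∀ c, ∃ z ∈ Z, c ∈ U z := by
    intro c
    obtain ⟨x, hx⟩ := hne c
    obtain ⟨z, hz, hxz⟩ := hnet x
    obtain ⟨E, -, hE, hxE, hzE, hEs⟩ := hL z r x hxz z (mem_ball_self hr)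
    refine ⟨z, hz, (nerve hcl hE.isPreconnected (by rw [hcov]; exact subset_univ _) hzE hxE
      (hhm z) hx).mono ?_⟩
    rintro k ⟨y, hyk, hyE⟩
    exact ⟨y, hyk, hEs hyE⟩
  obtain ⟨col, hcolN, hcol⟩ := exists_colour Z (fun z z' => dist z z' ≤ 2 * (lam + 1) * r)
    (fun a b h => by rw [dist_comm]; exact h) N (fun a ha F hF hFa => by
      have h1 := hpack a r (2 * (lam + 1) * r) hr (by nlinarith) F
        (fun y hy => by rw [dist_comm]; exact hFa y hy)
        (fun y hy z hz => hsep y (hF hy) z (hF hz))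
      rw [mul_div_assoc, div_self hr.ne', mul_one] at h1
      have := h1.trans (Nat.le_ceil _)
      exact_mod_cast this)
  have hzc : ∀ c, ∃ z ∈ Z, c ∈ U z ∧ ∀ z' ∈ Z, c ∈ U z' → col z ≤ col z' := by
    intro c
    obtain ⟨z0, hz0, hc0⟩ := hex c
    obtain ⟨z, hz, hmin⟩ := (Z.filter fun z => c ∈ U z).exists_min_image col
      ⟨z0, Finset.mem_filter.2 ⟨hz0, hc0⟩⟩
    rw [Finset.mem_filter] at hz
    exact ⟨z, hz.1, hz.2, fun z' h1 h2 => hmin z' (Finset.mem_filter.2 ⟨h1, h2⟩)⟩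
  choose zc hzZ hzU hzmin using hzc
  have huniq : ∀ c, ∀ z ∈ Z, c ∈ U z → col z = col (zc c) → zc c = z := by
    intro c z hz hc hcc
    by_contra hne'
    exact hcol (zc c) (hzZ c) z hz hne' (hUU _ _ c (hzU c) hc) hcc.symm
  -- walks
  set ℓ : X → B → ℕ → Prop := fun z c n => ∃ g : ℕ → B, g 0 = hm z ∧ g n = c ∧
    (∀ k ≤ n, g k ∈ W z) ∧ ∀ k < n, bint β (g k) (g (k + 1)) with hℓ
  have hℓU : ∀ z c n, ℓ z c n → c ∈ U z := by
    rintro z c n ⟨g, g0, gn, gW, gb⟩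
    have := Conn.of_walk (r := bint β) gW gb
    rw [g0, gn] at this
    exact this
  have hℓex : ∀ c, ∃ n, ℓ (zc c) c n := by
    intro c
    obtain ⟨n, g, h⟩ := Conn.exists_walk (show Conn _ _ _ _ from hzU c)
    exact ⟨n, g, h⟩
  set key : B → ℕ := fun c => Nat.find (hℓex c) with hkey
  have hkey1 : ∀ c, ℓ (zc c) c (key c) := fun c => Nat.find_spec (hℓex c)
  have hkey2 : ∀ c n, ℓ (zc c) c n → key c ≤ n := fun c n h => Nat.find_min' (hℓex c) h
  have hpar : ∀ c, ∃ c', (key c = 0 → c' = c) ∧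
      (key c ≠ 0 → ℓ (zc c) c' (key c - 1)) ∧ bint β c c' := by
    intro c
    by_cases h : key c = 0
    · obtain ⟨x, hx⟩ := hne c
      exact ⟨c, fun _ => rfl, fun h' => absurd h h', x, hx, hx⟩
    · obtain ⟨g, g0, gn, gW, gb⟩ := hkey1 c
      refine ⟨g (key c - 1), fun h' => absurd h' h, fun _ => ⟨g, g0, rfl, fun k hk => gW k (by omega),
        fun k hk => gb k (by omega)⟩, ?_⟩
      have := gb (key c - 1) (by omega)
      rw [show key c - 1 + 1 = key c by omega, gn] at this
      exact bint_symm _ _ _ this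
  choose par hpar0 hpar1 hparb using hpar
  obtain ⟨BIG, hBIG⟩ := (finite_range key).bddAbove
  have hBIG' : ∀ c, key c ≤ BIG := fun c => hBIG ⟨c, rfl⟩
  have hparU : ∀ c, par c ∈ U (zc c) := by
    intro c
    by_cases h : key c = 0
    · rw [hpar0 c h]; exact hzU c
    · exact hℓU _ _ _ (hpar1 c h)
  set rank : B → ℕ := fun c => col (zc c) * (BIG + 1) + key c with hrank
  have hrk : ∀ c, key c ≠ 0 → rank (par c) < rank c := by
    intro c h
    have h1 := hzmin (par c) (zc c) (hzZ c) (hparU c)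
    have h2 := hBIG' (par c)
    simp only [hrank]
    rcases h1.lt_or_eq with h3 | h3
    · have : (col (zc (par c)) + 1) * (BIG + 1) ≤ col (zc c) * (BIG + 1) :=
        Nat.mul_le_mul_right _ h3
      nlinarith
    · have h4 := huniq (par c) (zc c) (hzZ c) (hparU c) h3.symm
      have h5 := hkey2 (par c) (key c - 1) (by rw [h4]; exact hpar1 c h)
      rw [h3]
      omega
  obtain ⟨root, hr1, hr2, hr3, hr4⟩ := iter_root par key rank hpar0 hrk
  have hroot : ∀ c, root c = hm (zc (root c)) := by
    intro c
    obtain ⟨g, g0, gn, -⟩ := hkey1 (root c)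
    rw [hr1 c] at gn
    rw [← g0, gn]
  refine ⟨fun c => zc (root c), ?_, ?_, ?_⟩
  · have hclaim : ∀ n c, rank c = n → dist (zc c) (zc (root c)) ≤ col (zc c) * (2 * (lam + 1) * r) := by
      intro n
      induction n using Nat.strong_induction_on with
      | _ n ih =>
        intro c hc
        by_cases h : key c = 0
        · rw [hr3 c h, dist_self]; positivity
        · have h1 := hzmin (par c) (zc c) (hzZ c) (hparU c)
          have h2 := ih _ (hc ▸ hrk c h) (par c) rfl
          rw [hr2 c] at h2
          rcases h1.lt_or_eq with h3 | h3
          · have h4 := hUU (zc c) (zc (par c)) (par c) (hparU c) (hzU _)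
            have h5 := dist_triangle (zc c) (zc (par c)) (zc (root c))
            have h6 : ((col (zc (par c)) : ℝ) + 1) ≤ col (zc c) := by exact_mod_cast h3
            have h7 : 0 ≤ 2 * (lam + 1) * r := by positivity
            nlinarith
          · have h4 := huniq (par c) (zc c) (hzZ c) (hparU c) h3.symm
            rw [h4] at h2
            exact h2
    intro c x hx
    have h1 := hnear _ c (hzU c) x hx
    have h2 := hclaim _ c rfl
    have h3 := dist_triangle x (zc c) (zc (root c))
    have h4 : (col (zc c) : ℝ) ≤ N := by exact_mod_cast hcolN _
    have h7 : 0 ≤ 2 * (lam + 1) * r := by positivity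
    have h8 := mul_le_mul_of_nonneg_right h4 h7
    linarith
  · intro c d hcd
    simp only at hcd
    have hrr : root c = root d := by rw [hroot c, hroot d, hcd]
    have hto : ∀ c, Conn (bint β) {e | zc (root e) = zc (root c)} c (root c) := by
      intro c
      obtain ⟨n, hn⟩ := hr4 c
      have hri : ∀ k, root (par^[k] c) = root c := by
        intro k
        induction k with
        | zero => rfl
        | succ k ih => rw [Function.iterate_succ_apply', hr2, ih]
      have := Conn.of_walk (r := bint β) (S := {e | zc (root e) = zc (root c)}) (n := n)
        (g := fun k => par^[k] c) (fun k _ => by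
          rw [mem_ofPred_eq, hri k])
        (fun k _ => by simp only [Function.iterate_succ_apply']; exact hparb _)
      simpa only [← hn, Function.iterate_zero_apply] using this
    have h1 := hto c
    have h2 := (hto d).symm (bint_symm β)
    rw [← hrr] at h2
    rw [hrr] at h1
    rw [← hrr] at h1
    exact h1.trans h2
  · intro c d hcd
    exact hsep _ (hzZ _) _ (hzZ _) hcd

end BK

end

section
open Metric MeasureTheory Set
open scoped ENNReal NNReal Topology

namespace BK

/-- Translation of cells. -/
def tr (M : ℕ) (k : ℤ) (c : ℤ × ℤ) : ℤ × ℤ := (c.1 + k * M, c.2)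

theorem tr_tr (M : ℕ) (k l : ℤ) (c : ℤ × ℤ) : tr M k (tr M l c) = tr M (k + l) c := by
  ext <;> simp [tr]; ring

theorem tr_zero (M : ℕ) (c : ℤ × ℤ) : tr M 0 c = c := by ext <;> simp [tr]

theorem hadj_tr (M : ℕ) (k : ℤ) {c d : ℤ × ℤ} (h : hadj c d) : hadj (tr M k c) (tr M k d) := by
  unfold hadj at *; simp only [tr]; omega

theorem conn_tr {M : ℕ} {S : Set (ℤ × ℤ)} (hS : ∀ k, ∀ c ∈ S, tr M k c ∈ S) (k : ℤ)
    {c d : ℤ × ℤ} (h : Conn hadj S c d) : Conn hadj S (tr M k c) (tr M k d) :=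
  h.map (tr M k) (hS k c h.left) fun a b ha hb hab _ =>
    Conn.single (hS k a ha) (hadj_tr M k hab) (hS k b hb)

/-- Sets containing arbitrarily wide connections. -/
def Wide (S : Set (ℤ × ℤ)) : Prop := ∀ n : ℤ, ∃ x y, x.1 ≤ n ∧ -n ≤ y.1 ∧ Conn hadj S x y

theorem CH3' {L : ℕ} {S T : Set (ℤ × ℤ)} (hS : S ⊆ strip L) (hST : Disjoint S T) {p q : ℤ × ℤ}
    (hp : p.2 = 0) (hq : q.2 = L) (hT : Conn hadj T p q) (hw : Wide S) : False := by
  obtain ⟨n, g, g0, gn, gS, gr⟩ := hT.exists_walk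
  set T' : Set (ℤ × ℤ) := g '' (Set.Iic n) with hT'
  have hfin : T'.Finite := (Set.finite_Iic n).image g
  obtain ⟨A, hA⟩ := (hfin.image Prod.fst).bddBelow
  obtain ⟨B, hB⟩ := (hfin.image Prod.fst).bddAbove
  have hA' : ∀ e ∈ T', A ≤ e.1 := fun e he => hA ⟨e, he, rfl⟩
  have hB' : ∀ e ∈ T', e.1 ≤ B := fun e he => hB ⟨e, he, rfl⟩
  have hc : Conn hadj T' p q := by
    have := Conn.of_walk (r := hadj) (S := T') (n := n) (g := g) (fun k hk => ⟨k, hk, rfl⟩) gr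
    rwa [g0, gn] at this
  obtain ⟨x, y, hx, hy, hxy⟩ := hw (min A (-B - 1))
  refine CH3 hS (hST.mono_right ?_) hp hq hc hA' hB' (a := x) (b := y)
    (by have := min_le_left A (-B - 1); omega) (by have := min_le_right A (-B - 1); omega) hxy
  rintro _ ⟨k, hk, rfl⟩
  exact gS k hk

theorem wide_of_tr {M : ℕ} (hM : 0 < M) {S : Set (ℤ × ℤ)} (hS : ∀ k, ∀ c ∈ S, tr M k c ∈ S)
    {c : ℤ × ℤ} {m : ℤ} (hm : m ≠ 0) (h : Conn hadj S c (tr M m c)) : Wide S := by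
  wlog hm0 : 0 < m generalizing m
  · refine this (m := -m) (by omega) ?_ (by omega)
    have := (conn_tr hS (-m) h).symm hadj_symm
    rwa [tr_tr, neg_add_cancel, tr_zero] at this
  have h1 : ∀ k : ℕ, Conn hadj S c (tr M (k * m) c) := by
    intro k
    induction k with
    | zero => simpa [tr_zero] using Conn.refl h.left
    | succ k ih =>
      have := conn_tr hS (k * m) h
      rw [tr_tr] at this
      have h2 := ih.trans this
      rw [show ((k + 1 : ℕ) : ℤ) * m = k * m + m by push_cast; ring]
      exact h2
  intro n
  set k : ℕ := (|n| + |c.1|).toNat with hk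
  have hk' : (k : ℤ) = |n| + |c.1| := by rw [hk, Int.toNat_of_nonneg (by positivity)]
  refine ⟨tr M (-(k * m)) c, tr M (k * m) c, ?_, ?_, ?_⟩
  · have e1 : (k : ℤ) ≤ k * m * M := by
      have : (k : ℤ) * 1 ≤ k * (m * M) := mul_le_mul_of_nonneg_left (by nlinarith) (by positivity)
      linarith
    simp only [tr]
    have := le_abs_self c.1
    have := neg_abs_le n
    nlinarith
  · have e1 : (k : ℤ) ≤ k * m * M := by
      have : (k : ℤ) * 1 ≤ k * (m * M) := mul_le_mul_of_nonneg_left (by nlinarith) (by positivity)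
      linarith
    simp only [tr]
    have := neg_abs_le c.1
    have := neg_abs_le n
    linarith
  · have h2 := (conn_tr hS (-(k * m)) (h1 k))
    rw [tr_tr, neg_add_cancel, tr_zero] at h2
    exact h2.trans (h1 k)

/-- A periodic system of cells with a patch map. -/
structure Cells (X : Type) [MetricSpace X] (a b : X) (D r : ℝ) where
  M : ℕ
  L : ℕ
  hM : 0 < M
  hL : 0 < L
  β : ℤ × ℤ → Set X
  π : ℤ × ℤ → X
  closed : ∀ c, IsClosed (β c)
  ne : ∀ c ∈ strip L, (β c).Nonempty
  cover : ∀ x, ∃ c ∈ strip L, x ∈ β c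
  per : ∀ k c, β (tr M k c) = β c
  adj : ∀ c ∈ strip L, ∀ d ∈ strip L, hadj c d → bint β c d
  inter : ∀ c ∈ strip L, ∀ d ∈ strip L, bint β c d → (c.2 = 0 ∧ d.2 = 0) ∨
    (c.2 = (L : ℤ) ∧ d.2 = (L : ℤ)) ∨ ∃ k, c = tr M k d ∨ hadj c (tr M k d)
  rowa : ∀ c : ℤ × ℤ, c.2 = 0 → a ∈ β c
  rowb : ∀ c : ℤ × ℤ, c.2 = (L : ℤ) → b ∈ β c
  π_per : ∀ k c, π (tr M k c) = π c
  near : ∀ c ∈ strip L, ∀ x ∈ β c, dist x (π c) ≤ D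
  pconn : ∀ c ∈ strip L, ∀ d ∈ strip L, π c = π d →
    Conn (bint β) {e | e ∈ strip L ∧ π e = π c} c d
  sep : ∀ c ∈ strip L, ∀ d ∈ strip L, π c ≠ π d → r ≤ dist (π c) (π d)

theorem strip_tr {L M : ℕ} (k : ℤ) {c : ℤ × ℤ} (h : c ∈ strip L) : tr M k c ∈ strip L := h

/-- Point reflection of the strip. -/
def fl (L : ℕ) (c : ℤ × ℤ) : ℤ × ℤ := (-c.1, L - c.2)

theorem fl_fl (L : ℕ) (c : ℤ × ℤ) : fl L (fl L c) = c := by ext <;> simp [fl]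
theorem hadj_fl (L : ℕ) {c d : ℤ × ℤ} (h : hadj c d) : hadj (fl L c) (fl L d) := by
  unfold hadj at *; simp only [fl]; omega
theorem strip_fl {L : ℕ} {c : ℤ × ℤ} (h : c ∈ strip L) : fl L c ∈ strip L := by
  have h1 := h.1
  have h2 := h.2
  constructor <;> simp only [fl] <;> omega
theorem fl_tr (L M : ℕ) (k : ℤ) (c : ℤ × ℤ) : fl L (tr M k c) = tr M (-k) (fl L c) := by
  ext <;> simp [fl, tr]; ring
theorem conn_fl {L : ℕ} {S : Set (ℤ × ℤ)} {c d : ℤ × ℤ} (h : Conn hadj S c d) :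
    Conn hadj (fl L ⁻¹' S) (fl L c) (fl L d) :=
  h.map (fl L) (by rw [mem_preimage, fl_fl]; exact h.left) fun a b ha hb hab _ =>
    Conn.single (by rw [mem_preimage, fl_fl]; exact ha) (hadj_fl L hab)
      (by rw [mem_preimage, fl_fl]; exact hb)

namespace Cells
variable {X : Type} [MetricSpace X] {a b : X} {D r : ℝ} (K : Cells X a b D r)

def flip : Cells X b a D r where
  M := K.M
  L := K.L
  hM := K.hM
  hL := K.hL
  β := fun c => K.β (fl K.L c)
  π := fun c => K.π (fl K.L c)
  closed := fun c => K.closed _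
  ne := fun c hc => K.ne _ (strip_fl hc)
  cover := fun x => by
    obtain ⟨c, hc, hx⟩ := K.cover x
    exact ⟨fl K.L c, strip_fl hc, by rwa [fl_fl]⟩
  per := fun k c => by rw [fl_tr, K.per]
  adj := fun c hc d hd h => K.adj _ (strip_fl hc) _ (strip_fl hd) (hadj_fl _ h)
  inter := fun c hc d hd h => by
    rcases K.inter _ (strip_fl hc) _ (strip_fl hd) h with h | h | ⟨k, h | h⟩
    · right; left; simp only [fl] at h; omega
    · left; simp only [fl] at h; omega
    · right; right; refine ⟨-k, Or.inl ?_⟩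
      rw [← fl_fl K.L c, h, fl_tr, fl_fl]
    · right; right; refine ⟨-k, Or.inr ?_⟩
      have := hadj_fl K.L h
      rwa [fl_tr, fl_fl, fl_fl] at this
  rowa := fun c hc => K.rowb _ (by simp [fl, hc])
  rowb := fun c hc => K.rowa _ (by simp [fl, hc])
  π_per := fun k c => by rw [fl_tr, K.π_per]
  near := fun c hc => K.near _ (strip_fl hc)
  pconn := fun c hc d hd h => by
    have h1 := K.pconn _ (strip_fl hc) _ (strip_fl hd) h
    have h2 : Conn (bint fun c => K.β (fl K.L c))
        {e | e ∈ strip K.L ∧ K.π (fl K.L e) = K.π (fl K.L c)} (fl K.L (fl K.L c))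
        (fl K.L (fl K.L d)) := by
      refine h1.map (fl K.L) ⟨strip_fl (strip_fl hc), by simp only [fl_fl]⟩
        fun x y hx hy hxy _ => Conn.single ⟨strip_fl hx.1, by rw [fl_fl]; exact hx.2⟩ ?_
        ⟨strip_fl hy.1, by rw [fl_fl]; exact hy.2⟩
      simp only [bint, fl_fl]; exact hxy
    rwa [fl_fl, fl_fl] at h2
  sep := fun c hc d hd => K.sep _ (strip_fl hc) _ (strip_fl hd)

theorem small {c : ℤ × ℤ} (hc : c ∈ strip K.L) {x y : X} (hx : x ∈ K.β c) (hy : y ∈ K.β c) :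
    dist x y ≤ 2 * D := by
  have := dist_triangle_right x y (K.π c)
  linarith [K.near c hc x hx, K.near c hc y hy]

/-- Lifting lemma. -/
theorem lift1 {S : Set (ℤ × ℤ)} (hS : S ⊆ strip K.L) (hT : ∀ k, ∀ c ∈ S, tr K.M k c ∈ S)
    {c e : ℤ × ℤ} (h : Conn (bint K.β) S c e) :
    ∃ d, Conn hadj S c d ∧ (d.2 = 0 ∨ d.2 = K.L ∨ ∃ k, d = tr K.M k e) := by
  refine h.rec' (P := fun e => ∃ d, Conn hadj S c d ∧ (d.2 = 0 ∨ d.2 = K.L ∨ ∃ k, d = tr K.M k e))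
    ⟨c, Conn.refl h.left, Or.inr (Or.inr ⟨0, (tr_zero _ _).symm⟩)⟩ ?_
  rintro e f he hf hef ⟨d, hd, h1 | h1 | ⟨k, rfl⟩⟩
  · exact ⟨d, hd, Or.inl h1⟩
  · exact ⟨d, hd, Or.inr (Or.inl h1)⟩
  · rcases K.inter e (hS he) f (hS hf) hef with h2 | h2 | ⟨l, h2 | h2⟩
    · exact ⟨_, hd, Or.inl h2.1⟩
    · exact ⟨_, hd, Or.inr (Or.inl h2.1)⟩
    · exact ⟨_, hd, Or.inr (Or.inr ⟨k + l, by rw [h2, tr_tr]⟩)⟩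
    · refine ⟨tr K.M (k + l) f, hd.step ?_ (hT _ f hf), Or.inr (Or.inr ⟨_, rfl⟩)⟩
      rw [← tr_tr]; exact hadj_tr _ _ h2

theorem lift2 {S : Set (ℤ × ℤ)} (hS : S ⊆ strip K.L) (hT : ∀ k, ∀ c ∈ S, tr K.M k c ∈ S)
    {c e : ℤ × ℤ} (h : Conn (bint K.β) S c e) (hc : c.2 = 0) (he : e.2 = K.L) :
    ∃ p q : ℤ × ℤ, p.2 = 0 ∧ q.2 = (K.L : ℤ) ∧ Conn hadj S p q := by
  have := h.rec' (P := fun e => (∃ p q : ℤ × ℤ, p.2 = 0 ∧ q.2 = (K.L : ℤ) ∧ Conn hadj S p q) ∨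
    ∃ p, p.2 = 0 ∧ Conn hadj S p e) (Or.inr ⟨c, hc, Conn.refl h.left⟩) ?_
  · rcases this with h1 | ⟨p, hp, h1⟩
    · exact h1
    · exact ⟨p, e, hp, he, h1⟩
  · rintro e f he hf hef (h1 | ⟨p, hp, h1⟩)
    · exact Or.inl h1
    rcases K.inter e (hS he) f (hS hf) hef with h2 | h2 | ⟨l, h2 | h2⟩
    · exact Or.inr ⟨f, h2.2, Conn.refl hf⟩
    · exact Or.inl ⟨p, e, hp, h2.1, h1⟩
    · refine Or.inr ⟨tr K.M (-l) p, hp, ?_⟩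
      have := conn_tr hT (-l) h1
      rwa [h2, tr_tr, neg_add_cancel, tr_zero] at this
    · refine Or.inr ⟨tr K.M (-l) p, hp, ?_⟩
      have := conn_tr hT (-l) (h1.step h2 (hT l f hf))
      rwa [tr_tr, neg_add_cancel, tr_zero] at this

/-- Reduction to the fundamental domain. -/
noncomputable def red (c : ℤ × ℤ) : ℤ × ℤ := (c.1 % K.M, c.2)

theorem red_eq (c : ℤ × ℤ) : ∃ k, c = tr K.M k (K.red c) :=
  ⟨c.1 / K.M, by
    ext
    · simp only [tr, red]; rw [mul_comm]; exact (Int.emod_add_mul_ediv c.1 K.M).symm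
    · rfl⟩

noncomputable abbrev base : Finset (ℤ × ℤ) := Finset.Ico (0 : ℤ) K.M ×ˢ Finset.Icc (0 : ℤ) K.L

theorem red_mem {c : ℤ × ℤ} (hc : c ∈ strip K.L) : K.red c ∈ K.base := by
  have h1 : (0 : ℤ) < K.M := by exact_mod_cast K.hM
  simp only [base, red, Finset.mem_product, Finset.mem_Ico, Finset.mem_Icc]
  exact ⟨⟨Int.emod_nonneg _ h1.ne', Int.emod_lt_of_pos _ h1⟩, hc.1, hc.2⟩

theorem base_strip {c : ℤ × ℤ} (hc : c ∈ K.base) : c ∈ strip K.L := by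
  simp only [base, Finset.mem_product, Finset.mem_Icc] at hc
  exact hc.2

theorem chain {E : Set X} (hE : IsPreconnected E) {x y : X} (hx : x ∈ E) (hy : y ∈ E)
    {c e : ℤ × ℤ} (hc : c ∈ strip K.L) (he : e ∈ strip K.L) (hxc : x ∈ K.β c) (hye : y ∈ K.β e) :
    Conn (bint K.β) {k | k ∈ strip K.L ∧ (K.β k ∩ E).Nonempty} c e := by
  obtain ⟨k, hk⟩ := K.red_eq c
  obtain ⟨l, hl⟩ := K.red_eq e
  have b1 : K.β c = K.β (K.red c) := by conv_lhs => rw [hk, K.per]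
  have b2 : K.β e = K.β (K.red e) := by conv_lhs => rw [hl, K.per]
  have h1 := nerve (ι := K.base) (P := fun c => K.β c.1) (fun c => K.closed _) hE
    (fun z _ => by
      obtain ⟨d, hd, hz⟩ := K.cover z
      obtain ⟨m, hm⟩ := K.red_eq d
      refine mem_iUnion.2 ⟨⟨_, K.red_mem hd⟩, ?_⟩
      rw [hm, K.per] at hz; exact hz) hx hy (i := ⟨_, K.red_mem hc⟩) (j := ⟨_, K.red_mem he⟩)
      (by rw [b1] at hxc; exact hxc) (by rw [b2] at hye; exact hye)
  have hS : ∀ z : K.base, (K.β z.1 ∩ E).Nonempty →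
      z.1 ∈ {k | k ∈ strip K.L ∧ (K.β k ∩ E).Nonempty} := fun z hz => ⟨K.base_strip z.2, hz⟩
  have h2 : Conn (bint K.β) {k | k ∈ strip K.L ∧ (K.β k ∩ E).Nonempty} (K.red c) (K.red e) :=
    h1.map (fun z => z.1) (hS _ h1.left) fun z w hz hw hzw _ =>
      Conn.single (hS _ hz) hzw (hS _ hw)
  refine ((Conn.single (r := bint K.β) (S := {k | k ∈ strip K.L ∧ (K.β k ∩ E).Nonempty})
    ⟨hc, x, hxc, hx⟩ ?_ h2.left).trans h2).step ?_ ⟨he, y, hye, hy⟩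
  · exact ⟨x, hxc, b1 ▸ hxc⟩
  · exact ⟨y, b2 ▸ hye, hye⟩

theorem tinv_meet (E : Set X) (k : ℤ) (c : ℤ × ℤ)
    (hc : c ∈ {k | k ∈ strip K.L ∧ (K.β k ∩ E).Nonempty}) :
    tr K.M k c ∈ {k | k ∈ strip K.L ∧ (K.β k ∩ E).Nonempty} :=
  ⟨strip_tr k hc.1, by rw [K.per]; exact hc.2⟩

end Cells
end BK

end

section
open Metric MeasureTheory Set
open scoped ENNReal NNReal Topology

namespace BK

/-- Linear local connectivity with a given constant. -/
def LLCw (X : Type) [MetricSpace X] (lam : ℝ) : Prop :=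
  1 ≤ lam ∧ ∀ (a : X) (r : ℝ),
    (∀ x ∈ Metric.ball a r, ∀ y ∈ Metric.ball a r,
      ∃ E : Set X, IsCompact E ∧ IsConnected E ∧ x ∈ E ∧ y ∈ E ∧
        E ⊆ Metric.ball a (lam * r)) ∧
    (∀ x ∉ Metric.ball a r, ∀ y ∉ Metric.ball a r,
      ∃ E : Set X, IsCompact E ∧ IsConnected E ∧ x ∈ E ∧ y ∈ E ∧
        E ⊆ (Metric.ball a (r / lam))ᶜ)

/-- The radius `R2` as a function of `lam` and `D`. -/
noncomputable def rad0 (lam D : ℝ) : ℝ := lam * ((2 * lam + 1) * D)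
noncomputable def rad1 (lam D : ℝ) : ℝ := rad0 lam D + 2 * D
noncomputable def rad2 (lam D : ℝ) : ℝ := lam * rad1 lam D

theorem rad_facts {lam D : ℝ} (hl : 1 ≤ lam) (hD : 0 < D) :
    0 < rad0 lam D ∧ rad0 lam D + 2 * D = rad1 lam D ∧ rad1 lam D ≤ rad2 lam D := by
  have h0 : 0 < rad0 lam D := by unfold rad0; positivity
  refine ⟨h0, rfl, ?_⟩
  have : 0 < rad1 lam D := by unfold rad1; linarith
  unfold rad2; nlinarith

namespace Cells
variable {X : Type} [MetricSpace X] {a b : X} {D r : ℝ} (K : Cells X a b D r) {lam : ℝ}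

structure Hyp (a b : X) (D lam : ℝ) : Prop where
  llc : LLCw X lam
  hD : 0 < D
  hR : 3 * rad2 lam D ≤ dist a b

theorem Hyp.flip (h : Hyp a b D lam) : Hyp b a D lam := ⟨h.llc, h.hD, by rw [dist_comm]; exact h.hR⟩

/-- cells connected to row 0 near `a` -/
def Ka (lam : ℝ) : Set (ℤ × ℤ) := {c | ∃ p : ℤ × ℤ, p.2 = 0 ∧
  Conn hadj {e | e ∈ strip K.L ∧ (K.β e ∩ ball a (rad0 lam D)).Nonempty} p c}

def A0 (lam : ℝ) : Set (ℤ × ℤ) := {c | c ∈ strip K.L ∧ ∃ d ∈ K.Ka lam, K.π d = K.π c}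

theorem Ka_sub {c : ℤ × ℤ} (h : c ∈ K.Ka lam) :
    c ∈ strip K.L ∧ (K.β c ∩ ball a (rad0 lam D)).Nonempty := by
  obtain ⟨p, _, h⟩ := h; exact h.right

theorem Ka_A0 : K.Ka lam ⊆ K.A0 lam := fun c hc => ⟨(K.Ka_sub hc).1, c, hc, rfl⟩

theorem Ka_tr (k : ℤ) (c : ℤ × ℤ) (hc : c ∈ K.Ka lam) : tr K.M k c ∈ K.Ka lam := by
  obtain ⟨p, hp, h⟩ := hc
  exact ⟨tr K.M k p, hp, conn_tr (K.tinv_meet _) k h⟩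

theorem A0_tr (k : ℤ) (c : ℤ × ℤ) (hc : c ∈ K.A0 lam) : tr K.M k c ∈ K.A0 lam := by
  obtain ⟨h, d, hd, e⟩ := hc
  exact ⟨strip_tr k h, d, hd, by rw [e, K.π_per]⟩

theorem A0_pat {c d : ℤ × ℤ} (hc : c ∈ K.A0 lam) (hd : d ∈ strip K.L) (h : K.π d = K.π c) :
    d ∈ K.A0 lam := by
  obtain ⟨_, e, he, h1⟩ := hc
  exact ⟨hd, e, he, by rw [h1, h]⟩

theorem A1 {c : ℤ × ℤ} (hc : c ∈ K.A0 lam) {x : X} (hx : x ∈ K.β c) :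
    dist x a < rad1 lam D := by
  obtain ⟨h, d, hd, e⟩ := hc
  obtain ⟨hs, y, hy, hya⟩ := K.Ka_sub hd
  have h1 := K.near c h x hx
  have h2 := K.near d hs y hy
  rw [e] at h2
  have h3 := dist_triangle_right x y (K.π c)
  have h4 := dist_triangle x y a
  have h5 : dist y a < rad0 lam D := hya
  unfold rad1; linarith

theorem row0_strip {c : ℤ × ℤ} (h : c.2 = 0) : c ∈ strip K.L :=
  ⟨by omega, by rw [h]; positivity⟩
theorem rowL_strip {c : ℤ × ℤ} (h : c.2 = K.L) : c ∈ strip K.L :=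
  ⟨by rw [h]; positivity, by omega⟩

theorem A2 (H : Hyp a b D lam) {c : ℤ × ℤ} (hc : c.2 = 0) : c ∈ K.A0 lam :=
  K.Ka_A0 ⟨c, hc, Conn.refl ⟨K.row0_strip hc, a, K.rowa c hc,
    mem_ball_self (rad_facts H.llc.1 H.hD).1⟩⟩

theorem A0_rowL (H : Hyp a b D lam) {c : ℤ × ℤ} (hc : c ∈ K.A0 lam) (h : c.2 = K.L) : False := by
  have h1 := K.A1 hc (K.rowb c h)
  have := rad_facts H.llc.1 H.hD
  have h3 := H.hR
  have := H.hD
  rw [dist_comm] at h1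
  linarith

theorem A3 (H : Hyp a b D lam) {c : ℤ × ℤ} (hc : c ∈ K.A0 lam) :
    ∃ p : ℤ × ℤ, p.2 = 0 ∧ Conn hadj (K.A0 lam) p c := by
  obtain ⟨hs, d, hd, e⟩ := hc
  have hds := (K.Ka_sub hd).1
  have hsub : {e | e ∈ strip K.L ∧ K.π e = K.π c} ⊆ K.A0 lam := fun f hf =>
    K.A0_pat (c := c) (lam := lam) ⟨hs, d, hd, e⟩ hf.1 hf.2
  obtain ⟨d', h1, h2⟩ := K.lift1 (S := {e | e ∈ strip K.L ∧ K.π e = K.π c}) (fun f hf => hf.1)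
    (fun k f hf => ⟨strip_tr k hf.1, by rw [K.π_per]; exact hf.2⟩) (K.pconn c hs d hds e.symm)
  have h1' := (h1.mono hsub).symm hadj_symm
  rcases h2 with h2 | h2 | ⟨k, h2⟩
  · exact ⟨d', h2, h1'⟩
  · exact (K.A0_rowL H h1'.left h2).elim
  · obtain ⟨p, hp, hpd⟩ := hd
    refine ⟨tr K.M k p, hp, ?_⟩
    have h3 : Conn hadj (K.A0 lam) p d := hpd.restrict.mono fun f hf => K.Ka_A0 ⟨p, hp, hf⟩
    have h4 := conn_tr (K.A0_tr) k h3
    rw [← h2] at h4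
    exact h4.trans h1'

theorem A5 (H : Hyp a b D lam) {c : ℤ × ℤ} (hc : c ∈ strip K.L) {x : X} (hx : x ∈ K.β c)
    (hd : dist x a < (2 * lam + 1) * D) : c ∈ K.A0 lam := by
  have hl := H.llc.1
  have hD := H.hD
  obtain ⟨E, _, hE, hxE, haE, hEs⟩ := (H.llc.2 a ((2 * lam + 1) * D)).1 x hd a
    (mem_ball_self (by positivity))
  have h1 := K.chain hE.2 hxE haE hc (K.row0_strip (c := (0, 0)) rfl) hx (K.rowa _ rfl)
  obtain ⟨d, h2, h3⟩ := K.lift1 (S := {k | k ∈ strip K.L ∧ (K.β k ∩ E).Nonempty}) (fun f hf => hf.1)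
      (K.tinv_meet E) h1
  have hd0 : d.2 = 0 := by
    rcases h3 with h3 | h3 | ⟨k, h3⟩
    · exact h3
    · obtain ⟨hs, y, hy, hyE⟩ := h2.right
      have h4 := hEs hyE
      rw [mem_ball] at h4
      have h5 := K.small hs (K.rowb d h3) hy
      have h6 := dist_triangle b y a
      have := rad_facts H.llc.1 H.hD
      have h7 := H.hR
      rw [dist_comm] at h7
      have : rad0 lam D = lam * ((2 * lam + 1) * D) := rfl
      linarith
    · rw [h3]; rfl
  refine K.Ka_A0 ⟨d, hd0, (h2.symm hadj_symm).mono ?_⟩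
  rintro f ⟨hf, y, hy, hyE⟩
  exact ⟨hf, y, hy, hEs hyE⟩

/-- The complementary set near `b`, by symmetry. -/
def B0 (lam : ℝ) : Set (ℤ × ℤ) := fl K.L ⁻¹' (K.flip.A0 lam)

theorem B0_strip {c : ℤ × ℤ} (h : c ∈ K.B0 lam) : c ∈ strip K.L := by
  have h1 : fl K.L c ∈ strip K.L := h.1
  have := strip_fl h1; rwa [fl_fl] at this
theorem flip_β (c : ℤ × ℤ) : K.flip.β (fl K.L c) = K.β c := by
  change K.β (fl K.L (fl K.L c)) = _; rw [fl_fl]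
theorem flip_π (c : ℤ × ℤ) : K.flip.π (fl K.L c) = K.π c := by
  change K.π (fl K.L (fl K.L c)) = _; rw [fl_fl]
theorem fl_row {c : ℤ × ℤ} (h : c.2 = K.L) : (fl K.L c).2 = 0 := by simp [fl, h]
theorem fl_row' {c : ℤ × ℤ} (h : c.2 = 0) : (fl K.L c).2 = K.L := by simp [fl, h]

theorem B0_tr (k : ℤ) (c : ℤ × ℤ) (hc : c ∈ K.B0 lam) : tr K.M k c ∈ K.B0 lam := by
  unfold B0; rw [mem_preimage, fl_tr]; exact K.flip.A0_tr _ _ hc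
theorem B0_pat {c d : ℤ × ℤ} (hc : c ∈ K.B0 lam) (hd : d ∈ strip K.L) (h : K.π d = K.π c) :
    d ∈ K.B0 lam :=
  K.flip.A0_pat hc (strip_fl hd) (by rw [flip_π, flip_π, h])
theorem B1 {c : ℤ × ℤ} (hc : c ∈ K.B0 lam) {x : X} (hx : x ∈ K.β c) :
    dist x b < rad1 lam D := K.flip.A1 hc (by rwa [flip_β])
theorem B2 (H : Hyp a b D lam) {c : ℤ × ℤ} (hc : c.2 = K.L) : c ∈ K.B0 lam :=
  K.flip.A2 H.flip (K.fl_row hc)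
theorem B3 (H : Hyp a b D lam) {c : ℤ × ℤ} (hc : c ∈ K.B0 lam) :
    ∃ p : ℤ × ℤ, p.2 = K.L ∧ Conn hadj (K.B0 lam) p c := by
  obtain ⟨p, hp, h⟩ := K.flip.A3 H.flip hc
  refine ⟨fl K.L p, K.fl_row' hp, ?_⟩
  have := conn_fl (L := K.L) h
  rwa [fl_fl] at this
theorem B5 (H : Hyp a b D lam) {c : ℤ × ℤ} (hc : c ∈ strip K.L) {x : X} (hx : x ∈ K.β c)
    (hd : dist x b < (2 * lam + 1) * D) : c ∈ K.B0 lam :=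
  K.flip.A5 H.flip (strip_fl hc) (by rwa [flip_β]) hd

def V0 (lam : ℝ) : Set (ℤ × ℤ) := {c | c ∈ strip K.L ∧ c ∉ K.A0 lam ∧ c ∉ K.B0 lam}

theorem V0_tr (k : ℤ) (c : ℤ × ℤ) (hc : c ∈ K.V0 lam) : tr K.M k c ∈ K.V0 lam := by
  refine ⟨strip_tr k hc.1, fun h => hc.2.1 ?_, fun h => hc.2.2 ?_⟩
  · have := K.A0_tr (-k) _ h; rwa [tr_tr, neg_add_cancel, tr_zero] at this
  · have := K.B0_tr (-k) _ h; rwa [tr_tr, neg_add_cancel, tr_zero] at this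

theorem A0_B0 (H : Hyp a b D lam) {c d : ℤ × ℤ} (hc : c ∈ K.A0 lam) (hd : d ∈ K.B0 lam) :
    ¬ bint K.β c d := by
  rintro ⟨x, hx, hy⟩
  have h1 := K.A1 hc hx
  have h2 := K.B1 hd hy
  have h3 := dist_triangle_left a b x
  have := rad_facts H.llc.1 H.hD
  have h7 := H.hR
  have := H.hD
  linarith

theorem exists_c0 (H : Hyp a b D lam) : ∃ c0 ∈ K.V0 lam, ∀ i, ∃ j, Conn hadj (K.V0 lam) c0 (i, j) := by
  refine CH1 (L := K.L) (U := K.V0 lam) ?_ ?_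
  · rintro c ⟨hs, hA, hB⟩
    constructor
    · rcases hs.1.lt_or_eq with h | h
      · exact h
      · exact (hA (K.A2 H h.symm)).elim
    · rcases hs.2.lt_or_eq with h | h
      · exact h
      · exact (hB (K.B2 H h)).elim
  · intro c d hc hd h
    have hdA : d ∈ K.A0 lam := by
      refine h.rec' (P := fun d => d ∈ K.A0 lam) (K.A2 H hc) ?_
      intro e f he hf hef heA
      by_contra hfA
      have : f ∈ K.B0 lam := by
        by_contra hfB
        exact hf.2 ⟨hf.1, hfA, hfB⟩
      exact K.A0_B0 H heA this (K.adj _ he.1 _ hf.1 hef)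
    exact K.A0_rowL H hdA hd

def Far (lam : ℝ) (c : ℤ × ℤ) : Prop :=
  c ∈ strip K.L ∧ ∃ x ∈ K.β c, rad2 lam D ≤ dist x a ∧ rad2 lam D ≤ dist x b

theorem Far.flip {c : ℤ × ℤ} (h : K.Far lam c) : K.flip.Far lam (fl K.L c) := by
  obtain ⟨h, x, hx, h1, h2⟩ := h
  exact ⟨strip_fl h, x, by rwa [flip_β], h2, h1⟩

theorem Far.V0 (H : Hyp a b D lam) {c : ℤ × ℤ} (h : K.Far lam c) : c ∈ K.V0 lam := by
  obtain ⟨h, x, hx, h1, h2⟩ := h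
  have := rad_facts H.llc.1 H.hD
  exact ⟨h, fun h3 => by linarith [K.A1 h3 hx], fun h3 => by linarith [K.B1 h3 hx]⟩

theorem F2 (H : Hyp a b D lam) {c : ℤ × ℤ} (h : K.Far lam c) : ∃ q : ℤ × ℤ, q.2 = K.L ∧
    Conn hadj ({e | Conn hadj (K.V0 lam) c e} ∪ K.B0 lam) c q := by
  have hV := h.V0 K H
  obtain ⟨hs, x, hx, h1, h2⟩ := h
  have hl := H.llc.1
  have hr := rad_facts H.llc.1 H.hD
  have hab := H.hR
  have hD := H.hD
  have F1 : ∃ d : ℤ × ℤ, d.2 = K.L ∧ Conn hadj {e | e ∈ strip K.L ∧ e ∉ K.A0 lam} c d := by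
    obtain ⟨E, _, hE, hxE, hbE, hEs⟩ := (H.llc.2 a (rad2 lam D)).2 x (by simpa using h1) b
      (by rw [mem_ball, dist_comm]; linarith)
    have h3 := K.chain hE.2 hxE hbE hs (K.rowL_strip (c := (0, K.L)) rfl) hx (K.rowb _ rfl)
    obtain ⟨d, h4, h5⟩ := K.lift1 (S := {k | k ∈ strip K.L ∧ (K.β k ∩ E).Nonempty}) (fun f hf => hf.1)
      (K.tinv_meet E) h3
    have hsub : {k | k ∈ strip K.L ∧ (K.β k ∩ E).Nonempty} ⊆
        {e | e ∈ strip K.L ∧ e ∉ K.A0 lam} := by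
      rintro f ⟨hf, y, hy, hyE⟩
      refine ⟨hf, fun hA => hEs hyE ?_⟩
      have : rad2 lam D / lam = rad1 lam D := by unfold rad2; field_simp
      rw [this]; exact K.A1 hA hy
    refine ⟨d, ?_, h4.mono hsub⟩
    rcases h5 with h5 | h5 | ⟨k, h5⟩
    · exact ((hsub h4.right).2 (K.A2 H h5)).elim
    · exact h5
    · rw [h5]; rfl
  obtain ⟨d, hd, h3⟩ := F1
  have h4 := h3.rec' (P := fun e => Conn hadj (K.V0 lam) c e ∨ ∃ q ∈ K.B0 lam,
    Conn hadj ({e | Conn hadj (K.V0 lam) c e} ∪ K.B0 lam) c q) (Or.inl (Conn.refl hV)) (by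
      rintro e f he hf hef (h4 | h4)
      · by_cases hfB : f ∈ K.B0 lam
        · exact Or.inr ⟨f, hfB, (h4.restrict.mono subset_union_left).step hef (Or.inr hfB)⟩
        · exact Or.inl (h4.step hef ⟨hf.1, hf.2, hfB⟩)
      · exact Or.inr h4)
  rcases h4 with h4 | ⟨q, hq, h4⟩
  · exact (h4.right.2.2 (K.B2 H hd)).elim
  · obtain ⟨p, hp, hpq⟩ := K.B3 H hq
    exact ⟨p, hp, h4.trans ((hpq.symm hadj_symm).mono subset_union_right)⟩

theorem fl_V0 {c : ℤ × ℤ} (h : c ∈ K.flip.V0 lam) : fl K.L c ∈ K.V0 lam := by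
  refine ⟨strip_fl h.1, fun h1 => h.2.2 ?_, fun h1 => h.2.1 ?_⟩
  · change fl K.L c ∈ K.flip.flip.A0 lam
    have : K.flip.flip = K := by
      obtain ⟨⟩ := K
      simp [Cells.flip, fl_fl]
    rw [this]; exact h1
  · have h2 : fl K.L (fl K.L c) ∈ K.flip.A0 lam := h1
    rwa [fl_fl] at h2

theorem F2' (H : Hyp a b D lam) {c : ℤ × ℤ} (h : K.Far lam c) : ∃ q : ℤ × ℤ, q.2 = 0 ∧
    Conn hadj ({e | Conn hadj (K.V0 lam) c e} ∪ K.A0 lam) c q := by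
  obtain ⟨q, hq, h1⟩ := K.flip.F2 H.flip (h.flip K)
  refine ⟨fl K.L q, K.fl_row hq, ?_⟩
  have h2 := conn_fl (L := K.L) h1
  rw [fl_fl] at h2
  refine h2.mono ?_
  rintro e (he | he)
  · left
    have h3 := conn_fl (L := K.L) he
    rw [fl_fl, fl_fl] at h3
    exact h3.mono fun f hf => by
      have := K.fl_V0 hf; rwa [fl_fl] at this
  · right
    have h3 : fl K.L (fl K.L e) ∈ K.flip.flip.A0 lam := he
    have : K.flip.flip = K := by
      obtain ⟨⟩ := K
      simp [Cells.flip, fl_fl]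
    rw [this, fl_fl] at h3; exact h3

theorem wide_cols {S : Set (ℤ × ℤ)} {c0 : ℤ × ℤ} (h : ∀ i, ∃ j, Conn hadj S c0 (i, j)) :
    Wide {c | Conn hadj S c0 c} := by
  intro n
  obtain ⟨j, hj⟩ := h n
  obtain ⟨j', hj'⟩ := h (-n)
  exact ⟨_, _, le_refl n, le_refl (-n), (hj.restrict.symm hadj_symm).trans hj'.restrict⟩

theorem far_conn (H : Hyp a b D lam) {c0 : ℤ × ℤ}
    (h0 : ∀ i, ∃ j, Conn hadj (K.V0 lam) c0 (i, j)) {c : ℤ × ℤ} (h : K.Far lam c) :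
    Conn hadj (K.V0 lam) c0 c := by
  by_contra hn
  obtain ⟨q, hq, h1⟩ := K.F2 H h
  obtain ⟨p, hp, h2⟩ := K.F2' H h
  refine CH3' (L := K.L) (S := {c | Conn hadj (K.V0 lam) c0 c})
    (T := {e | Conn hadj (K.V0 lam) c e} ∪ (K.A0 lam ∪ K.B0 lam)) (fun e he => he.right.1) ?_ hp hq
    (((h2.symm hadj_symm).mono ?_).trans (h1.mono ?_)) (wide_cols h0)
  · rw [Set.disjoint_left]
    rintro e he (h3 | h3 | h3)
    · exact hn (he.trans (h3.symm hadj_symm))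
    · exact he.right.2.1 h3
    · exact he.right.2.2 h3
  · exact union_subset_union_right _ subset_union_left
  · exact union_subset_union_right _ subset_union_right

end Cells
end BK

end

section
open Metric MeasureTheory Set
open scoped ENNReal NNReal Topology

namespace BK
namespace Cells
variable {X : Type} [MetricSpace X] {a b : X} {D r : ℝ} (K : Cells X a b D r) {lam : ℝ}

/-- The patch through a cell. -/
def pat (c : ℤ × ℤ) : Set (ℤ × ℤ) := {e | e ∈ strip K.L ∧ K.π e = K.π c}

theorem pat_tr (c : ℤ × ℤ) (k : ℤ) (e : ℤ × ℤ) (h : e ∈ K.pat c) : tr K.M k e ∈ K.pat c :=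
  ⟨strip_tr k h.1, by rw [K.π_per]; exact h.2⟩

structure Core (lam : ℝ) where
  C : Set (ℤ × ℤ)
  ne : C.Nonempty
  sub : C ⊆ strip K.L
  tinv : ∀ k, ∀ c ∈ C, tr K.M k c ∈ C
  conn : ∀ c ∈ C, ∀ d ∈ C, Conn hadj C c d
  wide : Wide C
  patsub : ∀ c ∈ C, K.pat c ⊆ C
  patconn : ∀ c ∈ C, ∀ d ∈ K.pat c, ∃ k, Conn hadj (K.pat c) c (tr K.M k d)
  nowrap : ∀ c ∈ C, ∀ m, Conn hadj (K.pat c) c (tr K.M m c) → m = 0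
  far : ∀ c, K.Far lam c → c ∈ C
  comp : ∀ c ∈ strip K.L \ C, (∃ p : ℤ × ℤ, p.2 = 0 ∧ Conn hadj (strip K.L \ C) p c) ∨
    (∃ p : ℤ × ℤ, p.2 = K.L ∧ Conn hadj (strip K.L \ C) p c)
  row0 : ∀ c : ℤ × ℤ, c.2 = 0 → c ∉ C
  rowL : ∀ c : ℤ × ℤ, c.2 = K.L → c ∉ C

theorem exists_core (H : Hyp a b D lam) {o : X} (ho : rad2 lam D ≤ dist o a)
    (ho' : rad2 lam D ≤ dist o b) : Nonempty (K.Core lam) := by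
  obtain ⟨c0, hc0, h0⟩ := K.exists_c0 H
  have hl := H.llc.1
  have hD := H.hD
  have hr := rad_facts H.llc.1 H.hD
  have hab := H.hR
  set C := {c | Conn hadj (K.V0 lam) c0 c} with hC
  have hCV : C ⊆ K.V0 lam := fun c hc => hc.right
  have hfar : ∀ c, K.Far lam c → c ∈ C := fun c hc => K.far_conn H h0 hc
  obtain ⟨co, hco, hoo⟩ := K.cover o
  have hcofar : ∀ k, K.Far lam (tr K.M k co) := fun k =>
    ⟨strip_tr k hco, o, by rwa [K.per], ho, ho'⟩
  have htinv : ∀ k, ∀ c ∈ C, tr K.M k c ∈ C := by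
    intro k c hc
    have h1 := conn_tr K.V0_tr k (hc : Conn hadj (K.V0 lam) c0 c)
    have h2 := conn_tr K.V0_tr k (hfar co (by simpa [tr_zero] using hcofar 0) :
      Conn hadj (K.V0 lam) c0 co)
    have h3 : Conn hadj (K.V0 lam) c0 (tr K.M k co) := hfar _ (hcofar k)
    exact h3.trans ((h2.symm hadj_symm).trans h1)
  have hpatV : ∀ c ∈ C, K.pat c ⊆ K.V0 lam := by
    rintro c hc e ⟨he, hp⟩
    have h1 := hCV hc
    exact ⟨he, fun h => h1.2.1 (K.A0_pat h h1.1 hp.symm),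
      fun h => h1.2.2 (K.B0_pat h h1.1 hp.symm)⟩
  have hpc : ∀ c ∈ C, ∀ d ∈ K.pat c, ∃ k, Conn hadj (K.pat c) c (tr K.M k d) := by
    intro c hc d hd
    obtain ⟨e, h1, h2⟩ := K.lift1 (S := K.pat c) (fun f hf => hf.1) (K.pat_tr c)
      (K.pconn c (hCV hc).1 d hd.1 hd.2.symm)
    have h3 := hpatV c hc h1.right
    rcases h2 with h2 | h2 | ⟨k, h2⟩
    · exact (h3.2.1 (K.A2 H h2)).elim
    · exact (h3.2.2 (K.B2 H h2)).elim
    · exact ⟨k, h2 ▸ h1⟩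
  have hpatsub : ∀ c ∈ C, K.pat c ⊆ C := by
    intro c hc d hd
    obtain ⟨k, h1⟩ := hpc c hc d hd
    have h2 : tr K.M k d ∈ C :=
      (hc : Conn hadj (K.V0 lam) c0 c).trans (h1.mono (hpatV c hc))
    have h3 := htinv (-k) _ h2
    rwa [tr_tr, neg_add_cancel, tr_zero] at h3
  refine ⟨⟨C, ⟨c0, Conn.refl hc0⟩, fun c hc => (hCV hc).1, htinv, ?_, wide_cols h0, hpatsub, hpc,
    ?_, hfar, ?_, fun c h1 h2 => (hCV h2).2.1 (K.A2 H h1), fun c h1 h2 => (hCV h2).2.2 (K.B2 H h1)⟩⟩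
  · intro c hc d hd
    exact (hc.restrict.symm hadj_symm).trans hd.restrict
  · intro c hc m hm
    by_contra hm0
    have hw := wide_of_tr K.hM (K.pat_tr c) hm0 hm
    obtain ⟨x, hx⟩ := K.ne c (hCV hc).1
    have hxz := K.near c (hCV hc).1 x hx
    have hxa : (2 * lam + 1) * D ≤ dist x a := by
      by_contra h; push Not at h
      exact (hCV hc).2.1 (K.A5 H (hCV hc).1 hx h)
    have hxb : (2 * lam + 1) * D ≤ dist x b := by
      by_contra h; push Not at h
      exact (hCV hc).2.2 (K.B5 H (hCV hc).1 hx h)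
    have t1 := dist_triangle x (K.π c) a
    have t2 := dist_triangle x (K.π c) b
    obtain ⟨E, _, hE, haE, hbE, hEs⟩ := (H.llc.2 (K.π c) (2 * lam * D)).2 a
      (by rw [mem_ball, dist_comm]; linarith) b (by rw [mem_ball, dist_comm]; linarith)
    have hrad : 2 * lam * D / lam = 2 * D := by field_simp
    rw [hrad] at hEs
    have h1 := K.chain hE.2 haE hbE (K.row0_strip (c := (0, 0)) rfl)
      (K.rowL_strip (c := (0, K.L)) rfl) (K.rowa _ rfl) (K.rowb _ rfl)
    obtain ⟨p, q, hp, hq, h2⟩ := K.lift2 (S := {k | k ∈ strip K.L ∧ (K.β k ∩ E).Nonempty})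
      (fun f hf => hf.1) (K.tinv_meet E) h1 rfl rfl
    refine CH3' (L := K.L) (S := K.pat c) (fun e he => he.1) ?_ hp hq h2 hw
    rw [Set.disjoint_left]
    rintro e he ⟨_, y, hy, hyE⟩
    have h3 := K.near e he.1 y hy
    rw [he.2] at h3
    exact hEs hyE (by rw [mem_ball]; linarith)
  · have key : ∀ n : ℕ, ∀ c ∈ strip K.L \ C, c.2 = n →
        (∃ p : ℤ × ℤ, p.2 = 0 ∧ Conn hadj (strip K.L \ C) p c) ∨
        (∃ p : ℤ × ℤ, p.2 = K.L ∧ Conn hadj (strip K.L \ C) p c) := by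
      intro n
      induction n with
      | zero => intro c hc hn; exact Or.inl ⟨c, by simpa using hn, Conn.refl hc⟩
      | succ n ih =>
        intro c hc hn
        by_cases hA : c ∈ K.A0 lam
        · obtain ⟨p, hp, h⟩ := K.A3 H hA
          exact Or.inl ⟨p, hp, h.mono fun f hf => ⟨hf.1, fun h1 => (hCV h1).2.1 hf⟩⟩
        by_cases hB : c ∈ K.B0 lam
        · obtain ⟨p, hp, h⟩ := K.B3 H hB
          exact Or.inr ⟨p, hp, h.mono fun f hf => ⟨K.B0_strip hf, fun h1 => (hCV h1).2.2 hf⟩⟩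
        have hadj1 : hadj (c.1, c.2 - 1) c := by unfold hadj; simp
        have hs : ((c.1, c.2 - 1) : ℤ × ℤ) ∈ strip K.L \ C := by
          refine ⟨⟨?_, ?_⟩, fun h => hc.2 ?_⟩
          · push_cast at hn; simp only; omega
          · have := hc.1.2; simp only; omega
          · exact Conn.step h hadj1 ⟨hc.1, hA, hB⟩
        rcases ih _ hs (by push_cast at hn; simp only; omega) with ⟨p, hp, h⟩ | ⟨p, hp, h⟩
        · exact Or.inl ⟨p, hp, h.step hadj1 hc⟩
        · exact Or.inr ⟨p, hp, h.step hadj1 hc⟩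
    intro c hc
    exact key c.2.toNat c hc (by rw [Int.toNat_of_nonneg hc.1.1])

namespace Core
variable {K}
variable (Q : K.Core lam)

def A : Set (ℤ × ℤ) := {c | ∃ p : ℤ × ℤ, p.2 = 0 ∧ Conn hadj (strip K.L \ Q.C) p c}
def B : Set (ℤ × ℤ) := {c | ∃ p : ℤ × ℤ, p.2 = K.L ∧ Conn hadj (strip K.L \ Q.C) p c}

theorem A_sub {c : ℤ × ℤ} (h : c ∈ Q.A) : c ∈ strip K.L \ Q.C := by
  obtain ⟨p, _, h⟩ := h; exact h.right
theorem B_sub {c : ℤ × ℤ} (h : c ∈ Q.B) : c ∈ strip K.L \ Q.C := by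
  obtain ⟨p, _, h⟩ := h; exact h.right
theorem AB {c : ℤ × ℤ} (h : c ∈ strip K.L \ Q.C) : c ∈ Q.A ∨ c ∈ Q.B := Q.comp c h
theorem A_row {c : ℤ × ℤ} (h : c.2 = 0) : c ∈ Q.A :=
  ⟨c, h, Conn.refl ⟨K.row0_strip h, Q.row0 c h⟩⟩
theorem B_row {c : ℤ × ℤ} (h : c.2 = K.L) : c ∈ Q.B :=
  ⟨c, h, Conn.refl ⟨K.rowL_strip h, Q.rowL c h⟩⟩
theorem disj {c : ℤ × ℤ} (h : c ∈ Q.A) (h' : c ∈ Q.B) : False := by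
  obtain ⟨p, hp, h⟩ := h
  obtain ⟨q, hq, h'⟩ := h'
  exact CH3' Q.sub disjoint_sdiff_right hp hq (h.trans (h'.symm hadj_symm)) Q.wide
theorem A_step {c d : ℤ × ℤ} (h : c ∈ Q.A) (hcd : hadj c d) (hd : d ∈ strip K.L \ Q.C) :
    d ∈ Q.A := by
  obtain ⟨p, hp, h⟩ := h; exact ⟨p, hp, h.step hcd hd⟩
theorem co_tr (k : ℤ) (c : ℤ × ℤ) (h : c ∈ strip K.L \ Q.C) : tr K.M k c ∈ strip K.L \ Q.C := by
  refine ⟨strip_tr k h.1, fun h1 => h.2 ?_⟩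
  have h3 := Q.tinv (-k) _ h1
  rwa [tr_tr, neg_add_cancel, tr_zero] at h3
theorem A_tr (k : ℤ) (c : ℤ × ℤ) (h : c ∈ Q.A) : tr K.M k c ∈ Q.A := by
  obtain ⟨p, hp, h⟩ := h; exact ⟨tr K.M k p, hp, conn_tr Q.co_tr k h⟩
theorem B_tr (k : ℤ) (c : ℤ × ℤ) (h : c ∈ Q.B) : tr K.M k c ∈ Q.B := by
  obtain ⟨p, hp, h⟩ := h; exact ⟨tr K.M k p, hp, conn_tr Q.co_tr k h⟩

/-- Two cells meeting: either they are `hadj` up to translation, or in the same pole row. -/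
theorem AB_bint {c d : ℤ × ℤ} (hc : c ∈ Q.A) (hd : d ∈ Q.B) : ¬ bint K.β c d := by
  intro h
  rcases K.inter c (Q.A_sub hc).1 d (Q.B_sub hd).1 h with h1 | h1 | ⟨k, h1 | h1⟩
  · exact Q.disj (Q.A_row h1.2) hd
  · exact Q.disj hc (Q.B_row h1.1)
  · exact Q.disj hc (h1 ▸ Q.B_tr k d hd)
  · have := Q.B_tr k d hd
    exact Q.disj (Q.A_step hc h1 (Q.B_sub this)) this

theorem A_near (H : Hyp a b D lam) {c : ℤ × ℤ} (hc : c ∈ Q.A) : ∀ x ∈ K.β c,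
    dist x a < rad2 lam D := by
  have hl := H.llc.1
  have hD := H.hD
  have hr := rad_facts H.llc.1 H.hD
  have hab := H.hR
  obtain ⟨p, hp, h⟩ := hc
  refine h.rec' (P := fun c => ∀ x ∈ K.β c, dist x a < rad2 lam D) ?_ ?_
  · intro x hx
    have := K.small h.left.1 hx (K.rowa p hp)
    linarith
  · intro c d hc hd hcd hP y hy
    obtain ⟨z, hz, hz'⟩ := K.adj _ hc.1 _ hd.1 hcd
    have h1 := hP z hz
    have h2 := K.small hd.1 hy hz'
    by_contra h3
    push Not at h3
    refine hd.2 (Q.far d ⟨hd.1, y, hy, h3, ?_⟩)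
    have t1 := dist_triangle a z b
    have t2 := dist_triangle z y b
    rw [dist_comm] at h1 h2
    linarith

theorem B_near (H : Hyp a b D lam) {c : ℤ × ℤ} (hc : c ∈ Q.B) : ∀ x ∈ K.β c,
    dist x b < rad2 lam D := by
  have hl := H.llc.1
  have hD := H.hD
  have hr := rad_facts H.llc.1 H.hD
  have hab := H.hR
  obtain ⟨p, hp, h⟩ := hc
  refine h.rec' (P := fun c => ∀ x ∈ K.β c, dist x b < rad2 lam D) ?_ ?_
  · intro x hx
    have := K.small h.left.1 hx (K.rowb p hp)
    linarith
  · intro c d hc hd hcd hP y hy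
    obtain ⟨z, hz, hz'⟩ := K.adj _ hc.1 _ hd.1 hcd
    have h1 := hP z hz
    have h2 := K.small hd.1 hy hz'
    by_contra h3
    push Not at h3
    refine hd.2 (Q.far d ⟨hd.1, y, hy, ?_, h3⟩)
    have t1 := dist_triangle a y b
    have t2 := dist_triangle y z b
    rw [dist_comm a y] at t1
    linarith

end Core
end Cells
end BK

end

section
open Metric MeasureTheory Set
open scoped ENNReal NNReal Topology

namespace BK

/-- The combinatorial model of a space at a given scale. -/
structure Model (X : Type) [MetricSpace X] (a b : X) (D r R : ℝ) where
  V : Type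
  fin : Finite V
  S : Strip V
  P : V → Set X
  A : Set X
  B : Set X
  ctr : V → X
  Pclosed : ∀ v, IsClosed (P v)
  Aclosed : IsClosed A
  Bclosed : IsClosed B
  Pne : ∀ v, (P v).Nonempty
  cover : ∀ x, x ∈ A ∨ x ∈ B ∨ ∃ v, x ∈ P v
  PP : ∀ v w, (P v ∩ P w).Nonempty ↔ v = w ∨ ∃ k, S.adj (v, 0) (w, k)
  PA : ∀ v, (P v ∩ A).Nonempty ↔ v ∈ S.top
  PB : ∀ v, (P v ∩ B).Nonempty ↔ v ∈ S.bot
  AB : Disjoint A B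
  near : ∀ v, ∀ x ∈ P v, dist x (ctr v) ≤ D
  sep : ∀ v w, v ≠ w → r ≤ dist (ctr v) (ctr w)
  aA : a ∈ A
  bB : b ∈ B
  Asub : A ⊆ ball a R
  Bsub : B ⊆ ball b R

namespace Cells
variable {X : Type} [MetricSpace X] {a b : X} {D r : ℝ} {K : Cells X a b D r} {lam : ℝ}

theorem closed_un {S : Set (ℤ × ℤ)} (hS : S ⊆ strip K.L) (hT : ∀ k, ∀ c ∈ S, tr K.M k c ∈ S) :
    IsClosed {x | ∃ c ∈ S, x ∈ K.β c} := by
  have : {x | ∃ c ∈ S, x ∈ K.β c} = ⋃ c ∈ (K.base : Set (ℤ × ℤ)) ∩ S, K.β c := by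
    ext x
    simp only [mem_ofPred_eq, mem_iUnion, exists_prop]
    constructor
    · rintro ⟨c, hc, hx⟩
      obtain ⟨k, hk⟩ := K.red_eq c
      refine ⟨K.red c, ⟨K.red_mem (hS hc), ?_⟩, ?_⟩
      · have := hT (-k) c hc
        conv at this => rw [hk]
        rwa [tr_tr, neg_add_cancel, tr_zero] at this
      · rw [hk, K.per] at hx; exact hx
    · rintro ⟨c, hc, hx⟩
      exact ⟨c, hc.2, hx⟩
  rw [this]
  exact (K.base.finite_toSet.inter_of_left S).isClosed_biUnion fun c _ => K.closed c

namespace Core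
variable (Q : K.Core lam)

def VV : Type := {z : X // ∃ c ∈ Q.C, K.π c = z}

theorem finVV : Finite Q.VV := by
  have : ({z : X | ∃ c ∈ Q.C, K.π c = z}).Finite := by
    refine (K.base.finite_toSet.image K.π).subset ?_
    rintro z ⟨c, hc, rfl⟩
    obtain ⟨k, hk⟩ := K.red_eq c
    refine ⟨K.red c, K.red_mem (Q.sub hc), ?_⟩
    conv_rhs => rw [hk]
    rw [K.π_per]
  exact this.to_subtype

noncomputable def rt (v : Q.VV) : ℤ × ℤ := v.2.choose
theorem rt_mem (v : Q.VV) : Q.rt v ∈ Q.C := v.2.choose_spec.1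
theorem rt_π (v : Q.VV) : K.π (Q.rt v) = v.1 := v.2.choose_spec.2

/-- `c` belongs to the lifted patch `x`. -/
def Lab (c : ℤ × ℤ) (x : Q.VV × ℤ) : Prop :=
  Conn hadj (K.pat (Q.rt x.1)) (tr K.M x.2 (Q.rt x.1)) c

variable {Q}

theorem Lab.pat {c : ℤ × ℤ} {x : Q.VV × ℤ} (h : Q.Lab c x) : c ∈ K.pat (Q.rt x.1) := h.right
theorem Lab.C {c : ℤ × ℤ} {x : Q.VV × ℤ} (h : Q.Lab c x) : c ∈ Q.C :=
  Q.patsub _ (Q.rt_mem _) h.right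
theorem Lab.π {c : ℤ × ℤ} {x : Q.VV × ℤ} (h : Q.Lab c x) : K.π c = x.1.1 := by
  rw [← Q.rt_π]; exact h.right.2

theorem Lab.tr {c : ℤ × ℤ} {x : Q.VV × ℤ} (h : Q.Lab c x) (k : ℤ) :
    Q.Lab (tr K.M k c) (sh k x) := by
  have := conn_tr (K.pat_tr _) k h
  rw [tr_tr] at this
  unfold Lab sh
  rw [add_comm]; exact this

theorem Lab.uniq {c : ℤ × ℤ} {x y : Q.VV × ℤ} (h : Q.Lab c x) (h' : Q.Lab c y) : x = y := by
  have h1 : x.1 = y.1 := Subtype.ext (by rw [← h.π, ← h'.π])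
  obtain ⟨v, m⟩ := x
  obtain ⟨w, n⟩ := y
  simp only at h1
  subst h1
  have h2 := (h.trans (h'.symm hadj_symm) : Conn hadj _ (BK.tr K.M m (Q.rt v)) (BK.tr K.M n (Q.rt v)))
  have h3 := conn_tr (K.pat_tr _) (-m) h2
  rw [tr_tr, tr_tr, neg_add_cancel, tr_zero] at h3
  have := Q.nowrap _ (Q.rt_mem v) _ h3
  rw [show m = n by omega]

theorem exists_lab {c : ℤ × ℤ} (h : c ∈ Q.C) : ∃ x, Q.Lab c x ∧ K.π c = x.1.1 := by
  let v : Q.VV := ⟨K.π c, c, h, rfl⟩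
  obtain ⟨k, hk⟩ := Q.patconn _ (Q.rt_mem v) c ⟨Q.sub h, by rw [Q.rt_π]⟩
  refine ⟨(v, -k), ?_, rfl⟩
  have h3 := conn_tr (K.pat_tr _) (-k) hk
  rwa [tr_tr, neg_add_cancel, tr_zero] at h3

theorem lab_rt (x : Q.VV × ℤ) : Q.Lab (BK.tr K.M x.2 (Q.rt x.1)) x :=
  Conn.refl (K.pat_tr _ _ _ ⟨Q.sub (Q.rt_mem _), rfl⟩)

theorem Lab.conn {c d : ℤ × ℤ} {x : Q.VV × ℤ} (h : Q.Lab c x) (h' : Q.Lab d x) :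
    Conn hadj {f | Q.Lab f x} c d :=
  (h.restrict.symm hadj_symm).trans h'.restrict

theorem lab_bdd : ∃ G : ℤ, ∀ c x, Q.Lab c x → |c.1 - x.2 * K.M| ≤ G := by
  have hfin : {c | ∃ v : Q.VV, Q.Lab c (v, 0)}.Finite := by
    refine Set.Finite.of_finite_image (f := K.red) (K.base.finite_toSet.subset ?_) ?_
    · rintro _ ⟨c, ⟨v, hv⟩, rfl⟩
      exact K.red_mem (Q.sub hv.C)
    · rintro c ⟨v, hv⟩ d ⟨w, hw⟩ hcd
      obtain ⟨k, hk⟩ := K.red_eq c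
      obtain ⟨l, hl⟩ := K.red_eq d
      have h1 : c = BK.tr K.M (k - l) d := by
        conv_lhs => rw [hk, hcd]
        conv_rhs => rw [hl]
        rw [tr_tr, sub_add_cancel]
      have h2 := hw.tr (k - l)
      rw [← h1] at h2
      have h3 := congrArg Prod.snd (hv.uniq h2)
      simp only [sh] at h3
      rw [h1, show k - l = 0 by omega, tr_zero]
  obtain ⟨G, hG⟩ := (hfin.image fun c => |c.1|).bddAbove
  refine ⟨G, fun c x h => ?_⟩
  have h1 := h.tr (-x.2)
  have h2 : sh (-x.2) x = (x.1, 0) := by simp [sh]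
  rw [h2] at h1
  have h3 := hG ⟨_, ⟨_, h1⟩, rfl⟩
  simp only [BK.tr] at h3
  rwa [show c.1 - x.2 * (K.M : ℤ) = c.1 + -x.2 * K.M by ring]

variable (Q) in
def adjQ (x y : Q.VV × ℤ) : Prop := ∃ c d, Q.Lab c x ∧ Q.Lab d y ∧ hadj c d

theorem up {S : Set (Q.VV × ℤ)} {x y : Q.VV × ℤ} (h : Conn Q.adjQ S x y) {c d : ℤ × ℤ}
    (hc : Q.Lab c x) (hd : Q.Lab d y) : Conn hadj {e | ∃ z ∈ S, Q.Lab e z} c d := by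
  refine h.rec' (P := fun y => ∀ d, Q.Lab d y → Conn hadj {e | ∃ z ∈ S, Q.Lab e z} c d) ?_ ?_ d hd
  · intro d hd
    exact (hc.conn hd).mono fun f hf => ⟨x, h.left, hf⟩
  · rintro y z hy hz ⟨c', d', hc', hd', hh⟩ ih d hd
    exact ((ih c' hc').step hh ⟨z, hz, hd'⟩).trans ((hd'.conn hd).mono fun f hf => ⟨z, hz, hf⟩)

theorem down {S : Set (Q.VV × ℤ)} {x y : Q.VV × ℤ} {c d : ℤ × ℤ}
    (h : Conn hadj {e | ∃ z ∈ S, Q.Lab e z} c d) (hc : Q.Lab c x) (hd : Q.Lab d y) :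
    Conn Q.adjQ S x y := by
  refine h.rec' (P := fun d => ∀ y, Q.Lab d y → Conn Q.adjQ S x y) ?_ ?_ y hd
  · intro y hy
    obtain ⟨z, hz, hcz⟩ := h.left
    rw [← hc.uniq hy, hc.uniq hcz]; exact Conn.refl hz
  · rintro e f ⟨y, hy, hey⟩ ⟨z, hz, hfz⟩ hef ih z' hz'
    rw [← hfz.uniq hz']
    exact (ih y hey).step ⟨e, f, hey, hfz, hef⟩ hz

variable (Q) in
def topQ : Set Q.VV := {v | ∃ c d, (∃ m, Q.Lab c (v, m)) ∧ d ∈ Q.A ∧ hadj c d}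
variable (Q) in
def botQ : Set Q.VV := {v | ∃ c d, (∃ m, Q.Lab c (v, m)) ∧ d ∈ Q.B ∧ hadj c d}

theorem topQ_spec {x : Q.VV × ℤ} (h : x.1 ∈ Q.topQ) : ∃ c d, Q.Lab c x ∧ d ∈ Q.A ∧ hadj c d := by
  obtain ⟨c, d, ⟨m, hm⟩, hd, hh⟩ := h
  refine ⟨_, _, ?_, Q.A_tr (x.2 - m) d hd, hadj_tr _ _ hh⟩
  have := hm.tr (x.2 - m)
  have h2 : sh (x.2 - m) (x.1, m) = x := by simp [sh]
  rwa [h2] at this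

theorem botQ_spec {x : Q.VV × ℤ} (h : x.1 ∈ Q.botQ) : ∃ c d, Q.Lab c x ∧ d ∈ Q.B ∧ hadj c d := by
  obtain ⟨c, d, ⟨m, hm⟩, hd, hh⟩ := h
  refine ⟨_, _, ?_, Q.B_tr (x.2 - m) d hd, hadj_tr _ _ hh⟩
  have := hm.tr (x.2 - m)
  have h2 : sh (x.2 - m) (x.1, m) = x := by simp [sh]
  rwa [h2] at this

theorem HQ (S : Set (Q.VV × ℤ)) : (∃ x y, x.1 ∈ Q.topQ ∧ y.1 ∈ Q.botQ ∧ Conn Q.adjQ S x y) ∨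
    ∀ N : ℤ, ∃ x y : Q.VV × ℤ, x.2 < -N ∧ N < y.2 ∧ Conn Q.adjQ Sᶜ x y := by
  by_cases hn : ∃ x y, x.1 ∈ Q.topQ ∧ y.1 ∈ Q.botQ ∧ Conn Q.adjQ S x y
  · exact Or.inl hn
  right
  obtain ⟨c0, _, h0⟩ := CH1 (L := K.L) (U := {e | ∃ z ∈ Sᶜ, Q.Lab e z}) (by
    rintro c ⟨z, _, hc⟩
    have hs := Q.sub hc.C
    constructor
    · rcases hs.1.lt_or_eq with h | h
      · exact h
      · exact (Q.row0 c h.symm hc.C).elim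
    · rcases hs.2.lt_or_eq with h | h
      · exact h
      · exact (Q.rowL c h hc.C).elim) (by
    intro c d hc hd h
    have h1 := h.rec' (P := fun e => e ∈ Q.A ∨ ∃ x y, x.1 ∈ Q.topQ ∧ Q.Lab e y ∧ Conn Q.adjQ S x y)
      (Or.inl (Q.A_row hc)) (by
        intro e f he hf hef ih
        by_cases hfC : f ∈ Q.C
        · right
          obtain ⟨z, hz, -⟩ := exists_lab hfC
          have hzS : z ∈ S := by
            by_contra hzS
            exact hf.2 ⟨z, hzS, hz⟩
          rcases ih with ih | ⟨x, y, hx, hy, ih⟩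
          · exact ⟨z, z, ⟨f, e, ⟨z.2, hz⟩, ih, hadj_symm _ _ hef⟩, hz, Conn.refl hzS⟩
          · exact ⟨x, z, hx, hz, ih.step ⟨e, f, hy, hz, hef⟩ hzS⟩
        · rcases Q.AB ⟨hf.1, hfC⟩ with h2 | h2
          · exact Or.inl h2
          · rcases ih with ih | ⟨x, y, hx, hy, ih⟩
            · exact Or.inl (Q.A_step ih hef ⟨hf.1, hfC⟩)
            · exact (hn ⟨x, y, hx, ⟨e, f, ⟨y.2, hy⟩, h2, hef⟩, ih⟩).elim)
    rcases h1 with h1 | ⟨x, y, _, hy, _⟩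
    · exact Q.disj h1 (Q.B_row hd)
    · exact Q.rowL d hd hy.C)
  obtain ⟨G, hG⟩ := lab_bdd (Q := Q)
  have hM : (0 : ℤ) < K.M := by exact_mod_cast K.hM
  intro N
  obtain ⟨j, hj⟩ := h0 (-(N + 1) * K.M - G)
  obtain ⟨j', hj'⟩ := h0 ((N + 1) * K.M + G)
  obtain ⟨x, hx, hjx⟩ := hj.right
  obtain ⟨y, hy, hjy⟩ := hj'.right
  refine ⟨x, y, ?_, ?_, down ((hj.symm hadj_symm).trans hj') hjx hjy⟩
  · have := (abs_le.1 (hG _ _ hjx)).1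
    simp only at this
    nlinarith
  · have := (abs_le.1 (hG _ _ hjy)).2
    simp only at this
    nlinarith

theorem H3Q (S : Set (Q.VV × ℤ)) (h : ∃ x y, x.1 ∈ Q.topQ ∧ y.1 ∈ Q.botQ ∧ Conn Q.adjQ S x y) :
    ∃ N : ℤ, ∀ x y : Q.VV × ℤ, x.2 < -N → N < y.2 → ¬ Conn Q.adjQ Sᶜ x y := by
  by_contra hn
  push Not at hn
  obtain ⟨x, y, hx, hy, h⟩ := h
  obtain ⟨c, c', hc, hc', hcc⟩ := topQ_spec hx
  obtain ⟨d, d', hd, hd', hdd⟩ := botQ_spec hy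
  have h1 := up h hc hd
  obtain ⟨p, hp, hpc⟩ := hc'
  obtain ⟨q, hq, hqd⟩ := hd'
  obtain ⟨G, hG⟩ := lab_bdd (Q := Q)
  have hM : (0 : ℤ) < K.M := by exact_mod_cast K.hM
  have e1 := hpc.mono (T := (strip K.L \ Q.C) ∪ {e | ∃ z ∈ S, Q.Lab e z}) subset_union_left
  have e2 := hqd.mono (T := (strip K.L \ Q.C) ∪ {e | ∃ z ∈ S, Q.Lab e z}) subset_union_left
  have e3 := h1.mono (T := (strip K.L \ Q.C) ∪ {e | ∃ z ∈ S, Q.Lab e z}) subset_union_right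
  have e4 := ((e1.step (hadj_symm _ _ hcc) e3.left).trans e3).trans
    ((e2.step (hadj_symm _ _ hdd) e3.right).symm hadj_symm)
  refine CH3' (L := K.L) (S := {e | ∃ z ∈ Sᶜ, Q.Lab e z}) ?_ ?_ hp hq e4 ?_
  · rintro e ⟨z, _, hz⟩; exact Q.sub hz.C
  · rw [Set.disjoint_left]
    rintro e ⟨z, hz, hez⟩ (h2 | ⟨w, hw, hew⟩)
    · exact h2.2 hez.C
    · rw [hez.uniq hew] at hz; exact hz hw
  · intro n
    obtain ⟨x, y, hx, hy, h2⟩ := hn (|n| + |G|)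
    have g1 := abs_le.1 (hG _ _ (lab_rt x))
    have g2 := abs_le.1 (hG _ _ (lab_rt y))
    refine ⟨_, _, ?_, ?_, up h2 (lab_rt x) (lab_rt y)⟩
    · have := neg_abs_le n
      have := le_abs_self G
      have : x.2 * K.M ≤ x.2 * 1 := by
        have : (1 : ℤ) ≤ K.M := hM
        have : x.2 ≤ 0 := by have := abs_nonneg n; have := abs_nonneg G; omega
        nlinarith
      omega
    · have := neg_abs_le n
      have := le_abs_self G
      have : y.2 * 1 ≤ y.2 * K.M := by
        have : (1 : ℤ) ≤ K.M := hM
        have : 0 ≤ y.2 := by have := abs_nonneg n; have := abs_nonneg G; omega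
        nlinarith
      omega

variable (Q) in
def stripQ : Strip Q.VV where
  adj := Q.adjQ
  symm := fun x y ⟨c, d, hc, hd, h⟩ => ⟨d, c, hd, hc, hadj_symm _ _ h⟩
  shift := fun k x y ⟨c, d, hc, hd, h⟩ => ⟨_, _, hc.tr k, hd.tr k, hadj_tr _ k h⟩
  top := Q.topQ
  bot := Q.botQ
  H := HQ
  H3 := fun S _ h => H3Q S h
  conn := fun x y => by
    refine down ((Q.conn _ (lab_rt x).C _ (lab_rt y).C).mono ?_) (lab_rt x) (lab_rt y)
    intro c hc
    obtain ⟨z, hz, -⟩ := exists_lab hc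
    exact ⟨z, mem_univ _, hz⟩

theorem exists_model (Q : K.Core lam) (H : Hyp a b D lam) :
    Nonempty (Model X a b D r (rad2 lam D)) := by
  have mem : ∀ (v : Q.VV) c, c ∈ K.pat (Q.rt v) → c ∈ Q.C := fun v => Q.patsub _ (Q.rt_mem v)
  have lab : ∀ (v : Q.VV) c, c ∈ K.pat (Q.rt v) → ∃ m, Q.Lab c (v, m) := by
    intro v c hc
    obtain ⟨⟨w, m⟩, hx, hp⟩ := exists_lab (mem v c hc)
    have : w = v := Subtype.ext (by rw [← Q.rt_π v, ← hc.2, hp])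
    exact ⟨m, this ▸ hx⟩
  refine ⟨⟨Q.VV, Q.finVV, Q.stripQ, fun v => {x | ∃ c ∈ K.pat (Q.rt v), x ∈ K.β c},
    {x | ∃ c ∈ Q.A, x ∈ K.β c}, {x | ∃ c ∈ Q.B, x ∈ K.β c}, fun v => v.1,
    fun v => closed_un (fun c hc => hc.1) (K.pat_tr _),
    closed_un (fun c hc => (Q.A_sub hc).1) Q.A_tr, closed_un (fun c hc => (Q.B_sub hc).1) Q.B_tr,
    ?_, ?_, ?_, ?_, ?_, ?_, ?_, ?_, ?_, ?_, ?_, ?_⟩⟩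
  · intro v
    obtain ⟨x, hx⟩ := K.ne _ (Q.sub (Q.rt_mem v))
    exact ⟨x, _, ⟨Q.sub (Q.rt_mem v), rfl⟩, hx⟩
  · intro x
    obtain ⟨c, hc, hx⟩ := K.cover x
    by_cases h : c ∈ Q.C
    · refine Or.inr (Or.inr ⟨⟨K.π c, c, h, rfl⟩, c, ⟨hc, ?_⟩, hx⟩)
      exact (Q.rt_π (⟨K.π c, c, h, rfl⟩ : Q.VV)).symm
    · rcases Q.AB ⟨hc, h⟩ with h | h
      · exact Or.inl ⟨c, h, hx⟩
      · exact Or.inr (Or.inl ⟨c, h, hx⟩)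
  · intro v w
    constructor
    · rintro ⟨x, ⟨c, hc, hxc⟩, ⟨d, hd, hxd⟩⟩
      rcases K.inter c hc.1 d hd.1 ⟨x, hxc, hxd⟩ with h1 | h1 | ⟨k, h1 | h1⟩
      · exact (Q.row0 c h1.1 (mem v c hc)).elim
      · exact (Q.rowL c h1.1 (mem v c hc)).elim
      · left
        refine Subtype.ext ?_
        rw [← Q.rt_π v, ← Q.rt_π w, ← hc.2, ← hd.2, h1, K.π_per]
      · right
        obtain ⟨m, hm⟩ := lab v c hc
        obtain ⟨n, hn⟩ := lab w _ (K.pat_tr _ k d hd)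
        refine ⟨n + -m, ?_⟩
        have := Q.stripQ.shift (-m) (v, m) (w, n) ⟨_, _, hm, hn, h1⟩
        simpa [sh] using this
    · rintro (rfl | ⟨k, c, d, hc, hd, h⟩)
      · obtain ⟨x, hx⟩ := K.ne _ (Q.sub (Q.rt_mem v))
        exact ⟨x, ⟨_, ⟨Q.sub (Q.rt_mem v), rfl⟩, hx⟩, ⟨_, ⟨Q.sub (Q.rt_mem v), rfl⟩, hx⟩⟩
      · obtain ⟨x, hx, hx'⟩ := K.adj _ (Q.sub hc.C) _ (Q.sub hd.C) h
        exact ⟨x, ⟨c, hc.pat, hx⟩, ⟨d, hd.pat, hx'⟩⟩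
  · intro v
    constructor
    · rintro ⟨x, ⟨c, hc, hxc⟩, ⟨d, hd, hxd⟩⟩
      rcases K.inter c hc.1 d (Q.A_sub hd).1 ⟨x, hxc, hxd⟩ with h1 | h1 | ⟨k, h1 | h1⟩
      · exact (Q.row0 c h1.1 (mem v c hc)).elim
      · exact (Q.rowL c h1.1 (mem v c hc)).elim
      · exact ((Q.A_sub (Q.A_tr k d hd)).2 (h1 ▸ mem v c hc)).elim
      · exact ⟨c, _, lab v c hc, Q.A_tr k d hd, h1⟩
    · rintro ⟨c, d, ⟨m, hc⟩, hd, h⟩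
      obtain ⟨x, hx, hx'⟩ := K.adj _ (Q.sub hc.C) _ (Q.A_sub hd).1 h
      exact ⟨x, ⟨c, hc.pat, hx⟩, ⟨d, hd, hx'⟩⟩
  · intro v
    constructor
    · rintro ⟨x, ⟨c, hc, hxc⟩, ⟨d, hd, hxd⟩⟩
      rcases K.inter c hc.1 d (Q.B_sub hd).1 ⟨x, hxc, hxd⟩ with h1 | h1 | ⟨k, h1 | h1⟩
      · exact (Q.row0 c h1.1 (mem v c hc)).elim
      · exact (Q.rowL c h1.1 (mem v c hc)).elim
      · exact ((Q.B_sub (Q.B_tr k d hd)).2 (h1 ▸ mem v c hc)).elim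
      · exact ⟨c, _, lab v c hc, Q.B_tr k d hd, h1⟩
    · rintro ⟨c, d, ⟨m, hc⟩, hd, h⟩
      obtain ⟨x, hx, hx'⟩ := K.adj _ (Q.sub hc.C) _ (Q.B_sub hd).1 h
      exact ⟨x, ⟨c, hc.pat, hx⟩, ⟨d, hd, hx'⟩⟩
  · rw [Set.disjoint_left]
    rintro x ⟨c, hc, hxc⟩ ⟨d, hd, hxd⟩
    exact Q.AB_bint hc hd ⟨x, hxc, hxd⟩
  · rintro v x ⟨c, hc, hx⟩
    have := K.near c hc.1 x hx
    rwa [hc.2, Q.rt_π] at this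
  · intro v w hvw
    have h1 := K.sep _ (Q.sub (Q.rt_mem v)) _ (Q.sub (Q.rt_mem w))
    rw [Q.rt_π, Q.rt_π] at h1
    exact h1 fun h => hvw (Subtype.ext h)
  · exact ⟨(0, 0), Q.A_row rfl, K.rowa _ rfl⟩
  · exact ⟨(0, K.L), Q.B_row rfl, K.rowb _ rfl⟩
  · rintro x ⟨c, hc, hx⟩; exact Q.A_near H hc x hx
  · rintro x ⟨c, hc, hx⟩; exact Q.B_near H hc x hx

end Core
end Cells
end BK

end

section
open Metric MeasureTheory Set
open scoped ENNReal NNReal Topology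

namespace BK

abbrev S2 : Type := ↥(Metric.sphere (0 : EuclideanSpace ℝ (Fin 3)) 1)

/-- Polar coordinates on a topological sphere. -/
structure Kap (X : Type) [MetricSpace X] (a b : X) where
  κ : ℝ × ℝ → X
  cont : Continuous κ
  per : ∀ t s, κ (t + 1, s) = κ (t, s)
  k0 : ∀ t, κ (t, 0) = a
  k1 : ∀ t, κ (t, 1) = b
  surj : ∀ x, ∃ t s, 0 ≤ s ∧ s ≤ 1 ∧ κ (t, s) = x
  inj : ∀ t s t' s', 0 ≤ s → s ≤ 1 → 0 ≤ s' → s' ≤ 1 → κ (t, s) = κ (t', s') →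
    s = s' ∧ (s = 0 ∨ s = 1 ∨ ∃ k : ℤ, t - t' = k)

theorem mem_S2 (p : EuclideanSpace ℝ (Fin 3)) :
    p ∈ Metric.sphere (0 : EuclideanSpace ℝ (Fin 3)) 1 ↔ p 0 ^ 2 + p 1 ^ 2 + p 2 ^ 2 = 1 := by
  rw [mem_sphere_zero_iff_norm, EuclideanSpace.norm_eq, Fin.sum_univ_three]
  simp only [Real.norm_eq_abs, sq_abs]
  rw [Real.sqrt_eq_one]

noncomputable def pol (q : ℝ × ℝ) : S2 :=
  ⟨!₂[Real.sin (Real.pi * q.2) * Real.cos (2 * Real.pi * q.1),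
    Real.sin (Real.pi * q.2) * Real.sin (2 * Real.pi * q.1), Real.cos (Real.pi * q.2)], by
    rw [mem_S2]
    simp only [Matrix.cons_val_zero, Matrix.cons_val_one, Matrix.cons_val]
    have h1 := Real.sin_sq_add_cos_sq (Real.pi * q.2)
    have h2 := Real.sin_sq_add_cos_sq (2 * Real.pi * q.1)
    linear_combination (Real.sin (Real.pi * q.2)) ^ 2 * h2 + h1⟩

theorem pol_cont : Continuous pol := by
  unfold pol
  refine Continuous.subtype_mk ?_ _
  refine (PiLp.continuous_toLp 2 _).comp ?_
  refine continuous_pi fun i => ?_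
  fin_cases i <;> simp <;> fun_prop

theorem pol_coord (q : ℝ × ℝ) : (pol q).1 0 = Real.sin (Real.pi * q.2) * Real.cos (2 * Real.pi * q.1) ∧
    (pol q).1 1 = Real.sin (Real.pi * q.2) * Real.sin (2 * Real.pi * q.1) ∧
    (pol q).1 2 = Real.cos (Real.pi * q.2) := by
  refine ⟨?_, ?_, ?_⟩ <;> simp [pol]

theorem S2_ext {p q : S2} (h0 : p.1 0 = q.1 0) (h1 : p.1 1 = q.1 1) (h2 : p.1 2 = q.1 2) :
    p = q := by
  apply Subtype.ext
  ext i
  fin_cases i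
  · exact h0
  · exact h1
  · exact h2

theorem exists_kap {X : Type} [MetricSpace X] (φ : X ≃ₜ S2) : ∃ a b, Nonempty (Kap X a b) := by
  refine ⟨φ.symm (pol (0, 0)), φ.symm (pol (0, 1)), ⟨⟨fun q => φ.symm (pol q),
    φ.symm.continuous.comp pol_cont, ?_, ?_, ?_, ?_, ?_⟩⟩⟩
  · intro t s
    congr 1
    obtain ⟨a0, a1, a2⟩ := pol_coord (t + 1, s)
    obtain ⟨b0, b1, b2⟩ := pol_coord (t, s)
    apply S2_ext
    · rw [a0, b0]; simp only; rw [mul_add, mul_one, Real.cos_add_two_pi]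
    · rw [a1, b1]; simp only; rw [mul_add, mul_one, Real.sin_add_two_pi]
    · rw [a2, b2]
  · intro t
    congr 1
    obtain ⟨a0, a1, a2⟩ := pol_coord (t, 0)
    obtain ⟨b0, b1, b2⟩ := pol_coord (0, 0)
    apply S2_ext
    · rw [a0, b0]; simp
    · rw [a1, b1]; simp
    · rw [a2, b2]
  · intro t
    congr 1
    obtain ⟨a0, a1, a2⟩ := pol_coord (t, 1)
    obtain ⟨b0, b1, b2⟩ := pol_coord (0, 1)
    apply S2_ext
    · rw [a0, b0]; simp
    · rw [a1, b1]; simp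
    · rw [a2, b2]
  · intro x
    set p := φ x with hp
    have hs := (mem_S2 p.1).1 p.2
    have hpi := Real.pi_pos
    have hb1 : -1 ≤ p.1 2 := by nlinarith [sq_nonneg (p.1 0), sq_nonneg (p.1 1)]
    have hb2 : p.1 2 ≤ 1 := by nlinarith [sq_nonneg (p.1 0), sq_nonneg (p.1 1)]
    set z : ℂ := ⟨p.1 0, p.1 1⟩ with hz
    refine ⟨Complex.arg z / (2 * Real.pi), Real.arccos (p.1 2) / Real.pi,
      div_nonneg (Real.arccos_nonneg _) hpi.le, (div_le_one hpi).2 (Real.arccos_le_pi _), ?_⟩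
    rw [Homeomorph.symm_apply_eq]
    obtain ⟨a0, a1, a2⟩ := pol_coord (Complex.arg z / (2 * Real.pi), Real.arccos (p.1 2) / Real.pi)
    simp only [mul_div_cancel₀ _ hpi.ne',
      mul_div_cancel₀ (Complex.arg z) (show (2 * Real.pi) ≠ 0 by positivity)] at a0 a1 a2
    have hn : ‖z‖ = Real.sin (Real.arccos (p.1 2)) := by
      rw [Real.sin_arccos, Complex.norm_def, Complex.normSq_apply]
      congr 1
      simp only [hz]; linarith
    rw [← hn] at a0 a1
    apply S2_ext
    · rw [a0, Complex.norm_mul_cos_arg]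
    · rw [a1, Complex.norm_mul_sin_arg]
    · rw [a2, Real.cos_arccos hb1 hb2]
  · intro t s t' s' h0 h1 h0' h1' h
    have hpi := Real.pi_pos
    have h2 := φ.symm.injective h
    obtain ⟨a0, a1, a2⟩ := pol_coord (t, s)
    obtain ⟨b0, b1, b2⟩ := pol_coord (t', s')
    rw [h2] at a0 a1 a2
    rw [b0] at a0
    rw [b1] at a1
    rw [b2] at a2
    simp only at a0 a1 a2
    have hss : s = s' := by
      have := Real.injOn_cos (x₁ := Real.pi * s') (x₂ := Real.pi * s) ⟨by positivity, by nlinarith⟩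
        ⟨by positivity, by nlinarith⟩ a2
      exact (mul_left_cancel₀ hpi.ne' this).symm
    refine ⟨hss, ?_⟩
    by_cases e0 : s = 0
    · exact Or.inl e0
    by_cases e1 : s = 1
    · exact Or.inr (Or.inl e1)
    right; right
    have hsin : 0 < Real.sin (Real.pi * s) := Real.sin_pos_of_pos_of_lt_pi
      (by have : 0 < s := lt_of_le_of_ne h0 (Ne.symm e0); positivity)
      (by have : s < 1 := lt_of_le_of_ne h1 e1; nlinarith)
    rw [← hss] at a0 a1
    have c0 := mul_left_cancel₀ hsin.ne' a0
    have c1 := mul_left_cancel₀ hsin.ne' a1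
    have hcos : Real.cos (2 * Real.pi * t - 2 * Real.pi * t') = 1 := by
      rw [Real.cos_sub, c0, c1]
      nlinarith [Real.sin_sq_add_cos_sq (2 * Real.pi * t)]
    obtain ⟨k, hk⟩ := (Real.cos_eq_one_iff _).1 hcos
    refine ⟨k, ?_⟩
    have : (t - t') * (2 * Real.pi) = k * (2 * Real.pi) := by rw [hk]; ring
    exact mul_right_cancel₀ (by positivity) this

namespace Kap
variable {X : Type} [MetricSpace X] {a b : X} (q : Kap X a b)

theorem per_int (k : ℤ) (t s : ℝ) : q.κ (t + k, s) = q.κ (t, s) := by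
  have hn : ∀ (n : ℕ) t, q.κ (t + n, s) = q.κ (t, s) := by
    intro n
    induction n with
    | zero => intro t; simp
    | succ n ih => intro t; push_cast; rw [← add_assoc, q.per, ih]
  obtain ⟨n, rfl | rfl⟩ := k.eq_nat_or_neg
  · exact hn n t
  · have := hn n (t + ((-n : ℤ) : ℝ))
    rw [← this]; congr 2; push_cast; ring

theorem unif {r : ℝ} (hr : 0 < r) : ∃ δ > 0, ∀ t s t' s', 0 ≤ s → s ≤ 1 → 0 ≤ s' → s' ≤ 1 →
    |t - t'| ≤ δ → |s - s'| ≤ δ → dist (q.κ (t, s)) (q.κ (t', s')) ≤ r := by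
  have hcpt : IsCompact (Icc (-1 : ℝ) 2 ×ˢ Icc (0 : ℝ) 1) := isCompact_Icc.prod isCompact_Icc
  have hu := hcpt.uniformContinuousOn_of_continuous q.cont.continuousOn
  rw [Metric.uniformContinuousOn_iff] at hu
  obtain ⟨δ, hδ, h⟩ := hu r hr
  refine ⟨min (δ / 2) 1, by positivity, fun t s t' s' h0 h1 h0' h1' ht hs => ?_⟩
  have e1 : q.κ (t, s) = q.κ (Int.fract t, s) := by
    rw [← q.per_int ⌊t⌋ (Int.fract t), Int.fract_add_floor]
  have e2 : q.κ (t', s') = q.κ (t' - ⌊t⌋, s') := by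
    rw [← q.per_int ⌊t⌋ (t' - ⌊t⌋), sub_add_cancel]
  rw [e1, e2]
  have f0 := Int.fract_nonneg t
  have f1 := Int.fract_lt_one t
  have f2 : t = Int.fract t + ⌊t⌋ := (Int.fract_add_floor t).symm
  have ht1 := abs_le.1 (ht.trans (min_le_right _ _))
  refine (h _ ⟨⟨by simp only; linarith, by simp only; linarith⟩, ⟨h0, h1⟩⟩ _
    ⟨⟨by simp only; linarith [ht1.2], by simp only; linarith [ht1.1]⟩, ⟨h0', h1'⟩⟩ ?_).le
  rw [Prod.dist_eq, max_lt_iff, Real.dist_eq, Real.dist_eq]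
  constructor
  · simp only
    rw [show Int.fract t - (t' - ⌊t⌋) = t - t' by rw [Int.fract]; ring]
    have := ht.trans (min_le_left _ _); linarith
  · have := hs.trans (min_le_left _ _); simp only; linarith

/-- The bricks. -/
def brick (M L : ℕ) (c : ℤ × ℤ) : Set X :=
  q.κ '' (Icc (((c.1 : ℝ) + c.2 / 2) / M) ((c.1 + 1 + c.2 / 2) / M) ×ˢ
    Icc ((c.2 : ℝ) / (L + 1)) ((c.2 + 1) / (L + 1)))

theorem mem_brick {M L : ℕ} (hM : 0 < M) {c : ℤ × ℤ} {x : X} : x ∈ q.brick M L c ↔ ∃ t s : ℝ,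
    (c.1 : ℝ) + c.2 / 2 ≤ t * M ∧ t * M ≤ c.1 + 1 + c.2 / 2 ∧ (c.2 : ℝ) ≤ s * (L + 1) ∧
    s * (L + 1) ≤ c.2 + 1 ∧ q.κ (t, s) = x := by
  have hM' : (0 : ℝ) < M := by exact_mod_cast hM
  have hL' : (0 : ℝ) < (L : ℝ) + 1 := by positivity
  unfold brick
  constructor
  · rintro ⟨⟨t, s⟩, ⟨⟨h1, h2⟩, ⟨h3, h4⟩⟩, rfl⟩
    exact ⟨t, s, (div_le_iff₀ hM').1 h1, (le_div_iff₀ hM').1 h2, (div_le_iff₀ hL').1 h3,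
      (le_div_iff₀ hL').1 h4, rfl⟩
  · rintro ⟨t, s, h1, h2, h3, h4, rfl⟩
    exact ⟨(t, s), ⟨⟨(div_le_iff₀ hM').2 h1, (le_div_iff₀ hM').2 h2⟩,
      ⟨(div_le_iff₀ hL').2 h3, (le_div_iff₀ hL').2 h4⟩⟩, rfl⟩

theorem s_range {L : ℕ} {c : ℤ × ℤ} (hc : c ∈ strip L) {s : ℝ} (h3 : (c.2 : ℝ) ≤ s * (L + 1))
    (h4 : s * (L + 1) ≤ c.2 + 1) : 0 ≤ s ∧ s ≤ 1 := by
  have hL' : (0 : ℝ) < (L : ℝ) + 1 := by positivity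
  have h1 : (0 : ℝ) ≤ c.2 := by exact_mod_cast hc.1
  have h2 : (c.2 : ℝ) ≤ L := by exact_mod_cast hc.2
  constructor
  · by_contra h; push Not at h; nlinarith
  · by_contra h; push Not at h; nlinarith

theorem brick_per {M L : ℕ} (hM : 0 < M) (k : ℤ) (c : ℤ × ℤ) :
    q.brick M L (tr M k c) ⊆ q.brick M L c := by
  intro x hx
  rw [q.mem_brick hM] at hx ⊢
  obtain ⟨t, s, h1, h2, h3, h4, rfl⟩ := hx
  simp only [tr] at *
  push_cast at *
  refine ⟨t - k, s, by linarith, by linarith, h3, h4, ?_⟩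
  rw [← q.per_int k (t - k), sub_add_cancel]

theorem brick_inter {M L : ℕ} (hM : 0 < M) (c : ℤ × ℤ) (hc : c ∈ strip L) (d : ℤ × ℤ)
    (hd : d ∈ strip L) (h : bint (q.brick M L) c d) : (c.2 = 0 ∧ d.2 = 0) ∨
    (c.2 = (L : ℤ) ∧ d.2 = (L : ℤ)) ∨ ∃ k, c = tr M k d ∨ hadj c (tr M k d) := by
  obtain ⟨x, hx, hy⟩ := h
  rw [q.mem_brick hM] at hx hy
  obtain ⟨t, s, h1, h2, h3, h4, rfl⟩ := hx
  obtain ⟨t', s', h1', h2', h3', h4', he⟩ := hy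
  obtain ⟨s0, s1⟩ := s_range hc h3 h4
  obtain ⟨s0', s1'⟩ := s_range hd h3' h4'
  obtain ⟨hss, hor⟩ := q.inj _ _ _ _ s0 s1 s0' s1' he.symm
  subst hss
  have hc1 := hc.1
  have hc2 := hc.2
  have hd1 := hd.1
  have hd2 := hd.2
  rcases hor with e | e | ⟨k, hk⟩
  · left
    subst e
    rw [zero_mul] at h3 h3'
    have : c.2 ≤ 0 := by exact_mod_cast h3
    have : d.2 ≤ 0 := by exact_mod_cast h3'
    omega
  · right; left
    subst e
    rw [one_mul] at h4 h4'
    have : (L : ℤ) + 1 ≤ c.2 + 1 := by exact_mod_cast h4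
    have : (L : ℤ) + 1 ≤ d.2 + 1 := by exact_mod_cast h4'
    omega
  · right; right
    refine ⟨k, ?_⟩
    have ht : t = t' + k := by linarith
    subst ht
    have g1 : c.2 ≤ d.2 + 1 := by exact_mod_cast h3.trans h4'
    have g2 : d.2 ≤ c.2 + 1 := by exact_mod_cast h3'.trans h4
    have g3 : 2 * (d.1 + k * M) + d.2 ≤ 2 * c.1 + 2 + c.2 := by
      have : 2 * ((d.1 : ℝ) + k * M) + d.2 ≤ 2 * c.1 + 2 + c.2 := by linarith
      exact_mod_cast this
    have g4 : 2 * c.1 + c.2 ≤ 2 * (d.1 + k * M) + 2 + d.2 := by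
      have : 2 * (c.1 : ℝ) + c.2 ≤ 2 * (d.1 + k * M) + 2 + d.2 := by linarith
      exact_mod_cast this
    have g5 : c = tr M k d ↔ c.1 = d.1 + k * M ∧ c.2 = d.2 := by rw [Prod.ext_iff]; rfl
    rw [g5]
    unfold hadj
    simp only [tr]
    omega

theorem brick_adj {M L : ℕ} (hM : 0 < M) (c d : ℤ × ℤ) (h : hadj c d) :
    bint (q.brick M L) c d := by
  have hM' : (0 : ℝ) < M := by exact_mod_cast hM
  have hL' : (0 : ℝ) < (L : ℝ) + 1 := by positivity
  -- oriented version
  have key : ∀ c d : ℤ × ℤ, (d = (c.1 + 1, c.2) ∨ d = (c.1, c.2 + 1) ∨ d = (c.1 - 1, c.2 + 1)) →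
      bint (q.brick M L) c d := by
    rintro ⟨i, j⟩ d (rfl | rfl | rfl)
    · refine ⟨q.κ ((i + 1 + j / 2) / M, j / (L + 1)), ?_, ?_⟩ <;> rw [q.mem_brick hM] <;>
        refine ⟨_, _, ?_, ?_, ?_, ?_, rfl⟩ <;> simp only [div_mul_cancel₀ _ hM'.ne',
        div_mul_cancel₀ _ hL'.ne'] <;> push_cast <;> linarith
    · refine ⟨q.κ ((i + j / 2 + 1 / 2) / M, (j + 1) / (L + 1)), ?_, ?_⟩ <;> rw [q.mem_brick hM] <;>
        refine ⟨_, _, ?_, ?_, ?_, ?_, rfl⟩ <;> simp only [div_mul_cancel₀ _ hM'.ne',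
        div_mul_cancel₀ _ hL'.ne'] <;> push_cast <;> linarith
    · refine ⟨q.κ ((i + j / 2 + 1 / 2) / M, (j + 1) / (L + 1)), ?_, ?_⟩ <;> rw [q.mem_brick hM] <;>
        refine ⟨_, _, ?_, ?_, ?_, ?_, rfl⟩ <;> simp only [div_mul_cancel₀ _ hM'.ne',
        div_mul_cancel₀ _ hL'.ne'] <;> push_cast <;> linarith
  by_cases h1 : d = (c.1 + 1, c.2) ∨ d = (c.1, c.2 + 1) ∨ d = (c.1 - 1, c.2 + 1)
  · exact key c d h1
  · refine bint_symm _ _ _ (key d c ?_)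
    simp only [Prod.ext_iff] at *
    unfold hadj at h
    omega

theorem brick_cover {M L : ℕ} (hM : 0 < M) (x : X) : ∃ c ∈ strip L, x ∈ q.brick M L c := by
  obtain ⟨t, s, h0, h1, rfl⟩ := q.surj x
  have hL' : (0 : ℝ) < (L : ℝ) + 1 := by positivity
  set j : ℤ := min ⌊s * (L + 1)⌋ L with hj
  have j0 : 0 ≤ j := by
    refine le_min (Int.floor_nonneg.2 (by positivity)) (by positivity)
  have j1 : (j : ℝ) ≤ s * (L + 1) :=
    (Int.cast_le.2 (min_le_left _ _)).trans (Int.floor_le _)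
  have j2 : s * (L + 1) ≤ j + 1 := by
    rcases min_choice ⌊s * ((L : ℝ) + 1)⌋ (L : ℤ) with h | h
    · rw [hj, h]; exact (Int.lt_floor_add_one _).le
    · rw [hj, h]; push_cast; nlinarith
  refine ⟨(⌊t * M - j / 2⌋, j), ⟨j0, min_le_right _ _⟩, (q.mem_brick hM).2
    ⟨t, s, ?_, ?_, j1, j2, rfl⟩⟩
  · have := Int.floor_le (t * M - j / 2 : ℝ); simp only; linarith
  · have := Int.lt_floor_add_one (t * M - j / 2 : ℝ); simp only; linarith

theorem brick_ne {M L : ℕ} (hM : 0 < M) (c : ℤ × ℤ) : (q.brick M L c).Nonempty :=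
  ((q.brick_adj hM c (c.1 + 1, c.2) (by unfold hadj; simp)).mono inter_subset_left)

theorem exists_bricks {r : ℝ} (hr : 0 < r) : ∃ M L : ℕ, 0 < M ∧ 0 < L ∧
    ∀ c ∈ strip L, ∀ x ∈ q.brick M L c, ∀ y ∈ q.brick M L c, dist x y ≤ r := by
  obtain ⟨δ, hδ, h⟩ := q.unif hr
  obtain ⟨n, hn⟩ := exists_nat_gt (1 / δ)
  have hn0 : (0 : ℝ) < n := lt_trans (by positivity) hn
  have hn1 : 0 < n := by exact_mod_cast hn0
  have hnd : 1 < n * δ := by rwa [div_lt_iff₀ hδ] at hn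
  refine ⟨n, n, hn1, hn1, fun c hc x hx y hy => ?_⟩
  rw [q.mem_brick hn1] at hx hy
  obtain ⟨t, s, h1, h2, h3, h4, rfl⟩ := hx
  obtain ⟨t', s', h1', h2', h3', h4', rfl⟩ := hy
  obtain ⟨s0, s1⟩ := s_range hc h3 h4
  obtain ⟨s0', s1'⟩ := s_range hc h3' h4'
  refine h _ _ _ _ s0 s1 s0' s1' ?_ ?_
  · rw [abs_le]; constructor
    · by_contra g; push Not at g; nlinarith
    · by_contra g; push Not at g; nlinarith
  · rw [abs_le]; constructor
    · by_contra g; push Not at g; nlinarith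
    · by_contra g; push Not at g; nlinarith

theorem exists_cells (q : Kap X a b) [CompactSpace X] {lam : ℝ} (hL : LLCw X lam) {Cp : ℝ} (hCp : Pack X Cp) :
    ∃ C1 : ℝ, 1 ≤ C1 ∧ ∀ r : ℝ, 0 < r → Nonempty (Cells X a b (C1 * r) r) := by
  obtain ⟨C1, hC1, hpart⟩ := partition hL.1 (fun a r => (hL.2 a r).1) hCp
  refine ⟨C1, hC1, fun r hr => ?_⟩
  obtain ⟨M, L, hM, hL0, hsm⟩ := q.exists_bricks hr
  have hM0 : (0 : ℤ) < M := by exact_mod_cast hM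
  have hper : ∀ k c, q.brick M L (tr M k c) = q.brick M L c := fun k c =>
    (q.brick_per hM k c).antisymm (by
      have := q.brick_per (L := L) hM (-k) (tr M k c)
      rwa [tr_tr, neg_add_cancel, tr_zero] at this)
  have hclosed : ∀ c, IsClosed (q.brick M L c) := fun c =>
    ((isCompact_Icc.prod isCompact_Icc).image q.cont).isClosed
  let Bs : Type := {c : ℤ × ℤ // c ∈ (Ico (0 : ℤ) M) ×ˢ (Icc (0 : ℤ) L)}
  have hfin : Finite Bs := ((Set.finite_Ico _ _).prod (Set.finite_Icc _ _)).to_subtype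
  have hredstrip : ∀ c ∈ strip L, ((c.1 % M, c.2) : ℤ × ℤ) ∈ (Ico (0 : ℤ) M) ×ˢ (Icc (0 : ℤ) L) :=
    fun c hc => ⟨⟨Int.emod_nonneg _ hM0.ne', Int.emod_lt_of_pos _ hM0⟩, hc.1, hc.2⟩
  have hredeq : ∀ c : ℤ × ℤ, ∃ k, c = tr M k (c.1 % M, c.2) := fun c => ⟨c.1 / M, by
    ext
    · simp only [tr]; rw [mul_comm]; exact (Int.emod_add_mul_ediv c.1 M).symm
    · rfl⟩
  have hbred : ∀ c : ℤ × ℤ, q.brick M L (c.1 % M, c.2) = q.brick M L c := fun c => by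
    obtain ⟨k, hk⟩ := hredeq c
    conv_rhs => rw [hk, hper]
  obtain ⟨π, hp1, hp2, hp3⟩ := hpart r hr Bs (fun c => q.brick M L c.1) (fun c => hclosed _)
    (fun c => q.brick_ne hM _) (by
      rw [eq_univ_iff_forall]
      intro x
      obtain ⟨c, hc, hx⟩ := q.brick_cover (L := L) hM x
      exact mem_iUnion.2 ⟨⟨_, hredstrip c hc⟩, by simp only; rwa [hbred]⟩)
    (fun c => hsm c.1 ⟨c.2.2.1, c.2.2.2⟩)
  classical
  let π' : ℤ × ℤ → X := fun c => if h : ((c.1 % M, c.2) : ℤ × ℤ) ∈ (Ico (0 : ℤ) M) ×ˢ (Icc (0 : ℤ) L)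
    then π ⟨_, h⟩ else a
  have hπ' : ∀ c (hc : c ∈ strip L), π' c = π ⟨_, hredstrip c hc⟩ := fun c hc =>
    dif_pos (hredstrip c hc)
  refine ⟨⟨M, L, hM, hL0, q.brick M L, π', hclosed, fun c _ => q.brick_ne hM c, q.brick_cover hM,
    hper, fun c _ d _ h => q.brick_adj hM c d h, q.brick_inter hM, ?_, ?_, ?_, ?_, ?_, ?_⟩⟩
  · intro c hc
    rw [q.mem_brick hM]
    refine ⟨(c.1 + c.2 / 2) / M, 0, ?_, ?_, ?_, ?_, q.k0 _⟩
    all_goals first | rw [div_mul_cancel₀ _ (by positivity)] | skip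
    all_goals simp [hc]
  · intro c hc
    rw [q.mem_brick hM]
    refine ⟨(c.1 + c.2 / 2) / M, 1, ?_, ?_, ?_, ?_, q.k1 _⟩
    all_goals first | rw [div_mul_cancel₀ _ (by positivity)] | skip
    · linarith
    · simp [hc]
    · simp [hc]
  · intro k c
    have : ((tr M k c).1 % (M : ℤ), (tr M k c).2) = (c.1 % (M : ℤ), c.2) := by
      simp [tr]
    simp only [π', this]
  · intro c hc x hx
    rw [hπ' c hc]
    exact hp1 _ x (by simp only; rwa [hbred])
  · intro c hc d hd hcd
    rw [hπ' c hc, hπ' d hd] at hcd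
    have h1 := hp2 _ _ hcd
    have hS : ∀ z : Bs, π z = π ⟨_, hredstrip c hc⟩ → z.1 ∈ {e | e ∈ strip L ∧ π' e = π' c} := by
      intro z hz
      have hzs : z.1 ∈ strip L := ⟨z.2.2.1, z.2.2.2⟩
      refine ⟨hzs, ?_⟩
      rw [hπ' _ hzs, hπ' c hc, ← hz]
      congr 1
      apply Subtype.ext
      simp only
      rw [Int.emod_eq_of_lt z.2.1.1 z.2.1.2]
    have h2 : Conn (bint (q.brick M L)) {e | e ∈ strip L ∧ π' e = π' c} (c.1 % M, c.2)
        (d.1 % M, d.2) :=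
      h1.map (fun z => z.1) (hS _ h1.left) fun z w hz hw hzw _ =>
        Conn.single (hS _ hz) hzw (hS _ hw)
    refine ((Conn.single (r := bint (q.brick M L)) (S := {e | e ∈ strip L ∧ π' e = π' c})
      ⟨hc, rfl⟩ ?_ h2.left).trans h2).step ?_ ⟨hd, ?_⟩
    · unfold bint; rw [hbred, inter_self]; exact q.brick_ne hM c
    · unfold bint; rw [hbred, inter_self]; exact q.brick_ne hM d
    · rw [hπ' c hc, hπ' d hd, hcd]
  · intro c hc d hd
    rw [hπ' c hc, hπ' d hd]
    exact hp3 _ _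

end Kap
end BK

end

section
open Metric MeasureTheory Set
open scoped ENNReal NNReal Topology

namespace BK

def Model.mono {X : Type} [MetricSpace X] {a b : X} {D r R D' R' : ℝ} (M : Model X a b D r R)
    (hD : D ≤ D') (hR : R ≤ R') : Model X a b D' r R' :=
  { V := M.V, fin := M.fin, S := M.S, P := M.P, A := M.A, B := M.B, ctr := M.ctr,
    Pclosed := M.Pclosed, Aclosed := M.Aclosed, Bclosed := M.Bclosed, Pne := M.Pne,
    cover := M.cover, PP := M.PP, PA := M.PA, PB := M.PB, AB := M.AB,
    near := fun v x hx => (M.near v x hx).trans hD, sep := M.sep, aA := M.aA, bB := M.bB,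
    Asub := M.Asub.trans (ball_subset_ball hR), Bsub := M.Bsub.trans (ball_subset_ball hR) }

theorem exists_models {X : Type} [MetricSpace X] [CompactSpace X] (φ : X ≃ₜ S2) {lam Cp : ℝ}
    (hL : LLCw X lam) (hCp : Pack X Cp) :
    ∃ a b o : X, a ≠ b ∧ o ≠ a ∧ o ≠ b ∧ ∃ C0 : ℝ, 1 ≤ C0 ∧ ∃ r0 > 0, ∀ r, 0 < r → r < r0 →
      Nonempty (Model X a b (C0 * r) r (C0 * r)) := by
  obtain ⟨a, b, ⟨q⟩⟩ := exists_kap φ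
  obtain ⟨C1, hC1, hc⟩ := q.exists_cells hL hCp
  have hab : a ≠ b := by
    intro h
    have := q.inj 0 0 0 1 le_rfl zero_le_one zero_le_one le_rfl (by rw [q.k0, q.k1, h])
    exact zero_ne_one this.1
  have hoa : q.κ (0, 1 / 2) ≠ a := by
    intro h
    have := q.inj 0 (1 / 2) 0 0 (by norm_num) (by norm_num) le_rfl zero_le_one (by rw [q.k0, h])
    norm_num at this
  have hob : q.κ (0, 1 / 2) ≠ b := by
    intro h
    have := q.inj 0 (1 / 2) 0 1 (by norm_num) (by norm_num) zero_le_one le_rfl (by rw [q.k1, h])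
    norm_num at this
  refine ⟨a, b, q.κ (0, 1 / 2), hab, hoa, hob, rad2 lam C1, ?_, ?_⟩
  · obtain ⟨h0, h1, h2⟩ := rad_facts hL.1 (show 0 < C1 by linarith)
    linarith
  have hpos : 0 < rad2 lam C1 := by
    obtain ⟨h0, h1, h2⟩ := rad_facts hL.1 (show 0 < C1 by linarith)
    linarith
  set m := min (dist a b) (min (dist (q.κ (0, 1 / 2)) a) (dist (q.κ (0, 1 / 2)) b)) with hm
  have hm0 : 0 < m := lt_min (dist_pos.2 hab) (lt_min (dist_pos.2 hoa) (dist_pos.2 hob))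
  refine ⟨m / (3 * rad2 lam C1), by positivity, fun r hr hr0 => ?_⟩
  rw [lt_div_iff₀ (by positivity)] at hr0
  have e : rad2 lam (C1 * r) = rad2 lam C1 * r := by
    simp only [rad2, rad1, rad0]; ring
  have m1 : m ≤ dist a b := min_le_left _ _
  have m2 : m ≤ dist (q.κ (0, 1 / 2)) a := (min_le_right _ _).trans (min_le_left _ _)
  have m3 : m ≤ dist (q.κ (0, 1 / 2)) b := (min_le_right _ _).trans (min_le_right _ _)
  have hD : 0 < C1 * r := by positivity
  have hp2 : 0 < rad2 lam C1 * r := by positivity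
  obtain ⟨K⟩ := hc r hr
  have H : Cells.Hyp a b (C1 * r) lam := ⟨hL, hD, by rw [e]; nlinarith⟩
  obtain ⟨Q⟩ := K.exists_core H (o := q.κ (0, 1 / 2)) (by rw [e]; nlinarith) (by rw [e]; nlinarith)
  obtain ⟨M⟩ := Q.exists_model H
  obtain ⟨h0, h1, h2⟩ := rad_facts hL.1 hD
  exact ⟨M.mono (by rw [← e]; linarith) (by rw [e])⟩

namespace Model
variable {X : Type} [MetricSpace X] {a b : X} {C0 r : ℝ}

theorem conn_V (M : Model X a b (C0 * r) r (C0 * r)) {A : Set M.V} {e f : M.V × ℤ}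
    (h : Conn M.S.adj {z | z.1 ∈ A} e f) : Conn (bint M.P) A e.1 f.1 := by
  refine h.map Prod.fst h.left fun x y hx hy hxy _ => Conn.single hx ?_ hy
  refine (M.PP _ _).2 (Or.inr ⟨y.2 - x.2, ?_⟩)
  have := M.S.shift (-x.2) x y hxy
  simpa [sh, sub_eq_add_neg] using this

theorem chain_sum (M : Model X a b (C0 * r) r (C0 * r)) {F : X → ℝ} {w : M.V → ℝ}
    (hw : ∀ v, 0 ≤ w v) (hF : ∀ v, ∀ y ∈ M.P v, ∀ z ∈ M.P v, F y - F z ≤ w v)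
    {A : Finset M.V} {v v' : M.V} (h : Conn (bint M.P) A v v') {y z : X} (hz : z ∈ M.P v)
    (hy : y ∈ M.P v') : F y - F z ≤ ∑ u ∈ A, w u := by
  classical
  obtain ⟨n, g, h0, hn, hS, hr, hinj⟩ := h.exists_simple_walk
  have key : ∀ k ≤ n, ∀ y ∈ M.P (g k), F y - F z ≤ ∑ i ∈ Finset.range (k + 1), w (g i) := by
    intro k
    induction k with
    | zero => intro _ y hy; simpa using hF _ y hy z (by rwa [h0])
    | succ k ih =>
      intro hk y hy
      obtain ⟨p, hp1, hp2⟩ := hr k (by omega)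
      have := ih (by omega) p hp1
      rw [Finset.sum_range_succ]
      linarith [hF _ y hy p hp2]
  refine (key n le_rfl y (by rwa [hn])).trans ?_
  rw [← Finset.sum_image (s := Finset.range (n + 1)) (g := g) (f := w)]
  · refine Finset.sum_le_sum_of_subset_of_nonneg ?_ fun i _ _ => hw i
    intro u hu
    obtain ⟨k, hk, rfl⟩ := Finset.mem_image.1 hu
    rw [Finset.mem_range] at hk
    exact hS k (by omega)
  · intro i hi j hj hij
    simp only [Finset.coe_range, mem_Iio] at hi hj
    rcases lt_trichotomy i j with h | h | h
    · exact absurd hij (hinj i j h (by omega))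
    · exact h
    · exact absurd hij.symm (hinj j i h (by omega))

theorem card_le (M : Model X a b (C0 * r) r (C0 * r)) [Fintype M.V] {Cp : ℝ} (hCp : Pack X Cp)
    (hr : 0 < r) {x : X} {s : ℝ} (hs : r ≤ s) (G : Finset M.V)
    (hG : ∀ v ∈ G, dist (M.ctr v) x ≤ s) : (G.card : ℝ) ≤ Cp * (s / r) ^ 2 := by
  classical
  have hinj : Function.Injective M.ctr := by
    intro v w h
    by_contra hne
    have := M.sep v w hne
    rw [h, dist_self] at this
    linarith
  rw [← Finset.card_image_of_injective G hinj]
  refine hCp.2 x r s hr hs _ ?_ ?_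
  · intro y hy
    obtain ⟨v, hv, rfl⟩ := Finset.mem_image.1 hy
    exact hG v hv
  · intro y hy z hz hyz
    obtain ⟨v, hv, rfl⟩ := Finset.mem_image.1 hy
    obtain ⟨w, hw, rfl⟩ := Finset.mem_image.1 hz
    exact M.sep v w fun h => hyz (by rw [h])

theorem weights (M : Model X a b (C0 * r) r (C0 * r)) [Fintype M.V] {Cp : ℝ} (hCp : Pack X Cp)
    (hC0 : 1 ≤ C0) (hr : 0 < r) (x : X) {ρ1 : ℝ} (hρ : 4 * (C0 * r) ≤ ρ1) {K : ℕ} (hK : 1 ≤ K) :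
    ∃ w : M.V → ℝ, (∀ v, 0 ≤ w v) ∧ ∑ v, w v ^ 2 ≤ 768 * Cp * C0 ^ 2 / K ∧
      (∀ (A : Finset M.V) (v v' : M.V), Conn (bint M.P) A v v' →
        (∃ y ∈ M.P v, dist y x ≤ ρ1) → (∃ y ∈ M.P v', 2 ^ K * ρ1 ≤ dist y x) →
        1 ≤ ∑ u ∈ A, w u) ∧
      ∀ v, w v ≠ 0 → ∀ y ∈ M.P v, dist y x ≤ 2 ^ (K + 2) * ρ1 := by
  classical
  obtain ⟨D, hD⟩ : ∃ D, D = C0 * r := ⟨_, rfl⟩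
  rw [← hD] at hρ
  have hD0 : r ≤ D := by rw [hD]; nlinarith
  have hDp : 0 < D := by linarith
  have hρ0 : 0 < ρ1 := by linarith
  have hl2 : (1 / 2 : ℝ) ≤ Real.log 2 := by linarith [Real.log_two_gt_d9]
  have hK' : (1 : ℝ) ≤ K := by exact_mod_cast hK
  have hKl : 0 < K * Real.log 2 := by positivity
  have h2K : (1 : ℝ) ≤ 2 ^ K := one_le_pow₀ (by norm_num)
  set d : M.V → ℝ := fun v => dist (M.ctr v) x with hd
  set w : M.V → ℝ := fun v => if ρ1 / 2 ≤ d v ∧ d v ≤ 2 ^ (K + 1) * ρ1 then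
    4 * D / (K * Real.log 2 * d v) else 0 with hw
  have hw0 : ∀ v, 0 ≤ w v := by
    intro v; simp only [hw]; split_ifs with h
    · have : 0 < d v := by linarith [h.1]
      positivity
    · exact le_rfl
  have hsupp : ∀ v, w v ≠ 0 → ρ1 / 2 ≤ d v ∧ d v ≤ 2 ^ (K + 1) * ρ1 := by
    intro v hv; by_contra h; exact hv (by simp only [hw, if_neg h])
  have hnear : ∀ v, ∀ y ∈ M.P v, |dist y x - d v| ≤ D := by
    intro v y hy
    have := (M.near v y hy).trans hD.ge
    have h2 := abs_dist_sub_le y (M.ctr v) x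
    exact h2.trans this
  refine ⟨w, hw0, ?_, ?_, ?_⟩
  · -- sum of squares
    set c : ℝ := Cp * (8 * C0 / (K * Real.log 2)) ^ 2 with hc
    set G : ℕ → Finset M.V := fun j => Finset.univ.filter fun v =>
      2 ^ j * ρ1 / 2 ≤ d v ∧ d v ≤ 2 ^ j * ρ1 with hG
    have h1 : ∀ v, w v ^ 2 ≤ ∑ j ∈ Finset.range (K + 2), if v ∈ G j then
        (8 * D / (K * Real.log 2 * (2 ^ j * ρ1))) ^ 2 else 0 := by
      intro v
      have hnn : ∀ j ∈ Finset.range (K + 2), (0 : ℝ) ≤ if v ∈ G j then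
        (8 * D / (K * Real.log 2 * (2 ^ j * ρ1))) ^ 2 else 0 := by
        intro j _; split_ifs <;> positivity
      by_cases hv : w v = 0
      · rw [hv]; simpa using Finset.sum_nonneg hnn
      obtain ⟨g1, g2⟩ := hsupp v hv
      have hex : ∃ j, d v ≤ 2 ^ j * ρ1 := ⟨_, g2⟩
      set j := Nat.find hex with hj
      have hj1 : d v ≤ 2 ^ j * ρ1 := Nat.find_spec hex
      have hjK : j ≤ K + 1 := Nat.find_min' hex g2
      have hj2 : 2 ^ j * ρ1 / 2 ≤ d v := by
        rcases Nat.eq_zero_or_pos j with h | h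
        · rw [h]; simpa using g1
        · have := Nat.find_min hex (m := j - 1) (by omega)
          push Not at this
          have e : (2 : ℝ) ^ j = 2 ^ (j - 1) * 2 := by
            rw [← pow_succ]; congr 1; omega
          rw [e]; linarith
      have hvj : v ∈ G j := by simp only [hG, Finset.mem_filter, Finset.mem_univ, true_and]; exact ⟨hj2, hj1⟩
      refine le_trans ?_ (Finset.single_le_sum hnn (Finset.mem_range.2 (show j < K + 2 by omega)))
      rw [if_pos hvj]
      refine pow_le_pow_left₀ (hw0 v) ?_ 2
      simp only [hw, if_pos (And.intro g1 g2)]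
      have hdv : 0 < d v := by linarith
      have h2j : (0 : ℝ) < 2 ^ j * ρ1 := by positivity
      rw [div_le_div_iff₀ (by positivity) (by positivity)]
      have : 2 ^ j * ρ1 ≤ 2 * d v := by linarith
      have h4 : 0 ≤ 4 * D * (K * Real.log 2) := by positivity
      nlinarith [mul_le_mul_of_nonneg_left this h4]
    have h2 : ∀ j, ((G j).card : ℝ) * (8 * D / (K * Real.log 2 * (2 ^ j * ρ1))) ^ 2 ≤ c := by
      intro j
      have h2j : (1 : ℝ) ≤ 2 ^ j := one_le_pow₀ (by norm_num)
      have := M.card_le hCp hr (x := x) (s := 2 ^ j * ρ1) (by nlinarith) (G j) (by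
        intro v hv
        simp only [hG, Finset.mem_filter, Finset.mem_univ, true_and] at hv
        exact hv.2)
      refine (mul_le_mul_of_nonneg_right this (by positivity)).trans (le_of_eq ?_)
      rw [hc, hD]
      field_simp
    calc ∑ v, w v ^ 2 ≤ ∑ v, ∑ j ∈ Finset.range (K + 2), _ := Finset.sum_le_sum fun v _ => h1 v
      _ = ∑ j ∈ Finset.range (K + 2), ((G j).card : ℝ) * (8 * D / (K * Real.log 2 * (2 ^ j * ρ1))) ^ 2 := by
          rw [Finset.sum_comm]
          refine Finset.sum_congr rfl fun j _ => ?_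
          rw [← Finset.sum_filter, Finset.sum_const, nsmul_eq_mul]
          congr 3
          ext v; simp
      _ ≤ ∑ j ∈ Finset.range (K + 2), c := Finset.sum_le_sum fun j _ => h2 j
      _ = (K + 2) * c := by simp
      _ ≤ (3 * K) * (Cp * (8 * C0 / (K * (1 / 2))) ^ 2) := by
          have hCp1 := hCp.1
          have : c ≤ Cp * (8 * C0 / (K * (1 / 2))) ^ 2 := by
            rw [hc]; gcongr
          have hc0 : 0 ≤ c := by rw [hc]; positivity
          refine mul_le_mul (by linarith) this hc0 (by positivity)
      _ = 768 * Cp * C0 ^ 2 / K := by field_simp; ring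
  · rintro A v v' hconn ⟨y, hy, hyρ⟩ ⟨z, hz, hzρ⟩
    set cl : X → ℝ := fun y => min (max (dist y x) ρ1) (2 ^ K * ρ1) with hcl
    set F : X → ℝ := fun y => Real.log (cl y) / (K * Real.log 2) with hF
    have hKρ : ρ1 ≤ 2 ^ K * ρ1 := by nlinarith
    have hcl0 : ∀ y, ρ1 ≤ cl y := fun y => le_min (le_max_right _ _) hKρ
    have key : ∀ v, ∀ y ∈ M.P v, ∀ z ∈ M.P v, F y - F z ≤ w v := by
      intro v y hy z hz
      have ny := abs_le.1 (hnear v y hy)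
      have nz := abs_le.1 (hnear v z hz)
      by_cases hv : ρ1 / 2 ≤ d v ∧ d v ≤ 2 ^ (K + 1) * ρ1
      · simp only [hw, if_pos hv, hF]
        obtain ⟨g1, g2⟩ := hv
        have hdv : 0 < d v := by linarith
        have pz : 0 < cl z := hρ0.trans_le (hcl0 z)
        have py : 0 < cl y := hρ0.trans_le (hcl0 y)
        have c1 : cl y - cl z ≤ 2 * D := by
          have a1 : cl y ≤ cl z + 2 * D := by
            simp only [hcl]
            rw [← min_add_add_right]
            refine min_le_min ?_ (by linarith)
            rw [← max_add_add_right]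
            exact max_le_max (by linarith) (by linarith)
          linarith
        have c2 : d v / 2 ≤ cl z := by
          refine le_min (le_trans ?_ (le_max_left _ _)) ?_
          · linarith
          · rw [pow_succ] at g2; linarith
        have c3 : Real.log (cl y) - Real.log (cl z) ≤ 4 * D / d v := by
          rw [← Real.log_div py.ne' pz.ne']
          refine (Real.log_le_sub_one_of_pos (by positivity)).trans ?_
          rw [div_sub_one pz.ne', div_le_div_iff₀ pz hdv]
          nlinarith
        rw [← sub_div, div_le_div_iff₀ hKl (by positivity)]
        rw [le_div_iff₀ hdv] at c3
        nlinarith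
      · have : cl y = cl z := by
          simp only [hcl]
          rcases not_and_or.1 hv with h | h
          · push Not at h
            rw [max_eq_right (by linarith), max_eq_right (by linarith)]
          · push Not at h
            rw [pow_succ] at h
            have : 2 ^ K * ρ1 ≤ dist y x := by nlinarith
            have : 2 ^ K * ρ1 ≤ dist z x := by nlinarith
            rw [min_eq_right (le_max_of_le_left ‹_›), min_eq_right (le_max_of_le_left ‹_›)]
        simp only [hF, this, sub_self]; exact hw0 v
    have := M.chain_sum hw0 key hconn hy hz
    have e1 : F y = Real.log ρ1 / (K * Real.log 2) := by
      simp only [hF, hcl, max_eq_right hyρ, min_eq_left hKρ]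
    have e2 : F z = (K * Real.log 2 + Real.log ρ1) / (K * Real.log 2) := by
      simp only [hF, hcl]
      rw [min_eq_right (le_max_of_le_left hzρ), Real.log_mul (by positivity) hρ0.ne', Real.log_pow]
    rw [e1, e2, ← sub_div, add_sub_cancel_right, div_self hKl.ne'] at this
    exact this
  · intro v hv y hy
    obtain ⟨g1, g2⟩ := hsupp v hv
    have := abs_le.1 (hnear v y hy)
    rw [pow_succ] at g2 ⊢
    rw [pow_succ]
    nlinarith

end Model
end BK

end

section
open Metric MeasureTheory Set
open scoped ENNReal NNReal Topology

namespace BK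
namespace Model
variable {X : Type} [MetricSpace X] {a b : X} {C0 r : ℝ} (M : Model X a b (C0 * r) r (C0 * r))

/-- all the pieces, including the two caps -/
def nd : M.V ⊕ Bool → Set X := Sum.elim M.P fun i => if i then M.B else M.A

theorem nd_closed (i : M.V ⊕ Bool) : IsClosed (M.nd i) := by
  rcases i with v | i
  · exact M.Pclosed v
  · cases i
    · simpa [nd] using M.Aclosed
    · simpa [nd] using M.Bclosed

theorem nd_cover (x : X) : ∃ i, x ∈ M.nd i := by
  rcases M.cover x with h | h | ⟨v, h⟩
  · exact ⟨Sum.inr false, by simpa [nd] using h⟩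
  · exact ⟨Sum.inr true, by simpa [nd] using h⟩
  · exact ⟨Sum.inl v, h⟩

theorem nd_nerve {E : Set X} (hE : IsPreconnected E) {x y : X} (hx : x ∈ E) (hy : y ∈ E)
    {i j : M.V ⊕ Bool} (hi : x ∈ M.nd i) (hj : y ∈ M.nd j) :
    Conn (bint M.nd) {k | (M.nd k ∩ E).Nonempty} i j := by
  have := M.fin
  exact nerve M.nd_closed hE (fun x _ => mem_iUnion.2 (M.nd_cover x)) hx hy hi hj

variable [Fintype M.V] (T : M.S.Tiling)

/-- incidence between points of the space and points of the cylinder -/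
def inc (x : X) (p : ℝ × ℝ) : Prop :=
  (∃ z : M.V × ℤ, ∃ s : ℝ, x ∈ M.P z.1 ∧ (p.1, s) ∈ T.D z ∧ p.2 = min s T.h) ∨
    (x ∈ M.A ∧ p.2 = 0) ∨ (x ∈ M.B ∧ p.2 = T.h)

theorem inc_exists (x : X) : ∃ p, M.inc T x p := by
  rcases M.cover x with h | h | ⟨v, h⟩
  · exact ⟨(0, 0), Or.inr (Or.inl ⟨h, rfl⟩)⟩
  · exact ⟨(0, T.h), Or.inr (Or.inr ⟨h, rfl⟩)⟩
  · refine ⟨(T.Ψ (v, 0), min (T.u v) T.h), Or.inl ⟨(v, 0), T.u v, h, ?_, rfl⟩⟩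
    rw [T.mem_D]
    have := T.ρ_nonneg v
    refine ⟨⟨le_rfl, ?_⟩, ?_, le_rfl⟩ <;> simp only <;> linarith

theorem inc_a : M.inc T a (0, 0) := Or.inr (Or.inl ⟨M.aA, rfl⟩)

theorem inc_b : M.inc T b (0, T.h) := Or.inr (Or.inr ⟨M.bB, rfl⟩)

theorem exists_inc {t s : ℝ} (h0 : 0 < s) (h1 : s < T.h) : ∃ x, M.inc T x (t, s) := by
  obtain ⟨z, hz⟩ := T.cover (t := t) h0 h1
  obtain ⟨x, hx⟩ := M.Pne z.1
  exact ⟨x, Or.inl ⟨z, s, hx, hz, (min_eq_left h1.le).symm⟩⟩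

variable {M T} in
theorem inc.bd {x : X} {p : ℝ × ℝ} (h : M.inc T x p) : 0 ≤ p.2 ∧ p.2 ≤ T.h := by
  have hh := T.h_pos
  rcases h with ⟨z, s, hx, hz, hs⟩ | ⟨hx, hs⟩ | ⟨hx, hs⟩
  · rw [hs]
    rw [T.mem_D] at hz
    have := T.u_ge z.1
    exact ⟨le_min (by have := hz.2.1; simp only at this; linarith) hh.le, min_le_right _ _⟩
  · rw [hs]; exact ⟨le_rfl, hh.le⟩
  · rw [hs]; exact ⟨hh.le, le_rfl⟩

variable {M T} in
theorem inc.shift {x : X} {p : ℝ × ℝ} (h : M.inc T x p) (k : ℤ) : M.inc T x (p.1 + k, p.2) := by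
  rcases h with ⟨z, s, hx, hz, hs⟩ | ⟨hx, hs⟩ | ⟨hx, hs⟩
  · exact Or.inl ⟨sh k z, s, hx, (T.mem_D_sh k (p := (p.1, s))).2 hz, hs⟩
  · exact Or.inr (Or.inl ⟨hx, hs⟩)
  · exact Or.inr (Or.inr ⟨hx, hs⟩)

variable {M T} in
theorem inc.inner {x : X} {p : ℝ × ℝ} (h : M.inc T x p) (h0 : 0 < p.2) (h1 : p.2 < T.h) :
    ∃ z, x ∈ M.P z.1 ∧ p ∈ T.D z := by
  rcases h with ⟨z, s, hx, hz, hs⟩ | ⟨hx, hs⟩ | ⟨hx, hs⟩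
  · refine ⟨z, hx, ?_⟩
    have : s = p.2 := by
      rcases min_cases s T.h with ⟨e, _⟩ | ⟨e, _⟩ <;> linarith
    rw [← Prod.mk.eta (p := p), ← this]; exact hz
  · linarith
  · linarith

/-- vertices whose patch meets `E` -/
def EV (E : Set X) : Set (M.V × ℤ) := {z | (M.P z.1 ∩ E).Nonempty}

theorem level {E : Set X} (hE : IsPreconnected E) {x y : X} (hx : x ∈ E) (hy : y ∈ E)
    {p q : ℝ × ℝ} (hp : M.inc T x p) (hq : M.inc T y q) {s : ℝ} (h1 : p.2 < s) (h2 : s < q.2) :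
    ∃ z ∈ M.EV E, T.u z.1 - T.ρ z.1 ≤ s ∧ s ≤ T.u z.1 := by
  have bp := hp.bd
  have bq := hq.bd
  have hu0 : ∀ v, 0 ≤ T.u v := fun v => (T.ρ_nonneg v).trans (T.u_ge v)
  have hle : ∀ v, T.u v ≤ ∑ v, T.u v := fun v => Finset.single_le_sum (fun v _ => hu0 v) (Finset.mem_univ v)
  set N := T.h + ∑ v, T.u v with hN
  have hsum : 0 ≤ ∑ v, T.u v := Finset.sum_nonneg fun v _ => hu0 v
  set l : M.V ⊕ Bool → ℝ := Sum.elim (fun v => T.u v - T.ρ v) (fun i => if i then T.h else 0) with hl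
  set R : M.V ⊕ Bool → ℝ := Sum.elim T.u (fun i => if i then N else 0) with hR
  have hstart : ∃ i, x ∈ M.nd i ∧ l i ≤ s := by
    rcases hp with ⟨z, s', hx, hz, hs⟩ | ⟨hx, hs⟩ | ⟨hx, hs⟩
    · refine ⟨Sum.inl z.1, hx, ?_⟩
      rw [T.mem_D] at hz
      have : T.u z.1 - T.ρ z.1 ≤ s' := hz.2.1
      simp only [hl, Sum.elim_inl]
      rcases min_cases s' T.h with ⟨e, _⟩ | ⟨e, _⟩ <;> linarith
    · exact ⟨Sum.inr false, by simpa [nd] using hx, by simp [hl]; linarith⟩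
    · linarith
  have hend : ∃ i, y ∈ M.nd i ∧ s ≤ R i := by
    rcases hq with ⟨z, s', hx, hz, hs⟩ | ⟨hx, hs⟩ | ⟨hx, hs⟩
    · refine ⟨Sum.inl z.1, hx, ?_⟩
      rw [T.mem_D] at hz
      have : s' ≤ T.u z.1 := hz.2.2
      simp only [hR, Sum.elim_inl]
      linarith [min_le_left s' T.h]
    · linarith
    · exact ⟨Sum.inr true, by simpa [nd] using hx, by simp [hR]; linarith⟩
  obtain ⟨i, hi, hli⟩ := hstart
  obtain ⟨j, hj, hRj⟩ := hend
  obtain ⟨k, hk, k1, k2⟩ := conn_cover (l := l) (R := R) (τ := s) (M.nd_nerve hE hx hy hi hj) (by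
    rintro (v | i) - (w | j) - hij
    · rcases (M.PP v w).1 hij with e | ⟨k, hk⟩
      · subst e; simp only [hl, hR, Sum.elim_inl]; linarith [T.ρ_nonneg v]
      · have := T.u_adj _ _ hk
        simp only [hl, hR, Sum.elim_inl] at *; linarith
    · cases j
      · simp [hl, hR]; exact hu0 v
      · have : v ∈ M.S.bot := (M.PB v).1 (by simpa [bint, nd] using hij)
        simpa [hl, hR] using T.u_bot v this
    · cases i
      · have : w ∈ M.S.top := (M.PA w).1 (by rw [inter_comm]; simpa [bint, nd] using hij)
        simp [hl, hR, T.u_top w this]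
      · simp only [hl, hR, Sum.elim_inl, Sum.elim_inr, if_true]
        linarith [hle w, T.ρ_nonneg w, T.h_pos]
    · cases i <;> cases j
      · simp [hl, hR]
      · exfalso
        have : (M.A ∩ M.B).Nonempty := by simpa [bint, nd] using hij
        exact (Set.not_disjoint_iff_nonempty_inter.2 this) M.AB
      · exfalso
        have : (M.B ∩ M.A).Nonempty := by simpa [bint, nd] using hij
        exact (Set.not_disjoint_iff_nonempty_inter.2 this) M.AB.symm
      · simp only [hl, hR, Sum.elim_inr, if_true]; linarith) hli hRj
  rcases k with v | i
  · exact ⟨(v, 0), hk, k1, k2⟩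
  · cases i
    · simp [hR] at k2; linarith
    · simp [hl] at k1; linarith

theorem D_subset_ball {z : M.V × ℤ} {c : ℝ × ℝ} {δ : ℝ} {p : ℝ × ℝ} (hp : p ∈ T.D z)
    (hpc : dist p c < δ) (hno : z ∉ T.ringSet c δ) : ∀ q ∈ T.D z, dist q c < δ := by
  intro q hq
  by_contra hcon
  push Not at hcon
  have hconv : IsPreconnected (T.D z) :=
    ((convex_Icc _ _).prod (convex_Icc _ _)).isPreconnected
  have := hconv.intermediate_value hp hq (f := fun q => dist q c) (by fun_prop) ⟨hpc.le, hcon⟩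
  obtain ⟨p', hp', e⟩ := this
  exact hno ⟨p', hp', e⟩

theorem D_touch {x y : M.V × ℤ} (h : M.S.adj x y) : (T.D x ∩ T.D y).Nonempty := by
  have u1 := T.u_adj _ _ h
  have u2 := T.u_adj _ _ (M.S.symm _ _ h)
  have p1 := T.Ψ_adj _ _ h
  have p2 := T.Ψ_adj _ _ (M.S.symm _ _ h)
  have r1 := T.ρ_nonneg x.1
  have r2 := T.ρ_nonneg y.1
  refine ⟨(max (T.Ψ x) (T.Ψ y), min (T.u x.1) (T.u y.1)), ?_, ?_⟩
  · refine ⟨⟨le_max_left _ _, max_le ?_ ?_⟩, le_min ?_ ?_, min_le_left _ _⟩ <;> linarith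
  · refine ⟨⟨le_max_right _ _, max_le ?_ ?_⟩, le_min ?_ ?_, min_le_right _ _⟩ <;> linarith

theorem ring_hit {E : Set X} (hE : IsPreconnected E) {x y : X} (hx : x ∈ E) (hy : y ∈ E)
    {p q c : ℝ × ℝ} {δ : ℝ} (hp : M.inc T x p) (hq : M.inc T y q) (hpc : dist p c < δ)
    (h0 : δ ≤ c.2) (h1 : c.2 + δ ≤ T.h) (hqc : ∀ k : ℤ, δ ≤ dist (q.1 + k, q.2) c) :
    ∃ z ∈ M.EV E, z ∈ T.ringSet c δ := by
  by_contra hcon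
  push Not at hcon
  have hin : ∀ p : ℝ × ℝ, dist p c < δ → 0 < p.2 ∧ p.2 < T.h := by
    intro p hp
    have : |p.2 - c.2| < δ := lt_of_le_of_lt (by rw [← Real.dist_eq]; exact le_max_right _ _) hp
    rw [abs_lt] at this
    exact ⟨by linarith, by linarith⟩
  obtain ⟨z0, hz0, hpD⟩ := hp.inner (hin p hpc).1 (hin p hpc).2
  have inside : ∀ z, z ∈ M.EV E → (∃ p ∈ T.D z, dist p c < δ) → ∀ q ∈ T.D z, dist q c < δ := by
    rintro z hz ⟨p, h1, h2⟩
    exact M.D_subset_ball T h1 h2 (hcon z hz)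
  obtain ⟨j, hj⟩ := M.nd_cover y
  -- choose the node of y
  have hyn : ∃ j, y ∈ M.nd j ∧ ∀ z : M.V × ℤ, j = Sum.inl z.1 →
      (∀ q ∈ T.D z, dist q c < δ) → False := by
    rcases hq with ⟨z, s', hyz, hz, hs⟩ | ⟨hx, hs⟩ | ⟨hx, hs⟩
    · refine ⟨Sum.inl z.1, hyz, ?_⟩
      intro z' hz' hall
      have e : z.1 = z'.1 := Sum.inl.inj hz'
      have e2 : z' = sh (z'.2 - z.2) z := by ext <;> simp [sh, e]
      have h3 := (T.mem_D_sh (z'.2 - z.2) (p := (q.1, s'))).2 hz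
      rw [← e2] at h3
      have h4 := hall _ h3
      have h5 := (hin _ h4).2
      have h6 := hqc (z'.2 - z.2)
      simp only at h4 h5 h6
      rw [hs, min_eq_left h5.le] at h6
      linarith
    · exact ⟨Sum.inr false, by simpa [nd] using hx, fun z h => by simp at h⟩
    · exact ⟨Sum.inr true, by simpa [nd] using hx, fun z h => by simp at h⟩
  obtain ⟨j, hj, hjf⟩ := hyn
  have hconn := M.nd_nerve hE hx hy (i := Sum.inl z0.1) hz0 hj
  have : ∃ z : M.V × ℤ, j = Sum.inl z.1 ∧ ∀ q ∈ T.D z, dist q c < δ := by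
    refine hconn.rec' (P := fun j => ∃ z : M.V × ℤ, j = Sum.inl z.1 ∧ ∀ q ∈ T.D z, dist q c < δ) ?_ ?_
    · exact ⟨z0, rfl, inside z0 ⟨x, hz0, hx⟩ ⟨p, hpD, hpc⟩⟩
    · rintro i k hi hk hik ⟨z, rfl, hz⟩
      have r1 := T.ρ_nonneg z.1
      rcases k with w | k
      · rcases (M.PP z.1 w).1 hik with e | ⟨k, hk'⟩
        · exact ⟨z, by rw [e], hz⟩
        · have hadj := M.S.shift z.2 _ _ hk'
          have e1 : sh z.2 ((z.1, 0) : M.V × ℤ) = z := by ext <;> simp [sh]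
          rw [e1] at hadj
          obtain ⟨p', hp1, hp2⟩ := M.D_touch T hadj
          exact ⟨sh z.2 (w, k), rfl, inside _ hk ⟨p', hp2, hz p' hp1⟩⟩
      · exfalso
        cases k
        · have : z.1 ∈ M.S.top := (M.PA z.1).1 (by simpa [bint, nd] using hik)
          have hu := T.u_top _ this
          have := hin _ (hz (T.Ψ z, T.u z.1 - T.ρ z.1) ⟨⟨le_rfl, by simp only; linarith⟩,
            le_rfl, by simp only; linarith⟩)
          simp only at this; linarith
        · have : z.1 ∈ M.S.bot := (M.PB z.1).1 (by simpa [bint, nd] using hik)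
          have hu := T.u_bot _ this
          have := hin _ (hz (T.Ψ z, T.u z.1) ⟨⟨le_rfl, by simp only; linarith⟩,
            by simp only; linarith, le_rfl⟩)
          simp only at this; linarith
  obtain ⟨z, hz, hall⟩ := this
  exact hjf z hz hall

theorem adm_of {E F : Set X} {w : M.V → ℝ} {x : X} {ρ1 ρ2 : ℝ}
    (hw : ∀ (A : Finset M.V) (v v' : M.V), Conn (bint M.P) A v v' →
        (∃ y ∈ M.P v, dist y x ≤ ρ1) → (∃ y ∈ M.P v', ρ2 ≤ dist y x) → 1 ≤ ∑ u ∈ A, w u)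
    (hE : ∀ y ∈ E, dist y x ≤ ρ1) (hF : ∀ y ∈ F, ρ2 ≤ dist y x) :
    Strip.Tiling.Adm M.S (M.EV E) (M.EV F) w := by
  rintro e ⟨y, hy, hyE⟩ f ⟨z, hz, hzF⟩ A hA
  exact hw A _ _ (M.conn_V hA) ⟨y, hy, hE y hyE⟩ ⟨z, hz, hF z hzF⟩

/-- `s1 < s2` are separated by the values of `p` and `q`. -/
def Btw (s1 s2 : ℝ) (p q : ℝ × ℝ) : Prop := (p.2 ≤ s1 ∧ s2 ≤ q.2) ∨ (q.2 ≤ s1 ∧ s2 ≤ p.2)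

theorem level' {E : Set X} (hE : IsPreconnected E) {x y : X} (hx : x ∈ E) (hy : y ∈ E)
    {p q : ℝ × ℝ} (hp : M.inc T x p) (hq : M.inc T y q) {s1 s2 : ℝ} (hb : Btw s1 s2 p q) :
    ∀ s ∈ Ioo s1 s2, ∃ z ∈ M.EV E, T.u z.1 - T.ρ z.1 ≤ s ∧ s ≤ T.u z.1 := by
  rintro s ⟨h1, h2⟩
  rcases hb with ⟨g1, g2⟩ | ⟨g1, g2⟩
  · exact M.level T hE hx hy hp hq (by linarith) (by linarith)
  · exact M.level T hE hy hx hq hp (by linarith) (by linarith)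

theorem Btw.bd {s1 s2 : ℝ} {p q : ℝ × ℝ} (h : Btw s1 s2 p q) {x y : X} (hp : M.inc T x p)
    (hq : M.inc T y q) : 0 ≤ s1 ∧ s2 ≤ T.h := by
  have b1 := hp.bd
  have b2 := hq.bd
  rcases h with ⟨g1, g2⟩ | ⟨g1, g2⟩ <;> constructor <;> linarith

/-- Modulus estimates packaged. -/
theorem loopE {E F : Set X} (hE : IsPreconnected E) (hF : IsPreconnected F) {x y z w c : X}
    (hx : x ∈ E) (hy : y ∈ E) (hz : z ∈ F) (hw : w ∈ F) {px py pz pw : ℝ × ℝ}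
    (ix : M.inc T x px) (iy : M.inc T y py) (iz : M.inc T z pz) (iw : M.inc T w pw) {s1 s2 : ℝ}
    (h12 : s1 < s2) (hb : Btw s1 s2 px py) (hb' : Btw s1 s2 pz pw) {Cp : ℝ} (hCp : Pack X Cp)
    (hC0 : 1 ≤ C0) (hr : 0 < r) {ρ1 : ℝ} (hρ : 4 * (C0 * r) ≤ ρ1) {K : ℕ} (hK : 1 ≤ K)
    (hEb : ∀ y ∈ E, dist y c ≤ ρ1) (hFb : ∀ y ∈ F, 2 ^ K * ρ1 ≤ dist y c) :
    s2 - s1 ≤ 768 * Cp * C0 ^ 2 / K := by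
  obtain ⟨W, W0, W1, W2, -⟩ := M.weights hCp hC0 hr c hρ hK
  have bd := hb.bd M T ix iy
  exact (T.LOOP bd.1 h12 bd.2 (M.level' T hE hx hy ix iy hb) (M.level' T hF hz hw iz iw hb') W0
    (M.adm_of W2 hEb hFb)).trans W1

theorem sqE {E F : Set X} (hE : IsPreconnected E) (hF : IsPreconnected F) {x y z w c : X}
    (hx : x ∈ E) (hy : y ∈ E) (hz : z ∈ F) (hw : w ∈ F) {px py pz pw : ℝ × ℝ}
    (ix : M.inc T x px) (iy : M.inc T y py) (iz : M.inc T z pz) (iw : M.inc T w pw) {δ0 : ℝ}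
    (hδ0 : 0 < δ0) (h4 : 4 * δ0 ≤ 1) (h0 : 3 * δ0 < px.2) (h1 : px.2 + 3 * δ0 < T.h)
    (hyf : ∀ k : ℤ, 2 * δ0 ≤ dist (py.1 + k, py.2) px)
    (hzn : ∃ k : ℤ, dist (pz.1 + k, pz.2) px ≤ δ0)
    (hwf : ∀ k : ℤ, 2 * δ0 ≤ dist (pw.1 + k, pw.2) px) {Cp : ℝ} (hCp : Pack X Cp)
    (hC0 : 1 ≤ C0) (hr : 0 < r) {ρ1 : ℝ} (hρ : 4 * (C0 * r) ≤ ρ1) {K : ℕ} (hK : 1 ≤ K)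
    (hEb : ∀ y ∈ E, dist y c ≤ ρ1) (hFb : ∀ y ∈ F, 2 ^ K * ρ1 ≤ dist y c) :
    1 ≤ 108 * (768 * Cp * C0 ^ 2 / K) := by
  obtain ⟨W, W0, W1, W2, -⟩ := M.weights hCp hC0 hr c hρ hK
  obtain ⟨k, hk⟩ := hzn
  refine (T.SQ hδ0 h4 h0 h1 (E := M.EV E) (F := M.EV F) ?_ ?_ W0 (M.adm_of W2 hEb hFb)).trans
    (by linarith)
  · rintro δ ⟨d1, d2⟩
    exact M.ring_hit T hE hx hy ix iy (by rw [dist_self]; linarith) (by linarith) (by linarith)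
      fun k => by linarith [hyf k]
  · rintro δ ⟨d1, d2⟩
    exact M.ring_hit T hF hz hw (iz.shift k) iw (by linarith) (by linarith) (by linarith)
      fun k => by linarith [hwf k]

end Model
end BK

end

section
open Metric MeasureTheory Set
open scoped ENNReal NNReal Topology

namespace BK
namespace Model
variable {X : Type} [MetricSpace X] {a b : X} {C0 : ℝ}

theorem exists_K (Z : ℝ) {ε : ℝ} (hε : 0 < ε) : ∃ K : ℕ, 1 ≤ K ∧ Z / K < ε := by
  obtain ⟨K, hK⟩ := exists_nat_gt (max 1 (Z / ε))
  have h1 : (1 : ℝ) < K := (le_max_left _ _).trans_lt hK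
  have h2 : Z / ε < K := (le_max_right _ _).trans_lt hK
  refine ⟨K, by exact_mod_cast h1.le, ?_⟩
  rw [div_lt_iff₀ hε] at h2
  rw [div_lt_iff₀ (by linarith)]
  linarith

theorem norm1 {lam Cp : ℝ} (hL : LLCw X lam) (hCp : Pack X Cp) (hC0 : 1 ≤ C0) {o c c' : X}
    (hoc : o ≠ c) (hcc : c' ≠ c) : ∃ R > 0, R ≤ dist c' c ∧ ∀ r, 0 < r → 4 * (C0 * r) ≤ R →
      ∀ (M : Model X a b (C0 * r) r (C0 * r)) [Fintype M.V] (T : M.S.Tiling),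
      ∀ x ∈ ball c R, ∀ px pc pc' po, M.inc T x px → M.inc T c pc → M.inc T c' pc' → M.inc T o po →
      ∀ s1 s2, s1 < s2 → Btw s1 s2 pc px → Btw s1 s2 po pc' → s2 - s1 < 1 := by
  obtain ⟨K, hK, hKZ⟩ := exists_K (768 * Cp * C0 ^ 2) one_pos
  have hl := hL.1
  set R' := min (dist o c) (dist c' c) with hR'
  have hR0 : 0 < R' := lt_min (dist_pos.2 hoc) (dist_pos.2 hcc)
  have h2K : (1 : ℝ) ≤ 2 ^ K := one_le_pow₀ (by norm_num)
  have hq : 1 ≤ lam ^ 2 * 2 ^ K := by nlinarith [one_le_pow₀ hl (n := 2)]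
  refine ⟨R' / (lam ^ 2 * 2 ^ K), by positivity, ?_, ?_⟩
  · exact (div_le_self hR0.le hq).trans (min_le_right _ _)
  intro r hr hrR M _ T x hx px pc pc' po ix ic ic' io s1 s2 h12 b1 b2
  obtain ⟨E, -, hE, hcE, hxE, hEs⟩ := (hL.2 c (R' / (lam ^ 2 * 2 ^ K))).1 c
    (mem_ball_self (by positivity)) x hx
  obtain ⟨F, -, hF, hoF, hcF, hFs⟩ := (hL.2 c R').2 o (by
    rw [mem_ball, not_lt]; exact min_le_left _ _) c' (by
    rw [mem_ball, not_lt]; exact min_le_right _ _)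
  have := M.loopE T (c := c) hE.isPreconnected hF.isPreconnected hcE hxE hoF hcF ic ix io ic' h12 b1 b2
    hCp hC0 hr (ρ1 := lam * (R' / (lam ^ 2 * 2 ^ K))) (K := K) (by
      have : 0 < R' / (lam ^ 2 * 2 ^ K) := by positivity
      nlinarith) hK
    (fun y hy => (hEs hy).le) (fun y hy => by
      have := hFs hy
      rw [mem_compl_iff, mem_ball, not_lt] at this
      refine le_trans (le_of_eq ?_) this
      field_simp)
  linarith

theorem norm2 {lam Cp : ℝ} (hL : LLCw X lam) (hCp : Pack X Cp) (hC0 : 1 ≤ C0) {o : X}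
    (hab : a ≠ b) (hoa : o ≠ a) (hob : o ≠ b) (L : ℝ) : ∃ r1 > 0, ∀ r, 0 < r → r < r1 →
      ∀ (M : Model X a b (C0 * r) r (C0 * r)) [Fintype M.V] (T : M.S.Tiling),
      ∀ po, M.inc T o po → L ≤ po.2 ∧ po.2 ≤ T.h - L := by
  obtain ⟨Ra, hRa, hRa', Ha⟩ := norm1 (a := a) (b := b) hL hCp hC0 hoa hab.symm
  obtain ⟨Rb, hRb, hRb', Hb⟩ := norm1 (a := a) (b := b) hL hCp hC0 hob hab
  set R := min Ra Rb with hR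
  have hR0 : 0 < R := lt_min hRa hRb
  obtain ⟨K, hK, hKZ⟩ := exists_K (768 * Cp * C0 ^ 2) (show 0 < 1 / (|L| + 1) by positivity)
  have h2K : (1 : ℝ) ≤ 2 ^ K := one_le_pow₀ (by norm_num)
  set ρ1 := R / (8 * 2 ^ K) with hρ1
  have hρ0 : 0 < ρ1 := by positivity
  have eρ : 2 ^ K * ρ1 = R / 8 := by rw [hρ1]; field_simp
  have eρ2 : 2 ^ (K + 2) * ρ1 = R / 2 := by rw [pow_add]; linarith
  have hρR : ρ1 ≤ R / 8 := by rw [← eρ]; nlinarith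
  have hRab : R ≤ dist a b := (min_le_right _ _).trans hRb'
  refine ⟨ρ1 / (4 * C0), by positivity, fun r hr hr1 M _ T po io => ?_⟩
  rw [lt_div_iff₀ (by positivity)] at hr1
  have hr4 : 4 * (C0 * r) ≤ ρ1 := by linarith
  have hCr : 0 < C0 * r := by positivity
  have bdo := io.bd
  have hL0 : 0 < |L| + 1 := by positivity
  rw [lt_div_iff₀ hL0] at hKZ
  constructor
  · by_contra hcon
    push Not at hcon
    have hlev : ∀ x ∈ ball a R, ∀ px, M.inc T x px → px.2 ≤ |L| + 1 := by
      intro x hx px ix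
      by_contra hc
      push Not at hc
      have hLL := le_abs_self L
      have := Ha r hr (by linarith [min_le_left Ra Rb]) M T x (ball_subset_ball (min_le_left _ _) hx)
        px _ _ po ix (M.inc_a T) (M.inc_b T) io po.2 px.2 (by linarith)
        (Or.inl ⟨bdo.1, le_rfl⟩) (Or.inl ⟨le_rfl, ix.bd.2⟩)
      linarith
    obtain ⟨W, W0, W1, W2, W3⟩ := M.weights hCp hC0 hr a hr4 hK
    have hV := T.VERT (w := W) (s1 := 0) (s2 := min (|L| + 1) T.h) le_rfl
      (le_min hL0.le T.h_pos.le) (min_le_right _ _) (by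
        rintro F ⟨x, y, hx, hy, hxy⟩
        obtain ⟨p, hp, hpA⟩ := (M.PA _).2 hx
        obtain ⟨q, hq, hqB⟩ := (M.PB _).2 hy
        refine W2 F _ _ (M.conn_V hxy) ⟨p, hp, ?_⟩ ⟨q, hq, ?_⟩
        · have := mem_ball.1 (M.Asub hpA); linarith
        · have := mem_ball.1 (M.Bsub hqB)
          have h3 := dist_triangle_right a b q
          rw [dist_comm a q, dist_comm b q] at h3
          linarith) (by
        intro v hv hvρ
        obtain ⟨y, hy⟩ := M.Pne v
        have hyb : y ∈ ball a R := by
          have := W3 v hv y hy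
          rw [mem_ball]; linarith
        have huh := T.u_le_h hvρ
        have := hlev y hyb (T.Ψ (v, 0), T.u v) (Or.inl ⟨(v, 0), T.u v, hy,
          ⟨⟨le_rfl, by simp only; linarith⟩, by simp only; linarith, le_rfl⟩, (min_eq_left huh).symm⟩)
        exact ⟨by linarith [T.u_ge v], le_min this huh⟩)
    have h5 : 0 ≤ ∑ v, W v ^ 2 := Finset.sum_nonneg fun v _ => sq_nonneg _
    nlinarith [min_le_left (|L| + 1) T.h]
  · by_contra hcon
    push Not at hcon
    have hlev : ∀ x ∈ ball b R, ∀ px, M.inc T x px → T.h - (|L| + 1) ≤ px.2 := by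
      intro x hx px ix
      by_contra hc
      push Not at hc
      have hLL := le_abs_self L
      have := Hb r hr (by linarith [min_le_right Ra Rb]) M T x (ball_subset_ball (min_le_right _ _) hx)
        px _ _ po ix (M.inc_b T) (M.inc_a T) io px.2 po.2 (by linarith)
        (Or.inr ⟨le_rfl, bdo.2⟩) (Or.inr ⟨ix.bd.1, le_rfl⟩)
      linarith
    obtain ⟨W, W0, W1, W2, W3⟩ := M.weights hCp hC0 hr b hr4 hK
    have hV := T.VERT (w := W) (s1 := max 0 (T.h - (|L| + 1))) (s2 := T.h) (le_max_left _ _)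
      (max_le T.h_pos.le (by linarith)) le_rfl (by
        rintro F ⟨x, y, hx, hy, hxy⟩
        obtain ⟨p, hp, hpA⟩ := (M.PA _).2 hx
        obtain ⟨q, hq, hqB⟩ := (M.PB _).2 hy
        refine W2 F _ _ ((M.conn_V hxy).symm (bint_symm _)) ⟨q, hq, ?_⟩ ⟨p, hp, ?_⟩
        · have := mem_ball.1 (M.Bsub hqB); linarith
        · have := mem_ball.1 (M.Asub hpA)
          have h3 := dist_triangle_right a b p
          rw [dist_comm a p, dist_comm b p] at h3
          linarith) (by
        intro v hv hvρ
        obtain ⟨y, hy⟩ := M.Pne v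
        have hyb : y ∈ ball b R := by
          have := W3 v hv y hy
          rw [mem_ball]; linarith
        have huh := T.u_le_h hvρ
        have := hlev y hyb (T.Ψ (v, 0), T.u v - T.ρ v) (Or.inl ⟨(v, 0), T.u v - T.ρ v, hy,
          ⟨⟨le_rfl, by simp only; linarith⟩, le_rfl, by simp only; linarith⟩,
            (min_eq_left (by linarith)).symm⟩)
        exact ⟨max_le (by linarith [T.u_ge v]) this, huh⟩)
    have h5 : 0 ≤ ∑ v, W v ^ 2 := Finset.sum_nonneg fun v _ => sq_nonneg _
    nlinarith [le_max_right 0 (T.h - (|L| + 1))]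

end Model
end BK

end

section
open Metric MeasureTheory Set
open scoped ENNReal NNReal Topology

namespace BK

theorem S2_dist_sq (p q : S2) : dist p q ^ 2 =
    (p.1 0 - q.1 0) ^ 2 + (p.1 1 - q.1 1) ^ 2 + (p.1 2 - q.1 2) ^ 2 := by
  rw [Subtype.dist_eq, EuclideanSpace.dist_eq, Real.sq_sqrt (by positivity), Fin.sum_univ_three]
  simp only [Real.dist_eq, sq_abs]

theorem S2_dist_le (p q : S2) : dist p q ≤ 2 := by
  have h1 := (mem_S2 p.1).1 p.2
  have h2 := (mem_S2 q.1).1 q.2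
  have h := S2_dist_sq p q
  nlinarith [sq_nonneg (p.1 0 + q.1 0), sq_nonneg (p.1 1 + q.1 1), sq_nonneg (p.1 2 + q.1 2),
    dist_nonneg (x := p) (y := q)]

/-- Mercator coordinates. -/
noncomputable def merc (q : ℝ × ℝ) : S2 :=
  ⟨!₂[Real.cos q.1 / Real.cosh q.2, Real.sin q.1 / Real.cosh q.2,
    Real.sinh q.2 / Real.cosh q.2], by
    rw [mem_S2]
    simp only [Matrix.cons_val_zero, Matrix.cons_val_one, Matrix.cons_val]
    have h1 := Real.sin_sq_add_cos_sq q.1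
    have h2 := Real.cosh_sq q.2
    have h3 := (Real.cosh_pos q.2).ne'
    field_simp
    linear_combination h1 - h2⟩

theorem merc_coord (q : ℝ × ℝ) : (merc q).1 0 = Real.cos q.1 / Real.cosh q.2 ∧
    (merc q).1 1 = Real.sin q.1 / Real.cosh q.2 ∧ (merc q).1 2 = Real.sinh q.2 / Real.cosh q.2 := by
  simp [merc]

theorem merc_dist (p q : ℝ × ℝ) : dist (merc p) (merc q) ^ 2 * (Real.cosh p.2 * Real.cosh q.2) =
    2 * (Real.cosh (p.2 - q.2) - Real.cos (p.1 - q.1)) := by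
  obtain ⟨a0, a1, a2⟩ := merc_coord p
  obtain ⟨b0, b1, b2⟩ := merc_coord q
  rw [S2_dist_sq, a0, a1, a2, b0, b1, b2, Real.cosh_sub, Real.cos_sub]
  have h3 := (Real.cosh_pos q.2).ne'
  have h4 := (Real.cosh_pos p.2).ne'
  have e1 := Real.sin_sq_add_cos_sq p.1
  have e2 := Real.sin_sq_add_cos_sq q.1
  have e3 := Real.cosh_sq p.2
  have e4 := Real.cosh_sq q.2
  field_simp
  generalize Real.cosh p.2 = cp at *
  generalize Real.cosh q.2 = cq at *
  generalize Real.sinh p.2 = sp at *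
  generalize Real.sinh q.2 = sq at *
  linear_combination cq ^ 2 * e1 + cp ^ 2 * e2 - cq ^ 2 * e3 - cp ^ 2 * e4

/-- The poles. -/
noncomputable def pN : S2 := ⟨!₂[0, 0, 1], by rw [mem_S2]; simp⟩
noncomputable def pS : S2 := ⟨!₂[0, 0, -1], by rw [mem_S2]; simp⟩

theorem merc_pN (q : ℝ × ℝ) : dist (merc q) pN ^ 2 * (1 + Real.exp (2 * q.2)) = 4 := by
  obtain ⟨a0, a1, a2⟩ := merc_coord q
  rw [S2_dist_sq, a0, a1, a2]
  have h3 := (Real.cosh_pos q.2).ne'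
  have e1 := Real.sin_sq_add_cos_sq q.1
  simp only [pN, Matrix.cons_val_zero, Matrix.cons_val_one, Matrix.cons_val]
  have e3 := Real.cosh_sq q.2
  have e5 : Real.exp (2 * q.2) = (Real.cosh q.2 + Real.sinh q.2) ^ 2 := by
    rw [Real.cosh_add_sinh, ← Real.exp_nat_mul]; norm_num
  rw [e5]
  field_simp
  generalize Real.cosh q.2 = c at *
  generalize Real.sinh q.2 = s at *
  linear_combination (1 + (c + s) ^ 2) * e1 + (c^2 - s^2 - 1) * e3

theorem merc_pS (q : ℝ × ℝ) : dist (merc q) pS ^ 2 * (1 + Real.exp (-(2 * q.2))) = 4 := by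
  obtain ⟨a0, a1, a2⟩ := merc_coord q
  rw [S2_dist_sq, a0, a1, a2]
  have h3 := (Real.cosh_pos q.2).ne'
  have e1 := Real.sin_sq_add_cos_sq q.1
  simp only [pS, Matrix.cons_val_zero, Matrix.cons_val_one, Matrix.cons_val]
  have e3 := Real.cosh_sq q.2
  have e5 : Real.exp (-(2 * q.2)) = (Real.cosh q.2 - Real.sinh q.2) ^ 2 := by
    rw [Real.cosh_sub_sinh, ← Real.exp_nat_mul]; norm_num
  rw [e5]
  field_simp
  generalize Real.cosh q.2 = c at *
  generalize Real.sinh q.2 = s at *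
  linear_combination (1 + (c - s) ^ 2) * e1 + (c^2 - s^2 - 1) * e3

theorem cosh_ratio (x y : ℝ) : Real.cosh x ≤ Real.exp |x - y| * Real.cosh y := by
  rw [Real.cosh_eq, Real.cosh_eq]
  have h1 : Real.exp x ≤ Real.exp |x - y| * Real.exp y := by
    rw [← Real.exp_add]; exact Real.exp_le_exp.2 (by linarith [le_abs_self (x - y)])
  have h2 : Real.exp (-x) ≤ Real.exp |x - y| * Real.exp (-y) := by
    rw [← Real.exp_add]; exact Real.exp_le_exp.2 (by linarith [neg_abs_le (x - y)])
  linarith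

theorem merc_far {p q : ℝ × ℝ} {τ : ℝ} (hτ : τ ≤ 1) (h1 : |p.1 - q.1| ≤ τ) (h2 : |p.2 - q.2| ≤ τ) :
    dist (merc p) (merc q) * Real.cosh p.2 ≤ 3 * τ := by
  have hτ0 : 0 ≤ τ := (abs_nonneg _).trans h1
  have hd := merc_dist p q
  have c1 : Real.cosh (p.2 - q.2) ≤ 1 + τ ^ 2 := by
    have e1 : Real.cosh (p.2 - q.2) ≤ Real.cosh τ := by
      rw [Real.cosh_le_cosh, abs_of_nonneg hτ0]; exact h2
    have e2 := Real.cosh_le_exp_half_sq τ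
    have e3 := Real.abs_exp_sub_one_le (x := τ ^ 2 / 2) (by
      rw [abs_of_nonneg (by positivity)]; nlinarith)
    rw [abs_of_nonneg (show 0 ≤ τ ^ 2 / 2 by positivity)] at e3
    linarith [le_abs_self (Real.exp (τ ^ 2 / 2) - 1)]
  have c2 : 1 - τ ^ 2 / 2 ≤ Real.cos (p.1 - q.1) := by
    have := Real.one_sub_sq_div_two_le_cos (x := p.1 - q.1)
    have h3 : (p.1 - q.1) ^ 2 ≤ τ ^ 2 := sq_le_sq' (by linarith [(abs_le.1 h1).1]) (abs_le.1 h1).2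
    linarith
  have c3 : Real.cosh p.2 ≤ 3 * Real.cosh q.2 := by
    refine (cosh_ratio p.2 q.2).trans ?_
    refine mul_le_mul_of_nonneg_right ?_ (Real.cosh_pos _).le
    calc Real.exp |p.2 - q.2| ≤ Real.exp 1 := Real.exp_le_exp.2 (h2.trans hτ)
      _ ≤ 3 := by linarith [Real.exp_one_lt_d9]
  have cp := Real.cosh_pos p.2
  have cq := Real.cosh_pos q.2
  have hdn := dist_nonneg (x := merc p) (y := merc q)
  refine le_of_sq_le_sq ?_ (by positivity)
  calc (dist (merc p) (merc q) * Real.cosh p.2) ^ 2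
      = dist (merc p) (merc q) ^ 2 * (Real.cosh p.2 * Real.cosh p.2) := by ring
    _ ≤ dist (merc p) (merc q) ^ 2 * (Real.cosh p.2 * (3 * Real.cosh q.2)) := by gcongr
    _ = 3 * (2 * (Real.cosh (p.2 - q.2) - Real.cos (p.1 - q.1))) := by rw [← hd]; ring
    _ ≤ (3 * τ) ^ 2 := by nlinarith

theorem merc_near {p q : ℝ × ℝ} {η : ℝ} (hη : η ≤ 1 / 2)
    (h : dist (merc p) (merc q) * Real.cosh p.2 ≤ η) :
    |p.2 - q.2| ≤ 2 * η ∧ ∃ k : ℤ, |q.1 + k * (2 * Real.pi) - p.1| ≤ Real.pi * η := by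
  have hd := merc_dist p q
  have cp := Real.cosh_pos p.2
  have cq := Real.cosh_pos q.2
  have hdn := dist_nonneg (x := merc p) (y := merc q)
  have hη0 : 0 ≤ η := le_trans (by positivity) h
  set D := |p.2 - q.2| with hD
  have hD0 : 0 ≤ D := abs_nonneg _
  have m1 : 2 * (Real.cosh D - Real.cos (p.1 - q.1)) ≤ η ^ 2 * Real.exp D := by
    rw [hD, Real.cosh_abs, ← hd]
    have : Real.cosh q.2 ≤ Real.exp |p.2 - q.2| * Real.cosh p.2 := by
      rw [abs_sub_comm]; exact cosh_ratio _ _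
    calc dist (merc p) (merc q) ^ 2 * (Real.cosh p.2 * Real.cosh q.2)
        ≤ dist (merc p) (merc q) ^ 2 * (Real.cosh p.2 * (Real.exp |p.2 - q.2| * Real.cosh p.2)) := by
          gcongr
      _ = (dist (merc p) (merc q) * Real.cosh p.2) ^ 2 * Real.exp |p.2 - q.2| := by ring
      _ ≤ η ^ 2 * Real.exp |p.2 - q.2| := by gcongr
  have hcos1 := Real.cos_le_one (p.1 - q.1)
  have hch1 := Real.one_le_cosh D
  have he : Real.exp D * Real.exp (-D) = 1 := by rw [← Real.exp_add]; simp
  have hep := Real.exp_pos D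
  have hem := Real.exp_pos (-D)
  have hem1 : Real.exp (-D) ≤ 1 := Real.exp_le_one_iff.2 (by linarith)
  have m2 : (1 - Real.exp (-D)) ^ 2 ≤ η ^ 2 := by
    have : Real.exp D * (1 - Real.exp (-D)) ^ 2 = 2 * (Real.cosh D - 1) := by
      rw [Real.cosh_eq]; linear_combination (Real.exp (-D) - 2) * he
    refine le_of_mul_le_mul_left ?_ hep
    rw [this]; linarith
  have m3 : 1 - Real.exp (-D) ≤ η := le_of_sq_le_sq m2 hη0
  have m4 : Real.exp D ≤ 1 + 2 * η := by nlinarith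
  refine ⟨by linarith [Real.add_one_le_exp D], ?_⟩
  set k := round ((p.1 - q.1) / (2 * Real.pi)) with hk
  have hpi := Real.pi_pos
  have hr := abs_sub_round ((p.1 - q.1) / (2 * Real.pi))
  rw [← hk] at hr
  set θ := q.1 + k * (2 * Real.pi) - p.1 with hθ
  have hθ1 : |θ| ≤ Real.pi := by
    have : θ = -(((p.1 - q.1) / (2 * Real.pi) - k) * (2 * Real.pi)) := by rw [hθ]; field_simp; ring
    rw [this, abs_neg, abs_mul, abs_of_pos (show 0 < 2 * Real.pi by positivity)]
    nlinarith
  have hcos : Real.cos (p.1 - q.1) = Real.cos θ := by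
    have : θ = -(p.1 - q.1) + k * (2 * Real.pi) := by rw [hθ]; ring
    rw [this, Real.cos_add_int_mul_two_pi, Real.cos_neg]
  have hq := Real.cos_le_one_sub_mul_cos_sq hθ1
  refine ⟨k, ?_⟩
  refine abs_le_of_sq_le_sq ?_ (by positivity)
  have m5 : 2 * (2 / Real.pi ^ 2 * θ ^ 2) ≤ 2 * η ^ 2 := by
    rw [hcos] at m1
    nlinarith
  have m6 : 2 / Real.pi ^ 2 * θ ^ 2 * Real.pi ^ 2 = 2 * θ ^ 2 := by field_simp
  nlinarith [sq_nonneg Real.pi, sq_nonneg θ]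

/-- near the pole -/
theorem pole_est {A : Fin 4 → ℝ} {n : Fin 4 → ℝ} {e c : ℝ} (he : 0 < e) (he2 : e ≤ 2) (hc : 0 < c)
    (hA : ∀ i, 0 < A i) (hn0 : ∀ i, 0 ≤ n i) (hn : ∀ i, n i ^ 2 * (1 + A i) = 4)
    (hcA : c ^ 2 ≤ A 0) (hec : 60 ≤ e * c) (h1 : e ≤ n 0 + n 1) (h2 : n 2 ≤ n 0 + e / 1000)
    (h3 : 0.6 ≤ n 0 + n 3) : ∀ i j : Fin 4, (i = 0 ∨ i = 2) → (j = 1 ∨ j = 3) → 2 * A j ≤ A i := by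
  have hn0' : n 0 ≤ e / 30 := by
    refine le_of_sq_le_sq ?_ (by positivity)
    have a1 := hn 0
    have a2 : 3600 ≤ e ^ 2 * c ^ 2 := by nlinarith
    have a3 : n 0 ^ 2 * c ^ 2 ≤ 4 := by nlinarith [sq_nonneg (n 0)]
    have a4 : n 0 ^ 2 * c ^ 2 ≤ (e / 30) ^ 2 * c ^ 2 := by nlinarith
    exact le_of_mul_le_mul_right a4 (by positivity)
  have up : ∀ i, n i ≤ e / 20 → 1600 ≤ e ^ 2 * (1 + A i) := by
    intro i hi
    have : n i ^ 2 ≤ (e / 20) ^ 2 := pow_le_pow_left₀ (hn0 i) hi 2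
    nlinarith [hn i, hA i]
  have lo : ∀ i, e / 4 ≤ n i → e ^ 2 * (1 + A i) ≤ 64 := by
    intro i hi
    have : (e / 4) ^ 2 ≤ n i ^ 2 := pow_le_pow_left₀ (by positivity) hi 2
    nlinarith [hn i, hA i]
  have g0 := up 0 (by linarith)
  have g2 := up 2 (by linarith)
  have g1 := lo 1 (by linarith)
  have g3 := lo 3 (by linarith)
  have hee : e ^ 2 ≤ 4 := by nlinarith
  have hep : 0 < e ^ 2 := by positivity
  have fin : ∀ i j, 1600 ≤ e ^ 2 * (1 + A i) → e ^ 2 * (1 + A j) ≤ 64 → 2 * A j ≤ A i := by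
    intro i j hi hj
    refine le_of_mul_le_mul_left ?_ hep
    nlinarith
  rintro i j (rfl | rfl) (rfl | rfl)
  · exact fin _ _ g0 g1
  · exact fin _ _ g0 g3
  · exact fin _ _ g2 g1
  · exact fin _ _ g2 g3

end BK

end

section
open Metric MeasureTheory Set
open scoped ENNReal NNReal Topology

namespace BK

/-- rescaling to Mercator coordinates centred at height `so` -/
noncomputable def mc (so : ℝ) (q : ℝ × ℝ) : S2 :=
  merc (2 * Real.pi * q.1, 2 * Real.pi * (q.2 - so))

theorem gap_of {so s t : ℝ} (h : 2 * Real.exp (2 * (2 * Real.pi * (t - so))) ≤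
    Real.exp (2 * (2 * Real.pi * (s - so)))) : t + 0.05 ≤ s := by
  have h1 : Real.exp (Real.log 2 + 2 * (2 * Real.pi * (t - so))) ≤
      Real.exp (2 * (2 * Real.pi * (s - so))) := by
    rw [Real.exp_add, Real.exp_log (by norm_num)]; exact h
  rw [Real.exp_le_exp] at h1
  have h2 := Real.log_two_gt_d9
  have h3 := Real.pi_lt_d2
  have h4 := Real.pi_gt_three
  by_contra hc
  push Not at hc
  nlinarith

theorem mc_shift (so : ℝ) (q : ℝ × ℝ) (k : ℤ) : mc so (q.1 + k, q.2) = mc so q := by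
  unfold mc
  apply S2_ext
  · rw [(merc_coord _).1, (merc_coord _).1]
    simp only
    rw [mul_add, mul_comm (2 * Real.pi) (k : ℝ), Real.cos_add_int_mul_two_pi]
  · rw [(merc_coord _).2.1, (merc_coord _).2.1]
    simp only
    rw [mul_add, mul_comm (2 * Real.pi) (k : ℝ), Real.sin_add_int_mul_two_pi]
  · rw [(merc_coord _).2.2, (merc_coord _).2.2]

/-- nearby points in the cylinder are nearby on the sphere -/
theorem mc_far {so : ℝ} {p q : ℝ × ℝ} {δ : ℝ} (hδ : 4 * Real.pi * δ ≤ 1) {k : ℤ}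
    (h : dist (q.1 + k, q.2) p < 2 * δ) :
    dist (mc so p) (mc so q) * Real.cosh (2 * Real.pi * (p.2 - so)) ≤ 3 * (4 * Real.pi * δ) := by
  rw [← mc_shift so q k]
  rw [Prod.dist_eq, max_lt_iff, Real.dist_eq, Real.dist_eq] at h
  have hpi := Real.pi_pos
  refine merc_far hδ ?_ ?_
  · have : 2 * Real.pi * p.1 - 2 * Real.pi * (q.1 + k) = -(2 * Real.pi * (q.1 + k - p.1)) := by ring
    simp only [this, abs_neg, abs_mul, abs_of_pos (show 0 < 2 * Real.pi by positivity),
      abs_two, abs_of_pos hpi]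
    simp only at h
    nlinarith [h.1]
  · have : 2 * Real.pi * (p.2 - so) - 2 * Real.pi * (q.2 - so) = -(2 * Real.pi * (q.2 - p.2)) := by
      ring
    simp only [this, abs_neg, abs_mul, abs_two, abs_of_pos hpi]
    simp only at h
    nlinarith [h.2]

theorem mc_near {so : ℝ} {p q : ℝ × ℝ} {η : ℝ} (hη : η ≤ 1 / 2)
    (h : dist (mc so p) (mc so q) * Real.cosh (2 * Real.pi * (p.2 - so)) ≤ η) :
    ∃ k : ℤ, dist (q.1 + k, q.2) p ≤ η := by
  obtain ⟨h1, k, h2⟩ := merc_near hη h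
  have hpi := Real.pi_pos
  have hpi3 := Real.pi_gt_three
  refine ⟨k, ?_⟩
  rw [Prod.dist_eq, max_le_iff, Real.dist_eq, Real.dist_eq]
  have e1 : 2 * Real.pi * (p.2 - so) - 2 * Real.pi * (q.2 - so) = -(2 * Real.pi * (q.2 - p.2)) := by
    ring
  have e2 : 2 * Real.pi * q.1 + k * (2 * Real.pi) - 2 * Real.pi * p.1 =
    2 * Real.pi * (q.1 + k - p.1) := by ring
  simp only [e1, e2, abs_neg, abs_mul, abs_two, abs_of_pos hpi] at h1 h2 ⊢
  have a1 := abs_nonneg (q.1 + k - p.1)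
  have a2 := abs_nonneg (q.2 - p.2)
  constructor
  · have : 2 * |q.1 + k - p.1| ≤ η := le_of_mul_le_mul_left (by linarith) hpi
    linarith
  · nlinarith

theorem mc_cont {so : ℝ} : Continuous (mc so) := by
  unfold mc merc
  refine Continuous.subtype_mk ?_ _
  have hne : ∀ x : ℝ × ℝ, Real.cosh (2 * Real.pi * (x.2 - so)) ≠ 0 := fun x => (Real.cosh_pos _).ne'
  refine (PiLp.continuous_toLp 2 _).comp ?_
  refine continuous_pi fun i => ?_
  fin_cases i
  · exact Continuous.div (by fun_prop) (by fun_prop) hne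
  · exact Continuous.div (by fun_prop) (by fun_prop) hne
  · exact Continuous.div (by fun_prop) (by fun_prop) hne

theorem cosh_sq_le {x : ℝ} (hx : 0 ≤ x) : Real.cosh x ^ 2 ≤ Real.exp (2 * x) := by
  have h := cosh_ratio x 0
  rw [sub_zero, abs_of_nonneg hx, Real.cosh_zero, mul_one] at h
  have e : Real.exp (2 * x) = Real.exp x ^ 2 := by rw [← Real.exp_nat_mul]; norm_num
  rw [e]
  exact pow_le_pow_left₀ (Real.cosh_pos _).le h 2

/-- gaps near a pole -/
theorem pole_gap {so : ℝ} {p : Fin 4 → ℝ × ℝ} (he : 0 < dist (mc so (p 0)) (mc so (p 1)))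
    (hz : 1000 * dist (mc so (p 0)) (mc so (p 2)) ≤ dist (mc so (p 0)) (mc so (p 1)))
    (hw : 0.6 ≤ dist (mc so (p 0)) (mc so (p 3)))
    (hg : 60 ≤ dist (mc so (p 0)) (mc so (p 1)) * Real.cosh (2 * Real.pi * ((p 0).2 - so))) :
    (∀ i j : Fin 4, (i = 0 ∨ i = 2) → (j = 1 ∨ j = 3) → (p j).2 + 0.05 ≤ (p i).2) ∨
    (∀ i j : Fin 4, (i = 0 ∨ i = 2) → (j = 1 ∨ j = 3) → (p i).2 + 0.05 ≤ (p j).2) := by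
  have tri : ∀ (P : S2) (i : Fin 4), dist (mc so (p 0)) (mc so (p i)) ≤
      dist (mc so (p 0)) P + dist (mc so (p i)) P := fun P i => dist_triangle_right _ _ _
  have tri2 : ∀ (P : S2), dist (mc so (p 2)) P ≤
      dist (mc so (p 0)) P + dist (mc so (p 0)) (mc so (p 2)) := fun P => by
    rw [dist_comm (mc so (p 0)) (mc so (p 2)), add_comm]; exact dist_triangle _ _ _
  have hpi := Real.pi_pos
  rcases le_total 0 ((p 0).2 - so) with h0 | h0
  · left
    intro i j hi hj
    refine gap_of (so := so) ?_
    exact pole_est (A := fun i => Real.exp (2 * (2 * Real.pi * ((p i).2 - so))))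
      (n := fun i => dist (mc so (p i)) pN) he (S2_dist_le _ _) (Real.cosh_pos _)
      (fun i => Real.exp_pos _) (fun i => dist_nonneg) (fun i => merc_pN _)
      (cosh_sq_le (by positivity)) hg (tri _ 1) (by
        have := tri2 pN
        linarith) (hw.trans (tri _ 3)) i j hi hj
  · right
    intro i j hi hj
    have := pole_est (A := fun i => Real.exp (-(2 * (2 * Real.pi * ((p i).2 - so)))))
      (n := fun i => dist (mc so (p i)) pS) he (S2_dist_le _ _) (Real.cosh_pos _)
      (fun i => Real.exp_pos _) (fun i => dist_nonneg) (fun i => merc_pS _)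
      (by
        rw [← Real.cosh_neg]
        refine (cosh_sq_le (by nlinarith)).trans_eq ?_
        congr 1; ring) hg (tri _ 1) (by
        have := tri2 pS
        linarith) (hw.trans (tri _ 3)) i j hi hj
    have g := gap_of (so := -so) (s := -(p i).2) (t := -(p j).2) (by
      convert this using 3 <;> ring)
    linarith

namespace Model
variable {X : Type} [MetricSpace X] {a b : X} {C0 r : ℝ}

theorem main_fin (M : Model X a b (C0 * r) r (C0 * r)) [Fintype M.V] (T : M.S.Tiling)
    {E F : Set X} (hE : IsPreconnected E) (hF : IsPreconnected F) {x y z w c : X}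
    (hx : x ∈ E) (hy : y ∈ E) (hz : z ∈ F) (hw : w ∈ F) {px py pz pw : ℝ × ℝ}
    (ix : M.inc T x px) (iy : M.inc T y py) (iz : M.inc T z pz) (iw : M.inc T w pw)
    {Cp : ℝ} (hCp : Pack X Cp)
    (hC0 : 1 ≤ C0) (hr : 0 < r) {ρ1 : ℝ} (hρ : 4 * (C0 * r) ≤ ρ1) {K : ℕ} (hK : 1 ≤ K)
    (hEb : ∀ y ∈ E, dist y c ≤ ρ1) (hFb : ∀ y ∈ F, 2 ^ K * ρ1 ≤ dist y c)
    (hK2 : 768 * Cp * C0 ^ 2 / K < 1 / 108) {so : ℝ} (hs1 : 1 < so) (hs2 : so + 1 < T.h)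
    (he : 0 < dist (mc so px) (mc so py))
    (hb1 : 60 < dist (mc so px) (mc so py) * Real.cosh (2 * Real.pi * (so - 1)))
    (hb2 : 60 < dist (mc so px) (mc so py) * Real.cosh (2 * Real.pi * (T.h - 1 - so)))
    (hz' : 1000 * dist (mc so px) (mc so pz) ≤ dist (mc so px) (mc so py))
    (hw' : 0.6 ≤ dist (mc so px) (mc so pw)) : False := by
  have hpi := Real.pi_pos
  have hpi3 := Real.pi_lt_d2
  rcases le_or_gt 60 (dist (mc so px) (mc so py) * Real.cosh (2 * Real.pi * (px.2 - so)))
    with hg | hg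
  · have key : ∃ s1 s2, s1 + 0.05 ≤ s2 ∧ Btw s1 s2 px py ∧ Btw s1 s2 pz pw := by
      rcases pole_gap (so := so) (p := ![px, py, pz, pw]) he hz' hw' hg with h | h
      · have h01 := h 0 1 (by simp) (by simp)
        have h03 := h 0 3 (by simp) (by simp)
        have h21 := h 2 1 (by simp) (by simp)
        have h23 := h 2 3 (by simp) (by simp)
        simp only [Matrix.cons_val_zero, Matrix.cons_val_one, Matrix.cons_val] at h01 h03 h21 h23
        refine ⟨max py.2 pw.2, min px.2 pz.2, ?_, Or.inr ⟨le_max_left _ _, min_le_left _ _⟩,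
          Or.inr ⟨le_max_right _ _, min_le_right _ _⟩⟩
        rcases max_cases py.2 pw.2 with ⟨e, _⟩ | ⟨e, _⟩ <;>
        rcases min_cases px.2 pz.2 with ⟨e', _⟩ | ⟨e', _⟩ <;> rw [e, e'] <;> linarith
      · have h01 := h 0 1 (by simp) (by simp)
        have h03 := h 0 3 (by simp) (by simp)
        have h21 := h 2 1 (by simp) (by simp)
        have h23 := h 2 3 (by simp) (by simp)
        simp only [Matrix.cons_val_zero, Matrix.cons_val_one, Matrix.cons_val] at h01 h03 h21 h23
        refine ⟨max px.2 pz.2, min py.2 pw.2, ?_, Or.inl ⟨le_max_left _ _, min_le_left _ _⟩,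
          Or.inl ⟨le_max_right _ _, min_le_right _ _⟩⟩
        rcases max_cases px.2 pz.2 with ⟨e, _⟩ | ⟨e, _⟩ <;>
        rcases min_cases py.2 pw.2 with ⟨e', _⟩ | ⟨e', _⟩ <;> rw [e, e'] <;> linarith
    obtain ⟨s1, s2, h12, hB1, hB2⟩ := key
    have := M.loopE T hE hF (c := c) hx hy hz hw ix iy iz iw (by linarith) hB1 hB2 hCp hC0 hr hρ hK
      hEb hFb
    norm_num at h12 hK2 this
    linarith
  · have hch := Real.cosh_pos (2 * Real.pi * (px.2 - so))
    set g := dist (mc so px) (mc so py) * Real.cosh (2 * Real.pi * (px.2 - so)) with hgd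
    have hg0 : 0 < g := by positivity
    have hτ : 4 * Real.pi * (g / 800) ≤ 1 := by nlinarith
    have low : 3 * (g / 800) < px.2 := by
      by_contra hcon
      push Not at hcon
      have : Real.cosh (2 * Real.pi * (so - 1)) ≤ Real.cosh (2 * Real.pi * (px.2 - so)) := by
        rw [Real.cosh_le_cosh, abs_of_nonneg (by nlinarith), abs_of_nonpos (by nlinarith)]
        nlinarith
      nlinarith
    have high : px.2 + 3 * (g / 800) < T.h := by
      by_contra hcon
      push Not at hcon
      have : Real.cosh (2 * Real.pi * (T.h - 1 - so)) ≤ Real.cosh (2 * Real.pi * (px.2 - so)) := by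
        rw [Real.cosh_le_cosh, abs_of_nonneg (by nlinarith), abs_of_nonneg (by nlinarith)]
        nlinarith
      nlinarith
    have := M.sqE T hE hF (c := c) hx hy hz hw ix iy iz iw (δ0 := g / 800) (by positivity)
      (by linarith) low high (by
        intro k
        by_contra hcon
        push Not at hcon
        have := mc_far (so := so) hτ hcon
        nlinarith) (by
        obtain ⟨k, hk⟩ := mc_near (so := so) (p := px) (q := pz) (η := g / 1000) (by linarith) (by
          rw [hgd]; nlinarith)
        exact ⟨k, by linarith⟩) (by
        intro k
        by_contra hcon
        push Not at hcon
        have h1 := mc_far (so := so) hτ hcon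
        have h2 := S2_dist_le (mc so px) (mc so py)
        have h3 : 0.3 * g ≤ dist (mc so px) (mc so pw) * Real.cosh (2 * Real.pi * (px.2 - so)) := by
          rw [hgd, ← mul_assoc]
          refine mul_le_mul_of_nonneg_right ?_ hch.le
          linarith
        nlinarith) hCp hC0 hr hρ hK hEb hFb
    linarith

end Model
end BK

end

section
open Metric MeasureTheory Set
open scoped ENNReal NNReal Topology

namespace BK

theorem exists_merc (p : S2) (h1 : p ≠ pN) (h2 : p ≠ pS) : ∃ q, merc q = p := by
  have hp := (mem_S2 p.1).1 p.2
  set x := p.1 0 with hx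
  set y := p.1 1 with hy
  set z := p.1 2 with hz
  have hxy : 0 < x ^ 2 + y ^ 2 := by
    rcases (show 0 ≤ x ^ 2 + y ^ 2 by positivity).eq_or_lt with h | h
    · exfalso
      have x0 : x = 0 := by nlinarith [sq_nonneg x, sq_nonneg y]
      have y0 : y = 0 := by nlinarith [sq_nonneg x, sq_nonneg y]
      have z1 : (z - 1) * (z + 1) = 0 := by nlinarith
      rcases mul_eq_zero.1 z1 with h | h
      · apply h1
        apply S2_ext
        · simp [pN, ← hx, x0]
        · simp [pN, ← hy, y0]
        · simp [pN, ← hz]; linarith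
      · apply h2
        apply S2_ext
        · simp [pS, ← hx, x0]
        · simp [pS, ← hy, y0]
        · simp [pS, ← hz]; linarith
    · exact h
  set m := Real.sqrt (x ^ 2 + y ^ 2) with hm
  have hm0 : 0 < m := Real.sqrt_pos.2 hxy
  have hm2 : m ^ 2 = x ^ 2 + y ^ 2 := Real.sq_sqrt hxy.le
  have hn : ‖(⟨x / m, y / m⟩ : ℂ)‖ = 1 := by
    have : ‖(⟨x / m, y / m⟩ : ℂ)‖ ^ 2 = 1 := by
      rw [Complex.sq_norm, Complex.normSq_mk]
      field_simp
      linarith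
    nlinarith [norm_nonneg (⟨x / m, y / m⟩ : ℂ)]
  obtain ⟨θ, hθ⟩ := (Complex.norm_eq_one_iff _).1 hn
  have c1 : Real.cos θ = x / m := by
    have := congrArg Complex.re hθ
    rwa [Complex.exp_ofReal_mul_I_re] at this
  have c2 : Real.sin θ = y / m := by
    have := congrArg Complex.im hθ
    rwa [Complex.exp_ofReal_mul_I_im] at this
  have c3 : Real.cosh (Real.arsinh (z / m)) = 1 / m := by
    rw [Real.cosh_arsinh]
    have : 1 + (z / m) ^ 2 = (1 / m) ^ 2 := by
      field_simp; linarith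
    rw [this, Real.sqrt_sq (by positivity)]
  refine ⟨(θ, Real.arsinh (z / m)), ?_⟩
  apply S2_ext
  · rw [(merc_coord _).1, c3, c1]; field_simp; rfl
  · rw [(merc_coord _).2.1, c3, c2]; field_simp; rfl
  · rw [(merc_coord _).2.2, c3, Real.sinh_arsinh]; field_simp; rfl

/-- Approximate uniformization at scale `ε`. -/
structure Approx (X : Type) [MetricSpace X] (a b o : X) (K : ℕ) (ε : ℝ) where
  I : X → S2 → Prop
  left : ∀ x, ∃ p, I x p
  right : ∀ p, ∃ p', dist p p' ≤ 2 * ε ∧ ∃ x, I x p'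
  ha : ∃ p, I a p ∧ dist p pS ≤ ε
  hb : ∃ p, I b p ∧ dist p pN ≤ ε
  ho : ∃ p, I o p ∧ p.1 2 = 0
  main : ∀ {E F : Set X}, IsPreconnected E → IsPreconnected F → ∀ {x y z w c : X}
    {p p' p'' pd : S2} {ρ1 : ℝ}, x ∈ E → y ∈ E → z ∈ F → w ∈ F → I x p → I y p' → I z p'' →
    I w pd → ε ≤ ρ1 → (∀ y ∈ E, dist y c ≤ ρ1) → (∀ y ∈ F, 2 ^ K * ρ1 ≤ dist y c) →
    ε ≤ dist p p' → 1000 * dist p p'' ≤ dist p p' → 0.6 ≤ dist p pd → False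

theorem exists_approx {X : Type} [MetricSpace X] [CompactSpace X] (φ : X ≃ₜ S2) {lam Cp : ℝ}
    (hL : LLCw X lam) (hCp : Pack X Cp) :
    ∃ a b o : X, a ≠ b ∧ o ≠ a ∧ o ≠ b ∧ ∃ K : ℕ, ∀ ε : ℝ, 0 < ε →
      Nonempty (Approx X a b o K ε) := by
  classical
  obtain ⟨a, b, o, hab, hoa, hob, C0, hC0, r0, hr0, Hm⟩ := exists_models φ hL hCp
  obtain ⟨K, hK, hKZ⟩ := Model.exists_K (768 * Cp * C0 ^ 2) (show (0 : ℝ) < 1 / 108 by norm_num)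
  refine ⟨a, b, o, hab, hoa, hob, K, fun ε hε => ?_⟩
  obtain ⟨L, hL2, hL3, hL4⟩ : ∃ L : ℝ, 2 < L ∧ 60 < ε * Real.cosh (2 * Real.pi * (L - 1)) ∧
      4 / ε ^ 2 ≤ Real.exp (2 * (2 * Real.pi * L)) := by
    have hpi := Real.pi_gt_three
    set Q := 200 / ε + 4 / ε ^ 2 with hQ
    have hQ0 : 0 < Q := by positivity
    have q1 : ε * Q = 200 + 4 / ε := by rw [hQ]; field_simp
    have q2 : 4 / ε ^ 2 ≤ Q := by rw [hQ]; have : 0 < 200 / ε := by positivity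
                                  linarith
    have q3 : 0 < 4 / ε := by positivity
    refine ⟨3 + Q, by linarith, ?_, ?_⟩
    · have e1 : Q ≤ Real.exp (2 * Real.pi * (3 + Q - 1)) := by
        have := Real.add_one_le_exp (2 * Real.pi * (3 + Q - 1))
        nlinarith
      have e2 : Real.exp (2 * Real.pi * (3 + Q - 1)) ≤ 2 * Real.cosh (2 * Real.pi * (3 + Q - 1)) := by
        rw [Real.cosh_eq]; linarith [Real.exp_pos (-(2 * Real.pi * (3 + Q - 1)))]
      nlinarith
    · have := Real.add_one_le_exp (2 * (2 * Real.pi * (3 + Q)))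
      nlinarith
  obtain ⟨r1, hr1, Hn⟩ := Model.norm2 (a := a) (b := b) hL hCp hC0 hab hoa hob L
  obtain ⟨r, hr, h0, h1, h4⟩ : ∃ r, 0 < r ∧ r < r0 ∧ r < r1 ∧ 4 * (C0 * r) ≤ ε := by
    refine ⟨min (min (r0 / 2) (r1 / 2)) (ε / (4 * C0)), by positivity, ?_, ?_, ?_⟩
    · exact ((min_le_left _ _).trans (min_le_left _ _)).trans_lt (by linarith)
    · exact ((min_le_left _ _).trans (min_le_right _ _)).trans_lt (by linarith)
    · have : min (min (r0 / 2) (r1 / 2)) (ε / (4 * C0)) ≤ ε / (4 * C0) := min_le_right _ _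
      rw [le_div_iff₀ (by positivity)] at this
      linarith
  obtain ⟨M⟩ := Hm r hr h0
  have := M.fin
  have := Fintype.ofFinite M.V
  obtain ⟨T⟩ := M.S.exists_tiling
  obtain ⟨po, hpo⟩ := M.inc_exists T o
  obtain ⟨g1, g2⟩ := Hn r hr h1 M T po hpo
  set so := po.2 with hso
  have hpi := Real.pi_gt_three
  have small : ∀ (P P' : S2) (A : ℝ), dist P P' ^ 2 * (1 + A) = 4 → 4 / ε ^ 2 ≤ A →
      dist P P' ≤ ε := by
    intro P P' A hA hA'
    refine le_of_sq_le_sq ?_ hε.le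
    rw [div_le_iff₀ (by positivity)] at hA'
    have h4A : 0 < 1 + A := by
      by_contra hcon
      nlinarith [sq_nonneg (dist P P')]
    refine le_of_mul_le_mul_right ?_ h4A
    rw [hA]; nlinarith
  refine ⟨⟨fun x p => ∃ q, M.inc T x q ∧ mc so q = p, ?_, ?_, ?_, ?_, ?_, ?_⟩⟩
  · intro x
    obtain ⟨q, hq⟩ := M.inc_exists T x
    exact ⟨_, q, hq, rfl⟩
  · intro p
    have hA : dist (mc so (0, 0)) pS ≤ ε := by
      refine small _ _ _ (merc_pS _) (hL4.trans (Real.exp_le_exp.2 ?_))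
      simp only; nlinarith
    have hB : dist (mc so (0, T.h)) pN ≤ ε := by
      refine small _ _ _ (merc_pN _) (hL4.trans (Real.exp_le_exp.2 ?_))
      simp only; nlinarith
    by_cases hN : p = pN
    · exact ⟨mc so (0, T.h), by rw [hN, dist_comm]; linarith, b, _, M.inc_b T, rfl⟩
    by_cases hS : p = pS
    · exact ⟨mc so (0, 0), by rw [hS, dist_comm]; linarith, a, _, M.inc_a T, rfl⟩
    obtain ⟨q, rfl⟩ := exists_merc p hN hS
    have eq : mc so (q.1 / (2 * Real.pi), so + q.2 / (2 * Real.pi)) = merc q := by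
      unfold mc; congr 1; ext <;> simp <;> field_simp
    have hq : 2 * Real.pi * (q.2 / (2 * Real.pi)) = q.2 := by field_simp
    by_cases k1 : so + q.2 / (2 * Real.pi) < T.h
    · by_cases k2 : 0 < so + q.2 / (2 * Real.pi)
      · obtain ⟨x, hx⟩ := M.exists_inc T (t := q.1 / (2 * Real.pi)) k2 k1
        exact ⟨merc q, by simpa using hε.le, x, _, hx, eq⟩
      · refine ⟨mc so (0, 0), ?_, a, _, M.inc_a T, rfl⟩
        have : dist (merc q) pS ≤ ε := by
          refine small _ _ _ (merc_pS _) (hL4.trans (Real.exp_le_exp.2 ?_))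
          nlinarith
        linarith [dist_triangle_right (merc q) (mc so (0, 0)) pS]
    · refine ⟨mc so (0, T.h), ?_, b, _, M.inc_b T, rfl⟩
      have : dist (merc q) pN ≤ ε := by
        refine small _ _ _ (merc_pN _) (hL4.trans (Real.exp_le_exp.2 ?_))
        nlinarith
      linarith [dist_triangle_right (merc q) (mc so (0, T.h)) pN]
  · exact ⟨_, ⟨_, M.inc_a T, rfl⟩, small _ _ _ (merc_pS _) (hL4.trans (Real.exp_le_exp.2 (by
      simp only; nlinarith)))⟩
  · exact ⟨_, ⟨_, M.inc_b T, rfl⟩, small _ _ _ (merc_pN _) (hL4.trans (Real.exp_le_exp.2 (by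
      simp only; nlinarith)))⟩
  · refine ⟨_, ⟨_, hpo, rfl⟩, ?_⟩
    unfold mc
    rw [(merc_coord _).2.2, ← hso]
    simp
  · rintro E F hE hF x y z w c p p' p'' pd ρ1 hx hy hz hw ⟨px, ix, rfl⟩ ⟨py, iy, rfl⟩
      ⟨pz, iz, rfl⟩ ⟨pw, iw, rfl⟩ hρ hEb hFb he hz' hw'
    have cc : ∀ s, L ≤ s → 60 < dist (mc so px) (mc so py) * Real.cosh (2 * Real.pi * (s - 1)) := by
      intro s hs
      have : Real.cosh (2 * Real.pi * (L - 1)) ≤ Real.cosh (2 * Real.pi * (s - 1)) := by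
        rw [Real.cosh_le_cosh, abs_of_nonneg (by nlinarith), abs_of_nonneg (by nlinarith)]
        nlinarith
      have c0 := Real.cosh_pos (2 * Real.pi * (L - 1))
      nlinarith
    exact M.main_fin T hE hF hx hy hz hw ix iy iz iw hCp hC0 hr (h4.trans hρ) hK hEb hFb hKZ
      (by linarith) (by linarith) (hε.trans_le he) (cc _ g1)
      (by have := cc (T.h - so) (by linarith); convert this using 4; ring) hz' hw'

end BK

end

section
open Metric MeasureTheory Set Filter
open scoped ENNReal NNReal Topology

namespace BK

theorem exists_rel {X : Type} [MetricSpace X] [CompactSpace X] (φ : X ≃ₜ S2) {lam Cp : ℝ}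
    (hL : LLCw X lam) (hCp : Pack X Cp) :
    ∃ R : X → S2 → Prop, (∀ x, ∃ p, R x p) ∧ (∀ p, ∃ x, R x p) ∧ ∃ t0 > 0,
      ∀ x y z p p' p'', R x p → R y p' → R z p'' → dist x y < t0 * dist x z →
        dist p p' ≤ 1000 * dist p p'' := by
  classical
  obtain ⟨a, b, o, hab, hoa, hob, K, HA⟩ := exists_approx φ hL hCp
  have hεp : ∀ n : ℕ, (0 : ℝ) < 1 / (n + 1) := fun n => Nat.one_div_pos_of_nat
  let A : ∀ n : ℕ, Approx X a b o K (1 / (n + 1)) := fun n => (HA _ (hεp n)).some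
  let ω : Ultrafilter ℕ := hyperfilter ℕ
  have hω : Tendsto (fun n : ℕ => (1 : ℝ) / (n + 1)) ω (𝓝 0) :=
    tendsto_one_div_add_atTop_nhds_zero_nat.mono_left Nat.hyperfilter_le_atTop
  have limS : ∀ ps : ℕ → S2, ∃ p, Tendsto ps ω (𝓝 p) := fun ps =>
    ⟨_, (Ultrafilter.map ps ω).le_nhds_lim⟩
  have limX : ∀ ps : ℕ → X, ∃ p, Tendsto ps ω (𝓝 p) := fun ps => by
    have : Nonempty X := ⟨a⟩
    exact ⟨_, (Ultrafilter.map ps ω).le_nhds_lim⟩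
  let R : X → S2 → Prop := fun x p => ∃ xs ps, (∀ n, (A n).I (xs n) (ps n)) ∧
    Tendsto xs ω (𝓝 x) ∧ Tendsto ps ω (𝓝 p)
  have squeeze : ∀ (ps : ℕ → S2) (p : S2) (c : ℝ), (∀ n, dist (ps n) p ≤ c * (1 / (n + 1))) →
      Tendsto ps ω (𝓝 p) := by
    intro ps p c h
    rw [tendsto_iff_dist_tendsto_zero]
    refine squeeze_zero (fun n => dist_nonneg) h ?_
    simpa using hω.const_mul c
  have Ra : R a pS := by
    choose ps h1 h2 using fun n => (A n).ha
    exact ⟨fun _ => a, ps, h1, tendsto_const_nhds, squeeze _ _ 1 fun n => by rw [one_mul]; exact h2 n⟩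
  have Rb : R b pN := by
    choose ps h1 h2 using fun n => (A n).hb
    exact ⟨fun _ => b, ps, h1, tendsto_const_nhds, squeeze _ _ 1 fun n => by rw [one_mul]; exact h2 n⟩
  obtain ⟨po, Ro, hpo⟩ : ∃ po, R o po ∧ po.1 2 = 0 := by
    choose ps h1 h2 using fun n => (A n).ho
    obtain ⟨p, hp⟩ := limS ps
    refine ⟨p, ⟨fun _ => o, ps, h1, tendsto_const_nhds, hp⟩, ?_⟩
    have hc : Continuous fun p : S2 => p.1 2 := by fun_prop
    have := (hc.tendsto p).comp hp
    refine tendsto_nhds_unique this ?_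
    have e : ((fun p : S2 => p.1 2) ∘ ps) = fun _ => (0 : ℝ) := funext h2
    rw [e]; exact tendsto_const_nhds
  have hpo2 := (mem_S2 po.1).1 po.2
  rw [hpo] at hpo2
  have dNS : 1.4 ≤ dist pN pS := by
    refine le_of_sq_le_sq ?_ dist_nonneg
    rw [S2_dist_sq]; simp [pN, pS]; norm_num
  have dNo : 1.4 ≤ dist pN po := by
    refine le_of_sq_le_sq ?_ dist_nonneg
    rw [S2_dist_sq, hpo]; simp [pN]; linarith
  have dSo : 1.4 ≤ dist pS po := by
    refine le_of_sq_le_sq ?_ dist_nonneg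
    rw [S2_dist_sq, hpo]; simp [pS]; linarith
  obtain ⟨c0, hc0, hc01, dab, dao, dbo⟩ : ∃ c0 : ℝ, 0 < c0 ∧ c0 ≤ 1 ∧ 2 * c0 ≤ dist a b ∧
      2 * c0 ≤ dist o a ∧ 2 * c0 ≤ dist o b := by
    have := dist_pos.2 hab
    have := dist_pos.2 hoa
    have := dist_pos.2 hob
    refine ⟨min 1 (min (dist a b / 2) (min (dist o a / 2) (dist o b / 2))), by positivity,
      min_le_left _ _, ?_, ?_, ?_⟩
    · have : min 1 (min (dist a b / 2) (min (dist o a / 2) (dist o b / 2))) ≤ dist a b / 2 :=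
        (min_le_right _ _).trans (min_le_left _ _)
      linarith
    · have : min 1 (min (dist a b / 2) (min (dist o a / 2) (dist o b / 2))) ≤ dist o a / 2 :=
        (min_le_right _ _).trans ((min_le_right _ _).trans (min_le_left _ _))
      linarith
    · have : min 1 (min (dist a b / 2) (min (dist o a / 2) (dist o b / 2))) ≤ dist o b / 2 :=
        (min_le_right _ _).trans ((min_le_right _ _).trans (min_le_right _ _))
      linarith
  have third : ∀ x p, ∃ w pw, R w pw ∧ c0 ≤ dist x w ∧ 0.7 ≤ dist p pw := by
    intro x p
    by_contra! hcon
    have cA := hcon a pS Ra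
    have cB := hcon b pN Rb
    have cO := hcon o po Ro
    have t1 := dist_triangle_left a b x
    have t2 := dist_triangle_left o a x
    have t3 := dist_triangle_left o b x
    have u1 := dist_triangle_left pN pS p
    have u2 := dist_triangle_left pN po p
    have u3 := dist_triangle_left pS po p
    norm_num at dNS dNo dSo cA cB cO
    by_cases ka : c0 ≤ dist x a
    · have := cA ka
      by_cases kb : c0 ≤ dist x b
      · have := cB kb
        linarith
      · have := cO (by linarith)
        linarith
    · have := cB (by linarith)
      have := cO (by linarith)
      linarith
  obtain ⟨D, hD1, hD⟩ : ∃ D : ℝ, 1 ≤ D ∧ ∀ x y : X, dist x y ≤ D := by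
    refine ⟨max 1 (diam (univ : Set X)), le_max_left _ _, fun x y => ?_⟩
    exact (dist_le_diam_of_mem isCompact_univ.isBounded (mem_univ _) (mem_univ _)).trans
      (le_max_right _ _)
  obtain ⟨hl, HL⟩ := hL
  set t0 := c0 / D / (2 * lam ^ 2 * 2 ^ K) with ht0
  have ht0p : 0 < t0 := by positivity
  refine ⟨R, ?_, ?_, t0, ht0p, ?_⟩
  · intro x
    choose ps h1 using fun n => (A n).left x
    obtain ⟨p, hp⟩ := limS ps
    exact ⟨p, fun _ => x, ps, h1, tendsto_const_nhds, hp⟩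
  · intro p
    choose ps h1 xs h2 using fun n => (A n).right p
    obtain ⟨x, hx⟩ := limX xs
    exact ⟨x, xs, ps, h2, hx, squeeze _ _ 2 fun n => by rw [dist_comm]; exact h1 n⟩
  · rintro x y z p p' p'' ⟨xs, ps, iI, xT, pT⟩ ⟨ys, ps', iI', yT, pT'⟩ ⟨zs, ps'', iI'', zT, pT''⟩ hlt
    obtain ⟨w, pw, ⟨ws, ps3, iI3, wT, pT3⟩, hw, hpw⟩ := third x p
    by_contra! hcon
    have hz0 : 0 < dist x z := by
      rcases (dist_nonneg (x := x) (y := z)).eq_or_lt with h | h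
      · rw [← h, mul_zero] at hlt
        exact absurd hlt (not_lt.2 dist_nonneg)
      · exact h
    have hp0 : 0 < dist p p' := lt_of_le_of_lt (by positivity) hcon
    have hwz : c0 / D / 2 * dist x z < dist x w := by
      have h1 : c0 / D * dist x z ≤ c0 := by
        rw [div_mul_eq_mul_div, div_le_iff₀ (by positivity)]
        exact mul_le_mul_of_nonneg_left (hD _ _) hc0.le
      have h2 : 0 < c0 / D * dist x z := by positivity
      linarith
    have dxy := xT.dist yT
    have dxz := xT.dist zT
    have dxw := xT.dist wT
    have e1 := pT.dist pT'
    have e2 := pT.dist pT''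
    have e3 := pT.dist pT3
    have v1 := dxy.eventually_lt (dxz.const_mul t0) hlt
    have v2 := (dxz.const_mul (c0 / D / 2)).eventually_lt dxw hwz
    have v3 := (e2.const_mul 1000).eventually_lt e1 hcon
    have v4 := hω.eventually_lt e1 hp0
    have v5 := hω.eventually_lt (dxz.const_mul (lam * t0))
      (show 0 < lam * t0 * dist x z by positivity)
    have v6 := (tendsto_const_nhds (x := (0.6 : ℝ)) (f := (ω : Filter ℕ))).eventually_lt e3
      (lt_of_lt_of_le (by norm_num) hpw)
    obtain ⟨n, ⟨⟨⟨⟨w1, w2⟩, w3⟩, w4⟩, w5⟩, w6⟩ := ((((v1.and v2).and v3).and v4).and v5).and v6 |>.exists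
    have hzp : 0 < dist (xs n) (zs n) := by
      have h1 : 0 < lam * t0 * dist (xs n) (zs n) := (hεp n).trans w5
      have h2 : 0 < lam * t0 := by positivity
      exact (pos_iff_pos_of_mul_pos h1).1 h2
    have hcD : c0 / D ≤ 1 := by rw [div_le_one (by positivity)]; linarith
    obtain ⟨E, -, hE, xE, yE, hEs⟩ := (HL (xs n) (t0 * dist (xs n) (zs n))).1 (xs n)
      (mem_ball_self (by positivity)) (ys n) (by rw [mem_ball, dist_comm]; exact w1)
    obtain ⟨F, -, hF, zF, wF, hFs⟩ := (HL (xs n) (c0 / D / 2 * dist (xs n) (zs n))).2 (zs n)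
      (by rw [mem_ball, dist_comm, not_lt]; nlinarith) (ws n)
      (by rw [mem_ball, dist_comm, not_lt]; exact w2.le)
    refine (A n).main hE.isPreconnected hF.isPreconnected (c := xs n) xE yE zF wF (iI n) (iI' n)
      (iI'' n) (iI3 n) w5.le ?_ ?_ w4.le w3.le w6.le
    · intro y hy
      have := hEs hy
      rw [mem_ball] at this
      linarith
    · intro y hy
      have := hFs hy
      rw [mem_compl_iff, mem_ball, not_lt] at this
      refine le_trans (le_of_eq ?_) this
      rw [ht0]; field_simp

end BK

end

section
open Metric MeasureTheory Set Filter
open scoped ENNReal NNReal Topology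

namespace BK

theorem unif_open {Y : Type} [MetricSpace Y] [PreconnectedSpace Y] {F : Set Y} (hF : F.Nonempty)
    {δ : ℝ} (hδ : 0 < δ) (h : ∀ p ∈ F, ∀ q, dist p q < δ → q ∈ F) : F = univ := by
  refine IsClopen.eq_univ ⟨?_, ?_⟩ hF
  · rw [← isOpen_compl_iff, Metric.isOpen_iff]
    intro x hx
    refine ⟨δ, hδ, fun y hy hyF => hx (h y hyF x hy)⟩
  · rw [Metric.isOpen_iff]
    intro x hx
    refine ⟨δ, hδ, fun y hy => h x hx y ?_⟩
    rw [dist_comm]; exact hy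

theorem exists_sphere {X : Type} [MetricSpace X] [PreconnectedSpace X] (x z : X) {ρ : ℝ}
    (h0 : 0 ≤ ρ) (h1 : ρ ≤ dist x z) : ∃ y, dist x y = ρ := by
  have hc : Continuous fun y => dist x y := by fun_prop
  exact mem_range_of_exists_le_of_exists_ge hc ⟨x, by simpa using h0⟩ ⟨z, h1⟩

/-- weak quasisymmetry -/
def WQ {X Y : Type} [MetricSpace X] [MetricSpace Y] (f : X → Y) (t H : ℝ) : Prop :=
  ∀ x y z, dist x y ≤ t * dist x z → dist (f x) (f y) ≤ H * dist (f x) (f z)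

theorem exists_fun {X Y : Type} [MetricSpace X] [MetricSpace Y] [PreconnectedSpace X]
    [PreconnectedSpace Y] [Nontrivial X] [Nontrivial Y] {R : X → Y → Prop}
    (hl : ∀ x, ∃ p, R x p) (hr : ∀ p, ∃ x, R x p) {t0 H : ℝ} (ht0 : 0 < t0) (hH : 1 ≤ H)
    (hR : ∀ x y z p p' p'', R x p → R y p' → R z p'' → dist x y < t0 * dist x z →
        dist p p' ≤ H * dist p p'') :
    ∃ f : X ≃ Y, ∀ x y z, dist x y < t0 * dist x z →
      dist (f x) (f y) ≤ H * dist (f x) (f z) := by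
  have uniq : ∀ x p p', R x p → R x p' → p = p' := by
    intro x p0 p1 h0 h1
    by_contra hne
    have hD := dist_pos.2 hne
    have key : ∀ p, R x p → ∀ q z, R z q → z ≠ x → dist p0 p1 / 2 ≤ H * dist p q := by
      intro p hp q z hz hzx
      have hd : dist x x < t0 * dist x z := by
        rw [dist_self]; exact mul_pos ht0 (dist_pos.2 hzx.symm)
      have a0 := hR x x z p p0 q hp h0 hz hd
      have a1 := hR x x z p p1 q hp h1 hz hd
      have := dist_triangle_left p0 p1 p
      linarith
    have hU : {p | R x p} = univ := by
      refine unif_open ⟨p0, h0⟩ (δ := dist p0 p1 / (2 * H)) (by positivity) ?_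
      intro p hp q hq
      obtain ⟨z, hz⟩ := hr q
      by_cases hzx : z = x
      · rw [hzx] at hz; exact hz
      · have := key p hp q z hz hzx
        rw [lt_div_iff₀ (by positivity)] at hq
        linarith
    obtain ⟨z, hzx⟩ := exists_ne x
    obtain ⟨q, hq⟩ := hl z
    have hxq : R x q := by
      have : q ∈ {p | R x p} := by rw [hU]; trivial
      exact this
    have := key q hxq q z hq hzx
    rw [dist_self] at this
    linarith
  choose f hf using hl
  have hQ : ∀ x y z, dist x y < t0 * dist x z → dist (f x) (f y) ≤ H * dist (f x) (f z) :=
    fun x y z h => hR x y z _ _ _ (hf x) (hf y) (hf z) h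
  have hsurj : Function.Surjective f := fun p => by
    obtain ⟨x, hx⟩ := hr p
    exact ⟨x, uniq _ _ _ (hf x) hx⟩
  have hinj : Function.Injective f := by
    intro x0 x1 h
    by_contra hne
    have hD := dist_pos.2 hne
    have hU : {x | f x = f x0} = univ := by
      refine unif_open ⟨x0, rfl⟩ (δ := t0 * (dist x0 x1 / 2)) (by positivity) ?_
      intro x hx y hy
      have hx' : f x = f x0 := hx
      have : ∀ z, f z = f x0 → dist x y < t0 * dist x z → f y = f x0 := by
        intro z hz hd
        have := hQ x y z hd
        rw [hz, hx', dist_self, mul_zero] at this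
        exact (dist_le_zero.1 this).symm
      by_cases h0 : dist x0 x1 / 2 ≤ dist x x0
      · exact this x0 rfl (hy.trans_le (mul_le_mul_of_nonneg_left h0 ht0.le))
      · refine this x1 h.symm (hy.trans_le (mul_le_mul_of_nonneg_left ?_ ht0.le))
        linarith [dist_triangle_left x0 x1 x]
    obtain ⟨q, hq⟩ := exists_ne (f x0)
    obtain ⟨y, rfl⟩ := hsurj q
    apply hq
    have : y ∈ {x | f x = f x0} := by rw [hU]; trivial
    exact this
  exact ⟨Equiv.ofBijective f ⟨hinj, hsurj⟩, hQ⟩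

theorem wq_large {X Y : Type} [MetricSpace X] [MetricSpace Y] [PreconnectedSpace Y]
    {f : X ≃ Y} {t0 H : ℝ} (ht0 : 0 < t0) (ht1 : t0 ≤ 1) (hH : 2 ≤ H)
    (hQ : ∀ x y z, dist x y < t0 * dist x z → dist (f x) (f y) ≤ H * dist (f x) (f z))
    {Cp : ℝ} (hCp : Pack X Cp) : ∃ B : ℝ, 1 ≤ B ∧ WQ f 2 B := by
  classical
  have hQ' : ∀ x y z, H * dist (f x) (f z) < dist (f x) (f y) → t0 * dist x z ≤ dist x y := by
    intro x y z h
    by_contra hcon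
    exact absurd (hQ x y z (not_le.1 hcon)) (not_le.2 h)
  have hCp1 := hCp.1
  obtain ⟨m, hm⟩ := exists_nat_gt (Cp * (2 / t0 ^ 3) ^ 2)
  refine ⟨(H ^ 2) ^ (m + 2), one_le_pow₀ (by nlinarith), ?_⟩
  intro x y z hd
  by_contra! hcon
  set e := dist (f x) (f z) with he
  by_cases hxz : x = z
  · subst hxz
    rw [dist_self, mul_zero] at hd
    have := dist_le_zero.1 hd
    subst this
    simp [he] at hcon
  have he0 : 0 < e := dist_pos.2 fun h => hxz (f.injective h)
  have hdz : 0 < dist x z := dist_pos.2 hxz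
  have H2 : 1 ≤ H ^ 2 := by nlinarith
  have ex : ∀ i : ℕ, i ≤ m + 2 → ∃ u, dist (f x) (f u) = (H ^ 2) ^ i * e := by
    intro i hi
    obtain ⟨q, hq⟩ := exists_sphere (f x) (f y) (ρ := (H ^ 2) ^ i * e) (by positivity) (by
      refine le_trans ?_ hcon.le
      exact mul_le_mul_of_nonneg_right (pow_le_pow_right₀ H2 hi) he0.le)
    exact ⟨f.symm q, by simpa using hq⟩
  have : Nonempty X := ⟨x⟩
  choose! u hu using ex
  have lower : ∀ i, 1 ≤ i → i ≤ m + 2 → t0 * dist x z ≤ dist x (u i) := by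
    intro i h1 h2
    apply hQ'
    rw [hu i h2]
    have : H ^ 2 ≤ (H ^ 2) ^ i := le_self_pow₀ H2 (by omega)
    refine mul_lt_mul_of_pos_right ?_ he0
    nlinarith
  have upper : ∀ i, i ≤ m + 1 → t0 * dist x (u i) ≤ dist x y := by
    intro i h1
    apply hQ'
    refine lt_of_le_of_lt ?_ hcon
    rw [hu i (by omega), ← mul_assoc]
    refine mul_le_mul_of_nonneg_right ?_ he0.le
    calc H * (H ^ 2) ^ i ≤ H ^ 2 * (H ^ 2) ^ i := by gcongr; nlinarith
      _ = (H ^ 2) ^ (i + 1) := by ring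
      _ ≤ _ := pow_le_pow_right₀ H2 (by omega)
  have sep : ∀ i j, 1 ≤ i → i < j → j ≤ m + 1 → t0 ^ 2 * dist x z ≤ dist (u i) (u j) := by
    intro i j h1 hij hj
    have h2 : t0 * dist (u i) x ≤ dist (u i) (u j) := by
      apply hQ'
      have t := dist_triangle (f x) (f (u i)) (f (u j))
      rw [dist_comm (f (u i)) (f x)]
      have a1 := hu i (by omega)
      have a2 := hu j (by omega)
      have : H ^ 2 * (H ^ 2) ^ i ≤ (H ^ 2) ^ j := by
        rw [← pow_succ']; exact pow_le_pow_right₀ H2 (by omega)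
      have h3 : 0 < (H ^ 2) ^ i * e := by positivity
      have h4 : H ^ 2 * ((H ^ 2) ^ i * e) ≤ (H ^ 2) ^ j * e := by
        rw [← mul_assoc]; exact mul_le_mul_of_nonneg_right this he0.le
      rw [a1]
      have h5 : H + 1 < H ^ 2 := by nlinarith
      have h6 := mul_lt_mul_of_pos_right h5 h3
      linarith
    have h3 := lower i h1 (by omega)
    rw [dist_comm] at h2
    nlinarith
  have hε : 0 < t0 ^ 2 * dist x z := by positivity
  have inj : ∀ i j, 1 ≤ i → i ≤ m + 1 → 1 ≤ j → j ≤ m + 1 → i ≠ j →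
      t0 ^ 2 * dist x z ≤ dist (u i) (u j) := by
    intro i j i1 i2 j1 j2 hij
    rcases lt_or_gt_of_ne hij with h | h
    · exact sep i j i1 h j2
    · rw [dist_comm (u i)]; exact sep j i j1 h i2
  have hinj : Set.InjOn u (Finset.Icc 1 (m + 1)) := by
    intro i hi j hj h
    by_contra hij
    rw [Finset.coe_Icc, mem_Icc] at hi hj
    have := inj i j hi.1 hi.2 hj.1 hj.2 hij
    rw [h, dist_self] at this
    linarith
  have hRR : t0 ^ 2 * dist x z ≤ 2 * dist x z / t0 := by
    rw [le_div_iff₀ ht0]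
    have : t0 ^ 2 ≤ 1 := pow_le_one₀ ht0.le ht1
    have : t0 ^ 2 * t0 ≤ 1 := mul_le_one₀ this ht0.le ht1
    nlinarith
  have := hCp.2 x (t0 ^ 2 * dist x z) (2 * dist x z / t0) hε hRR ((Finset.Icc 1 (m + 1)).image u)
    (by
      intro v hv
      obtain ⟨i, hi, rfl⟩ := Finset.mem_image.1 hv
      rw [Finset.mem_Icc] at hi
      rw [le_div_iff₀ ht0, dist_comm]
      linarith [upper i hi.2]) (by
      intro v hv w hw hvw
      obtain ⟨i, hi, rfl⟩ := Finset.mem_image.1 hv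
      obtain ⟨j, hj, rfl⟩ := Finset.mem_image.1 hw
      rw [Finset.mem_Icc] at hi hj
      exact inj i j hi.1 hi.2 hj.1 hj.2 fun h => hvw (by rw [h]))
  rw [Finset.card_image_of_injOn hinj, Nat.card_Icc] at this
  have e1 : 2 * dist x z / t0 / (t0 ^ 2 * dist x z) = 2 / t0 ^ 3 := by field_simp
  rw [e1] at this
  push_cast at this
  linarith

end BK

end

section
open Metric MeasureTheory Set Filter
open scoped ENNReal NNReal Topology

namespace BK

theorem pack3 (M : ℝ) : ∃ N : ℕ, ∀ (x : S2) (ε : ℝ), 0 < ε → ∀ (n : ℕ) (g : Fin n → S2),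
    (∀ i, dist (g i) x ≤ M * ε) → (∀ i j, i ≠ j → ε ≤ dist (g i) (g j)) → n ≤ N := by
  classical
  have hc : IsCompact (closedBall (0 : EuclideanSpace ℝ (Fin 3)) M) := isCompact_closedBall _ _
  obtain ⟨t, -, htf, htc⟩ := hc.finite_cover_balls (show (0 : ℝ) < 1 / 2 by norm_num)
  refine ⟨htf.toFinset.card, fun x ε hε n g h1 h2 => ?_⟩
  let G : Fin n → EuclideanSpace ℝ (Fin 3) := fun i => ε⁻¹ • ((g i).1 - x.1)
  have hG : ∀ i, ∃ c ∈ htf.toFinset, G i ∈ ball c (1 / 2) := by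
    intro i
    have : G i ∈ closedBall (0 : EuclideanSpace ℝ (Fin 3)) M := by
      rw [mem_closedBall_zero_iff]
      simp only [G]
      rw [norm_smul, ← dist_eq_norm, Real.norm_of_nonneg (by positivity), inv_mul_le_iff₀ hε,
        mul_comm]
      exact h1 i
    have := htc this
    simp only [mem_iUnion] at this
    obtain ⟨c, hc, hi⟩ := this
    exact ⟨c, htf.mem_toFinset.2 hc, hi⟩
  choose c hc1 hc2 using hG
  have hinj : Function.Injective c := by
    intro i j hij
    by_contra hne
    have a1 := hc2 i
    have a2 := hc2 j
    rw [← hij] at a2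
    rw [mem_ball] at a1 a2
    have a3 : dist (G i) (G j) < 1 := by linarith [dist_triangle_right (G i) (G j) (c i)]
    have a4 : dist (G i) (G j) = ε⁻¹ * dist (g i) (g j) := by
      simp only [G]
      rw [dist_smul₀, dist_sub_right, Real.norm_of_nonneg (by positivity)]
      rfl
    rw [a4, inv_mul_lt_iff₀ hε, mul_one] at a3
    exact absurd a3 (not_lt.2 (h2 i j hne))
  have := Finset.card_le_card_of_injOn c (s := Finset.univ) (t := htf.toFinset)
    (fun i _ => hc1 i) hinj.injOn
  simpa using this

theorem wq_small {X : Type} [MetricSpace X] [PreconnectedSpace X] {f : X → S2}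
    (hf : Function.Injective f) {B : ℝ} (hB : 1 ≤ B) (hW : WQ f 2 B) :
    ∃ k : ℕ, 1 ≤ k ∧ WQ f ((1 / 2) ^ k) (1 / 2) := by
  obtain ⟨N, hN⟩ := pack3 (B * (2 * B ^ 2))
  refine ⟨2 * N + 2, by omega, ?_⟩
  intro x y z hd
  by_contra! hcon
  have e4 : ((1 : ℝ) / 2) ^ (2 * N + 2) = (1 / 4) ^ (N + 1) := by
    rw [show 2 * N + 2 = 2 * (N + 1) by ring, pow_mul]; norm_num
  rw [e4] at hd
  by_cases hxz : x = z
  · subst hxz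
    rw [dist_self, mul_zero] at hd
    have := dist_le_zero.1 hd
    subst this
    simp at hcon
  have he0 : 0 < dist (f x) (f z) := dist_pos.2 fun h => hxz (hf h)
  have hdz : 0 < dist x z := dist_pos.2 hxz
  have ex : ∀ i : ℕ, ∃ u, dist x u = (1 / 4) ^ i * dist x z := fun i =>
    exists_sphere x z (by positivity)
      (mul_le_of_le_one_left hdz.le (pow_le_one₀ (by norm_num) (by norm_num)))
  choose u hu using ex
  have W1 : ∀ a b c, dist a b ≤ dist a c → dist (f a) (f b) ≤ B * dist (f a) (f c) :=
    fun a b c h => hW a b c (by linarith [dist_nonneg (x := a) (y := c)])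
  have up : ∀ i, dist (f x) (f (u i)) ≤ B * dist (f x) (f z) := fun i => W1 _ _ _ (by
    rw [hu]; exact mul_le_of_le_one_left hdz.le (pow_le_one₀ (by norm_num) (by norm_num)))
  have lo : ∀ i, i ≤ N → dist (f x) (f z) ≤ 2 * B * dist (f x) (f (u i)) := by
    intro i hi
    have := W1 x y (u i) (by
      rw [hu]
      refine hd.trans (mul_le_mul_of_nonneg_right ?_ hdz.le)
      exact pow_le_pow_of_le_one (by norm_num) (by norm_num) (by omega))
    nlinarith
  have sep : ∀ i j, i < j → i ≤ N → dist (f x) (f z) ≤ (2 * B ^ 2) * dist (f (u i)) (f (u j)) := by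
    intro i j hij hi
    have h1 : dist (u i) x ≤ 2 * dist (u i) (u j) := by
      have t := dist_triangle x (u j) (u i)
      rw [dist_comm (u j) (u i)] at t
      rw [dist_comm (u i) x, hu i]
      rw [hu i, hu j] at t
      have : ((1 : ℝ) / 4) ^ j ≤ (1 / 4) ^ (i + 1) :=
        pow_le_pow_of_le_one (by norm_num) (by norm_num) hij
      have h2 : ((1 : ℝ) / 4) ^ j * dist x z ≤ (1 / 4) ^ (i + 1) * dist x z :=
        mul_le_mul_of_nonneg_right this hdz.le
      rw [pow_succ] at h2
      have h3 : 0 < (1 / 4) ^ i * dist x z := by positivity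
      linarith
    have h2 := hW _ _ _ h1
    rw [dist_comm (f (u i)) (f x)] at h2
    have := lo i hi
    nlinarith
  have hBp : 0 < 2 * B ^ 2 := by positivity
  have := hN (f x) (dist (f x) (f z) / (2 * B ^ 2)) (by positivity) (N + 1) (fun i => f (u i)) (by
    intro i
    rw [dist_comm, mul_assoc, mul_div_cancel₀ _ hBp.ne']
    exact up i) (by
    intro i j hij
    rw [div_le_iff₀ hBp, mul_comm]
    rcases lt_or_gt_of_ne hij with h | h
    · exact sep i j h (by omega)
    · rw [dist_comm (f (u i))]
      exact sep j i h (by omega))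
  omega

theorem wq_large_pow {X Y : Type} [MetricSpace X] [MetricSpace Y] [PreconnectedSpace X] {f : X → Y}
    {B : ℝ} (hB : 1 ≤ B) (hW : WQ f 2 B) (n : ℕ) : WQ f (2 ^ n) (B ^ n * B) := by
  induction n with
  | zero =>
    intro x y z h
    rw [pow_zero, one_mul] at h ⊢
    exact hW x y z (by linarith [dist_nonneg (x := x) (y := z)])
  | succ n ih =>
    intro x y z h
    obtain ⟨y', hy'⟩ := exists_sphere x y (ρ := dist x y / 2) (by positivity)
      (by linarith [dist_nonneg (x := x) (y := y)])
    have h1 := hW x y y' (by rw [hy']; linarith)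
    have h2 := ih x y' z (by rw [hy']; rw [pow_succ] at h; linarith)
    calc _ ≤ _ := h1
      _ ≤ B * (B ^ n * B * dist (f x) (f z)) := mul_le_mul_of_nonneg_left h2 (by linarith)
      _ = _ := by ring

theorem wq_small_pow {X Y : Type} [MetricSpace X] [MetricSpace Y] [PreconnectedSpace X] {f : X → Y}
    {s : ℝ} (hs : 0 < s) (hs1 : s ≤ 1) (hW : WQ f s (1 / 2)) (n : ℕ) :
    WQ f (s ^ (n + 1)) ((1 / 2) ^ (n + 1)) := by
  induction n with
  | zero => simpa using hW
  | succ n ih =>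
    intro x y z h
    obtain ⟨y', hy'⟩ := exists_sphere x z (ρ := s * dist x z) (by positivity)
      (mul_le_of_le_one_left dist_nonneg hs1)
    have h1 := hW x y' z hy'.le
    have h2 := ih x y y' (by rw [hy']; refine h.trans_eq ?_; ring)
    calc _ ≤ _ := h2
      _ ≤ (1 / 2) ^ (n + 1) * (1 / 2 * dist (f x) (f z)) := mul_le_mul_of_nonneg_left h1 (by positivity)
      _ = _ := by ring

theorem exists_eta (b k : ℕ) (hb : 1 ≤ b) (hk : 1 ≤ k) : ∃ η : ℝ≥0 ≃ₜ ℝ≥0, ∀ t : ℝ≥0,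
    η t = 2 ^ (2 * b) * t ^ b + 2 ^ (b + 1) * t ^ ((1 : ℝ) / k) := by
  let F : ℝ≥0 → ℝ≥0 := fun t => 2 ^ (2 * b) * t ^ b + 2 ^ (b + 1) * t ^ ((1 : ℝ) / k)
  have hkp : (0 : ℝ) < 1 / k := by positivity
  have hc : Continuous F := by
    have := NNReal.continuous_rpow_const (y := (1 : ℝ) / k) hkp.le
    fun_prop
  have hm : StrictMono F := by
    intro s t h
    have h1 : s ^ b < t ^ b := pow_lt_pow_left₀ h zero_le (by omega)
    have h2 : s ^ ((1 : ℝ) / k) < t ^ ((1 : ℝ) / k) := NNReal.rpow_lt_rpow h hkp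
    simp only [F]
    gcongr
  have h0 : F 0 = 0 := by
    simp only [F]
    rw [NNReal.zero_rpow hkp.ne', zero_pow (by omega)]
    simp
  have hs : Function.Surjective F := by
    intro y
    refine mem_range_of_exists_le_of_exists_ge hc ⟨0, by rw [h0]; exact zero_le⟩ ⟨y + 1, ?_⟩
    simp only [F]
    have h1 : y + 1 ≤ (y + 1) ^ b := le_self_pow₀ (by simp) (by omega)
    have h2 : (1 : ℝ≥0) ≤ 2 ^ (2 * b) := one_le_pow₀ (by norm_num)
    calc y ≤ y + 1 := by simp
      _ ≤ 1 * (y + 1) ^ b := by rw [one_mul]; exact h1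
      _ ≤ 2 ^ (2 * b) * (y + 1) ^ b := by gcongr
      _ ≤ _ := le_self_add
  exact ⟨(hm.orderIsoOfSurjective F hs).toHomeomorph, fun t => rfl⟩

theorem qs_of_wq {X Y : Type} [MetricSpace X] [MetricSpace Y] [PreconnectedSpace X] {f : X → Y}
    (hf : Function.Injective f)
    {B : ℝ} (hB : 1 ≤ B) (hW : WQ f 2 B) {k : ℕ} (hk : 1 ≤ k) (hW' : WQ f ((1 / 2) ^ k) (1 / 2)) :
    IsQuasisymmetric f := by
  obtain ⟨b, hb⟩ := pow_unbounded_of_one_lt B (show (1 : ℝ) < 2 by norm_num)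
  have hb1 : 1 ≤ b := by
    by_contra h
    have : b = 0 := by omega
    rw [this, pow_zero] at hb; linarith
  have hW2 : WQ f 2 (2 ^ b) := fun x y z h => (hW x y z h).trans
    (mul_le_mul_of_nonneg_right hb.le dist_nonneg)
  obtain ⟨η, hη⟩ := exists_eta b k hb1 hk
  refine ⟨η, fun x y z hxy hxz hyz => ?_⟩
  rw [hη]
  have hfz : 0 < nndist (f x) (f z) := by
    rw [← NNReal.coe_pos, coe_nndist]; exact dist_pos.2 fun h => hxz (hf h)
  have hz : 0 < dist x z := dist_pos.2 hxz
  have hy : 0 < dist x y := dist_pos.2 hxy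
  rw [div_le_iff₀ hfz, ← NNReal.coe_le_coe]
  set t : ℝ≥0 := nndist x y / nndist x z with ht
  have htr : (t : ℝ) = dist x y / dist x z := by rw [ht]; push_cast; rfl
  have ht0 : 0 < (t : ℝ) := by rw [htr]; positivity
  have hxyt : dist x y = t * dist x z := by rw [htr]; field_simp
  push_cast
  have hr0 : 0 ≤ (t : ℝ) ^ ((1 : ℝ) / k) := by positivity
  have hb0 : 0 ≤ (2 : ℝ) ^ (2 * b) * (t : ℝ) ^ b := by positivity
  rcases le_or_gt 1 (t : ℝ) with h1 | h1
  · obtain ⟨n, hn1, hn2⟩ := exists_nat_pow_near h1 (show (1 : ℝ) < 2 by norm_num)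
    have := wq_large_pow (one_le_pow₀ (by norm_num)) hW2 (n + 1) x y z (by
      rw [hxyt]; exact mul_le_mul_of_nonneg_right hn2.le hz.le)
    refine this.trans (mul_le_mul_of_nonneg_right ?_ dist_nonneg)
    have h2 : ((2 : ℝ) ^ n) ^ b ≤ (t : ℝ) ^ b := pow_le_pow_left₀ (by positivity) hn1 b
    calc ((2 : ℝ) ^ b) ^ (n + 1) * 2 ^ b = 2 ^ (2 * b) * (2 ^ n) ^ b := by ring
      _ ≤ 2 ^ (2 * b) * (t : ℝ) ^ b := by gcongr
      _ ≤ _ := le_add_of_nonneg_right (by positivity)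
  · have hs0 : (0 : ℝ) < (1 / 2) ^ k := by positivity
    have hs1 : ((1 : ℝ) / 2) ^ k < 1 := pow_lt_one₀ (by norm_num) (by norm_num) (by omega)
    obtain ⟨n, hn1, hn2⟩ := exists_nat_pow_near_of_lt_one ht0 h1.le hs0 hs1
    have h4 : ((1 : ℝ) / 2) ^ (n + 1) ≤ (t : ℝ) ^ ((1 : ℝ) / k) := by
      have e : ((1 : ℝ) / 2) ^ (n + 1) = ((((1 : ℝ) / 2) ^ k) ^ (n + 1)) ^ ((1 : ℝ) / k) := by
        rw [← pow_mul, mul_comm k, pow_mul, one_div (k : ℝ),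
          Real.pow_rpow_inv_natCast (by positivity) (by omega)]
      rw [e]
      exact Real.rpow_le_rpow (by positivity) hn1.le (by positivity)
    have h2b : (1 : ℝ) ≤ 2 ^ b := one_le_pow₀ (by norm_num)
    rcases n with _ | n
    · have := hW2 x y z (by rw [hxyt]; nlinarith)
      refine this.trans (mul_le_mul_of_nonneg_right ?_ dist_nonneg)
      have h5 : (2 : ℝ) ^ (b + 1) * (1 / 2) ^ (0 + 1) ≤ 2 ^ (b + 1) * (t : ℝ) ^ ((1 : ℝ) / k) := by
        gcongr
      have h6 : (2 : ℝ) ^ (b + 1) * (1 / 2) ^ (0 + 1) = 2 ^ b := by ring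
      linarith
    · have := wq_small_pow hs0 hs1.le hW' n x y z (by
        rw [hxyt]; exact mul_le_mul_of_nonneg_right hn2 hz.le)
      refine this.trans (mul_le_mul_of_nonneg_right ?_ dist_nonneg)
      have h5 : (2 : ℝ) * (1 / 2) ^ (n + 1 + 1) ≤ 2 ^ (b + 1) * (t : ℝ) ^ ((1 : ℝ) / k) := by
        gcongr
        rw [pow_succ]; linarith
      have h6 : (2 : ℝ) * (1 / 2) ^ (n + 1 + 1) = (1 / 2) ^ (n + 1) := by ring
      linarith

theorem cont_of_wq {X Y : Type} [MetricSpace X] [MetricSpace Y] [PreconnectedSpace X]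
    [Nontrivial X] {f : X → Y} {k : ℕ} (hW' : WQ f ((1 / 2) ^ k) (1 / 2)) : Continuous f := by
  have hs0 : (0 : ℝ) < (1 / 2) ^ k := by positivity
  have hs1 : ((1 : ℝ) / 2) ^ k ≤ 1 := pow_le_one₀ (by norm_num) (by norm_num)
  rw [Metric.continuous_iff]
  intro x ε hε
  obtain ⟨z, hz⟩ := exists_ne x
  have hd : 0 < dist x z := dist_pos.2 hz.symm
  obtain ⟨n, hn⟩ := exists_pow_lt_of_lt_one (show 0 < ε / (dist (f x) (f z) + 1) by positivity)
    (show (1 : ℝ) / 2 < 1 by norm_num)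
  refine ⟨((1 / 2) ^ k) ^ (n + 1) * dist x z, by positivity, fun y hy => ?_⟩
  rw [dist_comm] at hy ⊢
  have := wq_small_pow hs0 hs1 hW' n x y z hy.le
  rw [lt_div_iff₀ (by positivity)] at hn
  have h3 : (0 : ℝ) < (1 / 2) ^ n := by positivity
  rw [pow_succ] at this
  have h4 : 0 ≤ (1 / 2) ^ n * dist (f x) (f z) := by positivity
  linarith

/-- LLC implies quasisymmetrically equivalent to the sphere. -/
theorem backward {X : Type} [MetricSpace X] [CompactSpace X] (φ : X ≃ₜ S2) {lam Cp : ℝ}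
    (hL : LLCw X lam) (hCp : Pack X Cp) : ∃ f : X ≃ₜ S2, IsQuasisymmetric f := by
  have hpre : PreconnectedSpace S2 := by
    refine isPreconnected_iff_preconnectedSpace.1 ?_
    refine isPreconnected_sphere ?_ _ _
    rw [← Module.finrank_eq_rank, finrank_euclideanSpace]
    norm_num
  have hnt : Nontrivial S2 := ⟨⟨pN, pS, fun h => by
    have := congrArg (fun p : S2 => p.1 2) h
    simp [pN, pS] at this
    linarith⟩⟩
  have hpreX : PreconnectedSpace X := φ.symm.surjective.denseRange.preconnectedSpace φ.symm.continuous
  have hntX : Nontrivial X := φ.toEquiv.nontrivial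
  obtain ⟨R, hl, hr, t0, ht0, hR⟩ := exists_rel φ hL hCp
  obtain ⟨f, hf⟩ := exists_fun hl hr (t0 := min t0 1) (H := 1000) (by positivity) (by norm_num)
    (fun x y z p p' p'' h1 h2 h3 h => hR x y z p p' p'' h1 h2 h3
      (h.trans_le (mul_le_mul_of_nonneg_right (min_le_left _ _) dist_nonneg)))
  obtain ⟨B, hB, hW⟩ := wq_large (by positivity) (min_le_right _ _) (by norm_num) hf hCp
  obtain ⟨k, hk, hW'⟩ := wq_small f.injective hB hW
  have hc : Continuous f := cont_of_wq hW'
  exact ⟨hc.homeoOfEquivCompactToT2, qs_of_wq f.injective hB hW hk hW'⟩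

end BK

end

section
open Metric MeasureTheory Set Filter
open scoped ENNReal NNReal Topology

namespace BK

theorem S2_pre : PreconnectedSpace S2 := by
  refine isPreconnected_iff_preconnectedSpace.1 ?_
  refine isPreconnected_sphere ?_ _ _
  rw [← Module.finrank_eq_rank, finrank_euclideanSpace]
  norm_num

theorem eta_small (η : ℝ≥0 ≃ₜ ℝ≥0) : ∃ δ : ℝ, 0 < δ ∧ δ ≤ 1 ∧ ∀ t : ℝ≥0, 1 ≤ η t → δ ≤ t := by
  have hm : StrictMono η := by
    rcases η.continuous.strictMono_of_inj η.injective with h | h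
    · exact h
    · exfalso
      obtain ⟨v, hv⟩ := η.surjective (η 0 + 1)
      have : η v ≤ η 0 := h.antitone zero_le
      rw [hv] at this
      exact absurd this (not_le.2 (by simp))
  have h0 : η 0 = 0 := by
    obtain ⟨u, hu⟩ := η.surjective 0
    refine le_antisymm ?_ zero_le
    exact (hm.monotone (zero_le : 0 ≤ u)).trans_eq hu
  obtain ⟨u, hu⟩ := η.surjective 1
  have hu0 : 0 < u := by
    rw [pos_iff_ne_zero]
    rintro rfl
    rw [h0] at hu; exact zero_ne_one hu
  refine ⟨min u 1, ?_, min_le_right _ _, fun t ht => ?_⟩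
  · have : (0 : ℝ) < u := hu0
    positivity
  · rw [← hu, hm.le_iff_le] at ht
    exact (min_le_left _ _).trans (NNReal.coe_le_coe.2 ht)

theorem cap_pre (p : S2) (c : ℝ) :
    IsPreconnected {q : S2 | c ≤ inner ℝ p.1 q.1} := by
  have hpn : ‖p.1‖ = 1 := mem_sphere_zero_iff_norm.1 p.2
  rcases le_or_gt c (-1) with hc | hc
  · have : {q : S2 | c ≤ inner ℝ p.1 q.1} = univ := by
      refine eq_univ_of_forall fun q => ?_
      have hqn : ‖q.1‖ = 1 := mem_sphere_zero_iff_norm.1 q.2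
      have := abs_real_inner_le_norm p.1 q.1
      rw [hpn, hqn, one_mul] at this
      exact hc.trans (abs_le.1 this).1
    rw [this]
    have := S2_pre
    exact isPreconnected_univ
  · rw [← Topology.IsInducing.subtypeVal.isPreconnected_image]
    rcases le_or_gt c 1 with hc1 | hc1
    swap
    · have : {q : S2 | c ≤ inner ℝ p.1 q.1} = ∅ := by
        refine eq_empty_of_forall_notMem fun q hq => ?_
        have hqn : ‖q.1‖ = 1 := mem_sphere_zero_iff_norm.1 q.2
        have := abs_real_inner_le_norm p.1 q.1
        rw [hpn, hqn, one_mul] at this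
        exact absurd (hc1.trans_le hq) (not_lt.2 (abs_le.1 this).2)
      rw [this, image_empty]; exact isPreconnected_empty
    refine isPreconnected_of_forall p.1 ?_
    rintro _ ⟨q, hq, rfl⟩
    have hq' : c ≤ inner ℝ p.1 q.1 := hq
    have hqn : ‖q.1‖ = 1 := mem_sphere_zero_iff_norm.1 q.2
    have hpp : inner ℝ p.1 p.1 = (1 : ℝ) := by rw [real_inner_self_eq_norm_sq, hpn]; norm_num
    have hqq : inner ℝ q.1 q.1 = (1 : ℝ) := by rw [real_inner_self_eq_norm_sq, hqn]; norm_num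
    set u := inner ℝ p.1 q.1 with hu
    have hqp : inner ℝ q.1 p.1 = u := by rw [real_inner_comm]
    have hu1 : u ≤ 1 := by
      have := abs_real_inner_le_norm p.1 q.1
      rw [hpn, hqn, one_mul] at this
      exact (abs_le.1 this).2
    let v : ℝ → EuclideanSpace ℝ (Fin 3) := fun t => (1 - t) • p.1 + t • q.1
    have hvp : ∀ t, inner ℝ p.1 (v t) = (1 - t) + t * u := by
      intro t; simp only [v]; rw [inner_add_right, inner_smul_right, inner_smul_right, hpp, ← hu]; ring
    have hvq : ∀ t, inner ℝ q.1 (v t) = (1 - t) * u + t := by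
      intro t; simp only [v]; rw [inner_add_right, inner_smul_right, inner_smul_right, hqq, hqp]; ring
    have hvn : ∀ t, ‖v t‖ ^ 2 = (1 - 2 * t) ^ 2 + 2 * (t * (1 - t)) * (1 + u) := by
      intro t
      rw [← real_inner_self_eq_norm_sq]
      have : inner ℝ (v t) (v t) = (1 - t) * inner ℝ p.1 (v t) + t * inner ℝ q.1 (v t) := by
        conv_lhs => rw [show v t = (1 - t) • p.1 + t • q.1 from rfl]
        rw [inner_add_left, real_inner_smul_left, real_inner_smul_left]
      rw [this, hvp, hvq]; ring
    have hvpos : ∀ t ∈ Icc (0 : ℝ) 1, 0 < ‖v t‖ := by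
      rintro t ⟨h0, h1⟩
      have hsq : 0 < ‖v t‖ ^ 2 := by
        rw [hvn]
        have a1 : 0 ≤ t * (1 - t) := mul_nonneg h0 (by linarith)
        have a2 : 0 ≤ t * (1 - t) * (1 + u) := mul_nonneg a1 (by linarith)
        by_cases h2 : 1 - 2 * t = 0
        · have : t = 1 / 2 := by linarith
          subst this
          nlinarith
        · have := pow_pos (abs_pos.2 h2) 2
          rw [sq_abs] at this
          linarith
      rcases (norm_nonneg (v t)).eq_or_lt with h | h
      · rw [← h] at hsq; norm_num at hsq
      · exact h
    let γ : ℝ → EuclideanSpace ℝ (Fin 3) := fun t => ‖v t‖⁻¹ • v t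
    have hγ : ContinuousOn γ (Icc 0 1) := by
      have hv : Continuous v := by fun_prop
      exact (hv.norm.continuousOn.inv₀ fun t ht => (hvpos t ht).ne').smul hv.continuousOn
    refine ⟨γ '' Icc 0 1, ?_, ⟨0, by simp, ?_⟩, ⟨1, by simp, ?_⟩,
      (isPreconnected_Icc).image _ hγ⟩
    · rintro _ ⟨t, ht, rfl⟩
      have hp := hvpos t ht
      refine ⟨⟨γ t, ?_⟩, ?_, rfl⟩
      · rw [mem_sphere_zero_iff_norm]
        simp only [γ]
        rw [norm_smul, norm_inv, norm_norm, inv_mul_cancel₀ hp.ne']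
      · change c ≤ inner ℝ p.1 (γ t)
        simp only [γ]
        rw [inner_smul_right, hvp]
        refine hq'.trans ?_
        rw [inv_mul_eq_div, le_div_iff₀ hp]
        obtain ⟨h0, h1⟩ := ht
        have hle1 : ‖v t‖ ≤ 1 := by
          have a1 : 0 ≤ t * (1 - t) := mul_nonneg h0 (by linarith)
          have := hvn t
          nlinarith
        have hge : (1 - t) * u + t ≤ ‖v t‖ := by
          have := real_inner_le_norm q.1 (v t)
          rwa [hvq, hqn, one_mul] at this
        rcases le_total 0 u with hu0 | hu0
        · nlinarith
        · nlinarith [mul_le_mul_of_nonpos_left hge hu0, mul_nonneg (sub_nonneg.2 h1) (show 0 ≤ 1 - u ^ 2 by nlinarith)]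
    · simp [γ, v, hpn]
    · simp [γ, v, hqn]

theorem dist_inner (p q : S2) : dist p q ^ 2 = 2 - 2 * inner ℝ p.1 q.1 := by
  have hpn : ‖p.1‖ = 1 := mem_sphere_zero_iff_norm.1 p.2
  have hqn : ‖q.1‖ = 1 := mem_sphere_zero_iff_norm.1 q.2
  rw [Subtype.dist_eq, dist_eq_norm, norm_sub_sq_real, hpn, hqn]; ring

theorem near_pre (p q : S2) : IsPreconnected {e : S2 | dist p e ≤ dist p q} := by
  convert cap_pre p (inner ℝ p.1 q.1) using 1
  ext e
  simp only [mem_ofPred_eq]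
  rw [← sq_le_sq₀ dist_nonneg dist_nonneg, dist_inner, dist_inner]
  constructor <;> intro h <;> linarith

theorem far_pre (p q : S2) : IsPreconnected {e : S2 | dist p q ≤ dist p e} := by
  convert cap_pre ⟨-p.1, by simp⟩ (-inner ℝ p.1 q.1) using 1
  ext e
  simp only [mem_ofPred_eq]
  rw [← sq_le_sq₀ dist_nonneg dist_nonneg, dist_inner, dist_inner, inner_neg_left]
  constructor <;> intro h <;> linarith

theorem forward {X : Type} [MetricSpace X] (f : X ≃ₜ S2) (hf : IsQuasisymmetric f) :
    LinearlyLocallyConnected X := by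
  obtain ⟨η, hη⟩ := hf
  obtain ⟨δ, hδ, hδ1, hsm⟩ := eta_small η
  have hcX : CompactSpace X := f.symm.compactSpace
  have hS := S2_pre
  have hpX : PreconnectedSpace X := f.symm.surjective.denseRange.preconnectedSpace f.symm.continuous
  -- the key estimate
  have key : ∀ a m e : X, a ≠ e → dist (f a) (f e) ≤ dist (f a) (f m) →
      δ * dist a e ≤ dist a m := by
    intro a m e hae h
    have hdae := dist_pos.2 hae
    by_cases hme : m = e
    · rw [hme]; exact mul_le_of_le_one_left dist_nonneg hδ1
    by_cases ham : a = m
    · rw [ham, dist_self] at h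
      exact absurd (f.injective (ham.symm ▸ dist_le_zero.1 h)) hae
    have h1 := hη a m e ham hae hme
    have hfe : 0 < nndist (f a) (f e) := by
      rw [← NNReal.coe_pos, coe_nndist]; exact dist_pos.2 fun h => hae (f.injective h)
    have h2 : 1 ≤ nndist (f a) (f m) / nndist (f a) (f e) := by
      rw [one_le_div hfe]; exact h
    have h3 := hsm _ (h2.trans h1)
    push_cast at h3
    rwa [le_div_iff₀ hdae] at h3
  have hlam : 1 ≤ 1 / δ := by rw [one_le_div hδ]; exact hδ1
  refine ⟨1 / δ, hlam, fun a r => ⟨?_, ?_⟩⟩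
  · have main : ∀ x m, dist (f a) (f x) ≤ dist (f a) (f m) → m ∈ ball a r →
        ∃ E : Set X, IsCompact E ∧ IsConnected E ∧ x ∈ E ∧ m ∈ E ∧ E ⊆ ball a (1 / δ * r) := by
      intro x m hxm hm
      have hr : 0 < r := pos_of_mem_ball hm
      refine ⟨f ⁻¹' {e | dist (f a) e ≤ dist (f a) (f m)}, ?_, ⟨⟨x, hxm⟩, ?_⟩, hxm,
        (show dist (f a) (f m) ≤ dist (f a) (f m) from le_rfl), ?_⟩
      · refine IsClosed.isCompact ?_
        exact (isClosed_le (by fun_prop) continuous_const).preimage f.continuous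
      · rw [f.isPreconnected_preimage]; exact near_pre _ _
      · intro e he
        have he' : dist (f a) (f e) ≤ dist (f a) (f m) := he
        rw [mem_ball, dist_comm]
        by_cases hae : a = e
        · rw [← hae, dist_self]; positivity
        have := key a m e hae he'
        rw [mem_ball, dist_comm] at hm
        rw [one_div, inv_mul_eq_div, lt_div_iff₀ hδ]
        linarith
    intro x hx y hy
    rcases le_total (dist (f a) (f x)) (dist (f a) (f y)) with h | h
    · exact main x y h hy
    · obtain ⟨E, h1, h2, h3, h4, h5⟩ := main y x h hx
      exact ⟨E, h1, h2, h4, h3, h5⟩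
  · intro x hx y hy
    rcases le_or_gt r 0 with hr | hr
    · refine ⟨univ, isCompact_univ, ⟨⟨x, trivial⟩, isPreconnected_univ⟩, trivial, trivial, ?_⟩
      rw [ball_eq_empty.2 (div_nonpos_of_nonpos_of_nonneg hr (by positivity))]
      simp
    have main : ∀ x m, dist (f a) (f m) ≤ dist (f a) (f x) → m ∉ ball a r →
        ∃ E : Set X, IsCompact E ∧ IsConnected E ∧ x ∈ E ∧ m ∈ E ∧ E ⊆ (ball a (r / (1 / δ)))ᶜ := by
      intro x m hxm hm
      rw [mem_ball, not_lt, dist_comm] at hm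
      refine ⟨f ⁻¹' {e | dist (f a) (f m) ≤ dist (f a) e}, ?_, ⟨⟨x, hxm⟩, ?_⟩, hxm,
        (show dist (f a) (f m) ≤ dist (f a) (f m) from le_rfl), ?_⟩
      · refine IsClosed.isCompact ?_
        exact (isClosed_le continuous_const (by fun_prop)).preimage f.continuous
      · rw [f.isPreconnected_preimage]; exact far_pre _ _
      · intro e he
        have he' : dist (f a) (f m) ≤ dist (f a) (f e) := he
        rw [mem_compl_iff, mem_ball, not_lt, dist_comm]
        have ham : a ≠ m := by
          rintro rfl
          rw [dist_self] at hm; linarith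
        have := key a e m ham he'
        rw [div_div_eq_mul_div, div_one]
        nlinarith
    rcases le_total (dist (f a) (f x)) (dist (f a) (f y)) with h | h
    · obtain ⟨E, h1, h2, h3, h4, h5⟩ := main y x h hx
      exact ⟨E, h1, h2, h4, h3, h5⟩
    · exact main x y h hy

end BK

end

theorem bonk_kleiner
    (X : Type) [MetricSpace X] [MeasurableSpace X] [BorelSpace X]
    (hhomeo : Nonempty (X ≃ₜ ↥(Metric.sphere (0 : EuclideanSpace ℝ (Fin 3)) 1)))
    (hreg : AhlforsTwoRegular X) :
    (∃ f : X ≃ₜ ↥(Metric.sphere (0 : EuclideanSpace ℝ (Fin 3)) 1), IsQuasisymmetric f) ↔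
      LinearlyLocallyConnected X := by
  constructor
  · rintro ⟨f, hf⟩
    exact BK.forward f hf
  · rintro ⟨lam, hlam, hL⟩
    obtain ⟨φ⟩ := hhomeo
    have hcX : CompactSpace X := φ.symm.compactSpace
    obtain ⟨Cp, hCp⟩ := BK.exists_pack hreg
    exact BK.backward φ (lam := lam) ⟨hlam, hL⟩ hCp
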